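/- Let A be a real symmetric positive definite 3×3 matrix, Q(x) = xᵀAx, and let 4 ≤ p < ∞. There exists C = C(A, p) such that for all λ > 1 and all δ with λ^{−1} < δ < 1 and δ > min(λ^{−(p−4)/(2p−2)}, λ^{−(85p−358)/(158p−128)}), the following holds: for every finitely supported a : ℤ³ → ℂ vanishing outside {k ∈ ℤ³ : |√(Q(k)) − λ| < δ}, one has ‖f‖_{L^p} ≤ C ((λδ)^{1/2 − 1/p} + λ^{1 − 3/p} δ^{1/2}) ‖a‖_{ℓ²}. -/

import Mathlib

open MeasureTheory

noncomputable def trigSum (a : (Fin 3 → ℤ) →₀ ℂ) (x : Fin 3 → ℝ) : ℂ :=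
  ∑ k ∈ a.support, a k * Complex.exp (2 * Real.pi * Complex.I * ((∑ i, (k i : ℝ) * x i : ℝ) : ℂ))

noncomputable def lpNorm (p : ℝ) (a : (Fin 3 → ℤ) →₀ ℂ) : ℝ :=
  (∫ x in (Set.univ.pi fun _ : Fin 3 => Set.Icc (0:ℝ) 1), ‖trigSum a x‖ ^ p) ^ (1 / p)

noncomputable def l2Norm (a : (Fin 3 → ℤ) →₀ ℂ) : ℝ :=
  (∑ k ∈ a.support, ‖a k‖ ^ 2) ^ ((1:ℝ) / 2)

noncomputable def Qform (A : Matrix (Fin 3) (Fin 3) ℝ) (x : Fin 3 → ℝ) : ℝ :=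
  ∑ i, ∑ j, A i j * x i * x j

namespace ShellBound

/-- `BoxSup L c K`: all sums of `c` over boxes inside `[0, L]³` are bounded by `K`. -/
def BoxSup (L : ℤ) (c : (Fin 3 → ℤ) → ℂ) (K : ℝ) : Prop :=
  ∀ a b : Fin 3 → ℤ, (∀ i, 0 ≤ a i) → (∀ i, b i ≤ L) → ‖∑ z ∈ Finset.Icc a b, c z‖ ≤ K

/-- `BoxMul L w M`: multiplication by `w` increases box sums by a factor at most `M`. -/
def BoxMul (L : ℤ) (w : (Fin 3 → ℤ) → ℂ) (M : ℝ) : Prop :=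
  ∀ c K, BoxSup L c K → BoxSup L (fun z => w z * c z) (M * K)

lemma BoxSup.nonneg {L : ℤ} {c K} (h : BoxSup L c K) : 0 ≤ K :=
  (norm_nonneg _).trans (h (fun _ => L + 1 + |L|) (fun _ => L)
    (fun _ => by have := neg_abs_le L; omega) (fun _ => le_rfl))

lemma BoxSup.mono {L : ℤ} {c K K'} (h : BoxSup L c K) (hK : K ≤ K') : BoxSup L c K' :=
  fun a b ha hb => (h a b ha hb).trans hK

lemma BoxSup.congr {L : ℤ} {c c' K} (h : BoxSup L c K)
    (hc : ∀ z : Fin 3 → ℤ, (∀ i, 0 ≤ z i) → (∀ i, z i ≤ L) → c z = c' z) : BoxSup L c' K := by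
  intro a b ha hb
  rw [← Finset.sum_congr rfl (fun z hz => ?_)]
  · exact h a b ha hb
  · rw [Finset.mem_Icc] at hz
    exact hc z (fun i => (ha i).trans (hz.1 i)) (fun i => (hz.2 i).trans (hb i))

lemma BoxSup.add {L : ℤ} {c c' K K'} (h : BoxSup L c K) (h' : BoxSup L c' K') :
    BoxSup L (fun z => c z + c' z) (K + K') := by
  intro a b ha hb
  rw [Finset.sum_add_distrib]
  exact (norm_add_le _ _).trans (add_le_add (h a b ha hb) (h' a b ha hb))

lemma BoxSup.const_mul {L : ℤ} {c K} (h : BoxSup L c K) (w : ℂ) :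
    BoxSup L (fun z => w * c z) (‖w‖ * K) := by
  intro a b ha hb
  rw [← Finset.mul_sum, norm_mul]
  exact mul_le_mul_of_nonneg_left (h a b ha hb) (norm_nonneg _)

lemma BoxSup.of_tendsto {L : ℤ} {c : ℕ → (Fin 3 → ℤ) → ℂ} {c' : (Fin 3 → ℤ) → ℂ} {K : ℕ → ℝ}
    {K' : ℝ} (h : ∀ n, BoxSup L (c n) (K n))
    (hc : ∀ z : Fin 3 → ℤ, (∀ i, 0 ≤ z i) → (∀ i, z i ≤ L) →
      Filter.Tendsto (fun n => c n z) Filter.atTop (nhds (c' z)))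
    (hK : Filter.Tendsto K Filter.atTop (nhds K')) : BoxSup L c' K' := by
  intro a b ha hb
  refine le_of_tendsto_of_tendsto' (tendsto_finsetSum _ fun z hz => ?_).norm hK
    (fun n => h n a b ha hb)
  rw [Finset.mem_Icc] at hz
  exact hc z (fun i => (ha i).trans (hz.1 i)) (fun i => (hz.2 i).trans (hb i))

lemma boxSup_single {L : ℤ} (z₀ : Fin 3 → ℤ) : BoxSup L (fun z => if z = z₀ then 1 else 0) 1 := by
  intro a b _ _
  rw [Finset.sum_ite_eq']
  split_ifs <;> simp

lemma BoxMul.norm_le {L : ℤ} {w M} (h : BoxMul L w M) {z : Fin 3 → ℤ} (h0 : ∀ i, 0 ≤ z i)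
    (hL : ∀ i, z i ≤ L) : ‖w z‖ ≤ M := by
  simpa using h _ _ (boxSup_single z) z z h0 hL

lemma BoxMul.mono {L : ℤ} {w M M'} (h : BoxMul L w M) (hM : M ≤ M') : BoxMul L w M' :=
  fun c K hc => (h c K hc).mono (mul_le_mul_of_nonneg_right hM hc.nonneg)

lemma BoxMul.congr {L : ℤ} {w w' M} (h : BoxMul L w M)
    (hw : ∀ z : Fin 3 → ℤ, (∀ i, 0 ≤ z i) → (∀ i, z i ≤ L) → w z = w' z) : BoxMul L w' M :=
  fun c K hc => (h c K hc).congr fun z h0 hL => by rw [hw z h0 hL]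

lemma boxMul_const (L : ℤ) (w : ℂ) : BoxMul L (fun _ => w) ‖w‖ :=
  fun _ _ hc => hc.const_mul w

lemma BoxMul.add {L : ℤ} {w w' M M'} (h : BoxMul L w M) (h' : BoxMul L w' M') :
    BoxMul L (fun z => w z + w' z) (M + M') := by
  intro c K hc
  rw [add_mul]
  exact ((h c K hc).add (h' c K hc)).congr fun z _ _ => by ring

lemma BoxMul.mul {L : ℤ} {w w' M M'} (h : BoxMul L w M) (h' : BoxMul L w' M') :
    BoxMul L (fun z => w z * w' z) (M * M') := by
  intro c K hc
  rw [mul_assoc]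
  exact (h _ _ (h' c K hc)).congr fun z _ _ => by ring

lemma BoxMul.const_mul {L : ℤ} {w M} (h : BoxMul L w M) (u : ℂ) :
    BoxMul L (fun z => u * w z) (‖u‖ * M) := (boxMul_const L u).mul h

lemma BoxMul.pow {L : ℤ} {w M} (h : BoxMul L w M) (n : ℕ) :
    BoxMul L (fun z => w z ^ n) (M ^ n) := by
  induction n with
  | zero => simpa using boxMul_const L 1
  | succ n ih => simpa only [pow_succ] using ih.mul h

lemma BoxMul.sum {L : ℤ} {ι : Type*} (s : Finset ι) {w : ι → (Fin 3 → ℤ) → ℂ} {M : ι → ℝ}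
    (h : ∀ i ∈ s, BoxMul L (w i) (M i)) :
    BoxMul L (fun z => ∑ i ∈ s, w i z) (∑ i ∈ s, M i) := by
  classical
  induction s using Finset.induction_on with
  | empty => simpa using boxMul_const L 0
  | insert i s hi ih =>
    simp only [Finset.sum_insert hi]
    exact (h i (Finset.mem_insert_self i s)).add
      (ih fun j hj => h j (Finset.mem_insert_of_mem hj))

lemma BoxMul.of_hasSum {L : ℤ} {w : ℕ → (Fin 3 → ℤ) → ℂ} {M : ℕ → ℝ} {w' : (Fin 3 → ℤ) → ℂ}
    {M' : ℝ} (h : ∀ n, BoxMul L (w n) (M n)) (hM : HasSum M M')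
    (hw : ∀ z : Fin 3 → ℤ, (∀ i, 0 ≤ z i) → (∀ i, z i ≤ L) → HasSum (fun n => w n z) (w' z)) :
    BoxMul L w' M' := by
  intro c K hc
  refine BoxSup.of_tendsto (c := fun n z => (∑ i ∈ Finset.range n, w i z) * c z)
    (K := fun n => (∑ i ∈ Finset.range n, M i) * K)
    (fun n => (BoxMul.sum _ fun i _ => h i) c K hc) (fun z h0 hL => ?_) ?_
  · exact ((hw z h0 hL).tendsto_sum_nat).mul_const _
  · exact (hM.tendsto_sum_nat).mul_const _

lemma BoxMul.exp {L : ℤ} {w M} (h : BoxMul L w M) :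
    BoxMul L (fun z => Complex.exp (w z)) (Real.exp M) := by
  refine BoxMul.of_hasSum (w := fun n z => ((n.factorial : ℂ)⁻¹) * w z ^ n)
    (M := fun n => (n.factorial : ℝ)⁻¹ * M ^ n) (fun n => ?_) ?_ (fun z _ _ => ?_)
  · simpa using (h.pow n).const_mul ((n.factorial : ℂ)⁻¹)
  · simpa [← Real.exp_eq_exp_ℝ] using NormedSpace.exp_series_hasSum_exp' (𝕂 := ℝ) M
  · simpa [← Complex.exp_eq_exp_ℂ] using NormedSpace.exp_series_hasSum_exp' (𝕂 := ℂ) (w z)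

lemma Icc_filter_le (a b : Fin 3 → ℤ) (i : Fin 3) (t : ℤ) :
    (Finset.Icc a b).filter (fun z => t ≤ z i)
      = Finset.Icc (Function.update a i (max (a i) t)) b := by
  ext z
  simp only [Finset.mem_filter, Finset.mem_Icc, Pi.le_def]
  constructor
  · rintro ⟨⟨h1, h2⟩, h3⟩
    refine ⟨fun j => ?_, h2⟩
    by_cases hj : j = i
    · subst hj; simpa using ⟨h1 j, h3⟩
    · simpa [hj] using h1 j
  · rintro ⟨h1, h2⟩
    have hi : max (a i) t ≤ z i := by simpa using h1 i
    refine ⟨⟨fun j => ?_, h2⟩, (le_max_right _ _).trans hi⟩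
    by_cases hj : j = i
    · subst hj; exact (le_max_left _ _).trans hi
    · simpa [hj] using h1 j

lemma boxMul_coord {L : ℤ} (hL : 0 ≤ L) (i : Fin 3) : BoxMul L (fun z => (z i : ℂ)) L := by
  intro c K hc a b ha hb
  have key : ∑ z ∈ Finset.Icc a b, (z i : ℂ) * c z
      = ∑ t ∈ Finset.Icc 1 L, ∑ z ∈ (Finset.Icc a b).filter (fun z => t ≤ z i), c z := by
    simp_rw [Finset.sum_filter]
    rw [Finset.sum_comm]
    refine Finset.sum_congr rfl fun z hz => ?_
    rw [Finset.mem_Icc] at hz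
    rw [← Finset.sum_filter, Finset.sum_const, nsmul_eq_mul]
    congr 1
    have h1 : (Finset.Icc 1 L).filter (fun t => t ≤ z i) = Finset.Icc 1 (z i) := by
      ext t
      have : z i ≤ L := (hz.2 i).trans (hb i)
      simp only [Finset.mem_filter, Finset.mem_Icc]
      omega
    have h2 : 0 ≤ z i := (ha i).trans (hz.1 i)
    rw [h1, Int.card_Icc]
    have : ((z i + 1 - 1).toNat : ℤ) = z i := by omega
    exact_mod_cast this.symm
  rw [key]
  refine (norm_sum_le _ _).trans ((Finset.sum_le_card_nsmul _ _ K fun t ht => ?_).trans ?_)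
  · rw [Icc_filter_le]
    refine hc _ _ (fun j => ?_) hb
    by_cases hj : j = i
    · subst hj; simpa using Or.inl (ha j)
    · simpa [hj] using ha j
  · rw [Int.card_Icc, nsmul_eq_mul]
    refine le_of_eq ?_
    congr 1
    have : ((L + 1 - 1).toNat : ℤ) = L := by omega
    exact_mod_cast this

lemma BoxMul.intervalIntegral {L : ℤ} {w : ℝ → (Fin 3 → ℤ) → ℂ} {M : ℝ}
    (h : ∀ t ∈ Set.Icc (0:ℝ) 1, BoxMul L (w t) M)
    (hw : ∀ z : Fin 3 → ℤ, (∀ i, 0 ≤ z i) → (∀ i, z i ≤ L) →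
      IntervalIntegrable (fun t => w t z) volume 0 1) :
    BoxMul L (fun z => ∫ t in (0:ℝ)..1, w t z) M := by
  intro c K hc a b ha hb
  have : ∑ z ∈ Finset.Icc a b, (∫ t in (0:ℝ)..1, w t z) * c z
      = ∫ t in (0:ℝ)..1, ∑ z ∈ Finset.Icc a b, w t z * c z := by
    rw [intervalIntegral.integral_finsetSum]
    · simp
    · intro z hz
      rw [Finset.mem_Icc] at hz
      exact (hw z (fun i => (ha i).trans (hz.1 i)) (fun i => (hz.2 i).trans (hb i))).mul_const _
  rw [this]
  refine (intervalIntegral.norm_integral_le_of_norm_le_const (C := M * K) fun t ht => ?_).trans ?_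
  · rw [Set.uIoc_of_le zero_le_one] at ht
    exact h t ⟨ht.1.le, ht.2⟩ c K hc a b ha hb
  · simp

/-- The autocorrelation of `c` restricted to the box `[a, b]`, at lag `h`. -/
noncomputable def corr (c : (Fin 3 → ℤ) → ℂ) (a b h : Fin 3 → ℤ) : ℂ :=
  ∑ z ∈ (Finset.Icc a b).filter (fun z => z + h ∈ Finset.Icc a b),
    c (z + h) * (starRingEnd ℂ) (c z)

lemma filter_add_mem_Icc (a b h : Fin 3 → ℤ) :
    (Finset.Icc a b).filter (fun z => z + h ∈ Finset.Icc a b)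
      = Finset.Icc (a ⊔ (a - h)) (b ⊓ (b - h)) := by
  ext z
  simp only [Finset.mem_filter, Finset.mem_Icc, sup_le_iff, le_inf_iff, sub_le_iff_le_add,
    le_sub_iff_add_le]
  tauto

lemma norm_corr_neg (c : (Fin 3 → ℤ) → ℂ) (a b h : Fin 3 → ℤ) :
    ‖corr c a b (-h)‖ = ‖corr c a b h‖ := by
  rw [← RCLike.norm_conj (corr c a b h)]
  congr 1
  unfold corr
  rw [map_sum]
  refine Finset.sum_bij' (fun z _ => z + -h) (fun z _ => z + h) ?_ ?_ ?_ ?_ ?_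
  · intro z hz
    simp only [Finset.mem_filter] at hz ⊢
    exact ⟨hz.2, by simpa using hz.1⟩
  · intro z hz
    simp only [Finset.mem_filter] at hz ⊢
    exact ⟨hz.2, by simpa using hz.1⟩
  · intro z _; simp
  · intro z _; simp
  · intro z _; simp [mul_comm]

lemma norm_corr_zero_le {c : (Fin 3 → ℤ) → ℂ} (hc : ∀ z, ‖c z‖ ≤ 1) {L : ℤ} (hL : 1 ≤ L)
    {a b : Fin 3 → ℤ} (ha : ∀ i, 0 ≤ a i) (hb : ∀ i, b i ≤ L) (h : Fin 3 → ℤ) :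
    ‖corr c a b h‖ ≤ 8 * (L : ℝ) ^ 3 := by
  have hsub : (Finset.Icc a b).filter (fun z => z + h ∈ Finset.Icc a b)
      ⊆ Finset.Icc (fun _ => 0) (fun _ => L) := by
    intro z hz
    simp only [Finset.mem_filter, Finset.mem_Icc, Pi.le_def] at hz ⊢
    exact ⟨fun i => (ha i).trans (hz.1.1 i), fun i => (hz.1.2 i).trans (hb i)⟩
  refine (norm_sum_le _ _).trans ((Finset.sum_le_card_nsmul _ _ 1 fun z _ => ?_).trans ?_)
  · rw [norm_mul, RCLike.norm_conj]
    exact mul_le_one₀ (hc _) (norm_nonneg _) (hc _)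
  · have h1 := Finset.card_le_card hsub
    rw [Pi.card_Icc] at h1
    simp only [Int.card_Icc, Finset.prod_const, Finset.card_univ, Fintype.card_fin] at h1
    have h2 : (((L + 1 - 0).toNat : ℕ) : ℝ) = (L : ℝ) + 1 := by
      have : ((L + 1 - 0).toNat : ℤ) = L + 1 := by omega
      exact_mod_cast this
    have h3 : (1 : ℝ) ≤ L := by exact_mod_cast hL
    rw [nsmul_eq_mul, mul_one]
    calc _ ≤ ((((L + 1 - 0).toNat ^ 3 : ℕ)) : ℝ) := by exact_mod_cast h1
      _ = ((L : ℝ) + 1) ^ 3 := by push_cast; rw [h2]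
      _ ≤ (2 * L) ^ 3 := by gcongr; linarith
      _ = _ := by ring

/-- Van der Corput's inequality for box sums, with a general family of shifts. -/
lemma vanDerCorput {Γ : Type*} [AddCommGroup Γ] [DecidableEq Γ] (s : Γ →+ (Fin 3 → ℤ))
    (I D : Finset Γ) (hD : ∀ i ∈ I, ∀ j ∈ I, i - j ∈ D) {L : ℤ} (hL : 1 ≤ L)
    (hs : ∀ i ∈ I, ∀ k, |s i k| ≤ L) (c : (Fin 3 → ℤ) → ℂ) {a b : Fin 3 → ℤ}
    (ha : ∀ i, 0 ≤ a i) (hb : ∀ i, b i ≤ L) :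
    (I.card : ℝ) * ‖∑ z ∈ Finset.Icc a b, c z‖ ^ 2
      ≤ 64 * (L : ℝ) ^ 3 * ∑ n ∈ D, ‖corr c a b (s n)‖ := by
  classical
  have hL' : (1 : ℝ) ≤ L := by exact_mod_cast hL
  set c0 : (Fin 3 → ℤ) → ℂ := fun z => if z ∈ Finset.Icc a b then c z else 0 with hc0
  have c0_in : ∀ z ∈ Finset.Icc a b, c0 z = c z := fun z hz => if_pos hz
  have c0_out : ∀ z, z ∉ Finset.Icc a b → c0 z = 0 := fun z hz => if_neg hz
  set W : Finset (Fin 3 → ℤ) := Finset.Icc (fun _ => -L) (fun _ => 2 * L) with hW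
  have hWcard : (W.card : ℝ) ≤ 64 * (L : ℝ) ^ 3 := by
    rw [hW, Pi.card_Icc]
    simp only [Int.card_Icc, Finset.prod_const, Finset.card_univ, Fintype.card_fin]
    have h2 : (((2 * L + 1 - -L).toNat : ℕ) : ℝ) = 3 * (L : ℝ) + 1 := by
      have : ((2 * L + 1 - -L).toNat : ℤ) = 3 * L + 1 := by omega
      exact_mod_cast this
    push_cast
    rw [h2]
    calc (3 * (L : ℝ) + 1) ^ 3 ≤ (4 * L) ^ 3 := by gcongr; linarith
      _ = _ := by ring
  -- translating the summation variable
  have shift : ∀ (φ : (Fin 3 → ℤ) → ℂ) (v : Fin 3 → ℤ), (∀ k, |v k| ≤ L) →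
      (∀ z, z ∉ Finset.Icc a b → φ z = 0) →
      ∑ z ∈ W, φ (z + v) = ∑ z ∈ Finset.Icc a b, φ z := by
    intro φ v hv hφ
    have h1 : ∑ z ∈ W, φ (z + v) = ∑ z ∈ W.map (addRightEmbedding v), φ z := by
      rw [Finset.sum_map]; rfl
    rw [h1]
    refine (Finset.sum_subset (fun z hz => ?_) (fun z _ hz => hφ z hz)).symm
    rw [Finset.mem_map]
    refine ⟨z - v, ?_, by simp⟩
    rw [hW, Finset.mem_Icc, Pi.le_def, Pi.le_def]
    rw [Finset.mem_Icc, Pi.le_def, Pi.le_def] at hz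
    constructor <;> intro k <;> have h1 := hz.1 k <;> have h2 := hz.2 k <;>
      have h3 := ha k <;> have h4 := hb k <;> have h5 := abs_le.1 (hv k) <;>
      simp only [Pi.sub_apply] <;> omega
  have hS : ∑ z ∈ W, ∑ i ∈ I, c0 (z + s i) = (I.card : ℂ) * ∑ z ∈ Finset.Icc a b, c z := by
    rw [Finset.sum_comm]
    rw [Finset.sum_congr rfl fun i hi => shift c0 (s i) (hs i hi) c0_out]
    rw [Finset.sum_const, nsmul_eq_mul]
    congr 1
    exact Finset.sum_congr rfl c0_in
  have hsq : ∑ z ∈ W, ‖∑ i ∈ I, c0 (z + s i)‖ ^ 2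
      ≤ I.card * ∑ n ∈ D, ‖corr c a b (s n)‖ := by
    have h1 : ((∑ z ∈ W, ‖∑ i ∈ I, c0 (z + s i)‖ ^ 2 : ℝ) : ℂ)
        = ∑ j ∈ I, ∑ i ∈ I, corr c a b (s (i - j)) := by
      push_cast
      have : ∀ z, ((‖∑ i ∈ I, c0 (z + s i)‖ : ℂ)) ^ 2
          = ∑ j ∈ I, ∑ i ∈ I, c0 (z + s i) * (starRingEnd ℂ) (c0 (z + s j)) := by
        intro z
        rw [← Complex.mul_conj', map_sum, Finset.sum_mul_sum, Finset.sum_comm]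
      simp_rw [this]
      rw [Finset.sum_comm]
      refine Finset.sum_congr rfl fun j hj => ?_
      rw [Finset.sum_comm]
      refine Finset.sum_congr rfl fun i hi => ?_
      have h2 := shift (fun z => c0 (z + s (i - j)) * (starRingEnd ℂ) (c0 z)) (s j) (hs j hj)
        (fun z hz => by simp only [c0_out z hz, map_zero, mul_zero])
      have h3 : ∀ z, z + s j + s (i - j) = z + s i := by
        intro z; rw [map_sub]; abel
      simp only [h3] at h2
      rw [h2, corr, Finset.sum_filter]
      refine Finset.sum_congr rfl fun z hz => ?_
      simp only [hc0]
      rw [if_pos hz]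
      split_ifs <;> simp
    have h2 : ∑ z ∈ W, ‖∑ i ∈ I, c0 (z + s i)‖ ^ 2
        ≤ ‖∑ j ∈ I, ∑ i ∈ I, corr c a b (s (i - j))‖ := by
      rw [← h1, Complex.norm_real]
      exact le_abs_self _
    refine h2.trans ((norm_sum_le _ _).trans ?_)
    rw [← nsmul_eq_mul]
    refine Finset.sum_le_card_nsmul _ _ _ fun j hj => ((norm_sum_le _ _).trans ?_)
    have h3 : ∑ i ∈ I, ‖corr c a b (s (i - j))‖
        = ∑ n ∈ I.image (fun i => i - j), ‖corr c a b (s n)‖ := by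
      rw [Finset.sum_image]
      intro x _ y _ h
      simpa using h
    rw [h3]
    refine Finset.sum_le_sum_of_subset_of_nonneg (fun n hn => ?_) fun _ _ _ => norm_nonneg _
    obtain ⟨i, hi, rfl⟩ := Finset.mem_image.1 hn
    exact hD i hi j hj
  have hCS : ‖∑ z ∈ W, ∑ i ∈ I, c0 (z + s i)‖ ^ 2
      ≤ W.card * ∑ z ∈ W, ‖∑ i ∈ I, c0 (z + s i)‖ ^ 2 := by
    refine (pow_le_pow_left₀ (norm_nonneg _) (norm_sum_le _ _) 2).trans ?_
    exact sq_sum_le_card_mul_sum_sq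
  rw [hS, norm_mul, Complex.norm_natCast] at hCS
  rcases I.eq_empty_or_nonempty with hI | hI
  · subst hI
    simp only [Finset.card_empty, Nat.cast_zero, zero_mul]
    positivity
  have hIc : (0 : ℝ) < I.card := by exact_mod_cast hI.card_pos
  have hD0 : 0 ≤ ∑ n ∈ D, ‖corr c a b (s n)‖ := Finset.sum_nonneg fun _ _ => norm_nonneg _
  have : (I.card : ℝ) * ((I.card : ℝ) * ‖∑ z ∈ Finset.Icc a b, c z‖ ^ 2)
      ≤ I.card * (64 * (L : ℝ) ^ 3 * ∑ n ∈ D, ‖corr c a b (s n)‖) := by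
    calc _ = (I.card * ‖∑ z ∈ Finset.Icc a b, c z‖) ^ 2 := by ring
      _ ≤ W.card * ∑ z ∈ W, ‖∑ i ∈ I, c0 (z + s i)‖ ^ 2 := hCS
      _ ≤ (64 * (L : ℝ) ^ 3) * (I.card * ∑ n ∈ D, ‖corr c a b (s n)‖) := by gcongr
      _ = _ := by ring
  exact le_of_mul_le_mul_left this hIc

/-- `expi t = exp (2 π i t)`. -/
noncomputable def expi (t : ℝ) : ℂ := Complex.exp ((2 * Real.pi * t : ℝ) * Complex.I)

lemma norm_expi (t : ℝ) : ‖expi t‖ = 1 := Complex.norm_exp_ofReal_mul_I _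

lemma expi_add (s t : ℝ) : expi (s + t) = expi s * expi t := by
  unfold expi; rw [← Complex.exp_add]; congr 1; push_cast; ring

lemma conj_expi (t : ℝ) : (starRingEnd ℂ) (expi t) = expi (-t) := by
  unfold expi; rw [← Complex.exp_conj]; congr 1
  rw [map_mul, Complex.conj_I, Complex.conj_ofReal]; push_cast; ring

lemma expi_sub (s t : ℝ) : expi (s - t) = expi s * (starRingEnd ℂ) (expi t) := by
  rw [conj_expi, ← expi_add, sub_eq_add_neg]

lemma corr_expi (P : (Fin 3 → ℤ) → ℝ) (a b h : Fin 3 → ℤ) :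
    corr (fun z => expi (P z)) a b h
      = ∑ z ∈ Finset.Icc (a ⊔ (a - h)) (b ⊓ (b - h)), expi (P (z + h) - P z) := by
  rw [corr, filter_add_mem_Icc]
  exact Finset.sum_congr rfl fun z _ => (expi_sub _ _).symm

lemma norm_corr_expi_le {P : (Fin 3 → ℤ) → ℝ} {L : ℤ} {h : Fin 3 → ℤ} {K : ℝ}
    (hK : BoxSup L (fun z => expi (P (z + h) - P z)) K) {a b : Fin 3 → ℤ}
    (ha : ∀ i, 0 ≤ a i) (hb : ∀ i, b i ≤ L) : ‖corr (fun z => expi (P z)) a b h‖ ≤ K := by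
  rw [corr_expi]
  refine hK _ _ (fun i => ?_) (fun i => ?_)
  · exact (ha i).trans (le_sup_left (a := a) (b := a - h) i)
  · exact (inf_le_left (a := b) (b := b - h) i).trans (hb i)

/-- One van der Corput step along multiples of a fixed vector. -/
lemma boxSup_expi_vdC {P : (Fin 3 → ℤ) → ℝ} {L : ℤ} (hL : 1 ≤ L) (v : Fin 3 → ℤ) {H : ℕ}
    (hH : 1 ≤ H) (hv : ∀ k, H * |v k| ≤ L) {κ : ℕ → ℝ}
    (hκ : ∀ r ∈ Finset.Ico 1 H, BoxSup L (fun z => expi (P (z + (r : ℤ) • v) - P z)) (κ r)) :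
    BoxSup L (fun z => expi (P z))
      (Real.sqrt (64 * (L : ℝ) ^ 3 * (8 * (L : ℝ) ^ 3 + 2 * ∑ r ∈ Finset.Ico 1 H, κ r) / H)) := by
  intro a b ha hb
  have hH' : (0 : ℝ) < H := by exact_mod_cast hH
  have hL' : (0 : ℝ) < L := by exact_mod_cast (by omega : 0 < L)
  have key := vanDerCorput (Γ := ℤ) ((zmultiplesHom (Fin 3 → ℤ)) v) (Finset.Ico 0 (H : ℤ))
    (Finset.Ioo (-(H : ℤ)) H) (fun i hi j hj => by
      simp only [Finset.mem_Ico, Finset.mem_Ioo] at *; omega) hL (fun i hi k => by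
      rw [Finset.mem_Ico] at hi
      rw [zmultiplesHom_apply, Pi.smul_apply, smul_eq_mul, abs_mul, abs_of_nonneg hi.1]
      exact (mul_le_mul_of_nonneg_right hi.2.le (abs_nonneg _)).trans (hv k))
    (fun z => expi (P z)) ha hb
  rw [Int.card_Ico, sub_zero, Int.toNat_natCast] at key
  refine Real.le_sqrt_of_sq_le ?_
  rw [le_div_iff₀ hH', mul_comm]
  refine key.trans (mul_le_mul_of_nonneg_left ?_ (by positivity))
  set F : ℤ → ℝ := fun n => ‖corr (fun z => expi (P z)) a b (zmultiplesHom _ v n)‖ with hF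
  have hsplit : ∀ m : ℕ, 1 ≤ m → ∑ n ∈ Finset.Ioo (-(m : ℤ)) m, F n
      = F 0 + ∑ r ∈ Finset.Ico 1 m, (F r + F (-(r : ℤ))) := by
    intro m hm
    induction m, hm using Nat.le_induction with
    | base =>
      have : Finset.Ioo (-((1 : ℕ) : ℤ)) ((1 : ℕ) : ℤ) = {0} := by decide
      rw [this]; simp
    | succ m hm ih =>
      have h1 : Finset.Ioo (-((m + 1 : ℕ) : ℤ)) ((m + 1 : ℕ) : ℤ)
          = insert (m : ℤ) (insert (-(m : ℤ)) (Finset.Ioo (-(m : ℤ)) m)) := by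
        ext x; simp only [Finset.mem_Ioo, Finset.mem_insert]; omega
      rw [h1, Finset.sum_insert, Finset.sum_insert, ih, Finset.sum_Ico_succ_top hm]
      · ring
      · simp
      · simp only [Finset.mem_insert, Finset.mem_Ioo, not_or]; omega
  rw [hsplit H hH, Finset.mul_sum]
  refine add_le_add (norm_corr_zero_le (fun z => (norm_expi _).le) hL ha hb _)
    (Finset.sum_le_sum fun r hr => ?_)
  have h1 : F (-(r : ℤ)) = F r := by
    simp only [hF, map_neg]; exact norm_corr_neg _ _ _ _
  have h2 : F r ≤ κ r := norm_corr_expi_le (hκ r hr) ha hb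
  linarith

lemma card_le_of_abs_sub_le {S : Finset ℤ} {d : ℝ} (hd : 0 ≤ d)
    (h : ∀ x ∈ S, ∀ y ∈ S, |(x : ℝ) - y| ≤ d) : (S.card : ℝ) ≤ d + 1 := by
  rcases S.eq_empty_or_nonempty with rfl | hS
  · simp; linarith
  have hsub : S ⊆ Finset.Icc (S.min' hS) (S.min' hS + ⌊d⌋) := by
    intro x hx
    rw [Finset.mem_Icc]
    refine ⟨S.min'_le x hx, ?_⟩
    have h1 := (le_abs_self _).trans (h x hx _ (S.min'_mem hS))
    have : x - S.min' hS ≤ ⌊d⌋ := Int.le_floor.2 (by push_cast; exact h1)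
    omega
  have h1 := Finset.card_le_card hsub
  rw [Int.card_Icc] at h1
  have h2 : (S.card : ℤ) ≤ ⌊d⌋ + 1 := by have := Int.floor_nonneg.2 hd; omega
  have h3 : (S.card : ℝ) ≤ ((⌊d⌋ + 1 : ℤ) : ℝ) := by exact_mod_cast h2
  push_cast at h3
  linarith [Int.floor_le d]

lemma adjugate_cross (M : Matrix (Fin 3) (Fin 3) ℝ) (p q : Fin 3) :
    M.adjugate p q = M (q + 1) (p + 1) * M (q + 2) (p + 2)
      - M (q + 1) (p + 2) * M (q + 2) (p + 1) := by
  rw [Matrix.adjugate_fin_three]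
  fin_cases p <;> fin_cases q <;> simp <;> ring

lemma abs_adjugate_le {M : Matrix (Fin 3) (Fin 3) ℝ} {B : ℝ} (hB : ∀ i j, |M i j| ≤ B)
    (p q : Fin 3) : |M.adjugate p q| ≤ 2 * B ^ 2 := by
  have hB0 : 0 ≤ B := (abs_nonneg _).trans (hB 0 0)
  rw [adjugate_cross]
  refine (abs_sub _ _).trans ?_
  rw [abs_mul, abs_mul]
  have h1 := mul_le_mul (hB (q + 1) (p + 1)) (hB (q + 2) (p + 2)) (abs_nonneg _) hB0
  have h2 := mul_le_mul (hB (q + 1) (p + 2)) (hB (q + 2) (p + 1)) (abs_nonneg _) hB0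
  nlinarith

lemma card_le_of_mulVec_le {M : Matrix (Fin 3) (Fin 3) ℝ} {B A₀ τ X : ℝ} (hA₀ : 0 < A₀)
    (hτ : 0 ≤ τ) (hX : 0 ≤ X) (hB : ∀ i j, |M i j| ≤ B) {p q : Fin 3}
    (hpq : A₀ ≤ |M.adjugate p q|) {S : Finset (Fin 3 → ℤ)}
    (hS : ∀ k ∈ S, ∀ i, |∑ j, M i j * (k j : ℝ)| ≤ τ)
    (hSp : ∀ k ∈ S, ∀ k' ∈ S, |((k p : ℤ) : ℝ) - (k' p : ℤ)| ≤ X) :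
    (S.card : ℝ) ≤ (4 * B * τ / A₀ + 1) ^ 2 * (X + 1) := by
  classical
  have hB0 : 0 ≤ B := (abs_nonneg _).trans (hB 0 0)
  set d := 4 * B * τ / A₀ with hd
  have hd0 : 0 ≤ d := by positivity
  have him : ((S.image fun k => k p).card : ℝ) ≤ X + 1 := by
    refine card_le_of_abs_sub_le hX fun x hx y hy => ?_
    obtain ⟨k, hk, rfl⟩ := Finset.mem_image.1 hx
    obtain ⟨k', hk', rfl⟩ := Finset.mem_image.1 hy
    exact hSp k hk k' hk'
  have hdiff : ∀ k ∈ S, ∀ k' ∈ S, k p = k' p →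
      |((k (p + 1) : ℤ) : ℝ) - (k' (p + 1) : ℤ)| ≤ d ∧
      |((k (p + 2) : ℤ) : ℝ) - (k' (p + 2) : ℤ)| ≤ d := by
    intro k hk k' hk' hp
    have hp' : (k p : ℝ) = k' p := by exact_mod_cast hp
    set δ : Fin 3 → ℝ := fun i => (k i : ℝ) - k' i with hδ
    have hw : ∀ i, |M i p * δ p + M i (p + 1) * δ (p + 1) + M i (p + 2) * δ (p + 2)| ≤ 2 * τ := by
      intro i
      have h1 := hS k hk i
      have h2 := hS k' hk' i
      have h3 : M i p * δ p + M i (p + 1) * δ (p + 1) + M i (p + 2) * δ (p + 2)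
          = ∑ j, M i j * (k j : ℝ) - ∑ j, M i j * (k' j : ℝ) := by
        rw [← Finset.sum_sub_distrib, Fin.sum_univ_three]
        simp only [hδ]
        fin_cases p <;> simp <;> ring
      rw [h3]
      refine (abs_sub _ _).trans (by linarith)
    have hδp : δ p = 0 := by simp [hδ, hp']
    simp only [hδp, mul_zero, zero_add] at hw
    have e1 : M.adjugate p q * δ (p + 1)
        = M (q + 2) (p + 2) * (M (q + 1) (p + 1) * δ (p + 1) + M (q + 1) (p + 2) * δ (p + 2))
        - M (q + 1) (p + 2) * (M (q + 2) (p + 1) * δ (p + 1) + M (q + 2) (p + 2) * δ (p + 2)) := by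
      rw [adjugate_cross]; ring
    have e2 : M.adjugate p q * δ (p + 2)
        = M (q + 1) (p + 1) * (M (q + 2) (p + 1) * δ (p + 1) + M (q + 2) (p + 2) * δ (p + 2))
        - M (q + 2) (p + 1) * (M (q + 1) (p + 1) * δ (p + 1) + M (q + 1) (p + 2) * δ (p + 2)) := by
      rw [adjugate_cross]; ring
    have gen : ∀ (x u v a b : ℝ), M.adjugate p q * x = u * a - v * b → |u| ≤ B → |v| ≤ B →
        |a| ≤ 2 * τ → |b| ≤ 2 * τ → |x| ≤ d := by
      intro x u v a b h hu hv ha hb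
      rw [hd, le_div_iff₀ hA₀]
      calc |x| * A₀ ≤ |M.adjugate p q| * |x| := by
            rw [mul_comm]; exact mul_le_mul_of_nonneg_right hpq (abs_nonneg _)
        _ = |u * a - v * b| := by rw [← abs_mul, h]
        _ ≤ |u * a| + |v * b| := abs_sub _ _
        _ ≤ B * (2 * τ) + B * (2 * τ) := by
            rw [abs_mul, abs_mul]
            gcongr
        _ = 4 * B * τ := by ring
    exact ⟨gen _ _ _ _ _ e1 (hB _ _) (hB _ _) (hw _) (hw _),
      gen _ _ _ _ _ e2 (hB _ _) (hB _ _) (hw _) (hw _)⟩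
  have hfib : ∀ x ∈ S.image (fun k => k p),
      ((S.filter fun k => k p = x).card : ℝ) ≤ (d + 1) ^ 2 := by
    intro x _
    set F := S.filter fun k => k p = x with hF
    have hmem : ∀ k ∈ F, k ∈ S ∧ k p = x := fun k hk => by simpa [hF] using hk
    have c1 : ((F.image fun k => k (p + 1)).card : ℝ) ≤ d + 1 := by
      refine card_le_of_abs_sub_le hd0 fun x hx y hy => ?_
      obtain ⟨k, hk, rfl⟩ := Finset.mem_image.1 hx
      obtain ⟨k', hk', rfl⟩ := Finset.mem_image.1 hy
      exact (hdiff k (hmem k hk).1 k' (hmem k' hk').1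
        ((hmem k hk).2.trans (hmem k' hk').2.symm)).1
    have c2 : ((F.image fun k => k (p + 2)).card : ℝ) ≤ d + 1 := by
      refine card_le_of_abs_sub_le hd0 fun x hx y hy => ?_
      obtain ⟨k, hk, rfl⟩ := Finset.mem_image.1 hx
      obtain ⟨k', hk', rfl⟩ := Finset.mem_image.1 hy
      exact (hdiff k (hmem k hk).1 k' (hmem k' hk').1
        ((hmem k hk).2.trans (hmem k' hk').2.symm)).2
    have c3 : F.card ≤ ((F.image fun k => k (p + 1)) ×ˢ (F.image fun k => k (p + 2))).card := by
      refine Finset.card_le_card_of_injOn (fun k => (k (p + 1), k (p + 2))) ?_ ?_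
      · intro k hk
        simp only [Finset.coe_product, Set.mem_prod, Finset.mem_coe]
        exact ⟨Finset.mem_image_of_mem _ hk, Finset.mem_image_of_mem _ hk⟩
      · intro k hk k' hk' h
        simp only [Prod.mk.injEq] at h
        have h0 : k p = k' p := (hmem k hk).2.trans (hmem k' hk').2.symm
        funext i
        have : ∀ i p : Fin 3, i = p ∨ i = p + 1 ∨ i = p + 2 := by decide
        rcases this i p with rfl | rfl | rfl
        exacts [h0, h.1, h.2]
    rw [Finset.card_product] at c3
    calc (F.card : ℝ) ≤ ((F.image fun k => k (p + 1)).card : ℝ)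
          * ((F.image fun k => k (p + 2)).card : ℝ) := by exact_mod_cast c3
      _ ≤ (d + 1) * (d + 1) := by gcongr
      _ = (d + 1) ^ 2 := by ring
  rw [Finset.card_eq_sum_card_image (fun k => k p) S]
  push_cast
  refine (Finset.sum_le_card_nsmul _ _ _ hfib).trans ?_
  rw [nsmul_eq_mul, mul_comm]
  gcongr

lemma abs_det_mul_le {M : Matrix (Fin 3) (Fin 3) ℝ} {B τ : ℝ} (hB : ∀ i j, |M i j| ≤ B)
    {k : Fin 3 → ℝ} (hk : ∀ i, |∑ j, M i j * k j| ≤ τ) (p : Fin 3) :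
    |M.det| * |k p| ≤ 6 * B ^ 2 * τ := by
  have h1 : M.det * k p = ∑ j, M.adjugate p j * (∑ l, M j l * k l) := by
    have : M.adjugate.mulVec (M.mulVec k) = M.det • k := by
      rw [Matrix.mulVec_mulVec, Matrix.adjugate_mul, Matrix.smul_mulVec, Matrix.one_mulVec]
    have h2 := congrFun this p
    simp only [Pi.smul_apply, smul_eq_mul] at h2
    rw [← h2]; rfl
  have hB0 : 0 ≤ 2 * B ^ 2 := by positivity
  rw [← abs_mul, h1]
  refine (Finset.abs_sum_le_sum_abs _ _).trans ((Finset.sum_le_card_nsmul _ _ (2 * B ^ 2 * τ)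
    fun j _ => ?_).trans ?_)
  · rw [abs_mul]
    exact mul_le_mul (abs_adjugate_le hB p j) (hk j) (abs_nonneg _) hB0
  · simp; ring_nf; rfl

/-- The polarised determinant `tr(adj(M) X)`. -/
noncomputable def adjTrace (M X : Matrix (Fin 3) (Fin 3) ℝ) : ℝ := (M.adjugate * X).trace

/-- Simpson's rule for the determinant along a line is exact. -/
lemma det_add_smul_sub (M X : Matrix (Fin 3) (Fin 3) ℝ) (t : ℝ) :
    (M + t • X).det - M.det
      = t / 6 * (adjTrace M X + adjTrace ((2 : ℝ) • M + t • X) X + adjTrace (M + t • X) X) := by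
  unfold adjTrace
  simp only [Matrix.trace, Matrix.diag, Matrix.mul_apply, Fin.sum_univ_three,
    Matrix.adjugate_fin_three, Matrix.det_fin_three, Matrix.add_apply, Matrix.smul_apply,
    smul_eq_mul, Matrix.of_apply, Matrix.cons_val]
  ring

lemma exists_adjugate_ge {M X : Matrix (Fin 3) (Fin 3) ℝ} {m c : ℝ} (hm : 0 < m)
    (hX : ∀ i j, |X i j| ≤ m) (h : c ≤ |adjTrace M X|) :
    ∃ p q, c / (9 * m) ≤ |M.adjugate p q| := by
  by_contra! hcon
  have h1 : |adjTrace M X| < c := by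
    have : adjTrace M X = ∑ p, ∑ q, M.adjugate p q * X q p := by
      simp [adjTrace, Matrix.trace, Matrix.mul_apply]
    rw [this]
    calc _ ≤ ∑ p, ∑ q, |M.adjugate p q| * m := by
          refine (Finset.abs_sum_le_sum_abs _ _).trans (Finset.sum_le_sum fun p _ => ?_)
          refine (Finset.abs_sum_le_sum_abs _ _).trans (Finset.sum_le_sum fun q _ => ?_)
          rw [abs_mul]
          exact mul_le_mul_of_nonneg_left (hX q p) (abs_nonneg _)
      _ < ∑ p : Fin 3, ∑ q : Fin 3, c / (9 * m) * m := by
          refine Finset.sum_lt_sum_of_nonempty ⟨0, Finset.mem_univ _⟩ fun p _ => ?_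
          refine Finset.sum_lt_sum_of_nonempty ⟨0, Finset.mem_univ _⟩ fun q _ => ?_
          exact mul_lt_mul_of_pos_right (hcon p q) hm
      _ = c := by simp; field_simp; ring
  linarith

lemma four_mul_abs_le_norm_expi_sub_one {θ : ℝ} (hθ : |θ| ≤ 1 / 2) :
    4 * |θ| ≤ ‖expi θ - 1‖ := by
  have h1 : expi θ = Complex.exp (Complex.I * ((2 * Real.pi * θ : ℝ) : ℂ)) := by
    rw [expi, mul_comm]
  rw [h1, Complex.norm_exp_I_mul_ofReal_sub_one]
  have hpi := Real.pi_pos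
  have h2 : |2 * Real.pi * θ / 2| = Real.pi * |θ| := by
    rw [show 2 * Real.pi * θ / 2 = Real.pi * θ by ring, abs_mul, abs_of_pos hpi]
  have h3 := Real.mul_abs_le_abs_sin (x := 2 * Real.pi * θ / 2) (by rw [h2]; nlinarith)
  rw [h2] at h3
  rw [norm_mul, Real.norm_eq_abs, Real.norm_eq_abs, abs_two]
  have h4 : 2 / Real.pi * (Real.pi * |θ|) = 2 * |θ| := by field_simp
  linarith

lemma norm_sum_expi_mul_le {θ : ℝ} (hθ : |θ| ≤ 1 / 2) (a b : ℤ) :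
    |θ| * ‖∑ x ∈ Finset.Icc a b, expi (θ * x)‖ ≤ 1 / 2 := by
  rcases lt_or_ge b a with hab | hab
  · rw [Finset.Icc_eq_empty (by omega)]; simp
  have tele : (expi θ - 1) * ∑ x ∈ Finset.Icc a b, expi (θ * x)
      = expi (θ * (b + 1)) - expi (θ * a) := by
    induction b, hab using Int.leInduction with
    | base => simp [sub_mul, ← expi_add]; ring_nf
    | succ b hb ih =>
      have : Finset.Icc a (b + 1) = insert (b + 1) (Finset.Icc a b) := by
        ext x; simp only [Finset.mem_Icc, Finset.mem_insert]; omega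
      rw [this, Finset.sum_insert (by simp), mul_add, ih, sub_mul, ← expi_add]
      push_cast; ring_nf
  have h1 := four_mul_abs_le_norm_expi_sub_one hθ
  have h2 : ‖expi θ - 1‖ * ‖∑ x ∈ Finset.Icc a b, expi (θ * x)‖ ≤ 2 := by
    rw [← norm_mul, tele]
    refine (norm_sub_le _ _).trans ?_
    rw [norm_expi, norm_expi]; norm_num
  have h3 := mul_le_mul_of_nonneg_right h1 (norm_nonneg (∑ x ∈ Finset.Icc a b, expi (θ * x)))
  linarith

lemma norm_sum_expi_mul_le_floor {θ : ℝ} (hθ : |θ| ≤ 1 / 2) {L a b : ℤ} (hL : 1 ≤ L) (ha : 0 ≤ a)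
    (hb : b ≤ L) : ‖∑ x ∈ Finset.Icc a b, expi (θ * x)‖ ≤ 5 * L / (1 + |(⌊L * θ⌋ : ℝ)|) := by
  have hL' : (1 : ℝ) ≤ L := by exact_mod_cast hL
  set S := ‖∑ x ∈ Finset.Icc a b, expi (θ * x)‖ with hS
  have hS0 : 0 ≤ S := norm_nonneg _
  have htriv : S ≤ 2 * L := by
    refine (norm_sum_le _ _).trans ?_
    simp only [norm_expi, Finset.sum_const, nsmul_eq_mul, mul_one, Int.card_Icc]
    have : ((b + 1 - a).toNat : ℤ) ≤ 2 * L := by omega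
    exact_mod_cast this
  have hmain := norm_sum_expi_mul_le hθ a b
  rw [← hS] at hmain
  rw [le_div_iff₀ (by positivity)]
  have hf1 := Int.floor_le ((L : ℝ) * θ)
  have hf2 := Int.lt_floor_add_one ((L : ℝ) * θ)
  have hLθ : |(L : ℝ) * θ| * S ≤ L / 2 := by
    rw [abs_mul, abs_of_pos (by linarith : (0 : ℝ) < L)]; nlinarith
  have hj : |(⌊L * θ⌋ : ℝ)| ≤ |(L : ℝ) * θ| + 1 := by
    rcases abs_cases ((⌊L * θ⌋ : ℝ)) with h | h <;> rcases abs_cases ((L : ℝ) * θ) with h' | h' <;>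
      linarith
  nlinarith

lemma sum_Icc_pi_expi (θ : Fin 3 → ℝ) (a b : Fin 3 → ℤ) :
    ∑ z ∈ Finset.Icc a b, expi (∑ i, θ i * z i)
      = ∏ i, ∑ x ∈ Finset.Icc (a i) (b i), expi (θ i * x) := by
  rw [Finset.prod_univ_sum]
  refine Finset.sum_congr rfl fun z _ => ?_
  simp only [Fin.sum_univ_three, Fin.prod_univ_three, expi_add]

lemma sum_one_div_one_add_abs_le {L : ℤ} (hL : 1 ≤ L) :
    ∑ j ∈ Finset.Icc (-L) L, 1 / (1 + |(j : ℝ)|) ≤ 4 * (1 + Real.log L) := by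
  obtain ⟨N, rfl⟩ : ∃ N : ℕ, L = N := ⟨L.toNat, by omega⟩
  have hN : 1 ≤ N := by exact_mod_cast hL
  have h1 : ∑ j ∈ Finset.Icc (-(N : ℤ)) N, 1 / (1 + |(j : ℝ)|)
      ≤ 2 * ∑ i ∈ Finset.range (N + 1), ((i + 1 : ℕ) : ℝ)⁻¹ := by
    clear hL hN
    induction N with
    | zero => simp
    | succ N ih =>
      have : Finset.Icc (-((N + 1 : ℕ) : ℤ)) ((N + 1 : ℕ) : ℤ)
          = insert ((N + 1 : ℕ) : ℤ) (insert (-((N + 1 : ℕ) : ℤ)) (Finset.Icc (-(N : ℤ)) N)) := by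
        ext x; simp only [Finset.mem_Icc, Finset.mem_insert]; omega
      rw [this, Finset.sum_insert (by simp; omega), Finset.sum_insert (by simp),
        Finset.sum_range_succ]
      have h3 : |((N : ℝ) + 1)| = N + 1 := abs_of_nonneg (by positivity)
      have h4 : |(-1 : ℝ) + -(N : ℝ)| = N + 1 := by rw [← h3, ← abs_neg]; ring_nf
      push_cast at ih ⊢
      simp only [neg_add_rev, h4, h3, one_div] at ih ⊢
      rw [show (1 : ℝ) + ((N : ℝ) + 1) = N + 1 + 1 by ring]
      linarith
  have h2 : (∑ i ∈ Finset.range (N + 1), ((i + 1 : ℕ) : ℝ)⁻¹) ≤ 1 + Real.log (N + 1 : ℕ) := by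
    have := harmonic_le_one_add_log (N + 1)
    rw [harmonic] at this
    push_cast at this ⊢
    exact this
  have h3 : Real.log ((N + 1 : ℕ) : ℝ) ≤ 1 + Real.log N := by
    have hN' : (1 : ℝ) ≤ N := by exact_mod_cast hN
    calc Real.log ((N + 1 : ℕ) : ℝ) ≤ Real.log (2 * N) :=
          Real.log_le_log (by positivity) (by push_cast; linarith)
      _ = Real.log 2 + Real.log N := Real.log_mul (by norm_num) (by positivity)
      _ ≤ 1 + Real.log N := by linarith [Real.log_two_lt_d9]
  have h4 : 0 ≤ Real.log N := Real.log_natCast_nonneg N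
  push_cast at h1 h2 h3 ⊢
  linarith

/-- The number of small lattice points controlling a bilinear exponential sum. -/
noncomputable def smallCount (L : ℤ) (M : Matrix (Fin 3) (Fin 3) ℝ) (τ : ℝ) : ℕ :=
  ((Finset.Icc (fun _ => -(2 * L)) (fun _ => 2 * L) : Finset (Fin 3 → ℤ)).filter
    fun k => ∀ i, |∑ j, M i j * (k j : ℝ)| ≤ τ).card

/-- Davenport's bound for an exponential sum whose phase has a bilinear difference. -/
lemma norm_sq_sum_expi_le_smallCount {Q : (Fin 3 → ℤ) → ℝ} {M : Matrix (Fin 3) (Fin 3) ℝ} {Θ : ℝ}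
    {L : ℤ} (hL : 1 ≤ L) (hΘ : 0 < Θ) (κ : (Fin 3 → ℤ) → ℝ)
    (hQ : ∀ k z : Fin 3 → ℤ,
      Q (z + k) - Q z = κ k + Θ * ∑ i, (∑ j, M i j * (k j : ℝ)) * (z i : ℝ))
    (hM : ∀ k : Fin 3 → ℤ, (∀ i, |k i| ≤ L) → ∀ i, |Θ * ∑ j, M i j * (k j : ℝ)| ≤ 1 / 2)
    {a b : Fin 3 → ℤ} (ha : ∀ i, 0 ≤ a i) (hb : ∀ i, b i ≤ L) :
    ‖∑ z ∈ Finset.Icc a b, expi (Q z)‖ ^ 2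
      ≤ 64 * (20 * L * (1 + Real.log L)) ^ 3 * smallCount L M (1 / (Θ * L)) := by
  classical
  have hL' : (1 : ℝ) ≤ L := by exact_mod_cast hL
  set U : Finset (Fin 3 → ℤ) := Finset.Icc (fun _ => -L) (fun _ => L) with hU
  have hUmem : ∀ k ∈ U, ∀ i, |k i| ≤ L := by
    intro k hk i
    rw [hU, Finset.mem_Icc] at hk
    exact abs_le.2 ⟨hk.1 i, hk.2 i⟩
  have hvdc := vanDerCorput (AddMonoidHom.id (Fin 3 → ℤ)) (Finset.Icc (fun _ => 0) (fun _ => L)) U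
    (fun i hi j hj => by
      rw [Finset.mem_Icc, Pi.le_def, Pi.le_def] at hi hj
      rw [hU, Finset.mem_Icc, Pi.le_def, Pi.le_def]
      constructor <;> intro k <;> have h1 := hi.1 k <;> have h2 := hi.2 k <;> have h3 := hj.1 k <;>
        have h4 := hj.2 k <;> simp only [Pi.sub_apply] <;> omega) hL
    (fun i hi k => by
      rw [Finset.mem_Icc] at hi
      exact abs_le.2 ⟨(by omega : -L ≤ 0).trans (hi.1 k), hi.2 k⟩) (fun z => expi (Q z)) ha hb
  have hcard : (L : ℝ) ^ 3 ≤ ((Finset.Icc (fun _ => 0) (fun _ => L) : Finset (Fin 3 → ℤ)).card : ℝ) := by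
    rw [Pi.card_Icc]
    simp only [Int.card_Icc, Finset.prod_const, Finset.card_univ, Fintype.card_fin]
    have h2 : (((L + 1 - 0).toNat : ℕ) : ℝ) = (L : ℝ) + 1 := by
      have : ((L + 1 - 0).toNat : ℤ) = L + 1 := by omega
      exact_mod_cast this
    push_cast
    rw [h2]; gcongr; linarith
  set S := ‖∑ z ∈ Finset.Icc a b, expi (Q z)‖ with hS
  have h1 : S ^ 2 ≤ 64 * ∑ k ∈ U, ‖corr (fun z => expi (Q z)) a b k‖ := by
    have h2 := (mul_le_mul_of_nonneg_right hcard (sq_nonneg S)).trans hvdc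
    have h3 : (0 : ℝ) < (L : ℝ) ^ 3 := by positivity
    refine le_of_mul_le_mul_left (h2.trans (le_of_eq ?_)) h3
    simp only [AddMonoidHom.id_apply]; ring
  set fl : (Fin 3 → ℤ) → (Fin 3 → ℤ) := fun k i => ⌊(L : ℝ) * (Θ * ∑ j, M i j * (k j : ℝ))⌋ with hfl
  have h2 : ∀ k ∈ U, ‖corr (fun z => expi (Q z)) a b k‖
      ≤ ∏ i, (5 * L / (1 + |((fl k i : ℤ) : ℝ)|)) := by
    intro k hk
    rw [corr_expi]
    have e : ∀ z : Fin 3 → ℤ, expi (Q (z + k) - Q z)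
        = expi (κ k) * expi (∑ i, (Θ * ∑ j, M i j * (k j : ℝ)) * z i) := by
      intro z
      rw [hQ, ← expi_add, Finset.mul_sum]
      congr 2
      exact Finset.sum_congr rfl fun i _ => by ring
    simp_rw [e]
    rw [← Finset.mul_sum, norm_mul, norm_expi, one_mul, sum_Icc_pi_expi, norm_prod]
    refine Finset.prod_le_prod (fun _ _ => norm_nonneg _) fun i _ => ?_
    refine norm_sum_expi_mul_le_floor (hM k (hUmem k hk) i) hL ?_ ?_
    · exact (ha i).trans (le_sup_left (a := a) (b := a - k) i)
    · exact (inf_le_left (a := b) (b := b - k) i).trans (hb i)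
  have hfU : ∀ k ∈ U, fl k ∈ U := by
    intro k hk
    rw [hU, Finset.mem_Icc, Pi.le_def, Pi.le_def]
    have hle : ∀ i, |(L : ℝ) * (Θ * ∑ j, M i j * (k j : ℝ))| ≤ L := by
      intro i
      rw [abs_mul, abs_of_pos (by linarith : (0 : ℝ) < L)]
      have := hM k (hUmem k hk) i
      nlinarith
    refine ⟨fun i => Int.le_floor.2 ?_, fun i => ?_⟩
    · push_cast; exact (abs_le.1 (hle i)).1
    · have := (Int.floor_le ((L : ℝ) * (Θ * ∑ j, M i j * (k j : ℝ)))).trans (abs_le.1 (hle i)).2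
      exact_mod_cast this
  have hfib : ∀ j : Fin 3 → ℤ, (U.filter fun k => fl k = j).card ≤ smallCount L M (1 / (Θ * L)) := by
    intro j
    rcases (U.filter fun k => fl k = j).eq_empty_or_nonempty with h | ⟨k₀, hk₀⟩
    · rw [h]; simp
    refine Finset.card_le_card_of_injOn (fun k => k - k₀) ?_ (fun x _ y _ h => by simpa using h)
    intro k hk
    simp only [Finset.coe_filter, Set.mem_ofPred_eq, Finset.mem_filter] at hk hk₀ ⊢
    have b1 := hUmem k hk.1
    have b2 := hUmem k₀ hk₀.1
    refine ⟨?_, fun i => ?_⟩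
    · rw [Finset.mem_Icc, Pi.le_def, Pi.le_def]
      constructor <;> intro i <;> have h1 := abs_le.1 (b1 i) <;> have h2 := abs_le.1 (b2 i) <;>
        simp only [Pi.sub_apply] <;> omega
    · have h3 : fl k i = fl k₀ i := by rw [hk.2, hk₀.2]
      have h4 := Int.abs_sub_lt_one_of_floor_eq_floor h3
      have h5 : (L : ℝ) * (Θ * ∑ j, M i j * (k j : ℝ)) - L * (Θ * ∑ j, M i j * (k₀ j : ℝ))
          = (Θ * L) * ∑ j, M i j * (((k - k₀) j : ℤ) : ℝ) := by
        simp only [Fin.sum_univ_three, Pi.sub_apply]; push_cast; ring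
      have h6 : 0 < Θ * L := by positivity
      rw [h5, abs_mul, abs_of_pos h6] at h4
      rw [le_div_iff₀ h6]; linarith
  have h3 : ∑ k ∈ U, ‖corr (fun z => expi (Q z)) a b k‖
      ≤ ∑ j ∈ U, smallCount L M (1 / (Θ * L)) * ∏ i, (5 * L / (1 + |((j i : ℤ) : ℝ)|)) := by
    refine (Finset.sum_le_sum h2).trans ?_
    rw [← Finset.sum_fiberwise_of_maps_to hfU]
    refine Finset.sum_le_sum fun j _ => ?_
    rw [Finset.sum_congr rfl (g := fun _ => ∏ i, (5 * (L : ℝ) / (1 + |((j i : ℤ) : ℝ)|)))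
      (fun k hk => by rw [(Finset.mem_filter.1 hk).2]), Finset.sum_const, nsmul_eq_mul]
    exact mul_le_mul_of_nonneg_right (by exact_mod_cast hfib j)
      (Finset.prod_nonneg fun i _ => by positivity)
  have h4 : ∑ j ∈ U, ∏ i, (5 * L / (1 + |((j i : ℤ) : ℝ)|))
      = (∑ j ∈ Finset.Icc (-L) L, 5 * L / (1 + |(j : ℝ)|)) ^ 3 := by
    have := Finset.prod_univ_sum (fun _ : Fin 3 => Finset.Icc (-L) L)
      (fun _ j => 5 * (L : ℝ) / (1 + |(j : ℝ)|))
    simp only [Finset.prod_const, Finset.card_univ, Fintype.card_fin] at this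
    rw [this]; rfl
  have h5 : ∑ j ∈ Finset.Icc (-L) L, 5 * L / (1 + |(j : ℝ)|) ≤ 20 * L * (1 + Real.log L) := by
    have := sum_one_div_one_add_abs_le hL
    calc _ = 5 * L * ∑ j ∈ Finset.Icc (-L) L, 1 / (1 + |(j : ℝ)|) := by
          rw [Finset.mul_sum]; exact Finset.sum_congr rfl fun j _ => by ring
      _ ≤ 5 * L * (4 * (1 + Real.log L)) := by gcongr
      _ = _ := by ring
  rw [← Finset.mul_sum, h4] at h3
  have h6 : (∑ j ∈ Finset.Icc (-L) L, 5 * (L : ℝ) / (1 + |(j : ℝ)|)) ^ 3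
      ≤ (20 * L * (1 + Real.log L)) ^ 3 :=
    pow_le_pow_left₀ (Finset.sum_nonneg fun j _ => by positivity) h5 3
  calc S ^ 2 ≤ 64 * ∑ k ∈ U, ‖corr (fun z => expi (Q z)) a b k‖ := h1
    _ ≤ 64 * (smallCount L M (1 / (Θ * L)) * (20 * L * (1 + Real.log L)) ^ 3) := by
        gcongr; exact h3.trans (mul_le_mul_of_nonneg_left h6 (Nat.cast_nonneg _))
    _ = _ := by ring

lemma abs_intCast_le_norm (n : Fin 3 → ℤ) (i : Fin 3) : |(n i : ℝ)| ≤ ‖n‖ := by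
  have := norm_le_pi_norm n i
  rwa [Int.norm_eq_abs] at this

lemma one_le_norm_of_ne_zero {n : Fin 3 → ℤ} (hn : n ≠ 0) : 1 ≤ ‖n‖ := by
  obtain ⟨i, hi⟩ := Function.ne_iff.1 hn
  refine le_trans ?_ (abs_intCast_le_norm n i)
  have : 1 ≤ |n i| := Int.one_le_abs hi
  exact_mod_cast this

/-- A linear family of matrices along which the determinant is uniformly monotone in the first
coordinate direction. -/
structure GoodFamily (m c : ℝ) (M : (Fin 3 → ℤ) →+ Matrix (Fin 3) (Fin 3) ℝ) : Prop where
  bound : ∀ n i j, |M n i j| ≤ m * ‖n‖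
  adj : ∀ n, adjTrace (M n) (M (Pi.single 0 1)) ≤ -c * ‖n‖ ^ 2

section

variable {m c : ℝ} {M : (Fin 3 → ℤ) →+ Matrix (Fin 3) (Fin 3) ℝ}

lemma norm_pi_single_one : ‖(Pi.single 0 1 : Fin 3 → ℤ)‖ = 1 := by
  rw [Pi.norm_single]; simp

lemma GoodFamily.smallCount_le (h : GoodFamily m c M) (hm : 0 < m) (hc : 0 < c)
    {n : Fin 3 → ℤ} (hn : n ≠ 0) {L : ℤ} {τ X : ℝ} (hτ : ‖n‖ ≤ τ) (hX : 0 ≤ X)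
    (hXL : 4 * (L : ℝ) ≤ X ∨ 0 < |(M n).det| ∧ 12 * m ^ 2 * ‖n‖ ^ 2 * τ ≤ X * |(M n).det|) :
    (smallCount L (M n) τ : ℝ) ≤ (36 * m ^ 2 / c + 1) ^ 2 * (τ / ‖n‖) ^ 2 * (X + 1) := by
  have hn1 := one_le_norm_of_ne_zero hn
  have hn0 : 0 < ‖n‖ := by linarith
  have hτ0 : 0 < τ := by linarith
  obtain ⟨p, q, hpq⟩ := exists_adjugate_ge (M := M n) (X := M (Pi.single 0 1)) (m := m)
    (c := c * ‖n‖ ^ 2) hm (fun i j => by simpa [norm_pi_single_one] using h.bound (Pi.single 0 1) i j)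
    (by
      have := h.adj n
      rw [abs_of_nonpos (this.trans (by nlinarith [mul_pos hc (pow_pos hn0 2)]))]; linarith)
  have hA : 0 < c * ‖n‖ ^ 2 / (9 * m) := by positivity
  have key := card_le_of_mulVec_le (M := M n) (B := m * ‖n‖) (τ := τ) (X := X) hA hτ0.le hX
    (h.bound n) hpq (S := (Finset.Icc (fun _ => -(2 * L)) (fun _ => 2 * L)
      : Finset (Fin 3 → ℤ)).filter fun k => ∀ i, |∑ j, M n i j * (k j : ℝ)| ≤ τ)
    (fun k hk => (Finset.mem_filter.1 hk).2) (fun k hk k' hk' => by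
      rw [Finset.mem_filter, Finset.mem_Icc] at hk hk'
      rcases hXL with hX' | ⟨hD, hX'⟩
      · have h1 : -(2 * L) ≤ k p := hk.1.1 p
        have h2 : k p ≤ 2 * L := hk.1.2 p
        have h3 : -(2 * L) ≤ k' p := hk'.1.1 p
        have h4 : k' p ≤ 2 * L := hk'.1.2 p
        have h5 : |k p - k' p| ≤ 4 * L := by rw [abs_le]; constructor <;> omega
        have h6 : |((k p : ℤ) : ℝ) - (k' p : ℤ)| ≤ 4 * L := by exact_mod_cast h5
        exact h6.trans hX'
      · have h1 := abs_det_mul_le (h.bound n) (k := fun j => (k j : ℝ)) hk.2 p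
        have h2 := abs_det_mul_le (h.bound n) (k := fun j => (k' j : ℝ)) hk'.2 p
        have h3 : |((k p : ℤ) : ℝ) - (k' p : ℤ)| ≤ |(k p : ℝ)| + |(k' p : ℝ)| := abs_sub _ _
        have h4 := mul_le_mul_of_nonneg_left h3 hD.le
        refine le_of_mul_le_mul_left ?_ hD
        nlinarith)
  refine key.trans ?_
  have e : 4 * (m * ‖n‖) * τ / (c * ‖n‖ ^ 2 / (9 * m)) + 1
      ≤ (36 * m ^ 2 / c + 1) * (τ / ‖n‖) := by
    have : 4 * (m * ‖n‖) * τ / (c * ‖n‖ ^ 2 / (9 * m)) = 36 * m ^ 2 / c * (τ / ‖n‖) := by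
      field_simp; ring
    rw [this, add_mul, one_mul]
    have : 1 ≤ τ / ‖n‖ := (one_le_div hn0).2 hτ
    linarith
  rw [← mul_pow]
  gcongr

/-- Determinants separate along lines in the distinguished direction. -/
lemma GoodFamily.det_sub_ge (h : GoodFamily m c M) (hc : 0 < c) (n : Fin 3 → ℤ) (t : ℤ) :
    c / 6 * |(t : ℝ)| * ‖n + t • Pi.single 0 1‖ ^ 2
      ≤ |(M (n + t • Pi.single 0 1)).det - (M n).det| := by
  set e : Fin 3 → ℤ := Pi.single 0 1
  have h1 : M (n + t • e) = M n + (t : ℝ) • M e := by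
    rw [map_add, map_zsmul, Int.cast_smul_eq_zsmul]
  have h2 : (2 : ℝ) • M n + (t : ℝ) • M e = M (2 • n + t • e) := by
    rw [map_add, map_zsmul, map_nsmul, Int.cast_smul_eq_zsmul, ← Nat.cast_smul_eq_nsmul ℝ]
    norm_num
  rw [h1, det_add_smul_sub, h2, ← h1, abs_mul, abs_div, abs_of_pos (by norm_num : (0 : ℝ) < 6)]
  have a1 := h.adj n
  have a2 := h.adj (2 • n + t • e)
  have a3 := h.adj (n + t • e)
  have p1 : 0 ≤ c * ‖n‖ ^ 2 := by positivity
  have p2 : 0 ≤ c * ‖2 • n + t • e‖ ^ 2 := by positivity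
  have p3 : c * ‖n + t • e‖ ^ 2
      ≤ |adjTrace (M n) (M e) + adjTrace (M (2 • n + t • e)) (M e)
          + adjTrace (M (n + t • e)) (M e)| := by
    rw [abs_of_nonpos (by nlinarith [sq_nonneg ‖n + t • e‖])]
    linarith
  calc _ = |(t : ℝ)| / 6 * (c * ‖n + t • e‖ ^ 2) := by ring
    _ ≤ _ := by gcongr

lemma sum_cube (H : ℤ) (f : (Fin 3 → ℤ) → ℝ) :
    ∑ n ∈ Finset.Icc (fun _ => -H) (fun _ => H), f n
      = ∑ u ∈ Finset.Icc (-H) H, ∑ v ∈ Finset.Icc (-H) H, ∑ t ∈ Finset.Icc (-H) H,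
          f ![t, u, v] := by
  simp_rw [← Finset.sum_product']
  refine Finset.sum_nbij' (fun n => ((n 1, n 2, n 0) : ℤ × ℤ × ℤ))
    (fun x => ![x.2.2, x.1, x.2.1]) ?_ ?_ ?_ ?_ ?_
  · intro n hn
    rw [Finset.mem_Icc, Pi.le_def, Pi.le_def] at hn
    simp only [Finset.mem_product, Finset.mem_Icc]
    exact ⟨⟨hn.1 1, hn.2 1⟩, ⟨hn.1 2, hn.2 2⟩, hn.1 0, hn.2 0⟩
  · rintro ⟨u, v, t⟩ hx
    simp only [Finset.mem_product, Finset.mem_Icc] at hx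
    rw [Finset.mem_Icc, Pi.le_def, Pi.le_def]
    constructor <;> intro i <;> fin_cases i <;> simp <;> omega
  · intro n _; ext i; fin_cases i <;> rfl
  · intro x _; rfl
  · intro n _
    congr 1; ext i; fin_cases i <;> rfl

lemma log_two_mul_le {H L : ℤ} (hH : 1 ≤ H) (hHL : H ≤ L) :
    1 + Real.log ((2 * H : ℤ) : ℝ) ≤ 2 * (1 + Real.log L) := by
  have h1 : (1 : ℝ) ≤ H := by exact_mod_cast hH
  have h2 : (H : ℝ) ≤ L := by exact_mod_cast hHL
  push_cast
  rw [Real.log_mul (by norm_num) (by positivity)]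
  have h3 := Real.log_le_log (by linarith) h2
  have h4 := Real.log_nonneg h1
  linarith [Real.log_two_lt_d9]

lemma GoodFamily.sum_line_le (h : GoodFamily m c M) (hm : 0 < m) (hc : 0 < c) {L H : ℤ} {τ : ℝ}
    (hH : 1 ≤ H) (hHL : H ≤ L) (hτ : (H : ℝ) ≤ τ) {u v : ℤ} (hu : |u| ≤ H) (hv : |v| ≤ H) :
    ∑ t ∈ Finset.Icc (-H) H,
        (if ![t, u, v] = 0 then (0 : ℝ) else smallCount L (M ![t, u, v]) τ)
      ≤ (36 * m ^ 2 / c + 1) ^ 2 * (4 * τ ^ 2 * (1 / (1 + |(u : ℝ)|)) * (1 / (1 + |(v : ℝ)|)))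
        * ((7 + 2304 * m ^ 2 / c) * (τ + L) * (1 + Real.log L)) := by
  have hH' : (1 : ℝ) ≤ H := by exact_mod_cast hH
  have hHL' : (H : ℝ) ≤ L := by exact_mod_cast hHL
  have hlog : 0 ≤ Real.log L := Real.log_nonneg (by linarith)
  have hτ0 : 0 < τ := by linarith
  have hL0 : (0 : ℝ) < L := by linarith
  have hne : (Finset.Icc (-H) H).Nonempty := ⟨0, by rw [Finset.mem_Icc]; omega⟩
  obtain ⟨t₀, ht₀, hmin⟩ := Finset.exists_min_image _ (fun t => |(M ![t, u, v]).det|) hne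
  have hvec : ∀ t s : ℤ, ![t, u, v] = ![s, u, v] + (t - s) • (Pi.single 0 1 : Fin 3 → ℤ) := by
    intro t s; ext i; fin_cases i <;> simp
  set X : ℤ → ℝ := fun t => if t = t₀ then 4 * L else 288 * m ^ 2 / c * τ * (1 / (1 + |((t - t₀ : ℤ) : ℝ)|))
    with hX
  have hX0 : ∀ t, 0 ≤ X t := by
    intro t; simp only [hX]; split_ifs <;> positivity
  set W := (36 * m ^ 2 / c + 1) ^ 2 * (4 * τ ^ 2 * (1 / (1 + |(u : ℝ)|)) * (1 / (1 + |(v : ℝ)|)))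
    with hW
  have hW0 : 0 ≤ W := by positivity
  have hterm : ∀ t ∈ Finset.Icc (-H) H,
      (if ![t, u, v] = 0 then (0 : ℝ) else smallCount L (M ![t, u, v]) τ) ≤ W * (X t + 1) := by
    intro t ht
    rw [Finset.mem_Icc] at ht
    split_ifs with hn
    · have := hX0 t; positivity
    have hn1 := one_le_norm_of_ne_zero hn
    set n : Fin 3 → ℤ := ![t, u, v] with hndef
    have hnτ : ‖n‖ ≤ τ := by
      refine le_trans ((pi_norm_le_iff_of_nonneg (by linarith)).2 fun i => ?_) hτ
      rw [Int.norm_eq_abs]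
      have : |n i| ≤ H := by
        fin_cases i
        exacts [abs_le.2 ht, hu, hv]
      exact_mod_cast this
    have hcase : 4 * (L : ℝ) ≤ X t ∨
        0 < |(M n).det| ∧ 12 * m ^ 2 * ‖n‖ ^ 2 * τ ≤ X t * |(M n).det| := by
      by_cases htt : t = t₀
      · left; simp [hX, htt]
      right
      have hd := h.det_sub_ge hc ![t₀, u, v] (t - t₀)
      rw [← hvec t t₀, ← hndef] at hd
      have hd2 : |(M n).det - (M ![t₀, u, v]).det| ≤ 2 * |(M n).det| := by
        have := hmin t (Finset.mem_Icc.2 ht)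
        refine (abs_sub _ _).trans ?_
        simp only [← hndef] at this
        linarith
      have h1 : (1 : ℝ) ≤ |((t - t₀ : ℤ) : ℝ)| := by
        have := Int.one_le_abs (sub_ne_zero.2 htt)
        exact_mod_cast this
      have h2 : c / 12 * |((t - t₀ : ℤ) : ℝ)| * ‖n‖ ^ 2 ≤ |(M n).det| := by linarith
      have h3 : 0 < c / 12 * |((t - t₀ : ℤ) : ℝ)| * ‖n‖ ^ 2 := by positivity
      refine ⟨h3.trans_le h2, ?_⟩
      have h4 : X t = 288 * m ^ 2 / c * τ * (1 / (1 + |((t - t₀ : ℤ) : ℝ)|)) := by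
        simp [hX, htt]
      rw [h4]
      set y := |((t - t₀ : ℤ) : ℝ)|
      calc 12 * m ^ 2 * ‖n‖ ^ 2 * τ
          = 12 * m ^ 2 * ‖n‖ ^ 2 * τ * 1 := by ring
        _ ≤ 12 * m ^ 2 * ‖n‖ ^ 2 * τ * (2 * y / (1 + y)) := by
            gcongr
            rw [le_div_iff₀ (by linarith)]; linarith
        _ = 288 * m ^ 2 / c * τ * (1 / (1 + y)) * (c / 12 * y * ‖n‖ ^ 2) := by
            field_simp; ring
        _ ≤ _ := by
            gcongr
    refine (h.smallCount_le hm hc hn hnτ (hX0 t) hcase).trans ?_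
    have h1 : (τ / ‖n‖) ^ 2 ≤ 4 * τ ^ 2 * (1 / (1 + |(u : ℝ)|)) * (1 / (1 + |(v : ℝ)|)) := by
      have hu' : |(u : ℝ)| ≤ ‖n‖ := abs_intCast_le_norm n 1
      have hv' : |(v : ℝ)| ≤ ‖n‖ := abs_intCast_le_norm n 2
      rw [div_pow, div_le_iff₀ (by positivity)]
      have : (1 + |(u : ℝ)|) * (1 + |(v : ℝ)|) ≤ 4 * ‖n‖ ^ 2 := by
        nlinarith [abs_nonneg (u : ℝ), abs_nonneg (v : ℝ)]
      calc τ ^ 2 = τ ^ 2 * (1 / (1 + |(u : ℝ)|)) * (1 / (1 + |(v : ℝ)|))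
            * ((1 + |(u : ℝ)|) * (1 + |(v : ℝ)|)) := by field_simp
        _ ≤ τ ^ 2 * (1 / (1 + |(u : ℝ)|)) * (1 / (1 + |(v : ℝ)|)) * (4 * ‖n‖ ^ 2) := by gcongr
        _ = _ := by ring
    have := hX0 t
    rw [hW]
    gcongr
  refine (Finset.sum_le_sum hterm).trans ?_
  rw [← Finset.mul_sum]
  refine mul_le_mul_of_nonneg_left ?_ hW0
  have hcardI : ((Finset.Icc (-H) H).card : ℝ) = 2 * H + 1 := by
    rw [Int.card_Icc]
    have : ((H + 1 - -H).toNat : ℤ) = 2 * H + 1 := by omega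
    exact_mod_cast this
  have hshift : ∑ t ∈ Finset.Icc (-H) H, 1 / (1 + |((t - t₀ : ℤ) : ℝ)|)
      ≤ 8 * (1 + Real.log L) := by
    rw [Finset.mem_Icc] at ht₀
    have h1 : ∑ t ∈ Finset.Icc (-H) H, 1 / (1 + |((t - t₀ : ℤ) : ℝ)|)
        = ∑ s ∈ (Finset.Icc (-H) H).image (fun t => t - t₀), 1 / (1 + |(s : ℝ)|) := by
      rw [Finset.sum_image]; intro x _ y _ hxy; simpa using hxy
    rw [h1]
    refine (Finset.sum_le_sum_of_subset_of_nonneg (t := Finset.Icc (-(2 * H)) (2 * H))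
      (fun s hs => ?_) fun _ _ _ => by positivity).trans
      ((sum_one_div_one_add_abs_le (by omega)).trans ?_)
    · obtain ⟨t, ht, rfl⟩ := Finset.mem_image.1 hs
      rw [Finset.mem_Icc] at ht ⊢; omega
    · have := log_two_mul_le hH hHL; linarith
  have hXle : ∀ t ∈ Finset.Icc (-H) H, X t + 1
      ≤ (if t = t₀ then 4 * (L : ℝ) else 0)
        + (288 * m ^ 2 / c * τ * (1 / (1 + |((t - t₀ : ℤ) : ℝ)|)) + 1) := by
    intro t _
    simp only [hX]
    have : 0 ≤ 288 * m ^ 2 / c * τ * (1 / (1 + |((t - t₀ : ℤ) : ℝ)|)) := by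
      positivity
    split_ifs <;> linarith
  refine (Finset.sum_le_sum hXle).trans ?_
  rw [Finset.sum_add_distrib, Finset.sum_add_distrib, Finset.sum_ite_eq', if_pos ht₀,
    ← Finset.mul_sum, Finset.sum_const, nsmul_eq_mul, hcardI]
  have hq : 0 ≤ m ^ 2 / c := by positivity
  have h1 := mul_le_mul_of_nonneg_left hshift (by positivity : 0 ≤ 288 * m ^ 2 / c * τ)
  have e1 : 288 * m ^ 2 / c * τ * (8 * (1 + Real.log L))
      = 2304 * m ^ 2 / c * τ * (1 + Real.log L) := by ring
  rw [e1] at h1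
  have e2 : (7 + 2304 * m ^ 2 / c) * (τ + L) * (1 + Real.log L)
      = 2304 * m ^ 2 / c * τ * (1 + Real.log L) + 7 * (τ + L) * (1 + Real.log L)
        + 2304 * m ^ 2 / c * L * (1 + Real.log L) := by ring
  have h2 : 0 ≤ 2304 * m ^ 2 / c * L * (1 + Real.log L) := by
    have : (0 : ℝ) ≤ L := by linarith
    positivity
  have h3 : 0 ≤ (τ + L) * Real.log L := mul_nonneg (by linarith) hlog
  rw [e2]
  nlinarith

end

/-- Bound for box sums of a phase whose mixed second differences are affine with linear part
coming from a good family. -/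
lemma exists_norm_sq_sum_expi_le (m c : ℝ) (hm : 1 ≤ m) (hc : 0 < c) :
    ∃ C : ℝ, 0 < C ∧ ∀ (M : (Fin 3 → ℤ) →+ Matrix (Fin 3) (Fin 3) ℝ), GoodFamily m c M →
      ∀ (s : (Fin 3 → ℤ) →+ (Fin 3 → ℤ)) (L H : ℤ) (Θ : ℝ) (P : (Fin 3 → ℤ) → ℝ),
      1 ≤ H → H ≤ L → 0 < Θ → 6 * m * Θ * H * L ≤ 1 →
      (∀ n : Fin 3 → ℤ, (∀ i, |n i| ≤ H) → ∀ k, |s n k| ≤ L) →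
      (∀ n k : Fin 3 → ℤ, ∃ κ : ℝ, ∀ z : Fin 3 → ℤ,
        (P (z + k + s n) - P (z + k)) - (P (z + s n) - P z)
          = κ + Θ * ∑ i, (∑ j, M n i j * (k j : ℝ)) * (z i : ℝ)) →
      ∀ a b : Fin 3 → ℤ, (∀ i, 0 ≤ a i) → (∀ i, b i ≤ L) →
        ‖∑ z ∈ Finset.Icc a b, expi (P z)‖ ^ 2
          ≤ C * L ^ 6 * (1 + Real.log L) ^ 3 * (1 / H ^ 3
            + 1 / (Θ * L) * Real.sqrt (1 / (Θ * L) + L) / (H * L * Real.sqrt (H * L))) := by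
  classical
  set W : ℝ := (36 * m ^ 2 / c + 1) ^ 2 * (7 + 2304 * m ^ 2 / c) with hW
  have hW0 : 0 ≤ W := by positivity
  set C₁ : ℝ := Real.sqrt (27 * 32768000 * W) with hC₁
  refine ⟨512 + 64 * C₁, by positivity, ?_⟩
  intro M hM s L H Θ P hH hHL hΘ hsmall hs hP a b ha hb
  have hH' : (1 : ℝ) ≤ H := by exact_mod_cast hH
  have hHL' : (H : ℝ) ≤ L := by exact_mod_cast hHL
  have hL : 1 ≤ L := hH.trans hHL
  have hL' : (1 : ℝ) ≤ L := by linarith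
  have hlog : 0 ≤ Real.log L := Real.log_nonneg hL'
  set ℓ := 1 + Real.log L with hℓ
  have hℓ1 : 1 ≤ ℓ := by linarith
  set τ := 1 / (Θ * L) with hτdef
  have hτ0 : 0 < τ := by positivity
  have hτ : (H : ℝ) ≤ τ := by
    rw [hτdef, le_div_iff₀ (by positivity)]
    have : 0 ≤ Θ * H * L := by positivity
    nlinarith
  set D : Finset (Fin 3 → ℤ) := Finset.Icc (fun _ => -H) (fun _ => H) with hD
  have hDmem : ∀ n ∈ D, ∀ i, |n i| ≤ H := by
    intro n hn i
    rw [hD, Finset.mem_Icc] at hn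
    exact abs_le.2 ⟨hn.1 i, hn.2 i⟩
  have hvdc := vanDerCorput s (Finset.Icc (fun _ => 0) (fun _ => H - 1)) D
    (fun i hi j hj => by
      rw [Finset.mem_Icc, Pi.le_def, Pi.le_def] at hi hj
      rw [hD, Finset.mem_Icc, Pi.le_def, Pi.le_def]
      constructor <;> intro k <;> have h1 := hi.1 k <;> have h2 := hi.2 k <;> have h3 := hj.1 k <;>
        have h4 := hj.2 k <;> simp only [Pi.sub_apply] <;> omega) hL
    (fun i hi k => hs i (fun l => by
      rw [Finset.mem_Icc, Pi.le_def, Pi.le_def] at hi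
      have h1 := hi.1 l; have h2 := hi.2 l
      rw [abs_le]; constructor <;> omega) k) (fun z => expi (P z)) ha hb
  have hIcard : ((Finset.Icc (fun _ => 0) (fun _ => H - 1) : Finset (Fin 3 → ℤ)).card : ℝ)
      = (H : ℝ) ^ 3 := by
    rw [Pi.card_Icc]
    simp only [Int.card_Icc, Finset.prod_const, Finset.card_univ, Fintype.card_fin]
    have h2 : (((H - 1 + 1 - 0).toNat : ℕ) : ℝ) = (H : ℝ) := by
      have : ((H - 1 + 1 - 0).toNat : ℤ) = H := by omega
      exact_mod_cast this
    push_cast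
    rw [h2]
  have hDcard : (D.card : ℝ) ≤ 27 * (H : ℝ) ^ 3 := by
    rw [hD, Pi.card_Icc]
    simp only [Int.card_Icc, Finset.prod_const, Finset.card_univ, Fintype.card_fin]
    have h2 : (((H + 1 - -H).toNat : ℕ) : ℝ) = 2 * (H : ℝ) + 1 := by
      have : ((H + 1 - -H).toNat : ℤ) = 2 * H + 1 := by omega
      exact_mod_cast this
    push_cast
    rw [h2]
    calc (2 * (H : ℝ) + 1) ^ 3 ≤ (3 * H) ^ 3 := by gcongr; linarith
      _ = _ := by ring
  rw [hIcard] at hvdc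
  set F : (Fin 3 → ℤ) → ℝ := fun n => if n = 0 then (0 : ℝ) else smallCount L (M n) τ with hF
  set g : (Fin 3 → ℤ) → ℝ := fun n => if n = 0 then 0 else ‖corr (fun z => expi (P z)) a b (s n)‖
    with hg
  have hg2 : ∀ n ∈ D, g n ^ 2 ≤ 64 * (20 * L * ℓ) ^ 3 * F n := by
    intro n hn
    simp only [hg, hF]
    split_ifs with h0
    · simp
    rw [corr_expi]
    choose κ hκ using hP n
    refine norm_sq_sum_expi_le_smallCount (Q := fun z => P (z + s n) - P z) hL hΘ κ
      (fun k z => ?_) (fun k hk i => ?_) (fun i => ?_) (fun i => ?_)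
    · exact hκ k z
    · have h1 : |∑ j, M n i j * (k j : ℝ)| ≤ 3 * (m * H * L) := by
        refine (Finset.abs_sum_le_sum_abs _ _).trans
          ((Finset.sum_le_card_nsmul _ _ (m * H * L) fun j _ => ?_).trans (by simp))
        rw [abs_mul]
        have h2 := hM.bound n i j
        have h3 : ‖n‖ ≤ H := by
          refine (pi_norm_le_iff_of_nonneg (by linarith)).2 fun i => ?_
          rw [Int.norm_eq_abs]
          exact_mod_cast hDmem n hn i
        have h4 : |(k j : ℝ)| ≤ L := by exact_mod_cast hk j
        have h5 : |M n i j| ≤ m * H := h2.trans (by gcongr)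
        exact mul_le_mul h5 h4 (abs_nonneg _) (by positivity)
      rw [abs_mul, abs_of_pos hΘ]
      have := mul_le_mul_of_nonneg_left h1 hΘ.le
      linarith
    · exact (ha i).trans (le_sup_left (a := a) (b := a - s n) i)
    · exact (inf_le_left (a := b) (b := b - s n) i).trans (hb i)
  have hFsum : ∑ n ∈ D, F n ≤ 64 * W * τ ^ 2 * (τ + L) * ℓ ^ 3 := by
    rw [hD, sum_cube]
    have h1 : ∀ u ∈ Finset.Icc (-H) H, ∀ v ∈ Finset.Icc (-H) H,
        ∑ t ∈ Finset.Icc (-H) H, F ![t, u, v]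
          ≤ 4 * W * τ ^ 2 * (τ + L) * ℓ * ((1 / (1 + |(u : ℝ)|)) * (1 / (1 + |(v : ℝ)|))) := by
      intro u hu v hv
      rw [Finset.mem_Icc] at hu hv
      refine (hM.sum_line_le (by linarith) hc hH hHL hτ (abs_le.2 hu) (abs_le.2 hv)).trans
        (le_of_eq ?_)
      rw [hW]; ring
    refine (Finset.sum_le_sum fun u hu => Finset.sum_le_sum fun v hv => h1 u hu v hv).trans ?_
    simp_rw [← Finset.mul_sum]
    rw [← Finset.sum_mul]
    have h2 : ∑ j ∈ Finset.Icc (-H) H, 1 / (1 + |(j : ℝ)|) ≤ 4 * ℓ := by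
      refine (sum_one_div_one_add_abs_le hH).trans ?_
      have := Real.log_le_log (by linarith) hHL'
      linarith
    have h3 : 0 ≤ ∑ j ∈ Finset.Icc (-H) H, 1 / (1 + |(j : ℝ)|) :=
      Finset.sum_nonneg fun _ _ => by positivity
    calc _ ≤ 4 * W * τ ^ 2 * (τ + L) * ℓ * ((4 * ℓ) * (4 * ℓ)) := by gcongr
      _ = _ := by ring
  have hgsum : ∑ n ∈ D, g n ≤ C₁ * (H * Real.sqrt H) * (L * Real.sqrt L) * τ * Real.sqrt (τ + L)
      * ℓ ^ 3 := by
    have h1 : (∑ n ∈ D, g n) ^ 2 ≤ (27 * 32768000 * W) * H ^ 3 * L ^ 3 * τ ^ 2 * (τ + L) * ℓ ^ 6 := by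
      calc (∑ n ∈ D, g n) ^ 2 ≤ D.card * ∑ n ∈ D, g n ^ 2 := sq_sum_le_card_mul_sum_sq
        _ ≤ (27 * (H : ℝ) ^ 3) * (64 * (20 * L * ℓ) ^ 3 * (64 * W * τ ^ 2 * (τ + L) * ℓ ^ 3)) := by
            have h2 := (Finset.sum_le_sum hg2)
            rw [← Finset.mul_sum] at h2
            have h3 : 0 ≤ ∑ n ∈ D, g n ^ 2 := Finset.sum_nonneg fun _ _ => sq_nonneg _
            refine mul_le_mul hDcard (h2.trans ?_) h3 (by positivity)
            gcongr
        _ = _ := by ring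
    refine le_of_sq_le_sq (h1.trans (le_of_eq ?_)) (by positivity)
    have e1 := Real.sq_sqrt (by positivity : 0 ≤ 27 * 32768000 * W)
    have e2 := Real.sq_sqrt (by positivity : (0 : ℝ) ≤ H)
    have e3 := Real.sq_sqrt (by positivity : (0 : ℝ) ≤ L)
    have e4 := Real.sq_sqrt (by positivity : (0 : ℝ) ≤ τ + L)
    rw [hC₁]
    simp only [mul_pow, e1, e2, e3, e4]
    ring
  have hT : ∑ n ∈ D, ‖corr (fun z => expi (P z)) a b (s n)‖
      ≤ 8 * (L : ℝ) ^ 3 + ∑ n ∈ D, g n := by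
    have h1 : ∀ n ∈ D, ‖corr (fun z => expi (P z)) a b (s n)‖
        ≤ (if n = 0 then 8 * (L : ℝ) ^ 3 else 0) + g n := by
      intro n _
      simp only [hg]
      split_ifs with h0
      · rw [add_zero]
        exact norm_corr_zero_le (fun z => (norm_expi _).le) hL ha hb _
      · rw [zero_add]
    refine (Finset.sum_le_sum h1).trans ?_
    rw [Finset.sum_add_distrib, Finset.sum_ite_eq']
    gcongr
    split_ifs
    · exact le_rfl
    · positivity
  set S := ‖∑ z ∈ Finset.Icc a b, expi (P z)‖ with hS
  have hfin : (H : ℝ) ^ 3 * S ^ 2 ≤ 64 * L ^ 3 * (8 * L ^ 3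
      + C₁ * (H * Real.sqrt H) * (L * Real.sqrt L) * τ * Real.sqrt (τ + L) * ℓ ^ 3) := by
    refine hvdc.trans ?_
    gcongr
    linarith
  have hH3 : (0 : ℝ) < (H : ℝ) ^ 3 := by positivity
  have hC₁0 : 0 ≤ C₁ := Real.sqrt_nonneg _
  refine le_of_mul_le_mul_left (hfin.trans ?_) hH3
  have e2 := Real.sq_sqrt (by positivity : (0 : ℝ) ≤ H)
  have e3 := Real.sq_sqrt (by positivity : (0 : ℝ) ≤ L)
  have p2 : 0 < Real.sqrt H := Real.sqrt_pos.2 (by linarith)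
  have p3 : 0 < Real.sqrt L := Real.sqrt_pos.2 (by linarith)
  rw [Real.sqrt_mul (by linarith)]
  set y := τ * Real.sqrt (τ + L) with hy
  have hy0 : 0 ≤ y := by positivity
  have expand : (H : ℝ) ^ 3 * ((512 + 64 * C₁) * L ^ 6 * ℓ ^ 3 * (1 / H ^ 3
        + y / (H * L * (Real.sqrt H * Real.sqrt L))))
      = (512 + 64 * C₁) * L ^ 6 * ℓ ^ 3
        + (512 + 64 * C₁) * ℓ ^ 3 * L ^ 3 * (H * Real.sqrt H) * (L * Real.sqrt L) * y := by
    set p := Real.sqrt H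
    set q := Real.sqrt L
    rw [← e2, ← e3]
    field_simp
  rw [expand]
  have t1 : 512 * (L : ℝ) ^ 6 ≤ (512 + 64 * C₁) * L ^ 6 * ℓ ^ 3 := by
    have : 1 ≤ ℓ ^ 3 := one_le_pow₀ hℓ1
    have h6 : (0 : ℝ) ≤ (L : ℝ) ^ 6 := by positivity
    calc 512 * (L : ℝ) ^ 6 = 512 * L ^ 6 * 1 := by ring
      _ ≤ _ := by gcongr; linarith
  have t2 : 64 * L ^ 3 * (C₁ * (H * Real.sqrt H) * (L * Real.sqrt L) * τ * Real.sqrt (τ + L) * ℓ ^ 3)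
      ≤ (512 + 64 * C₁) * ℓ ^ 3 * L ^ 3 * (H * Real.sqrt H) * (L * Real.sqrt L) * y := by
    calc _ = (64 * C₁) * ℓ ^ 3 * L ^ 3 * (H * Real.sqrt H) * (L * Real.sqrt L) * y := by
          rw [hy]; ring
      _ ≤ _ := by gcongr; linarith
  linarith

/-- Euclidean three-space. -/
abbrev E3 := EuclideanSpace ℝ (Fin 3)

/-- A function of three vectors that is linear in each of them. -/
structure IsTri (T : E3 → E3 → E3 → ℝ) : Prop where
  fst : ∀ k z, IsLinearMap ℝ fun h => T h k z
  snd : ∀ h z, IsLinearMap ℝ fun k => T h k z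
  trd : ∀ h k, IsLinearMap ℝ fun z => T h k z

lemma IsTri.add {T T' : E3 → E3 → E3 → ℝ} (h : IsTri T) (h' : IsTri T') :
    IsTri fun x y z => T x y z + T' x y z where
  fst k z := ⟨fun x y => by rw [(h.fst k z).map_add, (h'.fst k z).map_add]; ring,
    fun c x => by rw [(h.fst k z).map_smul, (h'.fst k z).map_smul]; simp only [smul_eq_mul]; ring⟩
  snd k z := ⟨fun x y => by rw [(h.snd k z).map_add, (h'.snd k z).map_add]; ring,
    fun c x => by rw [(h.snd k z).map_smul, (h'.snd k z).map_smul]; simp only [smul_eq_mul]; ring⟩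
  trd k z := ⟨fun x y => by rw [(h.trd k z).map_add, (h'.trd k z).map_add]; ring,
    fun c x => by rw [(h.trd k z).map_smul, (h'.trd k z).map_smul]; simp only [smul_eq_mul]; ring⟩

lemma IsTri.const_mul {T : E3 → E3 → E3 → ℝ} (h : IsTri T) (s : ℝ) :
    IsTri fun x y z => s * T x y z where
  fst k z := ⟨fun x y => by rw [(h.fst k z).map_add]; ring,
    fun c x => by rw [(h.fst k z).map_smul]; simp only [smul_eq_mul]; ring⟩
  snd k z := ⟨fun x y => by rw [(h.snd k z).map_add]; ring,
    fun c x => by rw [(h.snd k z).map_smul]; simp only [smul_eq_mul]; ring⟩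
  trd k z := ⟨fun x y => by rw [(h.trd k z).map_add]; ring,
    fun c x => by rw [(h.trd k z).map_smul]; simp only [smul_eq_mul]; ring⟩

/-- Polarization of the cubic form `⟪p, x⟫ ‖x‖ ^ 2`. -/
noncomputable def polOne (p h k z : E3) : ℝ :=
  2 * (inner ℝ p h * inner ℝ k z + inner ℝ p k * inner ℝ h z + inner ℝ p z * inner ℝ h k)

/-- Polarization of the cubic form `⟪p, x⟫ ⟪q, x⟫ ⟪r, x⟫`. -/
noncomputable def polThree (p q r h k z : E3) : ℝ :=
  inner ℝ p h * inner ℝ q k * inner ℝ r z + inner ℝ p h * inner ℝ q z * inner ℝ r k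
    + inner ℝ p k * inner ℝ q h * inner ℝ r z + inner ℝ p k * inner ℝ q z * inner ℝ r h
    + inner ℝ p z * inner ℝ q h * inner ℝ r k + inner ℝ p z * inner ℝ q k * inner ℝ r h

lemma isTri_polOne (p : E3) : IsTri (polOne p) where
  fst k z := ⟨fun x y => by simp only [polOne, inner_add_left, inner_add_right]; ring,
    fun c x => by
      simp only [polOne, real_inner_smul_left, real_inner_smul_right, smul_eq_mul]; ring⟩
  snd k z := ⟨fun x y => by simp only [polOne, inner_add_left, inner_add_right]; ring,
    fun c x => by
      simp only [polOne, real_inner_smul_left, real_inner_smul_right, smul_eq_mul]; ring⟩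
  trd k z := ⟨fun x y => by simp only [polOne, inner_add_right]; ring,
    fun c x => by
      simp only [polOne, real_inner_smul_right, smul_eq_mul]; ring⟩

lemma isTri_polThree (p q r : E3) : IsTri (polThree p q r) where
  fst k z := ⟨fun x y => by simp only [polThree, inner_add_right]; ring,
    fun c x => by simp only [polThree, real_inner_smul_right, smul_eq_mul]; ring⟩
  snd k z := ⟨fun x y => by simp only [polThree, inner_add_right]; ring,
    fun c x => by simp only [polThree, real_inner_smul_right, smul_eq_mul]; ring⟩
  trd k z := ⟨fun x y => by simp only [polThree, inner_add_right]; ring,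
    fun c x => by simp only [polThree, real_inner_smul_right, smul_eq_mul]; ring⟩

/-- The third derivative at a unit vector `e` of the derivative of the norm along `b`. -/
noncomputable def cubOne (e b h k z : E3) : ℝ :=
  3 / 2 * inner ℝ b e * polOne e h k z + -(5 / 2 * inner ℝ b e) * polThree e e e h k z
    + (-(1 / 2) * polOne b h k z + 3 / 2 * polThree b e e h k z)

/-- The third derivative at a unit vector `e` of the second derivative of the norm along `b`. -/
noncomputable def cubTwo (e b h k z : E3) : ℝ :=
  (3 / 2 * (inner ℝ b b - 5 * inner ℝ b e ^ 2) * polOne e h k z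
    + -(5 / 2) * (inner ℝ b b - 7 * inner ℝ b e ^ 2) * polThree e e e h k z)
    + (3 * inner ℝ b e * polOne b h k z + -(15 * inner ℝ b e) * polThree b e e h k z
    + 3 * polThree b b e h k z)

lemma isTri_cubOne (e b : E3) : IsTri (cubOne e b) :=
  (((isTri_polOne e).const_mul _).add ((isTri_polThree e e e).const_mul _)).add
    (((isTri_polOne b).const_mul _).add ((isTri_polThree b e e).const_mul _))

lemma isTri_cubTwo (e b : E3) : IsTri (cubTwo e b) :=
  (((isTri_polOne e).const_mul _).add ((isTri_polThree e e e).const_mul _)).add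
    ((((isTri_polOne b).const_mul _).add ((isTri_polThree b e e).const_mul _)).add
      ((isTri_polThree b b e).const_mul _))

/-- Coefficients of a trilinear form in a family of vectors. -/
def tens (f : Fin 3 → E3) (T : E3 → E3 → E3 → ℝ) (i j l : Fin 3) : ℝ := T (f i) (f j) (f l)

/-- Contraction of the first index of a tensor. -/
def mat (t : Fin 3 → Fin 3 → Fin 3 → ℝ) (h : Fin 3 → ℝ) : Matrix (Fin 3) (Fin 3) ℝ :=
  Matrix.of fun k l => ∑ i, t i k l * h i

lemma isLinearMap_sum_smul {φ : E3 → ℝ} (hφ : IsLinearMap ℝ φ) (f : Fin 3 → E3) (h : Fin 3 → ℝ) :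
    φ (∑ i, h i • f i) = ∑ i, h i * φ (f i) := by
  simp only [Fin.sum_univ_three, hφ.map_add, hφ.map_smul, smul_eq_mul]

lemma IsTri.expand {T : E3 → E3 → E3 → ℝ} (hT : IsTri T) (f : Fin 3 → E3) (h k z : Fin 3 → ℝ) :
    T (∑ i, h i • f i) (∑ i, k i • f i) (∑ i, z i • f i)
      = ∑ i, ∑ j, ∑ l, tens f T i j l * h i * k j * z l := by
  have h1 : ∀ y w, T (∑ i, h i • f i) y w = ∑ i, h i * T (f i) y w := fun y w => by
    exact isLinearMap_sum_smul (hT.fst y w) f h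
  have h2 : ∀ y w, T y (∑ i, k i • f i) w = ∑ i, k i * T y (f i) w := fun y w => by
    exact isLinearMap_sum_smul (hT.snd y w) f k
  have h3 : ∀ y w, T y w (∑ i, z i • f i) = ∑ i, z i * T y w (f i) := fun y w => by
    exact isLinearMap_sum_smul (hT.trd y w) f z
  simp only [h1, h2, h3, Finset.mul_sum, tens]
  refine Finset.sum_congr rfl fun i _ => Finset.sum_congr rfl fun j _ =>
    Finset.sum_congr rfl fun l _ => by ring

lemma mat_tens_apply {T : E3 → E3 → E3 → ℝ} (hT : IsTri T) (f : Fin 3 → E3) (h : Fin 3 → ℝ)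
    (k l : Fin 3) : mat (tens f T) h k l = T (∑ i, h i • f i) (f k) (f l) := by
  rw [isLinearMap_sum_smul (hT.fst (f k) (f l)) f h]
  simp only [mat, tens, Matrix.of_apply]
  exact Finset.sum_congr rfl fun i _ => mul_comm _ _

lemma adjTrace_conj (q M X : Matrix (Fin 3) (Fin 3) ℝ) :
    adjTrace (q.transpose * M * q) (q.transpose * X * q) = q.det ^ 2 * adjTrace M X := by
  have h1 : (q.transpose * M * q).adjugate * (q.transpose * X * q)
      = q.adjugate * (M.adjugate * (q.transpose.adjugate * q.transpose) * X) * q := by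
    simp only [Matrix.adjugate_mul_distrib, Matrix.mul_assoc]
  rw [adjTrace, h1, Matrix.adjugate_mul, Matrix.trace_mul_comm, ← Matrix.mul_assoc,
    Matrix.mul_adjugate, Matrix.det_transpose, adjTrace]
  simp only [Matrix.mul_smul, Matrix.smul_mul, Matrix.one_mul, Matrix.mul_one, Matrix.trace_smul,
    smul_eq_mul]
  ring

lemma mat_tens_basis_change {T : E3 → E3 → E3 → ℝ} (hT : IsTri T) (f u : Fin 3 → E3)
    (q : Matrix (Fin 3) (Fin 3) ℝ) (hq : ∀ k, f k = ∑ i, q i k • u i) (h : Fin 3 → ℝ) :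
    mat (tens f T) h = q.transpose * mat (tens u T) (q.mulVec h) * q := by
  have hh : ∑ i, h i • f i = ∑ i, (q.mulVec h) i • u i := by
    simp only [hq, Matrix.mulVec, dotProduct, Finset.smul_sum, Finset.sum_smul, smul_smul]
    rw [Finset.sum_comm]
    exact Finset.sum_congr rfl fun i _ => Finset.sum_congr rfl fun j _ => by rw [mul_comm]
  ext k l
  rw [mat_tens_apply hT, hh, hq k, hq l, hT.expand]
  simp only [Matrix.mul_apply, Matrix.transpose_apply, mat, Matrix.of_apply, Finset.sum_mul,
    Finset.mul_sum]
  rw [Finset.sum_comm_cycle]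
  refine Finset.sum_congr rfl fun i _ => ?_
  rw [Finset.sum_comm]
  exact Finset.sum_congr rfl fun j _ => Finset.sum_congr rfl fun j _ => by ring

lemma adjTrace_eq (M X : Matrix (Fin 3) (Fin 3) ℝ) : adjTrace M X =
    (M 1 1 * M 2 2 - M 1 2 * M 2 1) * X 0 0 + (-(M 0 1 * M 2 2) + M 0 2 * M 2 1) * X 1 0
    + (M 0 1 * M 1 2 - M 0 2 * M 1 1) * X 2 0
    + ((-(M 1 0 * M 2 2) + M 1 2 * M 2 0) * X 0 1 + (M 0 0 * M 2 2 - M 0 2 * M 2 0) * X 1 1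
    + (-(M 0 0 * M 1 2) + M 0 2 * M 1 0) * X 2 1)
    + ((M 1 0 * M 2 1 - M 1 1 * M 2 0) * X 0 2 + (-(M 0 0 * M 2 1) + M 0 1 * M 2 0) * X 1 2
    + (M 0 0 * M 1 1 - M 0 1 * M 1 0) * X 2 2) := by
  rw [adjTrace, Matrix.trace_fin_three, Matrix.adjugate_fin_three]
  simp [Matrix.mul_apply, Fin.sum_univ_three]

lemma adjTrace_cubOne_neg {u : Fin 3 → E3} (hu : Orthonormal ℝ u) {x : Fin 3 → ℝ} (hx : x ≠ 0) :
    adjTrace (mat (tens u (cubOne (u 0) (u 0 + u 1))) x)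
      (mat (tens u (cubOne (u 0) (u 0 + u 1))) ![1, 0, 0]) < 0 := by
  have hi : ∀ i j, inner ℝ (u i) (u j) = if i = j then (1 : ℝ) else 0 :=
    orthonormal_iff_ite.1 hu
  rw [adjTrace_eq]
  simp only [mat, tens, cubOne, polOne, polThree, Matrix.of_apply, Fin.sum_univ_three,
    inner_add_left, hi]
  simp
  have : 0 < x 0 ^ 2 + x 1 ^ 2 + x 2 ^ 2 := by
    obtain ⟨i, hi⟩ := Function.ne_iff.1 hx
    have := sq_pos_of_ne_zero hi
    fin_cases i <;> simp at this <;> positivity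
  nlinarith [sq_nonneg (x 0 + x 1)]

lemma adjTrace_cubTwo_neg {u : Fin 3 → E3} (hu : Orthonormal ℝ u) {x : Fin 3 → ℝ} (hx : x ≠ 0) :
    adjTrace (mat (tens u (cubTwo (u 0) (u 0 + (1 / 2 : ℝ) • u 1))) x)
      (mat (tens u (cubTwo (u 0) (u 0 + (1 / 2 : ℝ) • u 1))) ![-1, 0, 0]) < 0 := by
  have hi : ∀ i j, inner ℝ (u i) (u j) = if i = j then (1 : ℝ) else 0 :=
    orthonormal_iff_ite.1 hu
  rw [adjTrace_eq]
  simp only [mat, tens, cubTwo, polOne, polThree, Matrix.of_apply, Fin.sum_univ_three,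
    inner_add_left, inner_add_right, real_inner_smul_left, real_inner_smul_right, hi]
  simp
  have : 0 < x 0 ^ 2 + x 1 ^ 2 + x 2 ^ 2 := by
    obtain ⟨i, hi⟩ := Function.ne_iff.1 hx
    have := sq_pos_of_ne_zero hi
    fin_cases i <;> simp at this <;> positivity
  nlinarith [sq_nonneg (x 0 + x 1)]

open Filter Topology

/-- The derivative of `det (mat t x)` in the direction `g`. -/
noncomputable def detDeriv (t : Fin 3 → Fin 3 → Fin 3 → ℝ) (g x : Fin 3 → ℝ) : ℝ :=
  adjTrace (mat t x) (mat t g)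

lemma mat_smul (t : Fin 3 → Fin 3 → Fin 3 → ℝ) (r : ℝ) (x : Fin 3 → ℝ) :
    mat t (r • x) = r • mat t x := by
  ext i j
  simp only [mat, Matrix.of_apply, Matrix.smul_apply, Pi.smul_apply, smul_eq_mul, Finset.mul_sum]
  exact Finset.sum_congr rfl fun _ _ => by ring

lemma smul_mat (t : Fin 3 → Fin 3 → Fin 3 → ℝ) (r : ℝ) (x : Fin 3 → ℝ) :
    mat (r • t) x = r • mat t x := by
  ext i j
  simp only [mat, Matrix.of_apply, Matrix.smul_apply, Pi.smul_apply, smul_eq_mul, Finset.mul_sum]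
  exact Finset.sum_congr rfl fun _ _ => by ring

lemma adjTrace_smul_smul (r s : ℝ) (M X : Matrix (Fin 3) (Fin 3) ℝ) :
    adjTrace (r • M) (s • X) = r ^ 2 * s * adjTrace M X := by
  simp only [adjTrace_eq, Matrix.smul_apply, smul_eq_mul]; ring

lemma detDeriv_smul (t : Fin 3 → Fin 3 → Fin 3 → ℝ) (g x : Fin 3 → ℝ) (r : ℝ) :
    detDeriv t g (r • x) = r ^ 2 * detDeriv t g x := by
  have := adjTrace_smul_smul r 1 (mat t x) (mat t g)
  simpa [detDeriv, mat_smul] using this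

lemma detDeriv_smul_smul (t : Fin 3 → Fin 3 → Fin 3 → ℝ) (g x : Fin 3 → ℝ) (r s : ℝ) :
    detDeriv (s • t) (r • g) x = s ^ 3 * r * detDeriv t g x := by
  rw [detDeriv, detDeriv, mat_smul, smul_mat, smul_mat, smul_smul, adjTrace_smul_smul]; ring

lemma continuous_detDeriv :
    Continuous fun p : ((Fin 3 → Fin 3 → Fin 3 → ℝ) × (Fin 3 → ℝ)) × (Fin 3 → ℝ) =>
      detDeriv p.1.1 p.1.2 p.2 := by
  have hM : Continuous fun p : (Fin 3 → Fin 3 → Fin 3 → ℝ) × (Fin 3 → ℝ) => mat p.1 p.2 :=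
    continuous_matrix fun i j => by
      simp only [mat, Matrix.of_apply]
      fun_prop
  exact ((hM.comp ((continuous_fst.fst).prodMk continuous_snd)).matrix_adjugate.matrix_mul
    (hM.comp continuous_fst)).matrix_trace

lemma exists_eventually_le_of_homogeneous {E : Type*} [TopologicalSpace E]
    {F : E → (Fin 3 → ℝ) → ℝ} (hF : Continuous fun p : E × (Fin 3 → ℝ) => F p.1 p.2)
    (hom : ∀ e (r : ℝ) x, F e (r • x) = r ^ 2 * F e x) {e₀ : E} (h : ∀ x, x ≠ 0 → F e₀ x < 0) :
    ∃ c > 0, ∀ᶠ e in 𝓝 e₀, ∀ x, F e x ≤ -c * ‖x‖ ^ 2 := by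
  have hK : IsCompact (Metric.sphere (0 : Fin 3 → ℝ) 1) := isCompact_sphere _ _
  have hne : (Metric.sphere (0 : Fin 3 → ℝ) 1).Nonempty :=
    NormedSpace.sphere_nonempty.2 zero_le_one
  have hcont : Continuous fun x => F e₀ x := hF.comp (Continuous.prodMk_right e₀)
  obtain ⟨x₀, hx₀, hmax⟩ := hK.exists_isMaxOn hne hcont.continuousOn
  have hx₀' : x₀ ≠ 0 := by rintro rfl; simp at hx₀
  have hneg := h x₀ hx₀'
  refine ⟨-F e₀ x₀ / 2, by linarith, ?_⟩
  have key : ∀ᶠ e in 𝓝 e₀, ∀ x ∈ Metric.sphere (0 : Fin 3 → ℝ) 1, F e x < F e₀ x₀ / 2 := by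
    refine hK.eventually_forall_of_forall_eventually fun x hx => ?_
    have h2 : F e₀ x ≤ F e₀ x₀ := hmax hx
    have h1 : F e₀ x < F e₀ x₀ / 2 := by linarith
    exact (hF.tendsto (e₀, x)).eventually_lt_const h1
  filter_upwards [key] with e he x
  rcases eq_or_ne x 0 with rfl | hx
  · have := hom e 0 0
    simp only [smul_zero] at this
    rw [this]; simp
  · have hx1 : 0 < ‖x‖ := norm_pos_iff.2 hx
    have h2 := he (‖x‖⁻¹ • x) (by
      rw [mem_sphere_zero_iff_norm, norm_smul, norm_inv, norm_norm, inv_mul_cancel₀ hx1.ne'])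
    have h3 : F e x = ‖x‖ ^ 2 * F e (‖x‖⁻¹ • x) := by
      rw [← hom, smul_smul, mul_inv_cancel₀ hx1.ne', one_smul]
    rw [h3]
    nlinarith [pow_pos hx1 2]

lemma exists_eventually_detDeriv_le {t₀ : Fin 3 → Fin 3 → Fin 3 → ℝ} {g₀ : Fin 3 → ℝ}
    (h : ∀ x, x ≠ 0 → detDeriv t₀ g₀ x < 0) :
    ∃ c > 0, ∀ᶠ p in 𝓝 (t₀, g₀), ∀ x, detDeriv p.1 p.2 x ≤ -c * ‖x‖ ^ 2 :=
  exists_eventually_le_of_homogeneous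
    (F := fun p : (Fin 3 → Fin 3 → Fin 3 → ℝ) × (Fin 3 → ℝ) => detDeriv p.1 p.2)
    continuous_detDeriv (fun p r x => detDeriv_smul p.1 p.2 x r) h

/-- A family of trilinear forms depending on a unit vector and homogeneously on a direction, with
a direction in which the determinant of the Hessian is decreasing. -/
structure CubicKernel (j : ℕ) (cub : E3 → E3 → E3 → E3 → E3 → ℝ) : Prop where
  tri : ∀ e b, IsTri (cub e b)
  cont : ∀ h k z, Continuous fun p : E3 × E3 => cub p.1 p.2 h k z
  hom : ∀ (s : ℝ) e b h k z, cub e (s • b) h k z = s ^ j * cub e b h k z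
  good : ∀ u : Fin 3 → E3, Orthonormal ℝ u → ∃ b g, ∀ x, x ≠ 0 →
    detDeriv (tens u (cub (u 0) b)) g x < 0

lemma cubicKernel_cubOne : CubicKernel 1 cubOne where
  tri := isTri_cubOne
  cont h k z := by unfold cubOne polOne polThree; fun_prop
  hom s e b h k z := by
    simp only [cubOne, polOne, polThree, real_inner_smul_left]; ring
  good u hu := ⟨_, _, fun x hx => adjTrace_cubOne_neg hu hx⟩

lemma cubicKernel_cubTwo : CubicKernel 2 cubTwo where
  tri := isTri_cubTwo
  cont h k z := by unfold cubTwo polOne polThree; fun_prop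
  hom s e b h k z := by
    simp only [cubTwo, polOne, polThree, real_inner_smul_left, real_inner_smul_right]; ring
  good u hu := ⟨_, _, fun x hx => adjTrace_cubTwo_neg hu hx⟩

/-- The embedding of the coordinate space given by a basis. -/
noncomputable def emb (f : Module.Basis (Fin 3) ℝ E3) (x : Fin 3 → ℝ) : E3 := ∑ i, x i • f i

lemma exists_orthonormal_extend {e : E3} (he : ‖e‖ = 1) :
    ∃ u : OrthonormalBasis (Fin 3) ℝ E3, u 0 = e := by
  obtain ⟨b, hb⟩ := Orthonormal.exists_orthonormalBasis_extension_of_card_eq (𝕜 := ℝ) (E := E3)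
    (ι := Fin 3) (by simp) (v := fun _ => e) (s := {0}) (by
      constructor
      · intro i; simpa using he
      · intro i j hij; exact (hij (Subsingleton.elim _ _)).elim)
  exact ⟨b, hb 0 rfl⟩

lemma CubicKernel.exists_real {j : ℕ} {cub : E3 → E3 → E3 → E3 → E3 → ℝ} (hc : CubicKernel j cub)
    (f : Module.Basis (Fin 3) ℝ E3) {e : E3} (he : ‖e‖ = 1) :
    ∃ b g : Fin 3 → ℝ, ∀ x, x ≠ 0 → detDeriv (tens f (cub e (emb f b))) g x < 0 := by
  obtain ⟨u, hu⟩ := exists_orthonormal_extend he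
  obtain ⟨b, g, hbg⟩ := hc.good u u.orthonormal
  rw [hu] at hbg
  set q : Matrix (Fin 3) (Fin 3) ℝ := Matrix.of fun i k => inner ℝ (u i) (f k) with hq
  have hf : ∀ k, f k = ∑ i, q i k • u i := fun k => (u.sum_repr' (f k)).symm
  have hq0 : ∀ x, q.mulVec x = 0 → x = 0 := by
    intro x hx
    have h1 : ∑ k, x k • f k = 0 := by
      have : ∑ k, x k • f k = ∑ i, (q.mulVec x) i • u i := by
        simp only [hf, Matrix.mulVec, dotProduct, Finset.smul_sum, Finset.sum_smul, smul_smul]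
        rw [Finset.sum_comm]
        exact Finset.sum_congr rfl fun i _ => Finset.sum_congr rfl fun j _ => by rw [mul_comm]
      rw [this, hx]; simp
    exact funext fun i => Fintype.linearIndependent_iff.1 f.linearIndependent x h1 i
  have hdet : q.det ≠ 0 := fun h0 => by
    obtain ⟨v, hv, hv'⟩ := Matrix.exists_mulVec_eq_zero_iff.2 h0
    exact hv (hq0 v hv')
  refine ⟨f.repr b, q⁻¹.mulVec g, fun x hx => ?_⟩
  have hb : emb f (f.repr b) = b := f.sum_repr b
  have hg : q.mulVec (q⁻¹.mulVec g) = g := by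
    rw [Matrix.mulVec_mulVec, Matrix.mul_nonsing_inv _ (isUnit_iff_ne_zero.2 hdet),
      Matrix.one_mulVec]
  rw [hb, detDeriv, mat_tens_basis_change (hc.tri e b) f u q hf,
    mat_tens_basis_change (hc.tri e b) f u q hf, adjTrace_conj, hg]
  have h1 := hbg (q.mulVec x) (fun h => hx (hq0 x h))
  exact mul_neg_of_pos_of_neg (by positivity) h1

section

variable {j : ℕ} {cub : E3 → E3 → E3 → E3 → E3 → ℝ} {f : Module.Basis (Fin 3) ℝ E3}

/-- The real vector with the given integer coordinates. -/
def castVec (n : Fin 3 → ℤ) : Fin 3 → ℝ := fun i => (n i : ℝ)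

lemma tendsto_floor_div (x : Fin 3 → ℝ) :
    Tendsto (fun k : ℕ => ((k : ℝ)⁻¹) • castVec fun i => ⌊(k : ℝ) * x i⌋) atTop (𝓝 x) := by
  rw [tendsto_pi_nhds]
  intro i
  have h0 : Tendsto (fun k : ℕ => (k : ℝ)⁻¹) atTop (𝓝 0) := tendsto_inv_atTop_nhds_zero_nat
  have h1 : Tendsto (fun k : ℕ => x i - (k : ℝ)⁻¹) atTop (𝓝 (x i)) := by
    simpa using tendsto_const_nhds.sub h0
  refine tendsto_of_tendsto_of_tendsto_of_le_of_le' h1 tendsto_const_nhds ?_ ?_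
  all_goals
    filter_upwards [eventually_gt_atTop 0] with k hk
    have hk' : (0 : ℝ) < k := by exact_mod_cast hk
    simp only [castVec, Pi.smul_apply, smul_eq_mul]
  · have := Int.lt_floor_add_one ((k : ℝ) * x i)
    rw [inv_mul_eq_div, le_div_iff₀ hk', sub_mul, inv_mul_cancel₀ hk'.ne']
    linarith
  · have := Int.floor_le ((k : ℝ) * x i)
    rw [inv_mul_eq_div, div_le_iff₀ hk']
    linarith

lemma emb_smul (s : ℝ) (x : Fin 3 → ℝ) : emb f (s • x) = s • emb f x := by
  simp [emb, Finset.smul_sum, smul_smul]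

lemma continuous_emb : Continuous (emb f) := by
  unfold emb; fun_prop

lemma CubicKernel.continuous_tens (hc : CubicKernel j cub) :
    Continuous fun p : E3 × E3 => tens f (cub p.1 p.2) :=
  continuous_pi fun _ => continuous_pi fun _ => continuous_pi fun _ => hc.cont _ _ _

lemma CubicKernel.tens_smul (hc : CubicKernel j cub) (s : ℝ) (e b : E3) :
    tens f (cub e (s • b)) = s ^ j • tens f (cub e b) := by
  ext i k l
  exact hc.hom _ _ _ _ _ _

lemma CubicKernel.exists_int (hc : CubicKernel j cub) {e : E3} (he : ‖e‖ = 1) :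
    ∃ b g : Fin 3 → ℤ, ∀ x, x ≠ 0 → detDeriv (tens f (cub e (emb f (castVec b)))) (castVec g) x < 0 := by
  obtain ⟨b, g, hbg⟩ := hc.exists_real f he
  obtain ⟨c, hc0, hev⟩ := exists_eventually_detDeriv_le hbg
  have hcont : Continuous fun b : Fin 3 → ℝ => tens f (cub e (emb f b)) :=
    hc.continuous_tens.comp (continuous_const.prodMk continuous_emb)
  have ht : Tendsto (fun k : ℕ =>
      (tens f (cub e (emb f (((k : ℝ)⁻¹) • castVec fun i => ⌊(k : ℝ) * b i⌋))),
        ((k : ℝ)⁻¹) • castVec fun i => ⌊(k : ℝ) * g i⌋)) atTop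
      (𝓝 (tens f (cub e (emb f b)), g)) :=
    ((hcont.tendsto b).comp (tendsto_floor_div b)).prodMk_nhds (tendsto_floor_div g)
  obtain ⟨k, hk, hk0⟩ := ((ht.eventually hev).and (eventually_gt_atTop 0)).exists
  have hk' : (0 : ℝ) < k := by exact_mod_cast hk0
  refine ⟨fun i => ⌊(k : ℝ) * b i⌋, fun i => ⌊(k : ℝ) * g i⌋, fun x hx => ?_⟩
  have h1 := hk x
  simp only at h1
  rw [emb_smul, hc.tens_smul, detDeriv_smul_smul] at h1
  have h2 : -c * ‖x‖ ^ 2 < 0 := by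
    have := pow_pos (norm_pos_iff.2 hx) 2
    nlinarith
  exact (pos_iff_neg_of_mul_neg (h1.trans_lt h2)).1 (by positivity)

/-- The third derivative at `Y` of the `j`-th derivative of the norm along `b`, in coordinates. -/
noncomputable def scaledTens (f : Module.Basis (Fin 3) ℝ E3) (j : ℕ)
    (cub : E3 → E3 → E3 → E3 → E3 → ℝ) (b Y : E3) : Fin 3 → Fin 3 → Fin 3 → ℝ :=
  (‖Y‖⁻¹) ^ (j + 2) • tens f (cub (‖Y‖⁻¹ • Y) b)

lemma CubicKernel.continuousAt_scaledTens (hc : CubicKernel j cub) (b : E3) {Y : E3} (hY : Y ≠ 0) :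
    ContinuousAt (scaledTens f j cub b) Y := by
  have h1 : ContinuousAt (fun Y : E3 => ‖Y‖⁻¹) Y :=
    continuous_norm.continuousAt.inv₀ (norm_ne_zero_iff.2 hY)
  have h2 : ContinuousAt (fun Y : E3 => (‖Y‖⁻¹ • Y, b)) Y :=
    (h1.smul continuousAt_id).prodMk continuousAt_const
  have h3 : ContinuousAt (fun Y : E3 => tens f (cub (‖Y‖⁻¹ • Y) b)) Y :=
    (hc.continuous_tens (f := f)).continuousAt.comp h2
  exact (h1.pow (j + 2)).smul h3

/-- Data of good directions near a unit vector, with bounds quantified by `n`. -/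
def GoodNear (f : Module.Basis (Fin 3) ℝ E3) (j : ℕ) (cub : E3 → E3 → E3 → E3 → E3 → ℝ) (n : ℝ)
    (e : E3) : Prop :=
  ∃ b g : Fin 3 → ℤ, ‖b‖ ≤ n ∧ ‖g‖ ≤ n ∧ ∃ (t₀ : Fin 3 → Fin 3 → Fin 3 → ℝ) (ρ : ℝ),
    (∀ Y, ‖Y - e‖ < 1 / n → ‖scaledTens f j cub (emb f (castVec b)) Y - t₀‖ ≤ ρ) ∧
    ∀ t, ‖t - t₀‖ ≤ ρ → ‖t‖ ≤ n ∧ ∀ x, detDeriv t (castVec g) x ≤ -(1 / n) * ‖x‖ ^ 2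

lemma GoodNear.mono {n n' : ℝ} {e : E3} (h : GoodNear f j cub n e) (hn : 0 < n) (hnn : n ≤ n') :
    GoodNear f j cub n' e := by
  obtain ⟨b, g, hb, hg, t₀, ρ, h1, h2⟩ := h
  have h3 : 1 / n' ≤ 1 / n := one_div_le_one_div_of_le hn hnn
  refine ⟨b, g, hb.trans hnn, hg.trans hnn, t₀, ρ, fun Y hY => h1 Y (hY.trans_le h3),
    fun t ht => ⟨(h2 t ht).1.trans hnn, fun x => ((h2 t ht).2 x).trans ?_⟩⟩
  nlinarith [sq_nonneg ‖x‖]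

lemma CubicKernel.exists_goodNear_nhds (hc : CubicKernel j cub) (f : Module.Basis (Fin 3) ℝ E3)
    {e : E3} (he : ‖e‖ = 1) : ∃ n : ℝ, 1 ≤ n ∧ ∀ᶠ e' in 𝓝 e, GoodNear f j cub n e' := by
  obtain ⟨b, g, hbg⟩ := hc.exists_int (f := f) he
  have he0 : e ≠ 0 := by rintro rfl; simp at he
  set t₀ := scaledTens f j cub (emb f (castVec b)) e with ht₀
  have ht₀' : t₀ = tens f (cub e (emb f (castVec b))) := by
    rw [ht₀, scaledTens, he]; simp
  rw [← ht₀'] at hbg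
  obtain ⟨c, hc0, hev⟩ := exists_eventually_detDeriv_le hbg
  have hev' : ∀ᶠ t in 𝓝 t₀, ∀ x, detDeriv t (castVec g) x ≤ -c * ‖x‖ ^ 2 :=
    ((Continuous.prodMk_left (castVec g)).tendsto t₀).eventually hev
  obtain ⟨ρ', hρ', hball⟩ := Metric.eventually_nhds_iff.1 hev'
  set ρ := min (ρ' / 2) 1 with hρ
  have hρ0 : 0 < ρ := by positivity
  obtain ⟨η, hη, hcont⟩ := Metric.continuousAt_iff.1
    (hc.continuousAt_scaledTens (f := f) (emb f (castVec b)) he0) ρ hρ0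
  set n := 1 + ‖b‖ + ‖g‖ + (‖t₀‖ + 1) + 1 / c + 2 / η with hn
  have hb0 := norm_nonneg b
  have hg0 := norm_nonneg g
  have ht0 := norm_nonneg t₀
  have hc1 : 0 < 1 / c := by positivity
  have hη1 : 0 < 2 / η := by positivity
  have hn1 : 1 ≤ n := by linarith
  have hn0 : 0 < n := by linarith
  have hnη : 1 / n ≤ η / 2 := by
    rw [div_le_div_iff₀ hn0 two_pos]
    have : 2 / η ≤ n := by linarith
    rw [div_le_iff₀ hη] at this; linarith
  have hnc : 1 / n ≤ c := by
    rw [div_le_iff₀ hn0]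
    have : 1 / c ≤ n := by linarith
    rw [div_le_iff₀ hc0] at this; linarith
  refine ⟨n, hn1, ?_⟩
  filter_upwards [Metric.ball_mem_nhds e (half_pos hη)] with e' he'
  refine ⟨b, g, by linarith, by linarith, t₀, ρ, fun Y hY => ?_, fun t ht => ⟨?_, fun x => ?_⟩⟩
  · have h1 : dist Y e < η := by
      have h2 : dist Y e' < 1 / n := by rwa [dist_eq_norm]
      have h3 : dist e' e < η / 2 := he'
      have := dist_triangle Y e' e
      linarith
    have := hcont h1
    rw [dist_eq_norm] at this
    exact this.le
  · have h1 : ‖t‖ ≤ ‖t - t₀‖ + ‖t₀‖ := by simpa using norm_add_le (t - t₀) t₀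
    have h2 : ρ ≤ 1 := min_le_right _ _
    linarith
  · have h1 : dist t t₀ < ρ' := by
      rw [dist_eq_norm]
      have : ρ ≤ ρ' / 2 := min_le_left _ _
      linarith
    refine (hball h1 x).trans ?_
    nlinarith [sq_nonneg ‖x‖]

lemma CubicKernel.exists_goodNear (hc : CubicKernel j cub) (f : Module.Basis (Fin 3) ℝ E3) :
    ∃ n : ℝ, 1 ≤ n ∧ ∀ e, ‖e‖ = 1 → GoodNear f j cub n e := by
  have hK : IsCompact (Metric.sphere (0 : E3) 1) := isCompact_sphere _ _
  suffices h : ∃ n : ℝ, 1 ≤ n ∧ ∀ e ∈ Metric.sphere (0 : E3) 1, GoodNear f j cub n e by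
    simpa using h
  refine hK.induction_on (p := fun S => ∃ n : ℝ, 1 ≤ n ∧ ∀ e ∈ S, GoodNear f j cub n e)
    ⟨1, le_rfl, by simp⟩ ?_ ?_ ?_
  · rintro S S' hS ⟨n, hn, h⟩
    exact ⟨n, hn, fun e he => h e (hS he)⟩
  · rintro S S' ⟨n, hn, h⟩ ⟨n', hn', h'⟩
    refine ⟨max n n', hn.trans (le_max_left _ _), ?_⟩
    rintro e (he | he)
    · exact (h e he).mono (by linarith) (le_max_left _ _)
    · exact (h' e he).mono (by linarith) (le_max_right _ _)
  · intro e he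
    obtain ⟨n, hn, h⟩ := hc.exists_goodNear_nhds f (e := e) (by simpa using he)
    exact ⟨_, mem_nhdsWithin_of_mem_nhds h, n, hn, fun e he => he⟩

end

/-- The second difference of `P` in the directions `h` and `k` is an affine function with linear
part given by the tensor `t`. -/
def HasCubic (P : (Fin 3 → ℤ) → ℝ) (t : Fin 3 → Fin 3 → Fin 3 → ℝ) : Prop :=
  ∀ h k z, (P (z + k + h) - P (z + k) - (P (z + h) - P z))
    - (P (0 + k + h) - P (0 + k) - (P (0 + h) - P 0))
    = ∑ a, ∑ i, ∑ l, t a i l * h a * z i * k l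

/-- The additive map sending the first coordinate vector to `g` and the others to coordinate
vectors different from the `i₀`-th one. -/
noncomputable def dirHom (g : Fin 3 → ℤ) (i₀ : Fin 3) : (Fin 3 → ℤ) →+ (Fin 3 → ℤ) :=
  AddMonoidHom.mk' (fun n => n 0 • g + n 1 • Pi.single (Equiv.swap 0 i₀ 1) 1
    + n 2 • Pi.single (Equiv.swap 0 i₀ 2) 1) fun a b => by
      simp only [Pi.add_apply, add_smul]; abel

lemma dirHom_apply (g : Fin 3 → ℤ) (i₀ : Fin 3) (n : Fin 3 → ℤ) :
    dirHom g i₀ n = n 0 • g + n 1 • Pi.single (Equiv.swap 0 i₀ 1) 1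
    + n 2 • Pi.single (Equiv.swap 0 i₀ 2) 1 := rfl

lemma norm_dirHom_le (g : Fin 3 → ℤ) (i₀ : Fin 3) (n : Fin 3 → ℤ) :
    ‖dirHom g i₀ n‖ ≤ (‖g‖ + 2) * ‖n‖ := by
  have h0 := norm_le_pi_norm n 0
  have h1 := norm_le_pi_norm n 1
  have h2 := norm_le_pi_norm n 2
  have e : ∀ i : Fin 3, ‖(Pi.single i 1 : Fin 3 → ℤ)‖ = 1 := fun i => by
    rw [Pi.norm_single]; simp
  have hs : ∀ (a : ℤ) (v : Fin 3 → ℤ), ‖a • v‖ ≤ ‖a‖ * ‖v‖ := fun a v => by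
    exact norm_smul_le a v
  calc ‖dirHom g i₀ n‖ ≤ ‖n 0 • g‖ + ‖n 1 • (Pi.single (Equiv.swap 0 i₀ 1) 1 : Fin 3 → ℤ)‖
      + ‖n 2 • (Pi.single (Equiv.swap 0 i₀ 2) 1 : Fin 3 → ℤ)‖ := norm_add₃_le
    _ ≤ ‖n 0‖ * ‖g‖ + ‖n 1‖ * 1 + ‖n 2‖ * 1 := by
        gcongr
        · exact hs _ _
        · exact (hs _ _).trans_eq (by rw [e])
        · exact (hs _ _).trans_eq (by rw [e])
    _ ≤ ‖n‖ * ‖g‖ + ‖n‖ * 1 + ‖n‖ * 1 := by gcongr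
    _ = _ := by ring

lemma norm_le_dirHom {g : Fin 3 → ℤ} {i₀ : Fin 3} (hg : g i₀ ≠ 0) (n : Fin 3 → ℤ) :
    ‖n‖ ≤ (‖g‖ + 1) * ‖dirHom g i₀ n‖ := by
  set s := dirHom g i₀ n with hs
  have hsi : ∀ i, s i = n 0 * g i + n 1 * (if i = Equiv.swap 0 i₀ 1 then 1 else 0)
      + n 2 * (if i = Equiv.swap 0 i₀ 2 then 1 else 0) := fun i => by
    rw [hs, dirHom_apply]
    simp only [Pi.add_apply, Pi.smul_apply, Pi.single_apply, smul_eq_mul]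
  have hn := norm_nonneg s
  have hgn := norm_nonneg g
  have hg1 : (1 : ℝ) ≤ |(g i₀ : ℝ)| := by exact_mod_cast Int.one_le_abs hg
  have h0 : |(n 0 : ℝ)| ≤ ‖s‖ := by
    have h1 := abs_intCast_le_norm s i₀
    have h2 : s i₀ = n 0 * g i₀ := by
      rw [hsi, if_neg, if_neg]
      · ring
      all_goals fin_cases i₀ <;> decide
    rw [h2] at h1
    push_cast at h1
    rw [abs_mul] at h1
    nlinarith [abs_nonneg (n 0 : ℝ)]
  have h1 : |(n 1 : ℝ)| ≤ (‖g‖ + 1) * ‖s‖ := by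
    have h2 : n 1 = s (Equiv.swap 0 i₀ 1) - n 0 * g (Equiv.swap 0 i₀ 1) := by
      rw [hsi, if_pos rfl, if_neg]
      · ring
      · exact (Equiv.swap 0 i₀).injective.ne (by decide)
    have h3 := abs_intCast_le_norm s (Equiv.swap 0 i₀ 1)
    have h4 := abs_intCast_le_norm g (Equiv.swap 0 i₀ 1)
    rw [h2]
    push_cast
    refine (abs_sub _ _).trans ?_
    rw [abs_mul]
    nlinarith [abs_nonneg (n 0 : ℝ), abs_nonneg (g (Equiv.swap 0 i₀ 1) : ℝ)]
  have h2 : |(n 2 : ℝ)| ≤ (‖g‖ + 1) * ‖s‖ := by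
    have h2 : n 2 = s (Equiv.swap 0 i₀ 2) - n 0 * g (Equiv.swap 0 i₀ 2) := by
      rw [hsi, if_pos rfl, if_neg]
      · ring
      · exact (Equiv.swap 0 i₀).injective.ne (by decide)
    have h3 := abs_intCast_le_norm s (Equiv.swap 0 i₀ 2)
    have h4 := abs_intCast_le_norm g (Equiv.swap 0 i₀ 2)
    rw [h2]
    push_cast
    refine (abs_sub _ _).trans ?_
    rw [abs_mul]
    nlinarith [abs_nonneg (n 0 : ℝ), abs_nonneg (g (Equiv.swap 0 i₀ 2) : ℝ)]
  refine (pi_norm_le_iff_of_nonneg (by positivity)).2 fun i => ?_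
  rw [Int.norm_eq_abs]
  fin_cases i
  · exact h0.trans (by nlinarith)
  · exact h1
  · exact h2

lemma norm_castVec (n : Fin 3 → ℤ) : ‖castVec n‖ = ‖n‖ := by
  simp only [Pi.norm_def, castVec]
  congr 1

lemma abs_mat_le (t : Fin 3 → Fin 3 → Fin 3 → ℝ) (x : Fin 3 → ℝ) (i k : Fin 3) :
    |mat t x i k| ≤ 3 * ‖t‖ * ‖x‖ := by
  simp only [mat, Matrix.of_apply]
  refine (Finset.abs_sum_le_sum_abs _ _).trans ?_
  have : ∀ a ∈ Finset.univ, |t a i k * x a| ≤ ‖t‖ * ‖x‖ := fun a _ => by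
    rw [abs_mul]
    have h1 : |t a i k| ≤ ‖t‖ := ((norm_le_pi_norm (t a i) k).trans
      (norm_le_pi_norm (t a) i)).trans (norm_le_pi_norm t a)
    have h2 : |x a| ≤ ‖x‖ := norm_le_pi_norm x a
    gcongr
  refine (Finset.sum_le_card_nsmul _ _ _ this).trans ?_
  simp
  linarith

lemma exists_boxSup_of_hasCubic (n : ℝ) (hn : 1 ≤ n) : ∃ C : ℝ, 1 ≤ C ∧ ∃ B : ℕ, 1 ≤ B ∧
    ∀ (t : Fin 3 → Fin 3 → Fin 3 → ℝ) (g : Fin 3 → ℤ), ‖t‖ ≤ n → ‖g‖ ≤ n →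
    (∀ x, detDeriv t (castVec g) x ≤ -(1 / n) * ‖x‖ ^ 2) →
    ∀ (P : (Fin 3 → ℤ) → ℝ) (Θ : ℝ) (L H : ℤ), HasCubic P (Θ • t) → 1 ≤ H → B * H ≤ L → 0 < Θ →
    B * Θ * H * L ≤ 1 →
    BoxSup L (fun z => expi (P z)) (√(C * L ^ 6 * (1 + Real.log L) ^ 3 *
      (1 / H ^ 3 + 1 / (Θ * L) * √(1 / (Θ * L) + L) / (H * L * √(H * L))))) := by
  set m := 3 * n * (n + 2) with hm
  have hm1 : 1 ≤ m := by nlinarith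
  obtain ⟨C, hC, key⟩ := exists_norm_sq_sum_expi_le m (1 / (n * (n + 1) ^ 2)) hm1 (by positivity)
  refine ⟨max C 1, le_max_right _ _, ⌈6 * m⌉₊, Nat.one_le_iff_ne_zero.2 (by
    have := Nat.ceil_pos.2 (show 0 < 6 * m by linarith); omega), ?_⟩
  intro t g ht hg hgood P Θ L H hP hH hHL hΘ hΘHL
  have hB : 6 * m ≤ (⌈6 * m⌉₊ : ℝ) := Nat.le_ceil _
  have hHr : (1 : ℝ) ≤ H := by exact_mod_cast hH
  have hBHL : (⌈6 * m⌉₊ : ℝ) * H ≤ L := by exact_mod_cast hHL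
  have hHLr : (H : ℝ) ≤ L := by nlinarith
  have hL1 : (1 : ℝ) ≤ L := hHr.trans hHLr
  have hg0 : g ≠ 0 := by
    rintro rfl
    have h1 := hgood 1
    have h2 : detDeriv t (castVec 0) 1 = 0 := by
      have : mat t (castVec 0) = 0 := by ext; simp [mat, castVec]
      simp [detDeriv, this, adjTrace]
    rw [h2, norm_one] at h1
    have : 0 < 1 / n := by positivity
    linarith
  obtain ⟨i₀, hi₀⟩ := Function.ne_iff.1 hg0
  have hi₀ : g i₀ ≠ 0 := hi₀
  set s := dirHom g i₀ with hs
  set M : (Fin 3 → ℤ) →+ Matrix (Fin 3) (Fin 3) ℝ := AddMonoidHom.mk'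
    (fun x => mat t (castVec (s x))) (fun x y => by
      ext i k
      simp only [map_add, mat, castVec, Pi.add_apply, Matrix.of_apply, Matrix.add_apply]
      rw [← Finset.sum_add_distrib]
      exact Finset.sum_congr rfl fun a _ => by push_cast; ring) with hM
  have hMa : ∀ x, M x = mat t (castVec (s x)) := fun x => rfl
  have hs0 : s (Pi.single 0 1) = g := by
    rw [hs, dirHom_apply]; simp
  have hsn : ∀ x, ‖s x‖ ≤ (n + 2) * ‖x‖ := fun x =>
    (norm_dirHom_le g i₀ x).trans (by gcongr)
  have hgf : GoodFamily m (1 / (n * (n + 1) ^ 2)) M := by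
    constructor
    · intro x i k
      rw [hMa]
      refine (abs_mat_le _ _ _ _).trans ?_
      rw [norm_castVec]
      have := hsn x
      calc 3 * ‖t‖ * ‖s x‖ ≤ 3 * n * ((n + 2) * ‖x‖) := by gcongr
        _ = _ := by rw [hm]; ring
    · intro x
      rw [hMa, hMa, hs0]
      refine (hgood _).trans ?_
      rw [norm_castVec]
      have h1 : ‖x‖ ≤ (n + 1) * ‖s x‖ := (norm_le_dirHom hi₀ x).trans (by gcongr)
      have h2 : ‖x‖ ^ 2 ≤ ((n + 1) * ‖s x‖) ^ 2 := by gcongr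
      rw [neg_mul, neg_mul, neg_le_neg_iff]
      calc 1 / (n * (n + 1) ^ 2) * ‖x‖ ^ 2 ≤ 1 / (n * (n + 1) ^ 2) * ((n + 1) * ‖s x‖) ^ 2 := by
            gcongr
        _ = _ := by field_simp
  have hfin := key M hgf s L H Θ P hH (by exact_mod_cast hHLr) hΘ (by
      refine le_trans ?_ hΘHL
      gcongr) (by
      intro x hx k
      have h1 : ‖x‖ ≤ H := (pi_norm_le_iff_of_nonneg (by linarith)).2 fun i => by
        rw [Int.norm_eq_abs]; exact_mod_cast hx i
      have h2 := (abs_intCast_le_norm (s x) k).trans (hsn x)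
      have h3 : (n + 2) * ‖x‖ ≤ ⌈6 * m⌉₊ * H := by
        gcongr
        refine le_trans ?_ hB
        rw [hm]; nlinarith
      have h4 : |((s x k : ℤ) : ℝ)| ≤ L := by linarith
      exact_mod_cast h4) (by
      intro x k
      refine ⟨P (0 + k + s x) - P (0 + k) - (P (0 + s x) - P 0), fun z => ?_⟩
      have h1 := hP (s x) k z
      rw [sub_eq_iff_eq_add'] at h1
      rw [h1, hMa]
      congr 1
      simp only [mat, Matrix.of_apply, Finset.mul_sum, Finset.sum_mul, castVec, Pi.smul_apply,
        smul_eq_mul]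
      rw [Finset.sum_comm]
      refine Finset.sum_congr rfl fun i _ => ?_
      rw [Finset.sum_comm]
      exact Finset.sum_congr rfl fun l _ => Finset.sum_congr rfl fun a _ => by ring)
  intro a b ha hb
  refine (le_abs_self _).trans (Real.abs_le_sqrt ((hfin a b ha hb).trans ?_))
  have := Real.log_nonneg hL1
  gcongr
  exact le_max_left _ _

lemma exists_invSqrt_series : ∃ c : ℕ → ℝ, (∀ n, |c n| ≤ 1) ∧ c 0 = 1 ∧ c 1 = -(1 / 2) ∧
    c 2 = 3 / 8 ∧ c 3 = -(5 / 16) ∧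
    ∀ w : ℝ, |w| < 1 → HasSum (fun n => c n * w ^ n) (1 / √(1 + w)) := by
  set c : ℕ → ℝ := fun n => Ring.choose (-(1 / 2) : ℝ) n with hc
  have hrec : ∀ n, c (n + 1) = c n * (-(1 / 2) - n) / (n + 1) := by
    intro n
    have h1 := Ring.descPochhammer_eq_factorial_smul_choose (-(1 / 2) : ℝ) n
    have h2 := Ring.descPochhammer_eq_factorial_smul_choose (-(1 / 2) : ℝ) (n + 1)
    rw [descPochhammer_succ_right, Polynomial.smeval_mul, h1] at h2
    simp only [Polynomial.smeval_sub, Polynomial.smeval_X, Polynomial.smeval_natCast, nsmul_eq_mul,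
      pow_one, pow_zero, mul_one, Nat.factorial_succ] at h2
    push_cast at h2
    have hf : (n.factorial : ℝ) ≠ 0 := by exact_mod_cast Nat.factorial_ne_zero n
    rw [eq_div_iff (by positivity)]
    simp only [hc]
    have h3 : (n.factorial : ℝ) * (Ring.choose (-(1 / 2) : ℝ) (n + 1) * (n + 1))
      = n.factorial * (Ring.choose (-(1 / 2) : ℝ) n * (-(1 / 2) - n)) := by linarith
    exact mul_left_cancel₀ hf h3
  have h0 : c 0 = 1 := Ring.choose_zero_right _
  have h1 : c 1 = -(1 / 2) := by rw [hrec 0, h0]; norm_num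
  have h2 : c 2 = 3 / 8 := by rw [hrec 1, h1]; norm_num
  have h3 : c 3 = -(5 / 16) := by rw [hrec 2, h2]; norm_num
  refine ⟨c, fun n => ?_, h0, h1, h2, h3, fun w hw => ?_⟩
  · induction n with
    | zero => rw [h0]; simp
    | succ n ih =>
      rw [hrec, mul_div_assoc, abs_mul]
      refine mul_le_one₀ ih (abs_nonneg _) ?_
      rw [abs_div, div_le_one (by positivity), abs_of_neg (by
        have : (0 : ℝ) ≤ n := n.cast_nonneg
        linarith), abs_of_pos (by positivity)]
      linarith
  · have h := (Real.one_add_rpow_hasFPowerSeriesOnBall_zero (a := -(1 / 2))).hasSum (y := w)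
      (by simpa [Metric.mem_eball, edist_dist] using hw)
    have hw1 : 0 < 1 + w := by linarith [(abs_lt.1 hw).1]
    have hs : (1 + (0 + w)) ^ (-(1 / 2) : ℝ) = 1 / √(1 + w) := by
      rw [zero_add, Real.rpow_neg hw1.le, ← Real.sqrt_eq_rpow, one_div]
    rw [hs] at h
    refine h.congr_fun fun n => ?_
    rw [FormalMultilinearSeries.apply_eq_prod_smul_coeff, Finset.prod_const, Finset.card_univ,
      Fintype.card_fin, binomialSeries, FormalMultilinearSeries.coeff_ofScalars, smul_eq_mul, mul_comm]

/-- The real function `w` has order `q ^ k` as a multiplier on boxes. -/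
def BoxO (L : ℤ) (q : ℝ) (k : ℕ) (C : ℝ) (w : (Fin 3 → ℤ) → ℝ) : Prop :=
  0 ≤ C ∧ BoxMul L (fun z => ((w z : ℝ) : ℂ)) (C * q ^ k)

section

variable {L : ℤ} {q : ℝ} {k k' : ℕ} {C C' : ℝ} {w w' : (Fin 3 → ℤ) → ℝ}

lemma BoxO.mono (h : BoxO L q k C w) (hq : 0 ≤ q) (hC : C ≤ C') : BoxO L q k C' w :=
  ⟨h.1.trans hC, h.2.mono (by gcongr)⟩

lemma BoxO.weaken (h : BoxO L q k C w) (hq : 0 ≤ q) (hq1 : q ≤ 1) (hk : k' ≤ k) :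
    BoxO L q k' C w :=
  ⟨h.1, h.2.mono (mul_le_mul_of_nonneg_left (pow_le_pow_of_le_one hq hq1 hk) h.1)⟩

lemma BoxO.add (h : BoxO L q k C w) (h' : BoxO L q k C' w') :
    BoxO L q k (C + C') fun z => w z + w' z :=
  ⟨add_nonneg h.1 h'.1, ((h.2.add h'.2).mono (by rw [add_mul])).congr fun z _ _ => by push_cast; rfl⟩

lemma BoxO.mul (h : BoxO L q k C w) (h' : BoxO L q k' C' w') :
    BoxO L q (k + k') (C * C') fun z => w z * w' z :=
  ⟨mul_nonneg h.1 h'.1, ((h.2.mul h'.2).mono (by rw [pow_add]; exact le_of_eq (by ring))).congr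
    fun z _ _ => by push_cast; rfl⟩

lemma BoxO.const_mul (h : BoxO L q k C w) (r : ℝ) : BoxO L q k (|r| * C) fun z => r * w z :=
  ⟨mul_nonneg (abs_nonneg r) h.1, ((h.2.const_mul (r : ℂ)).mono (by
    rw [Complex.norm_real, Real.norm_eq_abs, mul_assoc])).congr fun z _ _ => by push_cast; rfl⟩

lemma boxO_const (L : ℤ) (q r : ℝ) : BoxO L q 0 |r| fun _ => r :=
  ⟨abs_nonneg r, by simpa using boxMul_const L (r : ℂ)⟩

lemma BoxO.pow (h : BoxO L q k C w) (n : ℕ) : BoxO L q (k * n) (C ^ n) fun z => w z ^ n :=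
  ⟨pow_nonneg h.1 n, by simpa [mul_pow, pow_mul] using h.2.pow n⟩

lemma BoxO.congr (h : BoxO L q k C w) (hw : ∀ z, w z = w' z) : BoxO L q k C w' := by
  rwa [funext hw] at h

lemma BoxO.abs_le (h : BoxO L q k C w) {z : Fin 3 → ℤ} (h0 : ∀ i, 0 ≤ z i) (hL : ∀ i, z i ≤ L) :
    |w z| ≤ C * q ^ k := by
  simpa using h.2.norm_le h0 hL

lemma BoxO.invSqrt (h : BoxO L q 1 C w) (hq : 0 ≤ q) (hCq : C * q ≤ 1 / 2) :
    BoxO L q 4 (2 * C ^ 4) fun z => 1 / √(1 + w z)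
      - (1 - w z / 2 + 3 / 8 * w z ^ 2 - 5 / 16 * w z ^ 3) := by
  obtain ⟨c, hc, c0, c1, c2, c3, hsum⟩ := exists_invSqrt_series
  have hC := h.1
  refine ⟨by positivity, ?_⟩
  have hgeo : HasSum (fun n : ℕ => (C * q) ^ (n + 4)) ((C * q) ^ 4 * (1 - C * q)⁻¹) := by
    simpa only [pow_add, mul_comm] using
      (hasSum_geometric_of_lt_one (by positivity) (by linarith)).mul_left ((C * q) ^ 4)
  have := BoxMul.of_hasSum (L := L) (w := fun n z => ((c (n + 4) * w z ^ (n + 4) : ℝ) : ℂ))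
    (M := fun n => (C * q) ^ (n + 4)) (w' := fun z => ((1 / √(1 + w z)
      - (1 - w z / 2 + 3 / 8 * w z ^ 2 - 5 / 16 * w z ^ 3) : ℝ) : ℂ)) (fun n => ?_) hgeo
      (fun z h0 hL => ?_)
  · refine this.mono ?_
    have h1 : (1 - C * q)⁻¹ ≤ 2 := by
      rw [inv_le_comm₀ (by linarith) two_pos]; linarith
    calc (C * q) ^ 4 * (1 - C * q)⁻¹ ≤ (C * q) ^ 4 * 2 := by gcongr
      _ = _ := by ring
  · have h1 := ((h.pow (n + 4)).const_mul (c (n + 4))).2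
    refine h1.mono ?_
    rw [one_mul, mul_assoc, ← mul_pow]
    exact mul_le_of_le_one_left (by positivity) (hc _)
  · rw [Complex.hasSum_ofReal]
    have h1 := h.abs_le h0 hL
    rw [pow_one] at h1
    have h2 := (hasSum_nat_add_iff' 4).2 (hsum (w z) (by linarith))
    simp only [Finset.sum_range_succ, Finset.sum_range_zero, c0, c1, c2, c3] at h2
    have h3 : 1 / √(1 + w z) - (1 - w z / 2 + 3 / 8 * w z ^ 2 - 5 / 16 * w z ^ 3)
      = 1 / √(1 + w z) - (0 + 1 * w z ^ 0 + -(1 / 2) * w z ^ 1 + 3 / 8 * w z ^ 2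
        + -(5 / 16) * w z ^ 3) := by ring
    rw [h3]
    exact h2

end

/-- Third order Taylor polynomial of `1 / √(1 + (2 a + c))`, with `a`, `c` of degree one, two. -/
noncomputable def jetThree (a c : ℝ) : ℝ :=
  1 - a - c / 2 + 3 / 2 * a ^ 2 + 3 / 2 * (a * c) - 5 / 2 * a ^ 3

/-- Second order Taylor polynomial of `1 / √(1 + (2 a + c))`. -/
noncomputable def jetTwo (a c : ℝ) : ℝ := 1 - a - c / 2 + 3 / 2 * a ^ 2

/-- Third order Taylor polynomial of `(1 / √(1 + (2 a + c))) ^ 3`. -/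
noncomputable def cubeJetThree (a c : ℝ) : ℝ :=
  1 - 3 * a - 3 / 2 * c + 15 / 2 * a ^ 2 + 15 / 2 * (a * c) - 35 / 2 * a ^ 3

/-- Second order Taylor polynomial of `(1 / √(1 + (2 a + c))) ^ 3`. -/
noncomputable def cubeJetTwo (a c : ℝ) : ℝ := 1 - 3 * a - 3 / 2 * c + 15 / 2 * a ^ 2

/-- The bounds for the Taylor remainders of the powers of `1 / √(1 + (2 a + c))`. -/
structure JetBounds (L : ℤ) (q C : ℝ) (a c : (Fin 3 → ℤ) → ℝ) : Prop where
  one_three : BoxO L q 4 C fun z => 1 / √(1 + (2 * a z + c z)) - jetThree (a z) (c z)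
  one_two : BoxO L q 3 C fun z => 1 / √(1 + (2 * a z + c z)) - jetTwo (a z) (c z)
  cube_three : BoxO L q 4 C fun z => (1 / √(1 + (2 * a z + c z))) ^ 3 - cubeJetThree (a z) (c z)
  cube_two : BoxO L q 3 C fun z => (1 / √(1 + (2 * a z + c z))) ^ 3 - cubeJetTwo (a z) (c z)
  cube_one : BoxO L q 2 C fun z => (1 / √(1 + (2 * a z + c z))) ^ 3 - (1 - 3 * a z)

lemma exists_boxO_jetThree : ∃ C, ∀ (L : ℤ) (q : ℝ) (a c : (Fin 3 → ℤ) → ℝ), 0 ≤ q → q ≤ 1 / 6 →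
    BoxO L q 1 1 a → BoxO L q 2 1 c →
    BoxO L q 4 C fun z => 1 / √(1 + (2 * a z + c z)) - jetThree (a z) (c z) := by
  apply Exists.intro
  intro L q a c hq hq6 ha hc
  have hq1 : q ≤ 1 := by linarith
  have hw : BoxO L q 1 3 fun z => 2 * a z + c z :=
    ((ha.const_mul 2).add (hc.weaken hq hq1 one_le_two)).mono hq (by norm_num)
  have h1 := hw.invSqrt hq (by linarith)
  have h2 : BoxO L q 4 _ _ := (hc.pow 2).const_mul (3 / 8)
  have h3 : BoxO L q 4 _ _ := ((ha.pow 2).mul hc).const_mul (-(15 / 4))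
  have h4 : BoxO L q 4 _ _ := ((ha.mul (hc.pow 2)).const_mul (-(15 / 8))).weaken hq hq1 (by norm_num)
  have h5 : BoxO L q 4 _ _ := ((hc.pow 3).const_mul (-(5 / 16))).weaken hq hq1 (by norm_num)
  refine ((((h1.add h2).add h3).add h4).add h5).congr fun z => ?_
  simp only [jetThree]
  ring

lemma exists_boxO_jetTwo : ∃ C, ∀ (L : ℤ) (q : ℝ) (a c : (Fin 3 → ℤ) → ℝ), 0 ≤ q → q ≤ 1 / 6 →
    BoxO L q 1 1 a → BoxO L q 2 1 c →
    BoxO L q 3 C fun z => 1 / √(1 + (2 * a z + c z)) - jetTwo (a z) (c z) := by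
  obtain ⟨C, hC⟩ := exists_boxO_jetThree
  apply Exists.intro
  intro L q a c hq hq6 ha hc
  have hq1 : q ≤ 1 := by linarith
  have h1 : BoxO L q 3 _ _ := (hC L q a c hq hq6 ha hc).weaken hq hq1 (by norm_num)
  have h2 : BoxO L q 3 _ _ := (ha.mul hc).const_mul (3 / 2)
  have h3 : BoxO L q 3 _ _ := (ha.pow 3).const_mul (-(5 / 2))
  refine ((h1.add h2).add h3).congr fun z => ?_
  simp only [jetThree, jetTwo]
  ring

lemma exists_boxO_cubeJetThree : ∃ C, ∀ (L : ℤ) (q : ℝ) (a c : (Fin 3 → ℤ) → ℝ), 0 ≤ q →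
    q ≤ 1 / 6 → BoxO L q 1 1 a → BoxO L q 2 1 c →
    BoxO L q 4 C fun z => (1 / √(1 + (2 * a z + c z))) ^ 3 - cubeJetThree (a z) (c z) := by
  obtain ⟨C, hC⟩ := exists_boxO_jetThree
  apply Exists.intro
  intro L q a c hq hq6 ha hc
  have hq1 : q ≤ 1 := by linarith
  have hr := hC L q a c hq hq6 ha hc
  have hA : BoxO L q 1 _ _ := ha.const_mul (-1)
  have hB : BoxO L q 2 _ _ := (hc.const_mul (-(1 / 2))).add ((ha.pow 2).const_mul (3 / 2))
  have hD : BoxO L q 3 _ _ := ((ha.mul hc).const_mul (3 / 2)).add ((ha.pow 3).const_mul (-(5 / 2)))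
  have hBD : BoxO L q 2 _ _ := hB.add (hD.weaken hq hq1 (by norm_num))
  have hJ : BoxO L q 0 _ _ := ((boxO_const L q 1).add (hA.weaken hq hq1 zero_le_one)).add
    (hBD.weaken hq hq1 zero_le_two)
  have hI : BoxO L q 0 _ _ := (hr.weaken hq hq1 (by norm_num)).add hJ
  have h1 : BoxO L q 4 _ _ := hr.mul (((hI.pow 2).add (hI.mul hJ)).add (hJ.pow 2))
  have h2 : BoxO L q 4 _ _ := (hBD.pow 2).const_mul 3
  have h3 : BoxO L q 4 _ _ := (hA.mul hD).const_mul 6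
  have h4 : BoxO L q 4 _ _ := ((hA.pow 2).mul hBD).const_mul 3
  have h5 : BoxO L q 4 _ _ := ((hA.mul (hBD.pow 2)).const_mul 3).weaken hq hq1 (by norm_num)
  have h6 : BoxO L q 4 _ _ := (hBD.pow 3).weaken hq hq1 (by norm_num)
  refine (((((h1.add h2).add h3).add h4).add h5).add h6).congr fun z => ?_
  simp only [jetThree, cubeJetThree]
  ring

lemma exists_boxO_cubeJetTwo : ∃ C, ∀ (L : ℤ) (q : ℝ) (a c : (Fin 3 → ℤ) → ℝ), 0 ≤ q →
    q ≤ 1 / 6 → BoxO L q 1 1 a → BoxO L q 2 1 c →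
    BoxO L q 3 C fun z => (1 / √(1 + (2 * a z + c z))) ^ 3 - cubeJetTwo (a z) (c z) := by
  obtain ⟨C, hC⟩ := exists_boxO_cubeJetThree
  apply Exists.intro
  intro L q a c hq hq6 ha hc
  have hq1 : q ≤ 1 := by linarith
  have h1 : BoxO L q 3 _ _ := (hC L q a c hq hq6 ha hc).weaken hq hq1 (by norm_num)
  have h2 : BoxO L q 3 _ _ := (ha.mul hc).const_mul (15 / 2)
  have h3 : BoxO L q 3 _ _ := (ha.pow 3).const_mul (-(35 / 2))
  refine ((h1.add h2).add h3).congr fun z => ?_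
  simp only [cubeJetThree, cubeJetTwo]
  ring

lemma exists_boxO_cubeJetOne : ∃ C, ∀ (L : ℤ) (q : ℝ) (a c : (Fin 3 → ℤ) → ℝ), 0 ≤ q →
    q ≤ 1 / 6 → BoxO L q 1 1 a → BoxO L q 2 1 c →
    BoxO L q 2 C fun z => (1 / √(1 + (2 * a z + c z))) ^ 3 - (1 - 3 * a z) := by
  obtain ⟨C, hC⟩ := exists_boxO_cubeJetTwo
  apply Exists.intro
  intro L q a c hq hq6 ha hc
  have hq1 : q ≤ 1 := by linarith
  have h1 : BoxO L q 2 _ _ := (hC L q a c hq hq6 ha hc).weaken hq hq1 (by norm_num)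
  have h2 : BoxO L q 2 _ _ := hc.const_mul (-(3 / 2))
  have h3 : BoxO L q 2 _ _ := (ha.pow 2).const_mul (15 / 2)
  refine ((h1.add h2).add h3).congr fun z => ?_
  simp only [cubeJetTwo]
  ring

lemma exists_jetBounds : ∃ C, ∀ (L : ℤ) (q : ℝ) (a c : (Fin 3 → ℤ) → ℝ), 0 ≤ q →
    q ≤ 1 / 6 → BoxO L q 1 1 a → BoxO L q 2 1 c → JetBounds L q C a c := by
  obtain ⟨C₁, h₁⟩ := exists_boxO_jetThree
  obtain ⟨C₂, h₂⟩ := exists_boxO_jetTwo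
  obtain ⟨C₃, h₃⟩ := exists_boxO_cubeJetThree
  obtain ⟨C₄, h₄⟩ := exists_boxO_cubeJetTwo
  obtain ⟨C₅, h₅⟩ := exists_boxO_cubeJetOne
  refine ⟨max C₁ (max C₂ (max C₃ (max C₄ C₅))), fun L q a c hq hq6 ha hc => ⟨?_, ?_, ?_, ?_, ?_⟩⟩
  · exact (h₁ L q a c hq hq6 ha hc).mono hq (by simp)
  · exact (h₂ L q a c hq hq6 ha hc).mono hq (by simp)
  · exact (h₃ L q a c hq hq6 ha hc).mono hq (by simp)
  · exact (h₄ L q a c hq hq6 ha hc).mono hq (by simp)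
  · exact (h₅ L q a c hq hq6 ha hc).mono hq (by simp)

section Lattice

variable {f : Module.Basis (Fin 3) ℝ E3} {L : ℤ} {q ν : ℝ} {b Y : E3}

/-- The lattice vector with the given integer coordinates. -/
noncomputable def lat (f : Module.Basis (Fin 3) ℝ E3) (z : Fin 3 → ℤ) : E3 := emb f (castVec z)

/-- The sum of the lengths of the basis vectors. -/
noncomputable def basisSize (f : Module.Basis (Fin 3) ℝ E3) : ℝ := ∑ i, ‖f i‖

lemma basisSize_nonneg : 0 ≤ basisSize f := Finset.sum_nonneg fun _ _ => norm_nonneg _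

lemma lat_add (z w : Fin 3 → ℤ) : lat f (z + w) = lat f z + lat f w := by
  simp [lat, emb, castVec, add_smul, Finset.sum_add_distrib]

lemma lat_zero : lat f 0 = 0 := by simp [lat, emb, castVec]

lemma inner_lat (x : E3) (z : Fin 3 → ℤ) : inner ℝ x (lat f z) = ∑ i, inner ℝ x (f i) * (z i : ℝ) := by
  simp only [lat, emb, castVec, inner_sum, real_inner_smul_right]
  exact Finset.sum_congr rfl fun i _ => mul_comm _ _

lemma boxMul_scaled_coord (hL : 0 ≤ L) (hν : 0 ≤ ν) (i : Fin 3) (s : ℝ) :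
    BoxMul L (fun z => ((ν * (s * (z i : ℝ)) : ℝ) : ℂ)) (ν * (|s| * L)) := by
  have := (boxMul_coord hL i).const_mul ((ν * s : ℝ) : ℂ)
  refine (this.mono ?_).congr fun z _ _ => by push_cast; ring
  rw [Complex.norm_real, Real.norm_eq_abs, abs_mul, abs_of_nonneg hν, mul_assoc]

lemma boxO_inner (hL : 0 ≤ L) (hν : 0 ≤ ν) (hq : basisSize f * L * ν ≤ q) (x : E3) :
    BoxO L q 1 ‖x‖ fun z => ν * inner ℝ x (lat f z) := by
  have hL' : (0 : ℝ) ≤ L := by exact_mod_cast hL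
  refine ⟨norm_nonneg _, ?_⟩
  have h := BoxMul.sum Finset.univ fun i _ => boxMul_scaled_coord hL hν i (inner ℝ x (f i))
  refine (h.mono ?_).congr fun z _ _ => by
    rw [← Complex.ofReal_sum, ← Finset.mul_sum, ← inner_lat]
  calc ∑ i, ν * (|inner ℝ x (f i)| * L) ≤ ∑ i, ν * (‖x‖ * ‖f i‖ * L) := by
        gcongr with i; exact abs_real_inner_le_norm _ _
    _ = ‖x‖ * (basisSize f * L * ν) := by
        rw [basisSize, Finset.sum_mul, Finset.sum_mul, Finset.mul_sum]
        exact Finset.sum_congr rfl fun i _ => by ring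
    _ ≤ ‖x‖ * q ^ 1 := by rw [pow_one]; gcongr

lemma boxO_norm_sq (hL : 0 ≤ L) (hν : 0 ≤ ν) (hq : basisSize f * L * ν ≤ q) :
    BoxO L q 2 1 fun z => ν ^ 2 * ‖lat f z‖ ^ 2 := by
  have hL' : (0 : ℝ) ≤ L := by exact_mod_cast hL
  have hq0 : 0 ≤ q := (mul_nonneg (mul_nonneg basisSize_nonneg hL') hν).trans hq
  refine ⟨zero_le_one, ?_⟩
  have h := BoxMul.sum Finset.univ fun i (_ : i ∈ Finset.univ) =>
    (boxMul_scaled_coord hL hν i 1).mul (boxO_inner hL hν hq (f i)).2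
  refine (h.mono ?_).congr fun z _ _ => ?_
  · calc ∑ i, ν * (|1| * L) * (‖f i‖ * q ^ 1) = (basisSize f * L * ν) * q := by
          rw [basisSize, Finset.sum_mul, Finset.sum_mul, Finset.sum_mul]
          exact Finset.sum_congr rfl fun i _ => by rw [abs_one]; ring
      _ ≤ q * q := by gcongr
      _ = 1 * q ^ 2 := by ring
  · simp only [← real_inner_self_eq_norm_sq]
    rw [inner_lat]
    simp only [← Complex.ofReal_mul, ← Complex.ofReal_sum, Finset.mul_sum]
    congr 1
    refine Finset.sum_congr rfl fun i _ => ?_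
    rw [real_inner_comm]
    ring

/-- The derivative of the norm along `b`. -/
noncomputable def normDerivOne (b X : E3) : ℝ := inner ℝ b X / ‖X‖

/-- The second derivative of the norm along `b`. -/
noncomputable def normDerivTwo (b X : E3) : ℝ := (‖b‖ ^ 2 - (inner ℝ b X / ‖X‖) ^ 2) / ‖X‖

/-- Degree one coordinate in the expansion of the norm at `Y`. -/
noncomputable def coordA (f : Module.Basis (Fin 3) ℝ E3) (Y : E3) (z : Fin 3 → ℤ) : ℝ :=
  ‖Y‖⁻¹ * inner ℝ (‖Y‖⁻¹ • Y) (lat f z)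

/-- Degree two coordinate in the expansion of the norm at `Y`. -/
noncomputable def coordC (f : Module.Basis (Fin 3) ℝ E3) (Y : E3) (z : Fin 3 → ℤ) : ℝ :=
  (‖Y‖⁻¹) ^ 2 * ‖lat f z‖ ^ 2

/-- Cubic Taylor polynomial of `normDerivOne`. -/
noncomputable def jetOne (f : Module.Basis (Fin 3) ℝ E3) (b Y : E3) (z : Fin 3 → ℤ) : ℝ :=
  inner ℝ b (‖Y‖⁻¹ • Y) * jetThree (coordA f Y z) (coordC f Y z)
    + ‖Y‖⁻¹ * inner ℝ b (lat f z) * jetTwo (coordA f Y z) (coordC f Y z)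

/-- Cubic Taylor polynomial of `normDerivTwo`. -/
noncomputable def jetSnd (f : Module.Basis (Fin 3) ℝ E3) (b Y : E3) (z : Fin 3 → ℤ) : ℝ :=
  ‖Y‖⁻¹ * (‖b‖ ^ 2 * jetThree (coordA f Y z) (coordC f Y z)
    - inner ℝ b (‖Y‖⁻¹ • Y) ^ 2 * cubeJetThree (coordA f Y z) (coordC f Y z)
    - 2 * inner ℝ b (‖Y‖⁻¹ • Y) * (‖Y‖⁻¹ * inner ℝ b (lat f z))
      * cubeJetTwo (coordA f Y z) (coordC f Y z)
    - (‖Y‖⁻¹ * inner ℝ b (lat f z)) ^ 2 * (1 - 3 * coordA f Y z))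

lemma norm_add_lat (hY : Y ≠ 0) (z : Fin 3 → ℤ) :
    ‖Y + lat f z‖ = ‖Y‖ * √(1 + (2 * coordA f Y z + coordC f Y z)) := by
  have h0 : ‖Y‖ ≠ 0 := norm_ne_zero_iff.2 hY
  rw [← Real.sqrt_sq (norm_nonneg (Y + lat f z))]
  conv_rhs => rw [← Real.sqrt_sq (norm_nonneg Y), ← Real.sqrt_mul (sq_nonneg _)]
  congr 1
  rw [norm_add_sq_real, coordA, coordC, real_inner_smul_left]
  field_simp
  ring

lemma normDerivOne_eq (hY : Y ≠ 0) (z : Fin 3 → ℤ) :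
    normDerivOne b (Y + lat f z) = (inner ℝ b (‖Y‖⁻¹ • Y) + ‖Y‖⁻¹ * inner ℝ b (lat f z))
      * (1 / √(1 + (2 * coordA f Y z + coordC f Y z))) := by
  have h0 : ‖Y‖ ≠ 0 := norm_ne_zero_iff.2 hY
  rw [normDerivOne, norm_add_lat hY, inner_add_right, real_inner_smul_right, ← mul_add, mul_one_div,
    mul_comm ‖Y‖⁻¹, ← div_eq_mul_inv, div_div]

lemma normDerivTwo_eq (hY : Y ≠ 0) (z : Fin 3 → ℤ) :
    normDerivTwo b (Y + lat f z) = ‖Y‖⁻¹ * (‖b‖ ^ 2 * (1 / √(1 + (2 * coordA f Y z + coordC f Y z)))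
      - (inner ℝ b (‖Y‖⁻¹ • Y) + ‖Y‖⁻¹ * inner ℝ b (lat f z)) ^ 2
      * (1 / √(1 + (2 * coordA f Y z + coordC f Y z))) ^ 3) := by
  have h := normDerivOne_eq (b := b) (f := f) hY z
  rw [normDerivOne] at h
  rw [normDerivTwo, h, norm_add_lat hY, div_eq_mul_inv, mul_inv, one_div]
  ring

lemma abs_inner_unit_le : |inner ℝ b (‖Y‖⁻¹ • Y)| ≤ ‖b‖ := by
  refine (abs_real_inner_le_norm _ _).trans ?_
  rw [norm_smul, norm_inv, norm_norm]
  exact mul_le_of_le_one_right (norm_nonneg _) (inv_mul_le_one)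

lemma boxO_coordA (hL : 0 ≤ L) (hq : basisSize f * L * ‖Y‖⁻¹ ≤ q) : BoxO L q 1 1 (coordA f Y) := by
  have hL' : (0 : ℝ) ≤ L := by exact_mod_cast hL
  have hq0 : 0 ≤ q := (mul_nonneg (mul_nonneg basisSize_nonneg hL') (by positivity)).trans hq
  refine (boxO_inner hL (by positivity) hq _).mono hq0 ?_
  rw [norm_smul, norm_inv, norm_norm]
  exact inv_mul_le_one

lemma exists_normDeriv_sub_jet (f : Module.Basis (Fin 3) ℝ E3) : ∃ C, 0 ≤ C ∧
    ∀ (L : ℤ) (q : ℝ) (b Y : E3), 0 ≤ L → Y ≠ 0 → basisSize f * L * ‖Y‖⁻¹ ≤ q → q ≤ 1 / 6 →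
    BoxMul L (fun z => ((normDerivOne b (Y + lat f z) - jetOne f b Y z : ℝ) : ℂ)) (C * ‖b‖ * q ^ 4) ∧
    BoxMul L (fun z => ((normDerivTwo b (Y + lat f z) - jetSnd f b Y z : ℝ) : ℂ))
      (C * ‖b‖ ^ 2 * ‖Y‖⁻¹ * q ^ 4) := by
  obtain ⟨C, hC⟩ := exists_jetBounds
  refine ⟨5 * |C|, by positivity, fun L q b Y hL hY hq hq6 => ?_⟩
  have hL' : (0 : ℝ) ≤ L := by exact_mod_cast hL
  have hq0 : 0 ≤ q := (mul_nonneg (mul_nonneg basisSize_nonneg hL') (by positivity)).trans hq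
  have hJ := hC L q (coordA f Y) (coordC f Y) hq0 hq6 (boxO_coordA hL hq)
    (boxO_norm_sq hL (by positivity) hq)
  have hd : BoxO L q 1 ‖b‖ fun z => ‖Y‖⁻¹ * inner ℝ b (lat f z) := boxO_inner hL (by positivity) hq b
  have hβ := abs_inner_unit_le (b := b) (Y := Y)
  have hβ2 : |inner ℝ b (‖Y‖⁻¹ • Y) ^ 2| ≤ ‖b‖ ^ 2 := by rw [abs_pow]; gcongr
  have hC0 : 0 ≤ C := hJ.one_three.1
  rw [abs_of_nonneg hC0]
  set β := inner ℝ b (‖Y‖⁻¹ • Y) with hβdef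
  constructor
  · have h1 := hJ.one_three.const_mul β
    have h2 : BoxO L q 4 _ _ := hd.mul hJ.one_two
    have h3 : BoxO L q 4 (5 * C * ‖b‖) _ := (h1.add h2).mono hq0 (by nlinarith [norm_nonneg b])
    refine h3.2.congr fun z _ _ => ?_
    rw [normDerivOne_eq hY, jetOne, ← hβdef]
    congr 1
    ring
  · have h1 := hJ.one_three.const_mul (‖b‖ ^ 2)
    have h2 := hJ.cube_three.const_mul (-β ^ 2)
    have h3 : BoxO L q 4 _ _ := (hd.mul hJ.cube_two).const_mul (-(2 * β))
    have h4 : BoxO L q 4 _ _ := ((hd.pow 2).mul hJ.cube_one).const_mul (-1)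
    have h5 := ((h1.add h2).add (h3.add h4)).const_mul ‖Y‖⁻¹
    have h6 : BoxO L q 4 (5 * C * ‖b‖ ^ 2 * ‖Y‖⁻¹) _ := h5.mono hq0 (by
      have e1 : |β| ≤ ‖b‖ := hβ
      rw [abs_neg, abs_neg, abs_neg, abs_mul, abs_two, abs_one, abs_of_nonneg (sq_nonneg ‖b‖),
        abs_of_nonneg (inv_nonneg.2 (norm_nonneg Y)), mul_comm]
      gcongr
      have h7 : |β| * (‖b‖ * C) ≤ ‖b‖ * (‖b‖ * C) := by gcongr
      have h8 : |β ^ 2| * C ≤ ‖b‖ ^ 2 * C := by gcongr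
      nlinarith)
    refine h6.2.congr fun z _ _ => ?_
    rw [normDerivTwo_eq hY, jetSnd, ← hβdef]
    congr 1
    ring

lemma hasCubic_of_isTri {T : E3 → E3 → E3 → ℝ} (hT : IsTri T) {P : (Fin 3 → ℤ) → ℝ} (s : ℝ)
    (h : ∀ x k z, (P (z + k + x) - P (z + k) - (P (z + x) - P z))
      - (P (0 + k + x) - P (0 + k) - (P (0 + x) - P 0)) = s * T (lat f x) (lat f z) (lat f k)) :
    HasCubic P (s • tens f T) := by
  intro x k z
  rw [h, lat, lat, lat, emb, emb, emb, hT.expand]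
  simp only [castVec, Pi.smul_apply, smul_eq_mul, Finset.mul_sum]
  exact Finset.sum_congr rfl fun _ _ => Finset.sum_congr rfl fun _ _ =>
    Finset.sum_congr rfl fun _ _ => by ring

lemma hasCubic_jetOne (b Y : E3) : HasCubic (jetOne f b Y) (scaledTens f 1 cubOne b Y) := by
  refine hasCubic_of_isTri (isTri_cubOne _ _) _ fun x k z => ?_
  simp only [jetOne, jetThree, jetTwo, coordA, coordC, cubOne, polOne, polThree,
    ← real_inner_self_eq_norm_sq, lat_add, lat_zero, zero_add, inner_add_left, inner_add_right,
    inner_zero_right, real_inner_comm (lat f z) (lat f x),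
    real_inner_comm (lat f k) (lat f x), real_inner_comm (lat f k) (lat f z)]
  ring

lemma hasCubic_jetSnd (b Y : E3) : HasCubic (jetSnd f b Y) (scaledTens f 2 cubTwo b Y) := by
  refine hasCubic_of_isTri (isTri_cubTwo _ _) _ fun x k z => ?_
  simp only [jetSnd, jetThree, cubeJetThree, cubeJetTwo, coordA, coordC, cubTwo, polOne, polThree,
    ← real_inner_self_eq_norm_sq, lat_add, lat_zero, zero_add, inner_add_left, inner_add_right,
    inner_zero_right, real_inner_comm (lat f z) (lat f x),
    real_inner_comm (lat f k) (lat f x), real_inner_comm (lat f k) (lat f z)]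
  ring

end Lattice

/-- A continuous family of functions on a box, each of which is close to one with almost constant
third differences. -/
def CubicFamily (L : ℤ) (Θ ρ M : ℝ) (t₀ : Fin 3 → Fin 3 → Fin 3 → ℝ)
    (F : ℝ → (Fin 3 → ℤ) → ℝ) : Prop :=
  (∀ z : Fin 3 → ℤ, (∀ i, 0 ≤ z i) → (∀ i, z i ≤ L) → Continuous fun s => F s z) ∧
    ∃ (P : ℝ → (Fin 3 → ℤ) → ℝ) (T : ℝ → Fin 3 → Fin 3 → Fin 3 → ℝ),
      (∀ z, Continuous fun s => P s z) ∧ Continuous T ∧ (∀ s, HasCubic (P s) (T s)) ∧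
      (∀ s, ‖T s - Θ • t₀‖ ≤ Θ * ρ) ∧
      ∀ s, BoxMul L (fun z => ((F s z - P s z : ℝ) : ℂ)) M

lemma CubicFamily.average {L : ℤ} {Θ ρ M : ℝ} {t₀ : Fin 3 → Fin 3 → Fin 3 → ℝ}
    {F : ℝ → (Fin 3 → ℤ) → ℝ} (h : CubicFamily L Θ ρ M t₀ F) (r : ℝ) :
    CubicFamily L Θ ρ M t₀ fun s z => ∫ t in (0:ℝ)..1, F (s + r * t) z := by
  obtain ⟨hF, P, T, hP, hT, hPT, hTt, hM⟩ := h
  have hpar : ∀ {E : Type} [NormedAddCommGroup E] [NormedSpace ℝ E] (g : ℝ → E), Continuous g →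
      Continuous fun s => ∫ t in (0:ℝ)..1, g (s + r * t) := fun g hg =>
    intervalIntegral.continuous_parametric_intervalIntegral_of_continuous'
      (f := fun s t => g (s + r * t)) (by simp only [Function.uncurry_def]; fun_prop) 0 1
  refine ⟨fun z h0 hL => hpar _ (hF z h0 hL), fun s z => ∫ t in (0:ℝ)..1, P (s + r * t) z,
    fun s => ∫ t in (0:ℝ)..1, T (s + r * t), fun z => hpar _ (hP z), hpar _ hT, fun s => ?_,
    fun s => ?_, fun s => ?_⟩
  · have hPi : ∀ z, IntervalIntegrable (fun t => P (s + r * t) z) volume 0 1 := fun z =>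
      ((hP z).comp (by fun_prop : Continuous fun t : ℝ => s + r * t)).intervalIntegrable _ _
    have hTc : Continuous fun t : ℝ => T (s + r * t) := hT.comp (by fun_prop)
    have hTi : ∀ a i l, (∫ t in (0:ℝ)..1, T (s + r * t)) a i l
        = ∫ t in (0:ℝ)..1, T (s + r * t) a i l := by
      intro a i l
      have := ((ContinuousLinearMap.proj (R := ℝ) (φ := fun _ : Fin 3 => ℝ) l).comp
        ((ContinuousLinearMap.proj (R := ℝ) (φ := fun _ : Fin 3 => Fin 3 → ℝ) i).comp
        (ContinuousLinearMap.proj (R := ℝ) (φ := fun _ : Fin 3 => Fin 3 → Fin 3 → ℝ)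
          a))).intervalIntegral_comp_comm (hTc.intervalIntegrable (μ := volume) 0 1)
      simpa using this.symm
    have hTe : ∀ a i l, Continuous fun t : ℝ => T (s + r * t) a i l := fun a i l =>
      (continuous_apply l).comp ((continuous_apply i).comp ((continuous_apply a).comp hTc))
    intro x k z
    have hterm : ∀ a i l, Continuous fun t : ℝ =>
        T (s + r * t) a i l * (x a : ℝ) * (z i : ℝ) * (k l : ℝ) := fun a i l =>
      (((hTe a i l).mul continuous_const).mul continuous_const).mul continuous_const
    have hsum : ∀ a i, Continuous fun t : ℝ =>
        ∑ l, T (s + r * t) a i l * (x a : ℝ) * (z i : ℝ) * (k l : ℝ) := fun a i =>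
      continuous_finsetSum _ fun l _ => hterm a i l
    have hsum' : ∀ a, Continuous fun t : ℝ =>
        ∑ i, ∑ l, T (s + r * t) a i l * (x a : ℝ) * (z i : ℝ) * (k l : ℝ) := fun a =>
      continuous_finsetSum _ fun i _ => hsum a i
    have h1 : ∀ t : ℝ, _ := fun t => hPT (s + r * t) x k z
    have h2 := intervalIntegral.integral_congr (μ := volume) (a := 0) (b := 1) fun t _ => h1 t
    rw [intervalIntegral.integral_sub, intervalIntegral.integral_sub, intervalIntegral.integral_sub,
      intervalIntegral.integral_sub, intervalIntegral.integral_sub, intervalIntegral.integral_sub,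
      intervalIntegral.integral_sub] at h2
    · rw [h2, intervalIntegral.integral_finsetSum fun a _ => (hsum' a).intervalIntegrable _ _]
      refine Finset.sum_congr rfl fun a _ => ?_
      rw [intervalIntegral.integral_finsetSum fun i _ => (hsum a i).intervalIntegrable _ _]
      refine Finset.sum_congr rfl fun i _ => ?_
      rw [intervalIntegral.integral_finsetSum fun l _ => (hterm a i l).intervalIntegrable _ _]
      refine Finset.sum_congr rfl fun l _ => ?_
      beta_reduce
      rw [hTi, intervalIntegral.integral_mul_const, intervalIntegral.integral_mul_const,
        intervalIntegral.integral_mul_const]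
    all_goals
      first
      | exact hPi _
      | refine Continuous.intervalIntegrable ?_ _ _
        have := fun z => (hP z).comp (by fun_prop : Continuous fun t : ℝ => s + r * t)
        fun_prop
  · have hTc : Continuous fun t : ℝ => T (s + r * t) := hT.comp (by fun_prop)
    have h1 : (∫ t in (0:ℝ)..1, T (s + r * t)) - Θ • t₀
        = ∫ t in (0:ℝ)..1, (T (s + r * t) - Θ • t₀) := by
      rw [intervalIntegral.integral_sub (hTc.intervalIntegrable _ _)
        (continuous_const.intervalIntegrable _ _), intervalIntegral.integral_const]
      simp
    rw [h1]
    simpa using intervalIntegral.norm_integral_le_of_norm_le_const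
      (fun t _ => hTt (s + r * t) : ∀ t ∈ Set.uIoc (0:ℝ) 1, _)
  · refine (BoxMul.intervalIntegral (fun t _ => hM (s + r * t)) fun z h0 hL => ?_).congr
      fun z h0 hL => ?_
    · refine Continuous.intervalIntegrable ?_ _ _
      have h1 := hF z h0 hL
      have h2 := hP z
      fun_prop
    · rw [intervalIntegral.integral_ofReal, intervalIntegral.integral_sub]
      · exact ((hF z h0 hL).comp (by fun_prop : Continuous fun t : ℝ => s + r * t)).intervalIntegrable _ _
      · exact ((hP z).comp (by fun_prop : Continuous fun t : ℝ => s + r * t)).intervalIntegrable _ _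

section Ray

variable {f : Module.Basis (Fin 3) ℝ E3} {j : ℕ} {cub : E3 → E3 → E3 → E3 → E3 → ℝ}
  {L : ℤ} {S n M ρ : ℝ} {b Y : E3} {t₀ : Fin 3 → Fin 3 → Fin 3 → ℝ}

lemma scaledTens_smul {s : ℝ} (hs : 0 < s) (b Y : E3) :
    scaledTens f j cub b (s • Y) = (s⁻¹) ^ (j + 2) • scaledTens f j cub b Y := by
  have h : (s * ‖Y‖)⁻¹ • s • Y = ‖Y‖⁻¹ • Y := by
    rw [smul_smul, mul_inv, mul_right_comm, inv_mul_cancel₀ hs.ne', one_mul]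
  rw [scaledTens, scaledTens, norm_smul, Real.norm_eq_abs, abs_of_pos hs, h, smul_smul, mul_inv,
    mul_pow]

/-- A segment of length `S` from `Y` in direction `b`, extended by constants. -/
noncomputable def ray (Y b : E3) (S s : ℝ) : E3 := Y + max 0 (min s S) • b

lemma continuous_ray : Continuous (ray Y b S) := by unfold ray; fun_prop

lemma ray_of_mem {s : ℝ} (h0 : 0 ≤ s) (hS : s ≤ S) : ray Y b S s = Y + s • b := by
  rw [ray, min_eq_left hS, max_eq_right h0]

lemma norm_ray_sub_le (hS : 0 ≤ S) (s : ℝ) : ‖ray Y b S s - Y‖ ≤ S * ‖b‖ := by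
  rw [ray, add_sub_cancel_left, norm_smul, Real.norm_eq_abs, abs_of_nonneg (le_max_left _ _)]
  gcongr
  exact max_le hS (min_le_right _ _)

lemma norm_le_two_mul_norm_ray (hS : 0 ≤ S) (hSb : 2 * (S * ‖b‖) ≤ ‖Y‖) (s : ℝ) :
    ‖Y‖ ≤ 2 * ‖ray Y b S s‖ := by
  have h1 := norm_ray_sub_le (Y := Y) (b := b) hS s
  have h2 := norm_sub_norm_le Y (ray Y b S s)
  rw [norm_sub_rev] at h2
  linarith

lemma norm_lat_le {z : Fin 3 → ℤ} (h0 : ∀ i, 0 ≤ z i) (hL : ∀ i, z i ≤ L) :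
    ‖lat f z‖ ≤ basisSize f * L := by
  rw [lat, emb, basisSize, Finset.sum_mul]
  refine norm_sum_le_of_le _ fun i _ => ?_
  rw [norm_smul, mul_comm]
  gcongr
  rw [Real.norm_eq_abs, castVec, abs_of_nonneg (by exact_mod_cast h0 i)]
  exact_mod_cast hL i

lemma ray_add_lat_ne_zero (hS : 0 ≤ S) (hY : Y ≠ 0) (hSb : 2 * (S * ‖b‖) ≤ ‖Y‖)
    (hL : 12 * (basisSize f * L) ≤ ‖Y‖) (s : ℝ) {z : Fin 3 → ℤ} (h0 : ∀ i, 0 ≤ z i)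
    (hz : ∀ i, z i ≤ L) : ray Y b S s + lat f z ≠ 0 := by
  intro h
  have h1 := norm_le_two_mul_norm_ray hS hSb s
  rw [eq_neg_of_add_eq_zero_left h, norm_neg] at h1
  have h2 := norm_lat_le (f := f) h0 hz
  have h3 := norm_pos_iff.2 hY
  linarith

lemma ray_ne_zero (hS : 0 ≤ S) (hY : Y ≠ 0) (hSb : 2 * (S * ‖b‖) ≤ ‖Y‖) (s : ℝ) :
    ray Y b S s ≠ 0 := by
  intro h
  have h1 := norm_le_two_mul_norm_ray hS hSb s
  rw [h, norm_zero, mul_zero] at h1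
  exact hY (norm_le_zero_iff.1 h1)

lemma continuousAt_normDerivOne {X : E3} (hX : X ≠ 0) : ContinuousAt (normDerivOne b) X := by
  unfold normDerivOne
  exact ContinuousAt.div (by fun_prop) (by fun_prop) (norm_ne_zero_iff.2 hX)

lemma continuousAt_normDerivTwo {X : E3} (hX : X ≠ 0) : ContinuousAt (normDerivTwo b) X := by
  unfold normDerivTwo
  exact ContinuousAt.div (continuousAt_const.sub ((continuousAt_normDerivOne hX).pow 2))
    (by fun_prop) (norm_ne_zero_iff.2 hX)

lemma continuousAt_coordA {X : E3} (hX : X ≠ 0) (z : Fin 3 → ℤ) :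
    ContinuousAt (fun X => coordA f X z) X := by
  have h1 : ContinuousAt (fun Y : E3 => ‖Y‖⁻¹) X :=
    continuous_norm.continuousAt.inv₀ (norm_ne_zero_iff.2 hX)
  unfold coordA
  fun_prop

lemma continuousAt_coordC {X : E3} (hX : X ≠ 0) (z : Fin 3 → ℤ) :
    ContinuousAt (fun X => coordC f X z) X := by
  have h1 : ContinuousAt (fun Y : E3 => ‖Y‖⁻¹) X :=
    continuous_norm.continuousAt.inv₀ (norm_ne_zero_iff.2 hX)
  unfold coordC
  fun_prop

lemma continuousAt_jetOne {X : E3} (hX : X ≠ 0) (z : Fin 3 → ℤ) :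
    ContinuousAt (fun X => jetOne f b X z) X := by
  have h1 : ContinuousAt (fun Y : E3 => ‖Y‖⁻¹) X :=
    continuous_norm.continuousAt.inv₀ (norm_ne_zero_iff.2 hX)
  have h2 := continuousAt_coordA (f := f) hX z
  have h3 := continuousAt_coordC (f := f) hX z
  unfold jetOne jetThree jetTwo
  fun_prop

lemma continuousAt_jetSnd {X : E3} (hX : X ≠ 0) (z : Fin 3 → ℤ) :
    ContinuousAt (fun X => jetSnd f b X z) X := by
  have h1 : ContinuousAt (fun Y : E3 => ‖Y‖⁻¹) X :=
    continuous_norm.continuousAt.inv₀ (norm_ne_zero_iff.2 hX)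
  have h2 := continuousAt_coordA (f := f) hX z
  have h3 := continuousAt_coordC (f := f) hX z
  unfold jetSnd jetThree cubeJetThree cubeJetTwo
  fun_prop

lemma CubicKernel.cubicFamily (hc : CubicKernel j cub) {D : E3 → ℝ}
    {J : E3 → (Fin 3 → ℤ) → ℝ} (hn : 0 < n) (hS : 0 ≤ S) (hY : Y ≠ 0)
    (hSb : 2 * (S * ‖b‖) ≤ ‖Y‖) (hSn : 2 * n * (S * ‖b‖) ≤ ‖Y‖)
    (hL : 12 * (basisSize f * L) ≤ ‖Y‖)
    (ht₀ : ∀ X, ‖X - ‖Y‖⁻¹ • Y‖ < 1 / n → ‖scaledTens f j cub b X - t₀‖ ≤ ρ)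
    (hD : ∀ X, X ≠ 0 → ContinuousAt D X) (hJ : ∀ X z, X ≠ 0 → ContinuousAt (fun X => J X z) X)
    (hJ' : ∀ X, HasCubic (J X) (scaledTens f j cub b X))
    (hM : ∀ s, BoxMul L (fun z => ((D (ray Y b S s + lat f z) - J (ray Y b S s) z : ℝ) : ℂ)) M) :
    CubicFamily L ((‖Y‖⁻¹) ^ (j + 2)) ρ M t₀ fun s z => D (ray Y b S s + lat f z) := by
  have hY0 := norm_pos_iff.2 hY
  refine ⟨fun z h0 hz => continuous_iff_continuousAt.2 fun s => ?_, fun s => J (ray Y b S s),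
    fun s => scaledTens f j cub b (ray Y b S s), fun z => continuous_iff_continuousAt.2 fun s => ?_,
    continuous_iff_continuousAt.2 fun s => ?_, fun s => hJ' _, fun s => ?_, hM⟩
  · exact ContinuousAt.comp (f := fun s => ray Y b S s + lat f z)
      (hD _ (ray_add_lat_ne_zero hS hY hSb hL s h0 hz))
      (continuous_ray.continuousAt.add continuousAt_const)
  · exact ContinuousAt.comp (f := ray Y b S) (hJ _ z (ray_ne_zero hS hY hSb s))
      continuous_ray.continuousAt
  · exact ContinuousAt.comp (f := ray Y b S)
      (hc.continuousAt_scaledTens b (ray_ne_zero hS hY hSb s)) continuous_ray.continuousAt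
  · have h1 : ray Y b S s = ‖Y‖ • (‖Y‖⁻¹ • ray Y b S s) := by
      rw [smul_smul, mul_inv_cancel₀ hY0.ne', one_smul]
    beta_reduce
    rw [h1, scaledTens_smul hY0, ← smul_sub, norm_smul, Real.norm_eq_abs,
      abs_of_nonneg (by positivity)]
    gcongr
    apply ht₀
    rw [← smul_sub, norm_smul, norm_inv, norm_norm, inv_mul_lt_iff₀ hY0]
    refine (norm_ray_sub_le hS s).trans_lt ?_
    rw [mul_one_div, lt_div_iff₀ hn]
    linarith

lemma exists_cubicFamily (f : Module.Basis (Fin 3) ℝ E3) : ∃ C, 0 ≤ C ∧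
    ∀ (n : ℝ) (L : ℤ) (S : ℝ) (b Y : E3) (t₀ : Fin 3 → Fin 3 → Fin 3 → ℝ) (ρ : ℝ), 0 < n →
    0 ≤ L → 0 ≤ S → Y ≠ 0 → 2 * (S * ‖b‖) ≤ ‖Y‖ → 2 * n * (S * ‖b‖) ≤ ‖Y‖ →
    12 * (basisSize f * L) ≤ ‖Y‖ →
    ((∀ X, ‖X - ‖Y‖⁻¹ • Y‖ < 1 / n → ‖scaledTens f 1 cubOne b X - t₀‖ ≤ ρ) →
      CubicFamily L ((‖Y‖⁻¹) ^ 3) ρ (C * ‖b‖ * (L / ‖Y‖) ^ 4) t₀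
        fun s z => normDerivOne b (ray Y b S s + lat f z)) ∧
    ((∀ X, ‖X - ‖Y‖⁻¹ • Y‖ < 1 / n → ‖scaledTens f 2 cubTwo b X - t₀‖ ≤ ρ) →
      CubicFamily L ((‖Y‖⁻¹) ^ 4) ρ (C * ‖b‖ ^ 2 * ‖Y‖⁻¹ * (L / ‖Y‖) ^ 4) t₀
        fun s z => normDerivTwo b (ray Y b S s + lat f z)) := by
  obtain ⟨C, hC, key⟩ := exists_normDeriv_sub_jet f
  refine ⟨C * 2 * (2 * basisSize f) ^ 4, by have := basisSize_nonneg (f := f); positivity,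
    fun n L S b Y t₀ ρ hn hL hS hY hSb hSn hLY => ?_⟩
  have hY0 := norm_pos_iff.2 hY
  have hK := basisSize_nonneg (f := f)
  have hL' : (0 : ℝ) ≤ L := by exact_mod_cast hL
  have hinv : ∀ s, ‖ray Y b S s‖⁻¹ ≤ 2 * ‖Y‖⁻¹ := fun s => by
    have h1 := norm_pos_iff.2 (ray_ne_zero hS hY hSb s)
    rw [← div_eq_mul_inv, ← one_div, div_le_div_iff₀ h1 hY0]
    linarith [norm_le_two_mul_norm_ray hS hSb s]
  have hkey := fun s => key L (2 * basisSize f * (L / ‖Y‖)) b (ray Y b S s) hL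
    (ray_ne_zero hS hY hSb s) (by
      calc basisSize f * L * ‖ray Y b S s‖⁻¹ ≤ basisSize f * L * (2 * ‖Y‖⁻¹) := by
            gcongr; exact hinv s
        _ = _ := by ring) (by
      rw [mul_div_assoc', div_le_div_iff₀ hY0 (by norm_num)]
      linarith)
  have hq : (2 * basisSize f * (L / ‖Y‖)) ^ 4 = (2 * basisSize f) ^ 4 * (L / ‖Y‖) ^ 4 := by ring
  refine ⟨fun ht₀ => cubicKernel_cubOne.cubicFamily hn hS hY hSb hSn hLY ht₀
    (fun X hX => continuousAt_normDerivOne hX) (fun X z hX => continuousAt_jetOne hX z)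
    (fun X => hasCubic_jetOne b X) fun s => (hkey s).1.mono ?_,
    fun ht₀ => cubicKernel_cubTwo.cubicFamily hn hS hY hSb hSn hLY ht₀
    (fun X hX => continuousAt_normDerivTwo hX) (fun X z hX => continuousAt_jetSnd hX z)
    (fun X => hasCubic_jetSnd b X) fun s => (hkey s).2.mono ?_⟩
  · rw [hq]
    have : 0 ≤ C * ‖b‖ * ((2 * basisSize f) ^ 4 * (L / ‖Y‖) ^ 4) := by positivity
    linarith
  · rw [hq]
    calc C * ‖b‖ ^ 2 * ‖ray Y b S s‖⁻¹ * ((2 * basisSize f) ^ 4 * (L / ‖Y‖) ^ 4)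
        ≤ C * ‖b‖ ^ 2 * (2 * ‖Y‖⁻¹) * ((2 * basisSize f) ^ 4 * (L / ‖Y‖) ^ 4) := by
          gcongr; exact hinv s
      _ = _ := by ring

lemma hasDerivAt_norm_line {s : ℝ} {X : E3} (h : X + s • b ≠ 0) :
    HasDerivAt (fun s : ℝ => ‖X + s • b‖) (normDerivOne b (X + s • b)) s := by
  have h1 : HasDerivAt (fun s : ℝ => X + s • b) b s := by
    simpa using ((hasDerivAt_id s).smul_const b).const_add X
  have h2 := h1.norm_sq.sqrt (by simpa using h)
  simp only [Real.sqrt_sq (norm_nonneg _)] at h2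
  convert h2 using 1
  rw [normDerivOne, real_inner_comm]
  field_simp

lemma hasDerivAt_normDerivOne_line {s : ℝ} {X : E3} (h : X + s • b ≠ 0) :
    HasDerivAt (fun s : ℝ => normDerivOne b (X + s • b)) (normDerivTwo b (X + s • b)) s := by
  have h1 : HasDerivAt (fun s : ℝ => X + s • b) b s := by
    simpa using ((hasDerivAt_id s).smul_const b).const_add X
  have h0 : ‖X + s • b‖ ≠ 0 := norm_ne_zero_iff.2 h
  have h2 : HasDerivAt (fun s : ℝ => inner ℝ b (X + s • b)) (inner ℝ b b) s := by
    simpa using (hasDerivAt_const s b).inner ℝ h1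
  have h3 := h2.div (hasDerivAt_norm_line h) h0
  refine h3.congr_deriv ?_
  rw [normDerivTwo, normDerivOne, real_inner_self_eq_norm_sq]
  field_simp

lemma sub_eq_mul_intervalIntegral {φ φ' : ℝ → ℝ} {r s S : ℝ} (hs : 0 ≤ s) (hr : 0 ≤ r)
    (hrS : s + r ≤ S) (hφ : ∀ u, 0 ≤ u → u ≤ S → HasDerivAt φ (φ' u) u) (hc : Continuous φ') :
    φ (s + r) - φ s = r * ∫ t in (0:ℝ)..1, φ' (s + r * t) := by
  have h := intervalIntegral.integral_eq_sub_of_hasDerivAt (a := 0) (b := 1)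
    (f := fun t => φ (s + r * t)) (f' := fun t => r * φ' (s + r * t)) (fun t ht => ?_)
    (Continuous.intervalIntegrable (by fun_prop) _ _)
  · rw [← intervalIntegral.integral_const_mul, h]
    simp
  · rw [Set.uIcc_of_le zero_le_one] at ht
    have h1 : HasDerivAt (fun t : ℝ => s + r * t) r t := by
      simpa using ((hasDerivAt_id t).const_mul r).const_add s
    rw [mul_comm r]
    exact (hφ (s + r * t) (by nlinarith [mul_nonneg hr ht.1]) (by nlinarith [ht.2])).comp t h1

end Ray

lemma HasCubic.const_mul {P t} (h : HasCubic P t) (c : ℝ) :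
    HasCubic (fun z => c * P z) (c • t) := fun u k z => by
  have := h u k z
  simp only [Pi.smul_apply, smul_eq_mul, mul_assoc, ← Finset.mul_sum] at this ⊢
  rw [← this]
  ring

lemma sum_Ico_rpow_le (H : ℕ) :
    ∑ r ∈ Finset.Ico 1 H, ((r : ℝ) / H) ^ (-(3 / 4) : ℝ) ≤ 4 * H := by
  rcases Nat.eq_zero_or_pos H with rfl | hH
  · simp
  have hH' : (0 : ℝ) < H := by exact_mod_cast hH
  have key : ∀ n : ℕ, ∑ r ∈ Finset.Ico 1 (n + 1), (r : ℝ) ^ (-(3 / 4) : ℝ)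
      ≤ 4 * (n : ℝ) ^ (1 / 4 : ℝ) := by
    intro n
    induction n with
    | zero => simp
    | succ n ih =>
      rw [Finset.sum_Ico_succ_top (by omega)]
      refine (add_le_add_left ih _).trans ?_
      push_cast
      set a := (n : ℝ) ^ (1 / 4 : ℝ) with ha
      set c := ((n : ℝ) + 1) ^ (1 / 4 : ℝ) with hc
      have hn : (0 : ℝ) ≤ n := by positivity
      have ha0 : 0 ≤ a := by positivity
      have hc0 : 0 < c := by positivity
      have ha4 : a ^ 4 = n := by
        rw [ha, ← Real.rpow_natCast, ← Real.rpow_mul hn]; norm_num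
      have hc4 : c ^ 4 = n + 1 := by
        rw [hc, ← Real.rpow_natCast, ← Real.rpow_mul (by positivity)]; norm_num
      have hac : a ≤ c := by
        rw [ha, hc]; gcongr; linarith
      have h1 : ((n : ℝ) + 1) ^ (-(3 / 4) : ℝ) = (c ^ 3)⁻¹ := by
        rw [hc, ← Real.rpow_natCast, ← Real.rpow_mul (by positivity),
          ← Real.rpow_neg (by positivity)]
        norm_num
      rw [h1]
      have h2 : (c ^ 3)⁻¹ ≤ 4 * (c - a) := by
        rw [inv_le_iff_one_le_mul₀ (by positivity)]
        have h3 : c ^ 4 - a ^ 4 = 1 := by rw [ha4, hc4]; ring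
        have h4 : a ^ 3 ≤ c ^ 3 := by gcongr
        have h5 : a ^ 2 * c ≤ c ^ 2 * c := by gcongr
        have h6 : a * c ^ 2 ≤ c * c ^ 2 := by gcongr
        nlinarith [mul_nonneg (sub_nonneg.2 hac) (sub_nonneg.2 (add_le_add (add_le_add h4 h5) h6))]
      linarith
  have h1 := key (H - 1)
  rw [Nat.sub_add_cancel hH] at h1
  have h2 : ∀ r ∈ Finset.Ico 1 H, ((r : ℝ) / H) ^ (-(3 / 4) : ℝ)
      = (H : ℝ) ^ (3 / 4 : ℝ) * (r : ℝ) ^ (-(3 / 4) : ℝ) := fun r _ => by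
    rw [Real.div_rpow (by positivity) (by positivity), Real.rpow_neg hH'.le, div_inv_eq_mul,
      mul_comm]
  rw [Finset.sum_congr rfl h2, ← Finset.mul_sum]
  calc (H : ℝ) ^ (3 / 4 : ℝ) * _ ≤ (H : ℝ) ^ (3 / 4 : ℝ) * (4 * (H : ℝ) ^ (1 / 4 : ℝ)) := by
        gcongr
        refine h1.trans ?_
        gcongr
        exact_mod_cast Nat.sub_le _ _
    _ = 4 * (H : ℝ) ^ ((3 / 4 : ℝ) + 1 / 4) := by rw [Real.rpow_add hH']; ring
    _ = 4 * H := by norm_num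

lemma boxSup_expi_of_differences {P : (Fin 3 → ℤ) → ℝ} {L : ℤ} (hL : 1 ≤ L) (v : Fin 3 → ℤ)
    {H : ℕ} (hH : 1 ≤ H) (hv : ∀ k, H * |v k| ≤ L) {K : ℝ}
    (hK : ∀ r ∈ Finset.Ico 1 H, BoxSup L (fun z => expi (P (z + (r : ℤ) • v) - P z))
      (L ^ 3 * (K * ((r : ℝ) / H) ^ (-(3 / 4) : ℝ)))) (hK0 : 0 ≤ K) :
    BoxSup L (fun z => expi (P z)) (L ^ 3 * √(512 * (1 / H + K))) := by
  refine (boxSup_expi_vdC hL v hH hv hK).mono ?_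
  have hH' : (0 : ℝ) < H := by exact_mod_cast hH
  have hL' : (0 : ℝ) < L := by exact_mod_cast (by omega : 0 < L)
  rw [← Finset.mul_sum, ← Finset.mul_sum]
  have h1 : (L : ℝ) ^ 3 = √((L ^ 3) ^ 2) := (Real.sqrt_sq (by positivity)).symm
  conv_rhs => rw [h1, ← Real.sqrt_mul (by positivity)]
  apply Real.sqrt_le_sqrt
  rw [div_le_iff₀ hH']
  calc _ ≤ 64 * (L : ℝ) ^ 3 * (8 * (L : ℝ) ^ 3 + 2 * (L ^ 3 * (K * (4 * H)))) := by
        gcongr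
        exact sum_Ico_rpow_le H
    _ = _ := by field_simp; ring

/-- The bound for box sums of exponentials with nearly cubic phases, relative to `L ^ 3`. -/
noncomputable def cubicBound (C : ℝ) (L H : ℤ) (τ : ℝ) : ℝ :=
  Real.exp (2 * Real.pi) *
    √(C * (1 + Real.log L) ^ 3 * (1 / H ^ 3 + τ * √(τ + L) / (H * L * √(H * L))))

lemma cubicBound_nonneg {C : ℝ} {L H : ℤ} {τ : ℝ} : 0 ≤ cubicBound C L H τ := by
  unfold cubicBound; positivity

lemma cubicBound_div_le {C x τ : ℝ} {L H : ℤ} (hC : 0 ≤ C) (hL : 1 ≤ L) (hH : 1 ≤ H)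
    (hτ : 0 ≤ τ) (hx : 0 < x) (hx1 : x ≤ 1) :
    cubicBound C L H (τ / x) ≤ cubicBound C L H τ * x ^ (-(3 / 4) : ℝ) := by
  have hL' : (1 : ℝ) ≤ L := by exact_mod_cast hL
  have hH' : (1 : ℝ) ≤ H := by exact_mod_cast hH
  have hlog : 0 ≤ Real.log L := Real.log_nonneg hL'
  have h0 : x ^ (-(3 / 4) : ℝ) = √(x ^ (-(3 / 2) : ℝ)) := by
    rw [Real.sqrt_eq_rpow, ← Real.rpow_mul hx.le]; norm_num
  have h1 : x ^ (-(3 / 2) : ℝ) = x⁻¹ * √(x⁻¹) := by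
    rw [Real.sqrt_eq_rpow, ← Real.rpow_neg_one, ← Real.rpow_mul hx.le, ← Real.rpow_add hx]
    norm_num
  have hx2 : 1 ≤ x⁻¹ := (one_le_inv₀ hx).2 hx1
  unfold cubicBound
  rw [h0, mul_assoc (Real.exp _), ← Real.sqrt_mul (by positivity)]
  gcongr ?_ * √?_
  rw [mul_assoc (C * _), h1]
  gcongr
  rw [add_mul]
  have h2 : 1 ≤ x⁻¹ * √(x⁻¹) := one_le_mul_of_one_le_of_one_le hx2 (Real.one_le_sqrt.2 hx2)
  refine add_le_add (le_mul_of_one_le_right (by positivity) h2) ?_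
  have h3 : √(τ / x + L) ≤ √(τ + L) * √(x⁻¹) := by
    rw [← Real.sqrt_mul (by positivity)]
    apply Real.sqrt_le_sqrt
    rw [add_mul, div_eq_mul_inv]
    gcongr
    exact le_mul_of_one_le_right (by positivity) hx2
  calc τ / x * √(τ / x + L) / (H * L * √(H * L))
      ≤ τ / x * (√(τ + L) * √(x⁻¹)) / (H * L * √(H * L)) := by gcongr
    _ = _ := by rw [div_eq_mul_inv τ x]; ring

lemma exists_boxSup_of_cubicFamily (n : ℝ) (hn : 1 ≤ n) : ∃ C : ℝ, 1 ≤ C ∧ ∃ B : ℕ, 1 ≤ B ∧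
    ∀ (t₀ : Fin 3 → Fin 3 → Fin 3 → ℝ) (ρ : ℝ) (g : Fin 3 → ℤ), ‖g‖ ≤ n →
    (∀ t, ‖t - t₀‖ ≤ ρ → ‖t‖ ≤ n ∧ ∀ x, detDeriv t (castVec g) x ≤ -(1 / n) * ‖x‖ ^ 2) →
    ∀ (L H : ℤ) (Θ M μ x s : ℝ) (F : ℝ → (Fin 3 → ℤ) → ℝ), CubicFamily L Θ ρ M t₀ F →
    1 ≤ H → B * H ≤ L → 0 < Θ → 0 < μ → B * (μ * Θ) * H * L ≤ 1 → μ * M ≤ 1 → 0 < x → x ≤ 1 →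
    BoxSup L (fun z => expi (μ * x * F s z))
      (L ^ 3 * (cubicBound C L H (1 / (μ * Θ * L)) * x ^ (-(3 / 4) : ℝ))) := by
  obtain ⟨C, hC, B, hB, key⟩ := exists_boxSup_of_hasCubic n hn
  refine ⟨C, hC, B, hB, fun t₀ ρ g hg ht L H Θ M μ x s F hF hH hHL hΘ hμ hμL hμM hx hx1 => ?_⟩
  have hL : 1 ≤ L := by nlinarith
  have hL' : (1 : ℝ) ≤ L := by exact_mod_cast hL
  have hH' : (1 : ℝ) ≤ H := by exact_mod_cast hH
  obtain ⟨-, P, T, -, -, hPT, hTt, hM⟩ := hF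
  have ht' := ht (Θ⁻¹ • T s) (by
    have h1 : Θ⁻¹ • T s - t₀ = Θ⁻¹ • (T s - Θ • t₀) := by
      rw [smul_sub, smul_smul, inv_mul_cancel₀ hΘ.ne', one_smul]
    rw [h1, norm_smul, norm_inv, Real.norm_eq_abs, abs_of_pos hΘ, inv_mul_le_iff₀ hΘ]
    exact hTt s)
  have h2 : HasCubic (fun z => μ * x * P s z) ((μ * x * Θ) • (Θ⁻¹ • T s)) := by
    rw [smul_smul, mul_inv_cancel_right₀ hΘ.ne']
    exact (hPT s).const_mul _
  have h3 := key _ g ht'.1 hg ht'.2 _ _ L H h2 hH hHL (by positivity) (by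
    refine le_trans ?_ hμL
    have : μ * x * Θ ≤ μ * Θ := by
      rw [mul_right_comm]; exact mul_le_of_le_one_right (by positivity) hx1
    gcongr)
  have hM0 : 0 ≤ M := (norm_nonneg _).trans
    ((hM s).norm_le (fun _ => le_rfl) (fun _ => by simp; omega) (z := 0))
  have h4 := (((hM s).const_mul ((2 * Real.pi * (μ * x) : ℝ) * Complex.I)).exp).mono
    (show _ ≤ Real.exp (2 * Real.pi) by
      apply Real.exp_le_exp.2
      rw [norm_mul, Complex.norm_I, mul_one, Complex.norm_real, Real.norm_eq_abs,
        abs_of_nonneg (by positivity)]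
      have h5 : μ * x * M ≤ 1 := by
        refine le_trans ?_ hμM
        gcongr
        exact mul_le_of_le_one_right hμ.le hx1
      nlinarith [Real.pi_pos])
  refine ((h4 _ _ h3).congr (fun z _ _ => ?_)).mono ?_
  · rw [expi, expi, ← Complex.exp_add]
    congr 1
    push_cast
    ring
  · have h6 := cubicBound_div_le (τ := 1 / (μ * Θ * L)) (zero_le_one.trans hC) hL hH
      (by positivity) hx hx1
    refine le_trans (le_of_eq ?_) (mul_le_mul_of_nonneg_left h6 (by positivity))
    have h7 : 1 / (μ * Θ * L) / x = 1 / (μ * x * Θ * L) := by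
      rw [div_div]; congr 1; ring
    rw [h7, cubicBound, mul_left_comm]
    congr 1
    conv_rhs => rw [← Real.sqrt_sq (show (0:ℝ) ≤ L ^ 3 by positivity)]
    rw [← Real.sqrt_mul (by positivity)]
    congr 1
    ring

section
variable {f : Module.Basis (Fin 3) ℝ E3}

lemma lat_zsmul (r : ℤ) (b : Fin 3 → ℤ) : lat f (r • b) = (r : ℝ) • lat f b := by
  have : castVec (r • b) = (r : ℝ) • castVec b := by
    ext i; simp [castVec]
  rw [lat, this, emb_smul, lat]

lemma norm_lat_le_mul (b : Fin 3 → ℤ) : ‖lat f b‖ ≤ basisSize f * ‖b‖ := by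
  rw [lat, emb, basisSize, Finset.sum_mul]
  refine (norm_sum_le _ _).trans (Finset.sum_le_sum fun i _ => ?_)
  rw [norm_smul, mul_comm]
  gcongr
  simpa [castVec] using abs_intCast_le_norm b i

lemma exists_boxSup_norm_one (f : Module.Basis (Fin 3) ℝ E3) :
    ∃ C : ℝ, 1 ≤ C ∧ ∃ B : ℝ, 1 ≤ B ∧ ∀ (Y : E3) (lam : ℝ) (L H : ℤ) (H₁ : ℕ), Y ≠ 0 → 0 < lam →
    1 ≤ H → 1 ≤ H₁ → B * H ≤ L → B * H₁ ≤ L → B * L ≤ ‖Y‖ → B * (lam * H₁ * H * L) ≤ ‖Y‖ ^ 3 →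
    B * (lam * H₁ * L ^ 4) ≤ ‖Y‖ ^ 4 →
    BoxSup L (fun z => expi (lam * ‖Y + lat f z‖))
      (L ^ 3 * √(512 * (1 / H₁ + cubicBound C L H (‖Y‖ ^ 3 / (lam * H₁ * L))))) := by
  obtain ⟨n, hn, hgood⟩ := cubicKernel_cubOne.exists_goodNear f
  obtain ⟨C, hC, B, hB, hbox⟩ := exists_boxSup_of_cubicFamily n hn
  obtain ⟨C', hC', hfam⟩ := exists_cubicFamily f
  have hK := basisSize_nonneg (f := f)
  set K := basisSize f with hKdef
  refine ⟨C, hC, B + n + 2 * n * (K * n) + 12 * K + C' * (K * n), ?_, ?_⟩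
  · have : (1 : ℝ) ≤ B := by exact_mod_cast hB
    have : 0 ≤ n := by linarith
    have : 0 ≤ 2 * n * (K * n) + 12 * K + C' * (K * n) := by positivity
    linarith
  intro Y lam L H H₁ hY hlam hH hH₁ hHL hH₁L hLY hrem hrem'
  have hn0 : 0 < n := by linarith
  have hY0 := norm_pos_iff.2 hY
  have hH' : (1 : ℝ) ≤ H := by exact_mod_cast hH
  have hH₁' : (1 : ℝ) ≤ H₁ := by exact_mod_cast hH₁
  have hB' : (1 : ℝ) ≤ B := by exact_mod_cast hB
  have e1 : 0 ≤ 2 * n * (K * n) := by positivity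
  have e2 : 0 ≤ C' * (K * n) := by positivity
  have hL1 : (1 : ℝ) ≤ L := by
    refine le_trans ?_ hHL
    exact one_le_mul_of_one_le_of_one_le (by linarith) hH'
  have hL1' : 1 ≤ L := by exact_mod_cast hL1
  obtain ⟨b, g, hb, hg, t₀, ρ, ht1, ht2⟩ := hgood (‖Y‖⁻¹ • Y) (norm_smul_inv_norm hY)
  have hlb : ‖lat f b‖ ≤ K * n := by
    refine (norm_lat_le_mul b).trans ?_
    gcongr
  have hc1 : 2 * n * (H₁ * (K * n)) ≤ ‖Y‖ := by
    calc 2 * n * (H₁ * (K * n)) = (2 * n * (K * n)) * H₁ := by ring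
      _ ≤ (2 * n * (K * n)) * L := by
        gcongr
        exact le_trans (le_mul_of_one_le_left (by linarith) (by linarith)) hH₁L
      _ ≤ (B + n + 2 * n * (K * n) + 12 * K + C' * (K * n)) * L := by gcongr; linarith
      _ ≤ _ := hLY
  have hS : (0 : ℝ) ≤ H₁ := by linarith
  have hSn : 2 * n * (H₁ * ‖lat f b‖) ≤ ‖Y‖ := le_trans (by gcongr) hc1
  have hSb : 2 * (H₁ * ‖lat f b‖) ≤ ‖Y‖ := by
    refine le_trans ?_ hSn
    gcongr
    linarith
  have hLK : 12 * (K * L) ≤ ‖Y‖ := by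
    refine le_trans ?_ hLY
    rw [← mul_assoc]
    gcongr
    linarith
  have hF := (hfam n L H₁ (lat f b) Y t₀ ρ hn0 (by omega) hS hY hSb hSn hLK).1 ht1
  refine boxSup_expi_of_differences hL1' b hH₁ (fun k => ?_) (fun r hr => ?_) cubicBound_nonneg
  · have h1 : (|b k| : ℝ) ≤ n := by
      simpa using (abs_intCast_le_norm b k).trans hb
    have h2 : (H₁ : ℝ) * |(b k : ℝ)| ≤ L := by
      refine le_trans ?_ hH₁L
      rw [mul_comm]
      gcongr
      linarith
    exact_mod_cast h2
  · rw [Finset.mem_Ico] at hr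
    have hr1 : (1 : ℝ) ≤ r := by exact_mod_cast hr.1
    have hr2 : (r : ℝ) ≤ H₁ := by exact_mod_cast hr.2.le
    have h1 := hbox t₀ ρ g hg ht2 L H _ _ (lam * H₁) (r / H₁) 0 _ (hF.average r) hH
      (by have : (B : ℝ) * H ≤ L := le_trans (by gcongr; linarith) hHL
          exact_mod_cast this) (by positivity) (by positivity)
      (by
        calc (B : ℝ) * (lam * H₁ * ‖Y‖⁻¹ ^ 3) * H * L = B * (lam * H₁ * H * L) / ‖Y‖ ^ 3 := by
              field_simp
          _ ≤ 1 := by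
            rw [div_le_one (by positivity)]
            exact le_trans (by gcongr; linarith) hrem)
      (by
        calc lam * H₁ * (C' * ‖lat f b‖ * (L / ‖Y‖) ^ 4)
            ≤ lam * H₁ * (C' * (K * n) * (L / ‖Y‖) ^ 4) := by gcongr
          _ = C' * (K * n) * (lam * H₁ * L ^ 4) / ‖Y‖ ^ 4 := by field_simp
          _ ≤ 1 := by
            rw [div_le_one (by positivity)]
            exact le_trans (by gcongr; linarith) hrem')
      (by positivity) (by rw [div_le_one (by positivity)]; exact hr2)
    have h2 : 1 / (lam * H₁ * ‖Y‖⁻¹ ^ 3 * L) = ‖Y‖ ^ 3 / (lam * H₁ * L) := by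
      field_simp
    rw [h2] at h1
    refine h1.congr fun z h0 hz => ?_
    congr 1
    have h3 := sub_eq_mul_intervalIntegral (φ := fun u => ‖Y + u • lat f b + lat f z‖)
      (φ' := fun s => normDerivOne (lat f b) (ray Y (lat f b) H₁ s + lat f z)) (r := r) (s := 0)
      (S := H₁) le_rfl (by positivity) (by linarith) (fun u hu0 hu => ?_) (hF.1 z h0 hz)
    · simp only [zero_add, zero_smul, add_zero] at h3
      simp only [zero_add]
      rw [lat_add, lat_zsmul, ← mul_sub]
      have h4 : Y + (lat f z + ((r : ℤ) : ℝ) • lat f b) = Y + (r : ℝ) • lat f b + lat f z := by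
        push_cast; abel
      rw [h4, h3]
      field_simp
    · have h4 := ray_add_lat_ne_zero hS hY hSb hLK u h0 hz
      rw [ray_of_mem hu0 hu, add_right_comm] at h4
      have h5 := hasDerivAt_norm_line h4
      rw [ray_of_mem hu0 hu]
      simpa only [add_right_comm] using h5

lemma exists_boxSup_norm_two (f : Module.Basis (Fin 3) ℝ E3) :
    ∃ C : ℝ, 1 ≤ C ∧ ∃ B : ℝ, 1 ≤ B ∧ ∀ (Y : E3) (lam : ℝ) (L H : ℤ) (H₁ H₂ : ℕ), Y ≠ 0 →
    0 < lam → 1 ≤ H → 1 ≤ H₁ → 1 ≤ H₂ → B * H ≤ L → B * H₁ ≤ L → B * H₂ ≤ L → B * L ≤ ‖Y‖ →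
    B * (lam * (H₁ * H₂) * H * L) ≤ ‖Y‖ ^ 4 → B * (lam * (H₁ * H₂) * L ^ 4) ≤ ‖Y‖ ^ 5 →
    BoxSup L (fun z => expi (lam * ‖Y + lat f z‖))
      (L ^ 3 * √(512 * (1 / H₁ +
        √(512 * (1 / H₂ + cubicBound C L H (‖Y‖ ^ 4 / (lam * (H₁ * H₂) * L))))))) := by
  obtain ⟨n, hn, hgood⟩ := cubicKernel_cubTwo.exists_goodNear f
  obtain ⟨C, hC, B, hB, hbox⟩ := exists_boxSup_of_cubicFamily n hn
  obtain ⟨C', hC', hfam⟩ := exists_cubicFamily f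
  have hK := basisSize_nonneg (f := f)
  set K := basisSize f with hKdef
  refine ⟨C, hC, B + n + 2 * n * (2 * (K * n)) + 12 * K + C' * (K * n) ^ 2, ?_, ?_⟩
  · have : (1 : ℝ) ≤ B := by exact_mod_cast hB
    have : 0 ≤ n := by linarith
    have : 0 ≤ 2 * n * (2 * (K * n)) + 12 * K + C' * (K * n) ^ 2 := by positivity
    linarith
  intro Y lam L H H₁ H₂ hY hlam hH hH₁ hH₂ hHL hH₁L hH₂L hLY hrem hrem'
  have hn0 : 0 < n := by linarith
  have hY0 := norm_pos_iff.2 hY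
  have hH' : (1 : ℝ) ≤ H := by exact_mod_cast hH
  have hH₁' : (1 : ℝ) ≤ H₁ := by exact_mod_cast hH₁
  have hH₂' : (1 : ℝ) ≤ H₂ := by exact_mod_cast hH₂
  have hB' : (1 : ℝ) ≤ B := by exact_mod_cast hB
  have e1 : 0 ≤ 2 * n * (2 * (K * n)) := by positivity
  have e2 : 0 ≤ C' * (K * n) ^ 2 := by positivity
  have hL1 : (1 : ℝ) ≤ L := by
    refine le_trans ?_ hHL
    exact one_le_mul_of_one_le_of_one_le (by linarith) hH'
  have hL1' : 1 ≤ L := by exact_mod_cast hL1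
  obtain ⟨b, g, hb, hg, t₀, ρ, ht1, ht2⟩ := hgood (‖Y‖⁻¹ • Y) (norm_smul_inv_norm hY)
  have hlb : ‖lat f b‖ ≤ K * n := by
    refine (norm_lat_le_mul b).trans ?_
    gcongr
  have hH₁L' : (H₁ : ℝ) ≤ L :=
    le_trans (le_mul_of_one_le_left (by linarith) (by linarith)) hH₁L
  have hH₂L' : (H₂ : ℝ) ≤ L :=
    le_trans (le_mul_of_one_le_left (by linarith) (by linarith)) hH₂L
  have hS : (0 : ℝ) ≤ H₁ + H₂ := by linarith
  have hc1 : 2 * n * ((H₁ + H₂) * (K * n)) ≤ ‖Y‖ := by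
    calc 2 * n * ((H₁ + H₂) * (K * n)) ≤ 2 * n * ((L + L) * (K * n)) := by gcongr
      _ = (2 * n * (2 * (K * n))) * L := by ring
      _ ≤ (B + n + 2 * n * (2 * (K * n)) + 12 * K + C' * (K * n) ^ 2) * L := by gcongr; linarith
      _ ≤ _ := hLY
  have hSn : 2 * n * ((H₁ + H₂) * ‖lat f b‖) ≤ ‖Y‖ := le_trans (by gcongr) hc1
  have hSb : 2 * ((H₁ + H₂) * ‖lat f b‖) ≤ ‖Y‖ := by
    refine le_trans ?_ hSn
    gcongr
    linarith
  have hLK : 12 * (K * L) ≤ ‖Y‖ := by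
    refine le_trans ?_ hLY
    rw [← mul_assoc]
    gcongr
    linarith
  have hF := (hfam n L (H₁ + H₂) (lat f b) Y t₀ ρ hn0 (by omega) hS hY hSb hSn hLK).2 ht1
  have hbk : ∀ k, (|b k| : ℝ) ≤ n := fun k => by
    simpa using (abs_intCast_le_norm b k).trans hb
  have hbL : ∀ (h : ℕ), (B + n + 2 * n * (2 * (K * n)) + 12 * K + C' * (K * n) ^ 2) * h ≤ L →
      ∀ k, h * |b k| ≤ L := fun h hh k => by
    have h2 : (h : ℝ) * |(b k : ℝ)| ≤ L := by
      refine le_trans ?_ hh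
      rw [mul_comm]
      gcongr
      linarith [hbk k]
    exact_mod_cast h2
  set D := cubicBound C L H (‖Y‖ ^ 4 / (lam * (H₁ * H₂) * L)) with hD
  have hD0 : 0 ≤ D := cubicBound_nonneg
  refine boxSup_expi_of_differences hL1' b hH₁ (hbL _ hH₁L) (fun r hr => ?_) (by positivity)
  rw [Finset.mem_Ico] at hr
  have hr1 : (1 : ℝ) ≤ r := by exact_mod_cast hr.1
  have hr2 : (r : ℝ) ≤ H₁ := by exact_mod_cast hr.2.le
  set y := ((r : ℝ) / H₁) ^ (-(3 / 4) : ℝ) with hy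
  have hr0 : (0 : ℝ) < r / H₁ := by positivity
  have hy1 : 1 ≤ y :=
    Real.one_le_rpow_of_pos_of_le_one_of_nonpos hr0 ((div_le_one (by linarith)).2 hr2)
      (by norm_num)
  have hinner := boxSup_expi_of_differences (L := L) (K := D * y)
    (P := fun z => lam * ‖Y + lat f (z + (r : ℤ) • b)‖ - lam * ‖Y + lat f z‖) hL1' b hH₂
    (hbL _ hH₂L) (fun q hq => ?_) (by positivity)
  · refine hinner.mono ?_
    gcongr
    conv_rhs => rw [← Real.sqrt_sq (zero_le_one.trans hy1)]
    rw [← Real.sqrt_mul (by positivity)]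
    apply Real.sqrt_le_sqrt
    rw [mul_assoc]
    gcongr
    rw [add_mul]
    have h1 : y ≤ y ^ 2 := le_self_pow₀ hy1 two_ne_zero
    have h2 : 1 ≤ y ^ 2 := one_le_pow₀ hy1
    refine add_le_add (le_mul_of_one_le_right (by positivity) h2) (by gcongr)
  · rw [Finset.mem_Ico] at hq
    have hq1 : (1 : ℝ) ≤ q := by exact_mod_cast hq.1
    have hq2 : (q : ℝ) ≤ H₂ := by exact_mod_cast hq.2.le
    have hx : (r : ℝ) * q / (H₁ * H₂) = r / H₁ * (q / H₂) := by field_simp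
    have h1 := hbox t₀ ρ g hg ht2 L H _ _ (lam * (H₁ * H₂)) (r * q / (H₁ * H₂)) 0 _
      ((hF.average q).average r) hH
      (by have : (B : ℝ) * H ≤ L := le_trans (by gcongr; linarith) hHL
          exact_mod_cast this) (by positivity) (by positivity)
      (by
        calc (B : ℝ) * (lam * (H₁ * H₂) * ‖Y‖⁻¹ ^ 4) * H * L
            = B * (lam * (H₁ * H₂) * H * L) / ‖Y‖ ^ 4 := by field_simp
          _ ≤ 1 := by
            rw [div_le_one (by positivity)]
            exact le_trans (by gcongr; linarith) hrem)
      (by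
        calc lam * (H₁ * H₂) * (C' * ‖lat f b‖ ^ 2 * ‖Y‖⁻¹ * (L / ‖Y‖) ^ 4)
            ≤ lam * (H₁ * H₂) * (C' * (K * n) ^ 2 * ‖Y‖⁻¹ * (L / ‖Y‖) ^ 4) := by gcongr
          _ = C' * (K * n) ^ 2 * (lam * (H₁ * H₂) * L ^ 4) / ‖Y‖ ^ 5 := by field_simp
          _ ≤ 1 := by
            rw [div_le_one (by positivity)]
            exact le_trans (by gcongr; linarith) hrem')
      (by positivity) (by rw [div_le_one (by positivity)]; gcongr)
    have h2 : 1 / (lam * (H₁ * H₂) * ‖Y‖⁻¹ ^ 4 * L) = ‖Y‖ ^ 4 / (lam * (H₁ * H₂) * L) := by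
      field_simp
    rw [h2, hx, Real.mul_rpow (by positivity) (by positivity), ← hy, ← hD, ← mul_assoc D] at h1
    refine h1.congr fun z h0 hz => ?_
    congr 1
    set φ := fun u : ℝ => ‖Y + u • lat f b + lat f z‖ with hφ
    have hne : ∀ u : ℝ, 0 ≤ u → u ≤ H₁ + H₂ → Y + lat f z + u • lat f b ≠ 0 := fun u h0u hu => by
      have h4 := ray_add_lat_ne_zero hS hY hSb hLK u h0 hz
      rwa [ray_of_mem h0u hu, add_right_comm] at h4
    have hd1 : ∀ u : ℝ, 0 ≤ u → u ≤ H₁ + H₂ →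
        HasDerivAt φ (normDerivOne (lat f b) (Y + lat f z + u • lat f b)) u := fun u h0u hu => by
      simpa only [hφ, add_right_comm] using hasDerivAt_norm_line (hne u h0u hu)
    have hd2 : ∀ u : ℝ, 0 ≤ u → u ≤ H₁ →
        normDerivOne (lat f b) (Y + lat f z + (u + q) • lat f b)
          - normDerivOne (lat f b) (Y + lat f z + u • lat f b) = q * ∫ t in (0:ℝ)..1,
            normDerivTwo (lat f b) (ray Y (lat f b) (H₁ + H₂) (u + q * t) + lat f z) :=
      fun u h0u hu => sub_eq_mul_intervalIntegral
        (φ := fun u => normDerivOne (lat f b) (Y + lat f z + u • lat f b))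
        (φ' := fun s => normDerivTwo (lat f b) (ray Y (lat f b) (H₁ + H₂) s + lat f z))
        (S := H₁ + H₂) h0u (by positivity) (by linarith)
        (fun v hv0 hv => by
          rw [ray_of_mem hv0 hv, add_right_comm]
          exact hasDerivAt_normDerivOne_line (hne v hv0 hv)) (hF.1 z h0 hz)
    have h3 := sub_eq_mul_intervalIntegral (φ := fun u => φ (u + q) - φ u)
      (φ' := fun s => q * ∫ t in (0:ℝ)..1,
        normDerivTwo (lat f b) (ray Y (lat f b) (H₁ + H₂) (s + q * t) + lat f z)) (r := r) (s := 0)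
      (S := H₁) le_rfl (by positivity) (by linarith) (fun u hu0 hu => ?_)
      (continuous_const.mul ((hF.average q).1 z h0 hz))
    · have h4 : ∀ w : Fin 3 → ℤ, ∀ u : ℝ, lat f w = u • lat f b + lat f z →
          ‖Y + lat f w‖ = φ u := fun w u hw => by rw [hw, hφ, ← add_assoc]
      have e1 : lat f (z + (q : ℤ) • b + (r : ℤ) • b) = ((0 : ℝ) + r + q) • lat f b + lat f z := by
        rw [lat_add, lat_add, lat_zsmul, lat_zsmul]; push_cast; module
      have e2 : lat f (z + (q : ℤ) • b) = ((0 : ℝ) + q) • lat f b + lat f z := by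
        rw [lat_add, lat_zsmul]; push_cast; module
      have e3 : lat f (z + (r : ℤ) • b) = ((0 : ℝ) + r) • lat f b + lat f z := by
        rw [lat_add, lat_zsmul]; push_cast; module
      have e4 : lat f z = (0 : ℝ) • lat f b + lat f z := by module
      rw [h4 _ _ e1, h4 _ _ e2, h4 _ _ e3, h4 _ _ e4]
      simp only [intervalIntegral.integral_const_mul] at h3
      rw [← mul_sub, ← mul_sub, ← mul_sub, sub_sub_sub_comm, h3]
      field_simp
    · rw [← hd2 u hu0 hu]
      exact ((hd1 (u + q) (by positivity) (by linarith)).comp_add_const u q).sub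
        (hd1 u hu0 (by linarith))

end

lemma exists_log_pow_le_rpow (K : ℝ) {ε : ℝ} (hε : 0 < ε) : ∃ R₀ : ℝ, 1 ≤ R₀ ∧
    ∀ R, R₀ ≤ R → K * (1 + Real.log R) ^ 3 ≤ R ^ ε := by
  have h1 : (fun R : ℝ => K * (1 + Real.log R) ^ 3) =o[atTop] fun R => R ^ ε := by
    have h2 : (fun R : ℝ => 1 + Real.log R) =o[atTop] fun R => R ^ (ε / 3) := by
      refine Asymptotics.IsLittleO.add ?_ (isLittleO_log_rpow_atTop (by positivity))
      exact Asymptotics.isLittleO_const_left.2 (Or.inr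
        (tendsto_norm_atTop_atTop.comp (tendsto_rpow_atTop (by positivity))))
    refine ((h2.pow three_pos).const_mul_left K).congr' (EventuallyEq.refl _ _) ?_
    filter_upwards [eventually_ge_atTop 0] with R hR
    rw [← Real.rpow_natCast, ← Real.rpow_mul hR]
    norm_num
  obtain ⟨R₀, hR₀⟩ := eventually_atTop.1 (h1.bound one_pos)
  refine ⟨max 1 R₀, le_max_left _ _, fun R hR => ?_⟩
  have h3 := hR₀ R ((le_max_right _ _).trans hR)
  have hR1 : 0 < R := lt_of_lt_of_le one_pos ((le_max_left _ _).trans hR)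
  rw [one_mul, Real.norm_of_nonneg (Real.rpow_nonneg hR1.le ε)] at h3
  exact (le_abs_self _).trans h3

lemma half_le_floor {x : ℝ} (hx : 1 ≤ x) : x / 2 ≤ ⌊x⌋ := by
  have h1 := Int.sub_one_lt_floor x
  have h2 : (1 : ℝ) ≤ ⌊x⌋ := by exact_mod_cast Int.le_floor.2 (by exact_mod_cast hx)
  linarith

lemma half_le_natFloor {x : ℝ} (hx : 1 ≤ x) : x / 2 ≤ ⌊x⌋₊ := by
  have h1 := Nat.sub_one_lt_floor x
  have h2 : (1 : ℝ) ≤ ⌊x⌋₊ := by exact_mod_cast Nat.le_floor (by exact_mod_cast hx)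
  linarith

lemma cubicBound_le {C C₀ R l h ε ε₀ σ τ : ℝ} {L H : ℤ} (hC : 0 ≤ C) (hC₀ : 1 ≤ C₀) (hR : 1 ≤ R)
    (hlog : (1 + Real.log R) ^ 3 ≤ R ^ ε) (hL1 : 1 ≤ L) (hLR : L ≤ R) (hL : R ^ l / 2 ≤ L)
    (hH : R ^ h / 2 ≤ H) (hτ0 : 0 ≤ τ) (hτ : τ ≤ C₀ * R ^ (h + ε₀)) (h1 : 2 * σ + ε ≤ 3 * h)
    (h2 : 2 * σ + ε ≤ 3 / 2 * (l - ε₀)) (h3 : 2 * σ + ε ≤ l + h / 2 - ε₀) :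
    cubicBound C L H τ ≤ Real.exp (2 * Real.pi) * √(C * 32 * C₀ ^ 2) * R ^ (-σ) := by
  have hR0 : 0 < R := by linarith
  have hL1' : (1 : ℝ) ≤ L := by exact_mod_cast hL1
  have hL0 : (0 : ℝ) < L := by linarith
  have hH0 : (0 : ℝ) < H := lt_of_lt_of_le (by positivity) hH
  have hmono : ∀ {a b : ℝ}, a ≤ b → R ^ a ≤ R ^ b := fun h => Real.rpow_le_rpow_of_exponent_le hR h
  have e1 : 1 / (H : ℝ) ^ 3 ≤ 8 * R ^ (-(2 * σ + ε)) := by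
    calc 1 / (H : ℝ) ^ 3 ≤ 1 / (R ^ h / 2) ^ 3 := by gcongr
      _ = 8 * R ^ (-(3 * h)) := by
        rw [Real.rpow_neg hR0.le, mul_comm 3 h, Real.rpow_mul hR0.le]
        norm_num [Real.rpow_ofNat]
        field_simp
        norm_num
      _ ≤ _ := by gcongr 8 * ?_; exact hmono (by linarith)
  have e2 : τ * √τ / (H * L * √(H * L)) ≤ 8 * C₀ ^ 2 * R ^ (-(2 * σ + ε)) := by
    have hx : τ / (H * L) ≤ 4 * C₀ * R ^ (ε₀ - l) := by
      calc τ / (H * L) ≤ C₀ * R ^ (h + ε₀) / ((R ^ h / 2) * (R ^ l / 2)) := by gcongr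
        _ = _ := by
          rw [Real.rpow_add hR0, Real.rpow_sub hR0]; field_simp; norm_num
    have h4 : τ * √τ / (H * L * √(H * L)) = τ / (H * L) * √(τ / (H * L)) := by
      rw [Real.sqrt_div hτ0, div_mul_div_comm]
    rw [h4]
    calc _ ≤ 4 * C₀ * R ^ (ε₀ - l) * √(4 * C₀ * R ^ (ε₀ - l)) := by gcongr
      _ = 4 * C₀ * (2 * √C₀) * (R ^ (ε₀ - l) * R ^ ((ε₀ - l) / 2)) := by
        rw [Real.sqrt_mul (by positivity), Real.sqrt_mul (by positivity),
          show (4 : ℝ) = 2 ^ 2 by norm_num, Real.sqrt_sq (by norm_num),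
          Real.sqrt_eq_rpow (R ^ _), ← Real.rpow_mul hR0.le]
        ring_nf
      _ ≤ 4 * C₀ * (2 * C₀) * R ^ (-(2 * σ + ε)) := by
        rw [← Real.rpow_add hR0]
        gcongr
        · exact (Real.sqrt_le_left (by linarith)).2 (le_self_pow₀ hC₀ two_ne_zero)
        · linarith
      _ = _ := by ring
  have e3 : τ * √L / (H * L * √(H * L)) ≤ 8 * C₀ ^ 2 * R ^ (-(2 * σ + ε)) := by
    have h4 : τ * √L / (H * L * √(H * L)) = τ / (H * L * √H) := by
      rw [Real.sqrt_mul hH0.le]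
      have := (Real.sqrt_pos.2 hL0).ne'
      field_simp
    have h5 : R ^ (h / 2) / 2 ≤ √H := by
      apply Real.le_sqrt_of_sq_le
      refine le_trans ?_ hH
      rw [div_pow, ← Real.rpow_natCast, ← Real.rpow_mul hR0.le]
      norm_num
      have : 0 ≤ R ^ h := by positivity
      linarith
    rw [h4]
    calc _ ≤ C₀ * R ^ (h + ε₀) / ((R ^ h / 2) * (R ^ l / 2) * (R ^ (h / 2) / 2)) := by gcongr
      _ = 8 * C₀ * R ^ (ε₀ - l - h / 2) := by
        rw [Real.rpow_add hR0, Real.rpow_sub hR0, Real.rpow_sub hR0]; field_simp; norm_num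
      _ ≤ 8 * C₀ ^ 2 * R ^ (-(2 * σ + ε)) := by
        gcongr
        · exact le_self_pow₀ hC₀ two_ne_zero
        · linarith
  have e4 : 1 / (H : ℝ) ^ 3 + τ * √(τ + L) / (H * L * √(H * L))
      ≤ 32 * C₀ ^ 2 * R ^ (-(2 * σ + ε)) := by
    have h4 : τ * √(τ + L) / (H * L * √(H * L))
        ≤ τ * √τ / (H * L * √(H * L)) + τ * √L / (H * L * √(H * L)) := by
      rw [← add_div, ← mul_add]
      gcongr
      exact Real.sqrt_le_iff.2 ⟨by positivity, by
        nlinarith [Real.sq_sqrt hτ0, Real.sq_sqrt hL0.le,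
          mul_nonneg (Real.sqrt_nonneg τ) (Real.sqrt_nonneg (L : ℝ))]⟩
    have h5 : 1 ≤ C₀ ^ 2 := one_le_pow₀ hC₀
    have h6 : 0 ≤ R ^ (-(2 * σ + ε)) := by positivity
    nlinarith
  have hlogL : 0 ≤ 1 + Real.log L := by have := Real.log_nonneg hL1'; linarith
  rw [cubicBound, mul_assoc (Real.exp _)]
  gcongr ?_ * ?_
  have h7 : R ^ (-σ) = √(R ^ (-(2 * σ))) := by
    rw [Real.sqrt_eq_rpow, ← Real.rpow_mul hR0.le]; ring_nf
  rw [h7, ← Real.sqrt_mul (by positivity)]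
  apply Real.sqrt_le_sqrt
  calc _ ≤ C * R ^ ε * (32 * C₀ ^ 2 * R ^ (-(2 * σ + ε))) := by
        gcongr
        refine le_trans ?_ hlog
        gcongr
    _ = C * 32 * C₀ ^ 2 * (R ^ ε * R ^ (-(2 * σ + ε))) := by ring
    _ = _ := by rw [← Real.rpow_add hR0]; ring_nf

/-- If `R` is large, box sums of side length `L` have a power saving. -/
def HasSaving (f : Module.Basis (Fin 3) ℝ E3) (c₁ c₂ K₀ K R lam σ : ℝ) : Prop :=
  ∃ L : ℤ, 1 ≤ L ∧ K₀ * L ≤ R ∧ ∀ Y : E3, c₁ * R ≤ ‖Y‖ → ‖Y‖ ≤ c₂ * R →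
    BoxSup L (fun z => expi (lam * ‖Y + lat f z‖)) (L ^ 3 * (K * R ^ (-σ)))

set_option maxHeartbeats 1000000 in
lemma exists_hasSaving_of_exponents_one (f : Module.Basis (Fin 3) ℝ E3) {c₁ c₂ K₀ ε : ℝ}
    (hc₁ : 0 < c₁) (hc₂ : 1 ≤ c₂) (hK₀ : 1 ≤ K₀) (hε : 0 < ε) :
    ∃ K R₀ : ℝ, 0 ≤ K ∧ 1 ≤ R₀ ∧ ∀ R u l h h₁ ε₀ ρ : ℝ, R₀ ≤ R → 0 ≤ l → 0 ≤ h → 0 ≤ h₁ →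
      ε + h ≤ l → ε + h₁ ≤ l → ε + l ≤ 1 → ε + (u + h₁ + h + l) ≤ 3 → ε + (u + h₁ + l * 4) ≤ 4 →
      3 - u - h₁ - l ≤ h + ε₀ → 2 * (2 * ρ) + ε ≤ 3 * h → 2 * (2 * ρ) + ε ≤ 3 / 2 * (l - ε₀) →
      2 * (2 * ρ) + ε ≤ l + h / 2 - ε₀ → 2 * ρ ≤ h₁ → HasSaving f c₁ c₂ K₀ K R (R ^ u) ρ := by
  obtain ⟨C, hC, B, hB, key⟩ := exists_boxSup_norm_one f
  obtain ⟨A, hA⟩ : ∃ A, A = K₀ * (2 * B) * (1 + (c₁⁻¹) ^ 4 + c₁⁻¹ ^ 3 + c₁⁻¹) := ⟨_, rfl⟩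
  have hAB : 2 * B ≤ A ∧ B * c₁⁻¹ ^ 4 ≤ A ∧ B * c₁⁻¹ ^ 3 ≤ A ∧ B * c₁⁻¹ ≤ A ∧ K₀ ≤ A := by
    have h1 : 0 < c₁⁻¹ := inv_pos.2 hc₁
    have h3 : A = 2 * K₀ * B + 2 * K₀ * (B * c₁⁻¹ ^ 4) + 2 * K₀ * (B * c₁⁻¹ ^ 3)
      + 2 * K₀ * (B * c₁⁻¹) := by rw [hA]; ring
    have h4 : 0 < B * c₁⁻¹ ^ 4 := by positivity
    have h5 : 0 < B * c₁⁻¹ ^ 3 := by positivity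
    have h6 : 0 < B * c₁⁻¹ := by positivity
    refine ⟨?_, ?_, ?_, ?_, ?_⟩ <;> nlinarith
  obtain ⟨R₁, hR₁, hR₁'⟩ := exists_log_pow_le_rpow A hε
  have hC0 : (0 : ℝ) ≤ C := by linarith
  obtain ⟨K', hK'⟩ : ∃ K', K' = Real.exp (2 * Real.pi) * √(C * 32 * (4 * c₂ ^ 3) ^ 2) := ⟨_, rfl⟩
  have hK'0 : 0 ≤ K' := by rw [hK']; positivity
  refine ⟨√(512 * (2 + K')), R₁, by positivity, hR₁, fun R u l h h₁ ε₀ ρ hR hl hh hh₁ e1 e2 e3 e4 e5 e6 e7 e8 e9 e10 => ?_⟩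
  have hR1 : 1 ≤ R := hR₁.trans hR
  have hR0 : 0 < R := by linarith
  have hlog0 : 1 ≤ (1 + Real.log R) ^ 3 := one_le_pow₀ (by linarith [Real.log_nonneg hR1])
  have hA1 : 1 ≤ A := hK₀.trans hAB.2.2.2.2
  have hAR : A ≤ R ^ ε := by
    have := hR₁' R hR
    nlinarith
  have hlog : (1 + Real.log R) ^ 3 ≤ R ^ ε := by
    have := hR₁' R hR
    nlinarith
  have hone : ∀ {a : ℝ}, 0 ≤ a → 1 ≤ R ^ a := fun ha => Real.one_le_rpow hR1 ha
  have hmono : ∀ {a b : ℝ}, a ≤ b → R ^ a ≤ R ^ b := fun h => Real.rpow_le_rpow_of_exponent_le hR1 h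
  have hR' : R ^ (1 : ℝ) = R := Real.rpow_one R
  obtain ⟨L, hLdef⟩ : ∃ L : ℤ, L = ⌊R ^ l⌋ := ⟨_, rfl⟩
  obtain ⟨H, hHdef⟩ : ∃ H : ℤ, H = ⌊R ^ h⌋ := ⟨_, rfl⟩
  obtain ⟨H₁, hH₁def⟩ : ∃ H₁ : ℕ, H₁ = ⌊R ^ h₁⌋₊ := ⟨_, rfl⟩
  have hLl := half_le_floor (hone hl)
  have hHl := half_le_floor (hone hh)
  have hH₁l := half_le_natFloor (hone hh₁)
  rw [← hLdef] at hLl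
  rw [← hHdef] at hHl
  rw [← hH₁def] at hH₁l
  have hLu : (L : ℝ) ≤ R ^ l := hLdef ▸ Int.floor_le _
  have hHu : (H : ℝ) ≤ R ^ h := hHdef ▸ Int.floor_le _
  have hH₁u : (H₁ : ℝ) ≤ R ^ h₁ := hH₁def ▸ Nat.floor_le (by positivity)
  have hL1 : 1 ≤ L := by
    rw [hLdef]
    exact Int.le_floor.2 (by exact_mod_cast hone hl)
  have hH1 : 1 ≤ H := by
    rw [hHdef]
    exact Int.le_floor.2 (by exact_mod_cast hone hh)
  have hH₁1 : 1 ≤ H₁ := by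
    rw [hH₁def]
    exact Nat.le_floor (by exact_mod_cast hone hh₁)
  have hL0 : (0 : ℝ) < L := by exact_mod_cast (by omega : 0 < L)
  have hH0 : (0 : ℝ) < H := by exact_mod_cast (by omega : 0 < H)
  have hH₁0 : (0 : ℝ) < H₁ := by exact_mod_cast (by omega : 0 < H₁)
  have hsmall : ∀ {a b : ℝ}, ε + a ≤ b → A * R ^ a ≤ R ^ b := fun {a b} hab => by
    calc A * R ^ a ≤ R ^ ε * R ^ a := by gcongr
      _ = R ^ (ε + a) := (Real.rpow_add hR0 _ _).symm
      _ ≤ _ := hmono hab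
  refine ⟨L, hL1, ?_, fun Y hY1 hY2 => ?_⟩
  · calc K₀ * L ≤ A * R ^ l := by gcongr; exact hAB.2.2.2.2
      _ ≤ R ^ (1 : ℝ) := hsmall (by linarith)
      _ = R := hR'
  have hY0 : 0 < ‖Y‖ := lt_of_lt_of_le (by positivity) hY1
  have hRY : R ≤ c₁⁻¹ * ‖Y‖ := by rwa [le_inv_mul_iff₀ hc₁]
  have hBL : ∀ {x a : ℝ}, x ≤ R ^ a → ε + a ≤ l → 0 ≤ x → B * x ≤ L :=
    fun {x a} hx ha hx0 => by
      have h1 : 2 * B * x ≤ R ^ l := (mul_le_mul hAB.1 hx hx0 (by linarith)).trans (hsmall ha)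
      linarith
  have hres := key Y (R ^ u) L H H₁ (norm_pos_iff.1 hY0) (by positivity) hH1 hH₁1
    (hBL hHu (by linarith) hH0.le) (hBL hH₁u (by linarith) hH₁0.le) ?_ ?_ ?_
  · refine hres.mono ?_
    gcongr
    have hcub := cubicBound_le (C := C) (C₀ := 4 * c₂ ^ 3) (R := R) (l := l) (h := h) (ε := ε)
      (ε₀ := ε₀) (σ := 2 * ρ) (τ := ‖Y‖ ^ 3 / (R ^ u * H₁ * L)) (L := L) (H := H) hC0
      (by nlinarith [one_le_pow₀ hc₂ (n := 3)]) hR1 hlog hL1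
      (hLu.trans ((hmono (by linarith)).trans hR'.le)) hLl hHl (by positivity) ?_ (by linarith)
      (by linarith) (by linarith)
    · rw [← hK'] at hcub
      have h1 : R ^ (-ρ) = √(R ^ (-(2 * ρ))) := by
        rw [Real.sqrt_eq_rpow, ← Real.rpow_mul hR0.le]; ring_nf
      rw [h1, ← Real.sqrt_mul (by positivity)]
      apply Real.sqrt_le_sqrt
      rw [mul_assoc (512 : ℝ)]
      gcongr
      rw [add_mul]
      refine add_le_add ?_ hcub
      calc 1 / (H₁ : ℝ) ≤ 1 / (R ^ h₁ / 2) := by gcongr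
        _ = 2 * R ^ (-h₁) := by rw [Real.rpow_neg hR0.le]; field_simp
        _ ≤ _ := by gcongr 2 * ?_; exact hmono (by linarith)
    · calc ‖Y‖ ^ 3 / (R ^ u * H₁ * L) ≤ (c₂ * R) ^ 3 / (R ^ u * (R ^ h₁ / 2) * (R ^ l / 2)) := by
            gcongr
        _ = 4 * c₂ ^ 3 * R ^ (3 - u - h₁ - l) := by
          rw [Real.rpow_sub hR0, Real.rpow_sub hR0, Real.rpow_sub hR0, Real.rpow_ofNat]
          field_simp
          norm_num
        _ ≤ _ := by gcongr 4 * c₂ ^ 3 * ?_; exact hmono (by linarith)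
  · calc B * L ≤ B * R ^ l := by gcongr
      _ ≤ B * R ^ l * (c₁⁻¹ * ‖Y‖ / R) :=
        le_mul_of_one_le_right (by positivity) ((one_le_div hR0).2 hRY)
      _ = B * c₁⁻¹ * R ^ l * (‖Y‖ / R) := by ring
      _ ≤ A * R ^ l * (‖Y‖ / R) := by gcongr; exact hAB.2.2.2.1
      _ ≤ R ^ (1 : ℝ) * (‖Y‖ / R) := by gcongr; exact hsmall (by linarith)
      _ = ‖Y‖ := by rw [hR']; field_simp
  · calc B * (R ^ u * H₁ * H * L) ≤ B * (R ^ u * R ^ h₁ * R ^ h * R ^ l) := by gcongr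
      _ = B * R ^ (u + h₁ + h + l) := by rw [← Real.rpow_add hR0, ← Real.rpow_add hR0, ← Real.rpow_add hR0]
      _ ≤ B * R ^ (u + h₁ + h + l) * (c₁⁻¹ * ‖Y‖ / R) ^ 3 :=
        le_mul_of_one_le_right (by positivity) (one_le_pow₀ ((one_le_div hR0).2 hRY))
      _ = B * c₁⁻¹ ^ 3 * R ^ (u + h₁ + h + l) * (‖Y‖ / R) ^ 3 := by ring
      _ ≤ A * R ^ (u + h₁ + h + l) * (‖Y‖ / R) ^ 3 := by gcongr; exact hAB.2.2.1
      _ ≤ R ^ (3 : ℝ) * (‖Y‖ / R) ^ 3 := by gcongr; exact hsmall (by linarith)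
      _ = ‖Y‖ ^ 3 := by rw [Real.rpow_ofNat]; field_simp
  · calc B * (R ^ u * H₁ * L ^ 4) ≤ B * (R ^ u * R ^ h₁ * (R ^ l) ^ 4) := by gcongr
      _ = B * R ^ (u + h₁ + l * 4) := by
        rw [Real.rpow_add hR0, Real.rpow_add hR0, Real.rpow_mul hR0.le, Real.rpow_ofNat]
      _ ≤ B * R ^ (u + h₁ + l * 4) * (c₁⁻¹ * ‖Y‖ / R) ^ 4 :=
        le_mul_of_one_le_right (by positivity) (one_le_pow₀ ((one_le_div hR0).2 hRY))
      _ = B * c₁⁻¹ ^ 4 * R ^ (u + h₁ + l * 4) * (‖Y‖ / R) ^ 4 := by ring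
      _ ≤ A * R ^ (u + h₁ + l * 4) * (‖Y‖ / R) ^ 4 := by gcongr; exact hAB.2.1
      _ ≤ R ^ (4 : ℝ) * (‖Y‖ / R) ^ 4 := by gcongr; exact hsmall (by linarith)
      _ = ‖Y‖ ^ 4 := by rw [Real.rpow_ofNat]; field_simp

set_option maxHeartbeats 1000000 in
lemma exists_hasSaving_of_exponents_two (f : Module.Basis (Fin 3) ℝ E3) {c₁ c₂ K₀ ε : ℝ}
    (hc₁ : 0 < c₁) (hc₂ : 1 ≤ c₂) (hK₀ : 1 ≤ K₀) (hε : 0 < ε) :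
    ∃ K R₀ : ℝ, 0 ≤ K ∧ 1 ≤ R₀ ∧ ∀ R u l h h₁ h₂ ε₀ ρ : ℝ, R₀ ≤ R → 0 ≤ l → 0 ≤ h → 0 ≤ h₁ → 0 ≤ h₂ →
      ε + h ≤ l → ε + h₁ ≤ l → ε + h₂ ≤ l → ε + l ≤ 1 → ε + (u + (h₁ + h₂) + h + l) ≤ 4 →
      ε + (u + (h₁ + h₂) + l * 4) ≤ 5 →
      4 - u - (h₁ + h₂) - l ≤ h + ε₀ → 2 * (4 * ρ) + ε ≤ 3 * h → 2 * (4 * ρ) + ε ≤ 3 / 2 * (l - ε₀) →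
      2 * (4 * ρ) + ε ≤ l + h / 2 - ε₀ → 2 * ρ ≤ h₁ → 4 * ρ ≤ h₂ → HasSaving f c₁ c₂ K₀ K R (R ^ u) ρ := by
  obtain ⟨C, hC, B, hB, key⟩ := exists_boxSup_norm_two f
  obtain ⟨A, hA⟩ : ∃ A, A = K₀ * (2 * B) * (1 + (c₁⁻¹) ^ 5 + c₁⁻¹ ^ 4 + c₁⁻¹) := ⟨_, rfl⟩
  have hAB : 2 * B ≤ A ∧ B * c₁⁻¹ ^ 5 ≤ A ∧ B * c₁⁻¹ ^ 4 ≤ A ∧ B * c₁⁻¹ ≤ A ∧ K₀ ≤ A := by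
    have h1 : 0 < c₁⁻¹ := inv_pos.2 hc₁
    have h3 : A = 2 * K₀ * B + 2 * K₀ * (B * c₁⁻¹ ^ 5) + 2 * K₀ * (B * c₁⁻¹ ^ 4)
      + 2 * K₀ * (B * c₁⁻¹) := by rw [hA]; ring
    have h4 : 0 < B * c₁⁻¹ ^ 5 := by positivity
    have h5 : 0 < B * c₁⁻¹ ^ 4 := by positivity
    have h6 : 0 < B * c₁⁻¹ := by positivity
    refine ⟨?_, ?_, ?_, ?_, ?_⟩ <;> nlinarith
  obtain ⟨R₁, hR₁, hR₁'⟩ := exists_log_pow_le_rpow A hε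
  have hC0 : (0 : ℝ) ≤ C := by linarith
  obtain ⟨K', hK'⟩ : ∃ K', K' = Real.exp (2 * Real.pi) * √(C * 32 * (8 * c₂ ^ 4) ^ 2) := ⟨_, rfl⟩
  have hK'0 : 0 ≤ K' := by rw [hK']; positivity
  refine ⟨√(512 * (2 + √(512 * (2 + K')))), R₁, by positivity, hR₁, fun R u l h h₁ h₂ ε₀ ρ hR hl hh hh₁ hh₂ e1 e2 e2' e3 e4 e5 e6 e7 e8 e9 e10
    e11 => ?_⟩
  have hR1 : 1 ≤ R := hR₁.trans hR
  have hR0 : 0 < R := by linarith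
  have hlog0 : 1 ≤ (1 + Real.log R) ^ 3 := one_le_pow₀ (by linarith [Real.log_nonneg hR1])
  have hA1 : 1 ≤ A := hK₀.trans hAB.2.2.2.2
  have hAR : A ≤ R ^ ε := by
    have := hR₁' R hR
    nlinarith
  have hlog : (1 + Real.log R) ^ 3 ≤ R ^ ε := by
    have := hR₁' R hR
    nlinarith
  have hone : ∀ {a : ℝ}, 0 ≤ a → 1 ≤ R ^ a := fun ha => Real.one_le_rpow hR1 ha
  have hmono : ∀ {a b : ℝ}, a ≤ b → R ^ a ≤ R ^ b := fun h => Real.rpow_le_rpow_of_exponent_le hR1 h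
  have hR' : R ^ (1 : ℝ) = R := Real.rpow_one R
  obtain ⟨L, hLdef⟩ : ∃ L : ℤ, L = ⌊R ^ l⌋ := ⟨_, rfl⟩
  obtain ⟨H, hHdef⟩ : ∃ H : ℤ, H = ⌊R ^ h⌋ := ⟨_, rfl⟩
  obtain ⟨H₁, hH₁def⟩ : ∃ H₁ : ℕ, H₁ = ⌊R ^ h₁⌋₊ := ⟨_, rfl⟩
  obtain ⟨H₂, hH₂def⟩ : ∃ H₂ : ℕ, H₂ = ⌊R ^ h₂⌋₊ := ⟨_, rfl⟩
  have hLl := half_le_floor (hone hl)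
  have hHl := half_le_floor (hone hh)
  have hH₁l := half_le_natFloor (hone hh₁)
  have hH₂l := half_le_natFloor (hone hh₂)
  rw [← hLdef] at hLl
  rw [← hHdef] at hHl
  rw [← hH₁def] at hH₁l
  rw [← hH₂def] at hH₂l
  have hLu : (L : ℝ) ≤ R ^ l := hLdef ▸ Int.floor_le _
  have hHu : (H : ℝ) ≤ R ^ h := hHdef ▸ Int.floor_le _
  have hH₁u : (H₁ : ℝ) ≤ R ^ h₁ := hH₁def ▸ Nat.floor_le (by positivity)
  have hH₂u : (H₂ : ℝ) ≤ R ^ h₂ := hH₂def ▸ Nat.floor_le (by positivity)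
  have hL1 : 1 ≤ L := by
    rw [hLdef]
    exact Int.le_floor.2 (by exact_mod_cast hone hl)
  have hH1 : 1 ≤ H := by
    rw [hHdef]
    exact Int.le_floor.2 (by exact_mod_cast hone hh)
  have hH₁1 : 1 ≤ H₁ := by
    rw [hH₁def]
    exact Nat.le_floor (by exact_mod_cast hone hh₁)
  have hH₂1 : 1 ≤ H₂ := by
    rw [hH₂def]
    exact Nat.le_floor (by exact_mod_cast hone hh₂)
  have hL0 : (0 : ℝ) < L := by exact_mod_cast (by omega : 0 < L)
  have hH0 : (0 : ℝ) < H := by exact_mod_cast (by omega : 0 < H)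
  have hH₁0 : (0 : ℝ) < H₁ := by exact_mod_cast (by omega : 0 < H₁)
  have hH₂0 : (0 : ℝ) < H₂ := by exact_mod_cast (by omega : 0 < H₂)
  have hsmall : ∀ {a b : ℝ}, ε + a ≤ b → A * R ^ a ≤ R ^ b := fun {a b} hab => by
    calc A * R ^ a ≤ R ^ ε * R ^ a := by gcongr
      _ = R ^ (ε + a) := (Real.rpow_add hR0 _ _).symm
      _ ≤ _ := hmono hab
  refine ⟨L, hL1, ?_, fun Y hY1 hY2 => ?_⟩
  · calc K₀ * L ≤ A * R ^ l := by gcongr; exact hAB.2.2.2.2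
      _ ≤ R ^ (1 : ℝ) := hsmall (by linarith)
      _ = R := hR'
  have hY0 : 0 < ‖Y‖ := lt_of_lt_of_le (by positivity) hY1
  have hRY : R ≤ c₁⁻¹ * ‖Y‖ := by rwa [le_inv_mul_iff₀ hc₁]
  have hBL : ∀ {x a : ℝ}, x ≤ R ^ a → ε + a ≤ l → 0 ≤ x → B * x ≤ L :=
    fun {x a} hx ha hx0 => by
      have h1 : 2 * B * x ≤ R ^ l := (mul_le_mul hAB.1 hx hx0 (by linarith)).trans (hsmall ha)
      linarith
  have hres := key Y (R ^ u) L H H₁ H₂ (norm_pos_iff.1 hY0) (by positivity) hH1 hH₁1 hH₂1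
    (hBL hHu (by linarith) hH0.le) (hBL hH₁u (by linarith) hH₁0.le) (hBL hH₂u (by linarith) hH₂0.le) ?_ ?_ ?_
  · refine hres.mono ?_
    gcongr
    have hcub := cubicBound_le (C := C) (C₀ := 8 * c₂ ^ 4) (R := R) (l := l) (h := h) (ε := ε)
      (ε₀ := ε₀) (σ := 4 * ρ) (τ := ‖Y‖ ^ 4 / (R ^ u * (H₁ * H₂) * L)) (L := L) (H := H) hC0
      (by nlinarith [one_le_pow₀ hc₂ (n := 4)]) hR1 hlog hL1
      (hLu.trans ((hmono (by linarith)).trans hR'.le)) hLl hHl (by positivity) ?_ (by linarith)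
      (by linarith) (by linarith)
    · rw [← hK'] at hcub
      have hsq : ∀ {H' : ℕ} {h' x M σ : ℝ}, R ^ h' / 2 ≤ H' → x ≤ M * R ^ (-(2 * σ)) → 2 * σ ≤ h' →
          √(512 * (1 / (H' : ℝ) + x)) ≤ √(512 * (2 + M)) * R ^ (-σ) := by
        intro H' h' x M σ hH' hx hσ
        have h1 : R ^ (-σ) = √(R ^ (-(2 * σ))) := by
          rw [Real.sqrt_eq_rpow, ← Real.rpow_mul hR0.le]; ring_nf
        rw [h1, ← Real.sqrt_mul' _ (by positivity)]
        apply Real.sqrt_le_sqrt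
        rw [mul_assoc (512 : ℝ)]
        gcongr
        rw [add_mul]
        refine add_le_add ?_ hx
        calc 1 / (H' : ℝ) ≤ 1 / (R ^ h' / 2) := by gcongr
          _ = 2 * R ^ (-h') := by rw [Real.rpow_neg hR0.le]; field_simp
          _ ≤ _ := by gcongr 2 * ?_; exact hmono (by linarith)
      refine hsq hH₁l (hsq (σ := 2 * ρ) hH₂l (hcub.trans_eq ?_) (by linarith)) e10
      ring_nf
    · calc ‖Y‖ ^ 4 / (R ^ u * (H₁ * H₂) * L)
          ≤ (c₂ * R) ^ 4 / (R ^ u * (R ^ h₁ / 2 * (R ^ h₂ / 2)) * (R ^ l / 2)) := by gcongr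
        _ = 8 * c₂ ^ 4 * R ^ (4 - u - (h₁ + h₂) - l) := by
          rw [Real.rpow_sub hR0, Real.rpow_sub hR0, Real.rpow_sub hR0, Real.rpow_add hR0,
            Real.rpow_ofNat]
          field_simp
          norm_num
        _ ≤ _ := by gcongr 8 * c₂ ^ 4 * ?_; exact hmono (by linarith)
  · calc B * L ≤ B * R ^ l := by gcongr
      _ ≤ B * R ^ l * (c₁⁻¹ * ‖Y‖ / R) :=
        le_mul_of_one_le_right (by positivity) ((one_le_div hR0).2 hRY)
      _ = B * c₁⁻¹ * R ^ l * (‖Y‖ / R) := by ring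
      _ ≤ A * R ^ l * (‖Y‖ / R) := by gcongr; exact hAB.2.2.2.1
      _ ≤ R ^ (1 : ℝ) * (‖Y‖ / R) := by gcongr; exact hsmall (by linarith)
      _ = ‖Y‖ := by rw [hR']; field_simp
  · calc B * (R ^ u * (H₁ * H₂) * H * L)
        ≤ B * (R ^ u * (R ^ h₁ * R ^ h₂) * R ^ h * R ^ l) := by gcongr
      _ = B * R ^ (u + (h₁ + h₂) + h + l) := by
        rw [← Real.rpow_add hR0, ← Real.rpow_add hR0, ← Real.rpow_add hR0, ← Real.rpow_add hR0]
      _ ≤ B * R ^ (u + (h₁ + h₂) + h + l) * (c₁⁻¹ * ‖Y‖ / R) ^ 4 :=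
        le_mul_of_one_le_right (by positivity) (one_le_pow₀ ((one_le_div hR0).2 hRY))
      _ = B * c₁⁻¹ ^ 4 * R ^ (u + (h₁ + h₂) + h + l) * (‖Y‖ / R) ^ 4 := by ring
      _ ≤ A * R ^ (u + (h₁ + h₂) + h + l) * (‖Y‖ / R) ^ 4 := by gcongr; exact hAB.2.2.1
      _ ≤ R ^ (4 : ℝ) * (‖Y‖ / R) ^ 4 := by gcongr; exact hsmall (by linarith)
      _ = ‖Y‖ ^ 4 := by rw [Real.rpow_ofNat]; field_simp
  · calc B * (R ^ u * (H₁ * H₂) * L ^ 4) ≤ B * (R ^ u * (R ^ h₁ * R ^ h₂) * (R ^ l) ^ 4) := by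
          gcongr
      _ = B * R ^ (u + (h₁ + h₂) + l * 4) := by
        rw [Real.rpow_add hR0, Real.rpow_add hR0, Real.rpow_add hR0, Real.rpow_mul hR0.le,
          Real.rpow_ofNat]
      _ ≤ B * R ^ (u + (h₁ + h₂) + l * 4) * (c₁⁻¹ * ‖Y‖ / R) ^ 5 :=
        le_mul_of_one_le_right (by positivity) (one_le_pow₀ ((one_le_div hR0).2 hRY))
      _ = B * c₁⁻¹ ^ 5 * R ^ (u + (h₁ + h₂) + l * 4) * (‖Y‖ / R) ^ 5 := by ring
      _ ≤ A * R ^ (u + (h₁ + h₂) + l * 4) * (‖Y‖ / R) ^ 5 := by gcongr; exact hAB.2.1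
      _ ≤ R ^ (5 : ℝ) * (‖Y‖ / R) ^ 5 := by gcongr; exact hsmall (by linarith)
      _ = ‖Y‖ ^ 5 := by rw [Real.rpow_ofNat]; field_simp

/-- For `R ^ 1.85 ≤ lam ≤ R ^ 3.34` the box sums save a factor `(lam ^ 9 * R ^ (-30)) ^ (1 / 94)`. -/
lemma exists_hasSaving (f : Module.Basis (Fin 3) ℝ E3) {c₁ c₂ K₀ : ℝ} (hc₁ : 0 < c₁)
    (hc₂ : 1 ≤ c₂) (hK₀ : 1 ≤ K₀) : ∃ K R₀ : ℝ, 0 ≤ K ∧ 1 ≤ R₀ ∧ ∀ R u : ℝ, R₀ ≤ R →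
      185 / 100 ≤ u → u ≤ 334 / 100 →
      HasSaving f c₁ c₂ K₀ K R (R ^ u) ((30 - 9 * u) / 94) := by
  obtain ⟨K, R₀, hK, hR₀, h⟩ :=
    exists_hasSaving_of_exponents_one f (ε := 1 / 1000) hc₁ hc₂ hK₀ (by norm_num)
  obtain ⟨K', R₀', hK', hR₀', h'⟩ :=
    exists_hasSaving_of_exponents_two f (ε := 1 / 1000) hc₁ hc₂ hK₀ (by norm_num)
  refine ⟨max K K', max R₀ R₀', le_max_of_le_left hK, le_max_of_le_left hR₀,
    fun R u hR hu1 hu2 => ?_⟩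
  have hR1 : 0 ≤ R := by linarith [le_max_left R₀ R₀']
  rcases le_total u (238 / 100) with hu | hu
  · obtain ⟨t, ht⟩ : ∃ t, t = (u - 185 / 100) / (53 / 100) := ⟨_, rfl⟩
    obtain ⟨L, h1, h2, h3⟩ := h R u (43 / 100 - 12 / 100 * t) (42 / 100 - 295 / 1000 * t)
      (29 / 100 - 107 / 1000 * t) (11 / 1000 - 8 / 1000 * t) ((30 - 9 * u) / 94)
      ((le_max_left _ _).trans hR) (by linarith) (by linarith) (by linarith) (by linarith)
      (by linarith) (by linarith) (by linarith) (by linarith) (by linarith) (by linarith)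
      (by linarith) (by linarith) (by linarith)
    refine ⟨L, h1, h2, fun Y hY1 hY2 => (h3 Y hY1 hY2).mono ?_⟩
    have : (0 : ℝ) ≤ L := by exact_mod_cast (by omega : 0 ≤ L)
    gcongr
    exact le_max_left _ _
  · obtain ⟨t, ht⟩ : ∃ t, t = (u - 238 / 100) / (96 / 100) := ⟨_, rfl⟩
    obtain ⟨L, h1, h2, h3⟩ := h' R u (492 / 1000 - 282 / 1000 * t) (488 / 1000 - 288 / 1000 * t)
      (198 / 1000 - 118 / 1000 * t) (440 / 1000 - 280 / 1000 * t) (2 / 1000 + 8 / 1000 * t)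
      ((30 - 9 * u) / 94)
      ((le_max_right _ _).trans hR) (by linarith) (by linarith) (by linarith) (by linarith)
      (by linarith) (by linarith) (by linarith) (by linarith) (by linarith) (by linarith)
      (by linarith) (by linarith) (by linarith) (by linarith) (by linarith) (by linarith)
    refine ⟨L, h1, h2, fun Y hY1 hY2 => (h3 Y hY1 hY2).mono ?_⟩
    have : (0 : ℝ) ≤ L := by exact_mod_cast (by omega : 0 ≤ L)
    gcongr
    exact le_max_right _ _

/-- The amplitude of the kernel is a bounded multiplier on short boxes. -/
lemma exists_boxMul_amplitude (f : Module.Basis (Fin 3) ℝ E3) : ∃ C B : ℝ, 1 ≤ C ∧ 1 ≤ B ∧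
    ∀ (L : ℤ) (δ : ℝ) (Y : E3), 0 ≤ L → 0 ≤ δ → Y ≠ 0 → B * L ≤ ‖Y‖ →
    BoxMul L (fun z => ((Real.exp (-(2 * Real.pi * δ * ‖Y + lat f z‖)) / ‖Y + lat f z‖ : ℝ) : ℂ))
      (C * (Real.exp (-(Real.pi * δ * ‖Y‖)) / ‖Y‖)) := by
  obtain ⟨C₀, hC₀⟩ := exists_boxO_jetTwo
  have hC₀0 : 0 ≤ C₀ := (hC₀ 0 0 (fun _ => 0) (fun _ => 0) le_rfl (by norm_num)
    ⟨zero_le_one, by simpa using boxMul_const 0 0⟩ ⟨zero_le_one, by simpa using boxMul_const 0 0⟩).1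
  obtain ⟨D, hD⟩ : ∃ D, D = C₀ + 3 := ⟨_, rfl⟩
  obtain ⟨D', hD'⟩ : ∃ D', D' = 3 * (1 + D) + D := ⟨_, rfl⟩
  have hb := basisSize_nonneg (f := f)
  refine ⟨1 + D, 6 * (basisSize f + 1) * D', by linarith, by nlinarith, ?_⟩
  intro L δ Y hL hδ hY hLY
  have hL' : (0 : ℝ) ≤ L := by exact_mod_cast hL
  have hY0 : 0 < ‖Y‖ := norm_pos_iff.2 hY
  obtain ⟨q, hq⟩ : ∃ q, q = basisSize f * L * ‖Y‖⁻¹ := ⟨_, rfl⟩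
  have hq0 : 0 ≤ q := by rw [hq]; positivity
  have hqD : q * (6 * D') ≤ 1 := by
    have h1 : basisSize f * L * (6 * D') ≤ ‖Y‖ := by
      refine le_trans ?_ hLY
      nlinarith [mul_nonneg hL' (by linarith : 0 ≤ D')]
    calc q * (6 * D') = basisSize f * L * (6 * D') * ‖Y‖⁻¹ := by rw [hq]; ring
      _ ≤ ‖Y‖ * ‖Y‖⁻¹ := by gcongr
      _ = 1 := mul_inv_cancel₀ hY0.ne'
  have hq6 : q ≤ 1 / 6 := by nlinarith
  have hq1 : q ≤ 1 := by linarith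
  have ha := boxO_coordA hL hq.ge
  have hc : BoxO L q 2 1 (coordC f Y) :=
    boxO_norm_sq hL (by positivity : 0 ≤ ‖Y‖⁻¹) hq.ge
  have hw : BoxO L q 1 3 fun z => 2 * coordA f Y z + coordC f Y z :=
    ((ha.const_mul 2).add (hc.weaken hq0 hq1 one_le_two)).mono hq0 (by norm_num)
  have hI1 : BoxO L q 1 D fun z => 1 / √(1 + (2 * coordA f Y z + coordC f Y z)) - 1 := by
    have h1 := (hC₀ L q _ _ hq0 hq6 ha hc).weaken hq0 hq1 (by norm_num : 1 ≤ 3)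
    have h2 := ha.const_mul (-1)
    have h3 : BoxO L q 1 _ _ := (hc.const_mul (-(1 / 2))).weaken hq0 hq1 one_le_two
    have h4 : BoxO L q 1 _ _ := ((ha.pow 2).const_mul (3 / 2)).weaken hq0 hq1 (by norm_num)
    refine ((((h1.add h2).add h3).add h4).mono hq0 ?_).congr fun z => ?_
    · rw [hD]; norm_num; linarith
    · simp only [jetTwo]; ring
  have hI : BoxO L q 0 (1 + D) fun z => 1 / √(1 + (2 * coordA f Y z + coordC f Y z)) := by
    refine (((boxO_const L q 1).add (hI1.weaken hq0 hq1 zero_le_one)).mono hq0 ?_).congr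
      fun z => ?_
    · norm_num
    · ring
  have hS : BoxO L q 1 D' fun z => (2 * coordA f Y z + coordC f Y z)
      * (1 / √(1 + (2 * coordA f Y z + coordC f Y z)))
      + (1 / √(1 + (2 * coordA f Y z + coordC f Y z)) - 1) := by
    rw [hD']; exact (hw.mul hI).add hI1
  have hE := (hS.2.const_mul ((-(2 * Real.pi * δ * ‖Y‖) : ℝ) : ℂ)).exp
  have hF := (hE.const_mul ((Real.exp (-(2 * Real.pi * δ * ‖Y‖)) : ℝ) : ℂ)).mul
    (hI.2.const_mul ((‖Y‖⁻¹ : ℝ) : ℂ))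
  refine (hF.mono ?_).congr fun z hz0 hzL => ?_
  · rw [Complex.norm_real, Complex.norm_real, Complex.norm_real, Real.norm_eq_abs, Real.norm_eq_abs,
      Real.norm_eq_abs, Real.abs_exp, abs_neg, abs_of_nonneg (by positivity), abs_of_pos
      (inv_pos.2 hY0), ← Real.exp_add, pow_zero, pow_one, mul_one]
    calc _ ≤ Real.exp (-(Real.pi * δ * ‖Y‖)) * (‖Y‖⁻¹ * (1 + D)) := by
          have : 0 ≤ 1 + D := by linarith
          gcongr
          have h1 : 0 ≤ Real.pi * δ * ‖Y‖ := by positivity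
          nlinarith
      _ = _ := by ring
  · have h1 : 0 < 1 + (2 * coordA f Y z + coordC f Y z) := by
      have := (abs_le.1 (hw.abs_le hz0 hzL)).1
      rw [pow_one] at this
      linarith
    have h2 := Real.sqrt_pos.2 h1
    have h3 := Real.mul_self_sqrt h1.le
    rw [norm_add_lat hY]
    rw [← Complex.ofReal_mul, ← Complex.ofReal_exp, ← Complex.ofReal_mul, ← Complex.ofReal_mul,
      ← Complex.ofReal_mul, ← Real.exp_add]
    congr 1
    have h4 : -(2 * Real.pi * δ * ‖Y‖) + -(2 * Real.pi * δ * ‖Y‖)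
        * ((2 * coordA f Y z + coordC f Y z) * (1 / √(1 + (2 * coordA f Y z + coordC f Y z)))
      + (1 / √(1 + (2 * coordA f Y z + coordC f Y z)) - 1))
      = -(2 * Real.pi * δ * (‖Y‖ * √(1 + (2 * coordA f Y z + coordC f Y z)))) := by
      set S := √(1 + (2 * coordA f Y z + coordC f Y z)) with hSdef
      have h5 : 2 * coordA f Y z + coordC f Y z = S * S - 1 := by linarith
      rw [h5]
      field_simp
      ring
    rw [h4]
    field_simp

lemma mem_Icc_pi {a b z : Fin 3 → ℤ} : z ∈ Finset.Icc a b ↔ (∀ i, a i ≤ z i) ∧ ∀ i, z i ≤ b i := by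
  rw [Finset.mem_Icc]; rfl

/-- Averaging over translates: sums over differences of boxes are controlled by short box sums. -/
lemma norm_sum_sdiff_Icc_le {F : (Fin 3 → ℤ) → ℂ} {L : ℤ} (hL : 0 ≤ L) {a b a' b' : Fin 3 → ℤ}
    (hsub : Finset.Icc a' b' ⊆ Finset.Icc a b) {K : ℝ} (hK0 : 0 ≤ K)
    (hK : ∀ m z : Fin 3 → ℤ, (∀ i, 0 ≤ z i) → (∀ i, z i ≤ L) →
      m + z ∈ Finset.Icc a b \ Finset.Icc a' b' → BoxSup L (fun z => F (m + z)) K) :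
    ((L : ℝ) + 1) ^ 3 * ‖∑ m ∈ Finset.Icc a b \ Finset.Icc a' b', F m‖
      ≤ (Finset.Icc (a - fun _ => L) b).card * (2 * K) := by
  set S := Finset.Icc a b \ Finset.Icc a' b' with hS
  set amb : Finset (Fin 3 → ℤ) := Finset.Icc (fun _ => 0) (fun _ => L) with hamb
  set T := Finset.Icc (a - fun _ => L) b with hT
  have hbox : ∀ (m a b : Fin 3 → ℤ), amb.filter (fun z => m + z ∈ Finset.Icc a b)
      = Finset.Icc (fun i => max 0 (a i - m i)) (fun i => min L (b i - m i)) := by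
    intro m a b
    ext z
    simp only [Finset.mem_filter, hamb, mem_Icc_pi, Pi.add_apply, max_le_iff, le_min_iff]
    constructor
    · rintro ⟨⟨h1, h2⟩, h3, h4⟩
      exact ⟨fun i => ⟨h1 i, by have := h3 i; omega⟩, fun i => ⟨h2 i, by have := h4 i; omega⟩⟩
    · rintro ⟨h1, h2⟩
      exact ⟨⟨fun i => (h1 i).1, fun i => (h2 i).1⟩, fun i => by have := (h1 i).2; omega,
        fun i => by have := (h2 i).2; omega⟩
  have hshift : ∀ z ∈ amb, ∑ m ∈ S, F m = ∑ m ∈ T, if m + z ∈ S then F (m + z) else 0 := by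
    intro z hz
    rw [← Finset.sum_filter]
    refine Finset.sum_nbij' (fun m => m - z) (fun m => m + z) ?_ ?_ ?_ ?_ ?_
    · intro m hm
      have hm' := (mem_Icc_pi.1 (Finset.mem_sdiff.1 hm).1)
      have hz' := mem_Icc_pi.1 hz
      rw [Finset.mem_filter]
      refine ⟨mem_Icc_pi.2 ⟨fun i => ?_, fun i => ?_⟩, by rwa [sub_add_cancel]⟩
      · have := hm'.1 i; have := hz'.2 i
        simp only [Pi.sub_apply]; omega
      · have := hm'.2 i; have := hz'.1 i
        simp only [Pi.sub_apply]; omega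
    · intro m hm
      exact (Finset.mem_filter.1 hm).2
    · intro m _; simp
    · intro m _; simp
    · intro m _; simp
  have hcard : ((amb.card : ℕ) : ℝ) = ((L : ℝ) + 1) ^ 3 := by
    have h1 : (((L + 1).toNat : ℕ) : ℝ) = (L : ℝ) + 1 := by
      have : (((L + 1).toNat : ℕ) : ℤ) = L + 1 := Int.toNat_of_nonneg (by omega)
      exact_mod_cast this
    rw [hamb, Pi.card_Icc]
    simp [h1]
  have hmain : ((amb.card : ℕ) : ℂ) * ∑ m ∈ S, F m
      = ∑ m ∈ T, ∑ z ∈ amb, if m + z ∈ S then F (m + z) else 0 := by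
    rw [Finset.sum_comm, ← Finset.sum_congr rfl hshift, Finset.sum_const, nsmul_eq_mul]
  have hnorm := congrArg norm hmain
  rw [norm_mul, Complex.norm_natCast, hcard] at hnorm
  rw [hnorm, ← nsmul_eq_mul]
  refine (norm_sum_le_of_le _ fun m _ => ?_).trans (Finset.sum_const _).le
  by_cases hex : ∃ z ∈ amb, m + z ∈ S
  · obtain ⟨z, hz, hzS⟩ := hex
    have hB := hK m z (mem_Icc_pi.1 hz).1 (mem_Icc_pi.1 hz).2 hzS
    have hdiff : (∑ z ∈ amb, if m + z ∈ S then F (m + z) else 0)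
        = (∑ z ∈ amb.filter (fun z => m + z ∈ Finset.Icc a b), F (m + z))
          - ∑ z ∈ amb.filter (fun z => m + z ∈ Finset.Icc a' b'), F (m + z) := by
      rw [Finset.sum_filter, Finset.sum_filter, ← Finset.sum_sub_distrib]
      refine Finset.sum_congr rfl fun z _ => ?_
      simp only [hS, Finset.mem_sdiff]
      by_cases h2 : m + z ∈ Finset.Icc a' b'
      · simp [h2, hsub h2]
      · simp only [h2, not_false_iff, and_true, if_false, sub_zero]
    rw [hdiff, hbox, hbox, two_mul]
    refine (norm_sub_le _ _).trans (add_le_add ?_ ?_) <;>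
    exact hB _ _ (fun i => le_max_left _ _) (fun i => min_le_left _ _)
  · push Not at hex
    rw [Finset.sum_eq_zero fun z hz => if_neg (hex z hz), norm_zero]
    positivity

/-- The complex kernel `exp (2 π i (lam + i δ) ‖X‖) / ‖X‖`. -/
noncomputable def ker (lam δ : ℝ) (X : E3) : ℂ :=
  ((Real.exp (-(2 * Real.pi * δ * ‖X‖)) / ‖X‖ : ℝ) : ℂ) * expi (lam * ‖X‖)

/-- The lattice points with sup norm in `[R, 2 R)`. -/
noncomputable def shell (R : ℤ) : Finset (Fin 3 → ℤ) :=
  Finset.Icc (fun _ => -(2 * R - 1)) (fun _ => 2 * R - 1)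
    \ Finset.Icc (fun _ => -(R - 1)) (fun _ => R - 1)

lemma exists_mul_norm_le_emb (f : Module.Basis (Fin 3) ℝ E3) :
    ∃ c : ℝ, 0 < c ∧ ∀ x, c * ‖x‖ ≤ ‖emb f x‖ := by
  have h := (f.equivFunL : E3 →L[ℝ] (Fin 3 → ℝ)).le_opNorm
  set M := ‖(f.equivFunL : E3 →L[ℝ] (Fin 3 → ℝ))‖ with hM
  have hM0 : 0 ≤ M := norm_nonneg _
  refine ⟨(M + 1)⁻¹, by positivity, fun x => ?_⟩
  have h1 := h (emb f x)
  have h2 : (f.equivFunL : E3 →L[ℝ] (Fin 3 → ℝ)) (emb f x) = x := by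
    change f.equivFun (∑ i, x i • f i) = x
    rw [← f.equivFun_symm_apply, LinearEquiv.apply_symm_apply]
  rw [h2] at h1
  rw [inv_mul_le_iff₀ (by positivity)]
  nlinarith [norm_nonneg (emb f x)]

lemma norm_emb_le (f : Module.Basis (Fin 3) ℝ E3) (x : Fin 3 → ℝ) :
    ‖emb f x‖ ≤ basisSize f * ‖x‖ := by
  rw [emb, basisSize, Finset.sum_mul]
  refine norm_sum_le_of_le _ fun i _ => ?_
  rw [norm_smul, mul_comm]
  gcongr
  exact norm_le_pi_norm x i

lemma emb_add (f : Module.Basis (Fin 3) ℝ E3) (x y : Fin 3 → ℝ) :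
    emb f (x + y) = emb f x + emb f y := by
  simp [emb, add_smul, Finset.sum_add_distrib]

lemma norm_add_castVec_of_mem_shell {R : ℤ} (hR : 2 ≤ R) {x : Fin 3 → ℝ} (hx : ‖x‖ ≤ 1)
    {m : Fin 3 → ℤ} (hm : m ∈ shell R) : R / 2 ≤ ‖x + castVec m‖ ∧ ‖x + castVec m‖ ≤ 2 * R := by
  have hR' : (2 : ℝ) ≤ R := by exact_mod_cast hR
  obtain ⟨h1, h2⟩ := Finset.mem_sdiff.1 hm
  rw [mem_Icc_pi] at h1 h2
  have hxi : ∀ i, |x i| ≤ 1 := fun i => (norm_le_pi_norm x i).trans hx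
  constructor
  · by_contra hcon
    push Not at hcon
    refine h2 ⟨fun i => ?_, fun i => ?_⟩
    all_goals
      have h3 := (norm_le_pi_norm (x + castVec m) i).trans hcon.le
      rw [Pi.add_apply, castVec, Real.norm_eq_abs, abs_le] at h3
      have h4 := abs_le.1 (hxi i)
      have h5 := (norm_le_pi_norm (x + castVec m) i).trans_lt hcon
      rw [Pi.add_apply, castVec, Real.norm_eq_abs, abs_lt] at h5
    · have : (-R : ℝ) < m i := by linarith [h5.1]
      have : -R < m i := by exact_mod_cast this
      omega
    · have : (m i : ℝ) < R := by linarith [h5.2]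
      have : m i < R := by exact_mod_cast this
      omega
  · refine (pi_norm_le_iff_of_nonneg (by linarith)).2 fun i => ?_
    have h3 : ((-(2 * R - 1) : ℤ) : ℝ) ≤ m i := by exact_mod_cast h1.1 i
    have h4 : (m i : ℝ) ≤ ((2 * R - 1 : ℤ) : ℝ) := by exact_mod_cast h1.2 i
    push_cast at h3 h4
    have h5 := abs_le.1 (hxi i)
    rw [Pi.add_apply, castVec, Real.norm_eq_abs, abs_le]
    constructor <;> linarith

lemma norm_ker (lam δ : ℝ) (X : E3) :
    ‖ker lam δ X‖ = Real.exp (-(2 * Real.pi * δ * ‖X‖)) / ‖X‖ := by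
  rw [ker, norm_mul, norm_expi, mul_one, Complex.norm_real, Real.norm_of_nonneg (by positivity)]

lemma card_Icc_pi_le {a b : ℤ} {M : ℝ} (hab : a ≤ b) (h : (b : ℝ) - a + 1 ≤ M) :
    ((Finset.Icc (fun _ : Fin 3 => a) (fun _ => b)).card : ℝ) ≤ M ^ 3 := by
  have h1 : (((b + 1 - a).toNat : ℕ) : ℝ) = (b : ℝ) + 1 - a := by
    have : (((b + 1 - a).toNat : ℕ) : ℤ) = b + 1 - a := Int.toNat_of_nonneg (by omega)
    exact_mod_cast this
  have h0 : (a : ℝ) ≤ b := by exact_mod_cast hab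
  rw [Pi.card_Icc]
  simp only [Int.card_Icc, Finset.prod_const, Finset.card_univ, Fintype.card_fin]
  push_cast
  rw [h1]
  exact pow_le_pow_left₀ (by linarith) (by linarith) 3

lemma exists_shell_bound_trivial (f : Module.Basis (Fin 3) ℝ E3) : ∃ C c : ℝ, 0 ≤ C ∧ 0 < c ∧
    ∀ (R : ℤ) (lam δ : ℝ) (x : Fin 3 → ℝ), 2 ≤ R → 0 ≤ δ → ‖x‖ ≤ 1 →
    ∑ m ∈ shell R, ‖ker lam δ (emb f x + lat f m)‖ ≤ C * R ^ 2 * Real.exp (-(c * δ * R)) := by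
  obtain ⟨c, hc, hcle⟩ := exists_mul_norm_le_emb f
  refine ⟨128 / c, Real.pi * c, by positivity, by positivity, fun R lam δ x hR hδ hx => ?_⟩
  have hR' : (2 : ℝ) ≤ R := by exact_mod_cast hR
  have hR0 : (0 : ℝ) < R := by linarith
  have hterm : ∀ m ∈ shell R, ‖ker lam δ (emb f x + lat f m)‖
      ≤ Real.exp (-(Real.pi * c * δ * R)) / (c * (R / 2)) := by
    intro m hm
    have h1 := (norm_add_castVec_of_mem_shell hR hx hm).1
    have h2 := hcle (x + castVec m)
    rw [emb_add] at h2
    have h3 : c * (R / 2) ≤ ‖emb f x + lat f m‖ := le_trans (by gcongr) h2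
    rw [norm_ker]
    refine div_le_div₀ (Real.exp_pos _).le (Real.exp_le_exp.2 ?_) (by positivity) h3
    have := mul_le_mul_of_nonneg_left h3 (mul_nonneg Real.pi_pos.le hδ)
    linarith
  have hcard : ((shell R).card : ℝ) ≤ (4 * R) ^ 3 := by
    refine le_trans (by exact_mod_cast Finset.card_le_card Finset.sdiff_subset)
      (card_Icc_pi_le (a := -(2 * R - 1)) (b := 2 * R - 1) (by omega) ?_)
    push_cast
    linarith
  calc _ ≤ (shell R).card • (Real.exp (-(Real.pi * c * δ * R)) / (c * (R / 2))) :=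
        Finset.sum_le_card_nsmul _ _ _ hterm
    _ ≤ (4 * R) ^ 3 * (Real.exp (-(Real.pi * c * δ * R)) / (c * (R / 2))) := by
        rw [nsmul_eq_mul]; gcongr
    _ = _ := by field_simp; norm_num

lemma exists_shell_bound (f : Module.Basis (Fin 3) ℝ E3) : ∃ C c : ℝ, 0 ≤ C ∧ 0 < c ∧
    ∀ (R : ℤ) (u δ : ℝ) (x : Fin 3 → ℝ), 2 ≤ R → 0 ≤ δ → ‖x‖ ≤ 1 →
    185 / 100 ≤ u → u ≤ 334 / 100 →
    ‖∑ m ∈ shell R, ker ((R : ℝ) ^ u) δ (emb f x + lat f m)‖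
      ≤ C * R ^ 2 * (R : ℝ) ^ (-((30 - 9 * u) / 94)) * Real.exp (-(c * δ * R)) := by
  obtain ⟨c, hc, hcle⟩ := exists_mul_norm_le_emb f
  obtain ⟨C₀, c₀, hC₀, hc₀, htriv⟩ := exists_shell_bound_trivial f
  obtain ⟨C₁, B, hC₁, hB, hamp⟩ := exists_boxMul_amplitude f
  have hb := basisSize_nonneg (f := f)
  obtain ⟨K₀, hK₀⟩ : ∃ K₀, K₀ = 1 + (basisSize f + B) * (c / 4)⁻¹ := ⟨_, rfl⟩
  have hci : 0 < (c / 4)⁻¹ := by positivity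
  have hK1 : 1 ≤ K₀ := by rw [hK₀]; nlinarith
  have hKc : basisSize f + B ≤ c / 4 * K₀ := by
    rw [hK₀, mul_add, mul_comm (basisSize f + B), ← mul_assoc, mul_inv_cancel₀ (by positivity)]
    linarith
  obtain ⟨K, R₀, hK, hR₀, hsav⟩ := exists_hasSaving f (c₁ := c / 4) (c₂ := 3 * basisSize f + 1)
    (K₀ := K₀) (by positivity) (by linarith) hK1
  refine ⟨max (C₀ * R₀) (1000 * C₁ * K / c), min c₀ (Real.pi * (c / 4)),
    le_max_of_le_left (by positivity), lt_min hc₀ (by positivity), ?_⟩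
  intro R u δ x hR hδ hx hu1 hu2
  have hR' : (2 : ℝ) ≤ R := by exact_mod_cast hR
  have hR0 : (0 : ℝ) < R := by linarith
  obtain ⟨σ, hσ⟩ : ∃ σ, σ = (30 - 9 * u) / 94 := ⟨_, rfl⟩
  have hs := hsav R u
  rw [← hσ] at hs ⊢
  rcases lt_or_ge (R : ℝ) R₀ with hlt | hge
  · refine (norm_sum_le _ _).trans ((htriv R _ δ x hR hδ hx).trans ?_)
    have h1 : 1 ≤ R₀ * (R : ℝ) ^ (-σ) := by
      have h2 : (R : ℝ) ^ (-1 : ℝ) ≤ (R : ℝ) ^ (-σ) :=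
        Real.rpow_le_rpow_of_exponent_le (by linarith) (by linarith)
      rw [Real.rpow_neg_one] at h2
      calc (1 : ℝ) = R * (R : ℝ)⁻¹ := (mul_inv_cancel₀ hR0.ne').symm
        _ ≤ _ := by gcongr
    calc _ ≤ C₀ * R ^ 2 * Real.exp (-(c₀ * δ * R)) * (R₀ * (R : ℝ) ^ (-σ)) :=
          le_mul_of_one_le_right (by positivity) h1
      _ = (C₀ * R₀) * R ^ 2 * (R : ℝ) ^ (-σ) * Real.exp (-(c₀ * δ * R)) := by ring
      _ ≤ _ := by
        gcongr
        · exact le_max_left _ _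
        · exact min_le_left _ _
  · obtain ⟨L, hL1, hL2, hL3⟩ := hs hge hu1 hu2
    have hL0 : (0 : ℝ) < L := by exact_mod_cast (by omega : 0 < L)
    have hLR : (L : ℝ) ≤ R := by nlinarith
    obtain ⟨E, hE⟩ : ∃ E, E = Real.exp (-(Real.pi * (c / 4) * δ * R)) := ⟨_, rfl⟩
    have hE0 : 0 < E := hE ▸ Real.exp_pos _
    obtain ⟨W, hW⟩ : ∃ W, W = C₁ * (E / (c / 4 * R)) * (L ^ 3 * (K * (R : ℝ) ^ (-σ))) := ⟨_, rfl⟩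
    have hC₁0 : 0 ≤ C₁ := by linarith
    have hW0 : 0 ≤ W := by rw [hW]; positivity
    have hmain := norm_sum_sdiff_Icc_le (F := fun m => ker ((R : ℝ) ^ u) δ (emb f x + lat f m))
      (L := L) (by omega) (a := fun _ => -(2 * R - 1)) (b := fun _ => 2 * R - 1)
      (a' := fun _ => -(R - 1)) (b' := fun _ => R - 1)
      (Finset.Icc_subset_Icc (fun _ => by simp only; omega) (fun _ => by simp only; omega)) hW0 ?_
    · have hcard : ((Finset.Icc ((fun _ : Fin 3 => -(2 * R - 1)) - fun _ => L)
          (fun _ => 2 * R - 1)).card : ℝ) ≤ (5 * R) ^ 3 := by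
        refine card_Icc_pi_le (a := -(2 * R - 1) - L) (b := 2 * R - 1) (by omega) ?_
        push_cast
        linarith
      rw [← shell] at hmain
      have h1 : (L : ℝ) ^ 3 * ‖∑ m ∈ shell R, ker ((R : ℝ) ^ u) δ (emb f x + lat f m)‖
          ≤ L ^ 3 * ((1000 * C₁ * K / c) * R ^ 2 * (R : ℝ) ^ (-σ) * E) := by
        calc _ ≤ ((L : ℝ) + 1) ^ 3 * ‖∑ m ∈ shell R, ker ((R : ℝ) ^ u) δ (emb f x + lat f m)‖ := by
              gcongr; linarith
          _ ≤ _ := hmain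
          _ ≤ (5 * R) ^ 3 * (2 * W) := by gcongr
          _ = _ := by rw [hW]; field_simp; ring
      refine (le_of_mul_le_mul_left h1 (by positivity)).trans ?_
      rw [hE]
      gcongr
      · exact le_max_right _ _
      · exact min_le_right _ _
    · intro m z hz0 hzL hz
      have hb1 := norm_add_castVec_of_mem_shell hR hx hz
      have h2 := hcle (x + castVec (m + z))
      have h3 := norm_emb_le f (x + castVec (m + z))
      have h4 : emb f (x + castVec (m + z)) = (emb f x + lat f m) + lat f z := by
        rw [emb_add, add_assoc, ← lat_add]; rfl
      have h5 : ‖lat f z‖ ≤ basisSize f * L := norm_lat_le hz0 hzL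
      rw [h4] at h2 h3
      obtain ⟨Y, hYdef⟩ : ∃ Y, Y = emb f x + lat f m := ⟨_, rfl⟩
      rw [← hYdef] at h2 h3
      have hKL : (basisSize f + B) * L ≤ c / 4 * R := by
        calc (basisSize f + B) * L ≤ c / 4 * K₀ * L := by gcongr
          _ = c / 4 * (K₀ * L) := by ring
          _ ≤ _ := by gcongr
      have hBL : 0 ≤ B * L := by positivity
      have hbL : 0 ≤ basisSize f * L := by positivity
      have hYlow : c / 4 * R ≤ ‖Y‖ := by
        have h6 := norm_add_le Y (lat f z)
        have h7 : c * (R / 2) ≤ ‖Y + lat f z‖ := le_trans (by gcongr; exact hb1.1) h2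
        linarith
      have hYup : ‖Y‖ ≤ (3 * basisSize f + 1) * R := by
        have h6 := norm_sub_le (Y + lat f z) (lat f z)
        rw [add_sub_cancel_right] at h6
        have h7 : ‖Y + lat f z‖ ≤ basisSize f * (2 * R) := h3.trans (by gcongr; exact hb1.2)
        have h8 : basisSize f * L ≤ basisSize f * R := by gcongr
        linarith
      have hYpos : 0 < ‖Y‖ := lt_of_lt_of_le (by positivity) hYlow
      have hA := hamp L δ Y (by omega) hδ (norm_pos_iff.1 hYpos) (by linarith)
      have hres := hA _ _ (hL3 Y hYlow hYup)
      refine (hres.mono ?_).congr fun z _ _ => ?_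
      · rw [hW, hE]
        have h9 : Real.exp (-(Real.pi * δ * ‖Y‖)) ≤ Real.exp (-(Real.pi * (c / 4) * δ * R)) := by
          refine Real.exp_le_exp.2 ?_
          have := mul_le_mul_of_nonneg_left hYlow (mul_nonneg Real.pi_pos.le hδ)
          linarith
        gcongr
      · simp only [ker, hYdef, lat_add, add_assoc]

lemma exists_sum_two_pow_rpow_mul_exp_le {s c : ℝ} (hs : 1 ≤ s) (hc : 0 < c) : ∃ C, 0 ≤ C ∧
    ∀ (δ : ℝ) (J : ℕ), 0 < δ →
    ∑ j ∈ Finset.range J, ((2 : ℝ) ^ j) ^ s * Real.exp (-(c * δ * 2 ^ j)) ≤ C * δ ^ (-s) := by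
  refine ⟨(2 / c) ^ s * Real.Gamma s, mul_nonneg (by positivity)
    (Real.Gamma_pos_of_pos (by linarith)).le, fun δ J hδ => ?_⟩
  have hr : 0 < c * δ / 2 := by positivity
  obtain ⟨F, hF⟩ : ∃ F : ℝ → ℝ, F = fun t => t ^ (s - 1) * Real.exp (-(c * δ / 2 * t)) := ⟨_, rfl⟩
  have hval := Real.integral_rpow_mul_exp_neg_mul_Ioi (a := s) (by linarith) hr
  rw [← hF] at hval
  have hcont : Continuous F := by
    rw [hF]
    exact (Real.continuous_rpow_const (by linarith)).mul (by fun_prop)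
  have hint : IntegrableOn F (Set.Ioi 0) := by
    by_contra hcon
    rw [integral_undef hcon] at hval
    have := Real.Gamma_pos_of_pos (show 0 < s by linarith)
    have h2 : 0 < (1 / (c * δ / 2)) ^ s * Real.Gamma s := by positivity
    linarith
  have hF0 : ∀ t : ℝ, 0 < t → 0 ≤ F t := fun t ht => by rw [hF]; positivity
  have hterm : ∀ j : ℕ, ((2 : ℝ) ^ j) ^ s * Real.exp (-(c * δ * 2 ^ j))
      ≤ ∫ t in (2 : ℝ) ^ j..2 ^ (j + 1), F t := by
    intro j
    have h2 : (0 : ℝ) < 2 ^ j := by positivity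
    have h3 : (2 : ℝ) ^ j ≤ 2 ^ (j + 1) := by rw [pow_succ]; linarith
    calc ((2 : ℝ) ^ j) ^ s * Real.exp (-(c * δ * 2 ^ j))
        = ∫ t in (2 : ℝ) ^ j..2 ^ (j + 1),
          ((2 : ℝ) ^ j) ^ (s - 1) * Real.exp (-(c * δ * 2 ^ j)) := by
          rw [intervalIntegral.integral_const, smul_eq_mul, Real.rpow_sub_one h2.ne', pow_succ]
          field_simp
          ring
      _ ≤ _ := by
        refine intervalIntegral.integral_mono_on h3 (by simp) (hcont.intervalIntegrable _ _) ?_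
        intro t ht
        rw [hF]
        have ht' : t ≤ 2 * 2 ^ j := by have := ht.2; rw [pow_succ] at this; linarith
        have h5 : c * δ / 2 * t ≤ c * δ * 2 ^ j := by
          calc c * δ / 2 * t ≤ c * δ / 2 * (2 * 2 ^ j) := by gcongr
            _ = _ := by ring
        have h6 : ((2 : ℝ) ^ j) ^ (s - 1) ≤ t ^ (s - 1) :=
          Real.rpow_le_rpow h2.le ht.1 (by linarith)
        exact mul_le_mul h6 (Real.exp_le_exp.2 (neg_le_neg h5)) (Real.exp_pos _).le
          (Real.rpow_nonneg (h2.le.trans ht.1) _)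
  calc _ ≤ ∑ j ∈ Finset.range J, ∫ t in (2 : ℝ) ^ j..2 ^ (j + 1), F t :=
        Finset.sum_le_sum fun j _ => hterm j
    _ = ∫ t in (2 : ℝ) ^ 0..2 ^ J, F t :=
        intervalIntegral.sum_integral_adjacent_intervals fun k _ => hcont.intervalIntegrable _ _
    _ ≤ ∫ t in Set.Ioi 0, F t := by
        rw [intervalIntegral.integral_of_le (one_le_pow₀ (by norm_num) |>.trans_eq' (by simp))]
        refine setIntegral_mono_set hint ?_ ?_
        · exact (ae_restrict_iff' measurableSet_Ioi).2 (ae_of_all _ fun t ht => hF0 t ht)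
        · refine LE.le.eventuallyLE fun t ht => ?_
          have := ht.1
          simp only [pow_zero] at this
          exact lt_trans zero_lt_one this
    _ = _ := by
        rw [hval, Real.rpow_neg hδ.le, ← Real.inv_rpow hδ.le, mul_right_comm,
          ← Real.mul_rpow (by positivity) (by positivity)]
        congr 2
        field_simp

lemma exists_rpow_mul_exp_le {c η : ℝ} (hc : 0 < c) (hη : 0 < η) (a : ℝ) :
    ∃ C, 1 ≤ C ∧ ∀ R : ℝ, 1 ≤ R → R ^ a * Real.exp (-(c * R ^ η)) ≤ C := by
  obtain ⟨n, hn⟩ := exists_nat_ge (a / η)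
  refine ⟨max 1 ((c⁻¹) ^ n * n.factorial), le_max_left _ _, fun R hR => ?_⟩
  refine le_trans ?_ (le_max_right _ _)
  have hR0 : 0 < R := by linarith
  have h1 : R ^ a ≤ (R ^ η) ^ n := by
    rw [← Real.rpow_natCast, ← Real.rpow_mul hR0.le]
    exact Real.rpow_le_rpow_of_exponent_le hR (by rwa [div_le_iff₀' hη] at hn)
  have h2 := Real.pow_div_factorial_le_exp (c * R ^ η) (by positivity) n
  rw [div_le_iff₀ (by positivity)] at h2
  rw [Real.exp_neg, ← div_eq_mul_inv, div_le_iff₀ (Real.exp_pos _)]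
  calc R ^ a ≤ (R ^ η) ^ n := h1
    _ = (c⁻¹) ^ n * (c * R ^ η) ^ n := by rw [mul_pow, ← mul_assoc, ← mul_pow, inv_mul_cancel₀ hc.ne',
        one_pow, one_mul]
    _ ≤ (c⁻¹) ^ n * (Real.exp (c * R ^ η) * n.factorial) := by gcongr
    _ = _ := by ring

lemma exists_shell_bound_rpow (f : Module.Basis (Fin 3) ℝ E3) : ∃ C c : ℝ, 0 ≤ C ∧ 0 < c ∧
    ∀ (R : ℤ) (lam δ : ℝ) (x : Fin 3 → ℝ), 2 ≤ R → 1 < lam → lam ^ (-(85 / 158) : ℝ) ≤ δ → ‖x‖ ≤ 1 →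
    ‖∑ m ∈ shell R, ker lam δ (emb f x + lat f m)‖
      ≤ C * lam ^ (9 / 94 : ℝ) * ((R : ℝ) ^ (158 / 94 : ℝ) * Real.exp (-(c * δ * R))) := by
  obtain ⟨C₀, c₀, hC₀, hc₀, htriv⟩ := exists_shell_bound_trivial f
  obtain ⟨C₁, c₁, hC₁, hc₁, hsave⟩ := exists_shell_bound f
  obtain ⟨D, hD, hexp⟩ := exists_rpow_mul_exp_le (c := c₀ / 2) (η := 1 / 1000) (by positivity)
    (by norm_num) (30 / 94)
  refine ⟨max (C₀ * D) C₁, min (c₀ / 2) c₁, le_max_of_le_right hC₁, lt_min (by positivity) hc₁, ?_⟩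
  intro R lam δ x hR hlam hδ hx
  have hR' : (2 : ℝ) ≤ R := by exact_mod_cast hR
  have hR0 : (0 : ℝ) < R := by linarith
  have hlam0 : 0 < lam := by linarith
  have hδ0 : 0 < δ := lt_of_lt_of_le (by positivity) hδ
  have hlogR : 0 < Real.log R := Real.log_pos (by linarith)
  obtain ⟨u, hu⟩ : ∃ u, u = Real.log lam / Real.log R := ⟨_, rfl⟩
  have hlamu : lam = (R : ℝ) ^ u := by
    rw [Real.rpow_def_of_pos hR0, hu, mul_div_cancel₀ _ hlogR.ne', Real.exp_log hlam0]
  have hlam9 : lam ^ (9 / 94 : ℝ) = (R : ℝ) ^ (u * (9 / 94)) := by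
    rw [hlamu, ← Real.rpow_mul hR0.le]
  have hR2 : (R : ℝ) ^ 2 = (R : ℝ) ^ (2 : ℝ) := by norm_cast
  by_cases hmid : 185 / 100 ≤ u ∧ u ≤ 334 / 100
  · have h := hsave R u δ x hR hδ0.le hx hmid.1 hmid.2
    rw [← hlamu] at h
    refine h.trans ?_
    have hexpo : (R : ℝ) ^ 2 * (R : ℝ) ^ (-((30 - 9 * u) / 94))
        = lam ^ (9 / 94 : ℝ) * (R : ℝ) ^ (158 / 94 : ℝ) := by
      rw [hR2, hlam9, ← Real.rpow_add hR0, ← Real.rpow_add hR0]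
      ring_nf
    calc _ = C₁ * (lam ^ (9 / 94 : ℝ) * (R : ℝ) ^ (158 / 94 : ℝ)) * Real.exp (-(c₁ * δ * R)) := by
          rw [mul_assoc C₁, hexpo]
      _ = C₁ * lam ^ (9 / 94 : ℝ) * ((R : ℝ) ^ (158 / 94 : ℝ) * Real.exp (-(c₁ * δ * R))) := by ring
      _ ≤ _ := by
        gcongr
        · exact le_max_right _ _
        · exact min_le_right _ _
  · refine (norm_sum_le _ _).trans ((htriv R lam δ x hR hδ0.le hx).trans ?_)
    have hkey : (R : ℝ) ^ 2 * Real.exp (-(c₀ / 2 * δ * R))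
        ≤ D * (lam ^ (9 / 94 : ℝ) * (R : ℝ) ^ (158 / 94 : ℝ)) := by
      rcases lt_or_ge u (185 / 100) with hu1 | hu1
      · have h1 : (R : ℝ) ^ (1 / 1000 : ℝ) ≤ δ * R := by
          calc (R : ℝ) ^ (1 / 1000 : ℝ) ≤ (R : ℝ) ^ (u * -(85 / 158) + 1) :=
                Real.rpow_le_rpow_of_exponent_le (by linarith) (by linarith)
            _ = lam ^ (-(85 / 158) : ℝ) * R := by
                rw [Real.rpow_add hR0, Real.rpow_one, Real.rpow_mul hR0.le, ← hlamu]
            _ ≤ _ := by gcongr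
        have h2 : Real.exp (-(c₀ / 2 * δ * R)) ≤ Real.exp (-(c₀ / 2 * (R : ℝ) ^ (1 / 1000 : ℝ))) := by
          refine Real.exp_le_exp.2 (neg_le_neg ?_)
          rw [mul_assoc]
          gcongr
        have h3 : (R : ℝ) ^ 2 = (R : ℝ) ^ (158 / 94 : ℝ) * (R : ℝ) ^ (30 / 94 : ℝ) := by
          rw [hR2, ← Real.rpow_add hR0]; norm_num
        have h4 : 1 ≤ lam ^ (9 / 94 : ℝ) := Real.one_le_rpow hlam.le (by norm_num)
        calc _ ≤ (R : ℝ) ^ (158 / 94 : ℝ) * ((R : ℝ) ^ (30 / 94 : ℝ)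
              * Real.exp (-(c₀ / 2 * (R : ℝ) ^ (1 / 1000 : ℝ)))) := by
              rw [h3, mul_assoc]; gcongr
          _ ≤ (R : ℝ) ^ (158 / 94 : ℝ) * D := by gcongr; exact hexp R (by linarith)
          _ = D * (1 * (R : ℝ) ^ (158 / 94 : ℝ)) := by ring
          _ ≤ _ := by gcongr
      · have hu2 : 334 / 100 < u := by
          by_contra hcon
          exact hmid ⟨hu1, not_lt.1 hcon⟩
        calc (R : ℝ) ^ 2 * Real.exp (-(c₀ / 2 * δ * R)) ≤ (R : ℝ) ^ 2 * 1 := by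
              gcongr
              rw [Real.exp_le_one_iff]
              have : 0 ≤ c₀ / 2 * δ * R := by positivity
              linarith
          _ = (R : ℝ) ^ (2 : ℝ) := by rw [mul_one, hR2]
          _ ≤ (R : ℝ) ^ (u * (9 / 94) + 158 / 94) :=
              Real.rpow_le_rpow_of_exponent_le (by linarith) (by linarith)
          _ = 1 * (lam ^ (9 / 94 : ℝ) * (R : ℝ) ^ (158 / 94 : ℝ)) := by
              rw [Real.rpow_add hR0, hlam9, one_mul]
          _ ≤ _ := by gcongr
    have hsplit : Real.exp (-(c₀ * δ * R)) = Real.exp (-(c₀ / 2 * δ * R))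
        * Real.exp (-(c₀ / 2 * δ * R)) := by
      rw [← Real.exp_add]; ring_nf
    calc _ = C₀ * ((R : ℝ) ^ 2 * Real.exp (-(c₀ / 2 * δ * R))) * Real.exp (-(c₀ / 2 * δ * R)) := by
          rw [hsplit]; ring
      _ ≤ C₀ * (D * (lam ^ (9 / 94 : ℝ) * (R : ℝ) ^ (158 / 94 : ℝ)))
          * Real.exp (-(c₀ / 2 * δ * R)) := by gcongr
      _ = (C₀ * D) * lam ^ (9 / 94 : ℝ)
          * ((R : ℝ) ^ (158 / 94 : ℝ) * Real.exp (-(c₀ / 2 * δ * R))) := by ring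
      _ ≤ _ := by
        gcongr
        · exact le_max_left _ _
        · exact min_le_left _ _

/-- The lattice points of sup norm less than `2 ^ (j + 1)`. -/
noncomputable def dyadicBox (j : ℕ) : Finset (Fin 3 → ℤ) :=
  Finset.Icc (fun _ => -(2 ^ (j + 1) - 1)) (fun _ => 2 ^ (j + 1) - 1)

lemma dyadicBox_mono : Monotone dyadicBox := by
  intro i j hij
  have h : (2 : ℤ) ^ (i + 1) ≤ 2 ^ (j + 1) := pow_le_pow_right₀ (by norm_num) (by omega)
  refine Finset.Icc_subset_Icc (fun _ => ?_) (fun _ => ?_)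
  · exact neg_le_neg (by linarith)
  · show (2 : ℤ) ^ (i + 1) - 1 ≤ 2 ^ (j + 1) - 1
    linarith

lemma exists_mem_dyadicBox (m : Fin 3 → ℤ) : ∃ j, m ∈ dyadicBox j := by
  obtain ⟨M, hM⟩ : ∃ M : ℕ, ∀ i, |m i| ≤ M :=
    ⟨∑ i, (m i).natAbs, fun i => by
      rw [Int.abs_eq_natAbs]
      exact_mod_cast Finset.single_le_sum (f := fun i => (m i).natAbs) (fun _ _ => Nat.zero_le _)
        (Finset.mem_univ i)⟩
  refine ⟨M, ?_⟩
  have h2 : (M : ℤ) ≤ 2 ^ (M + 1) - 1 := by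
    have h3 : M + 1 ≤ 2 ^ (M + 1) := (Nat.lt_two_pow_self (n := M + 1)).le
    have h4 : (M : ℤ) + 1 ≤ 2 ^ (M + 1) := by exact_mod_cast h3
    linarith
  have h := fun i => abs_le.1 ((hM i).trans h2)
  exact mem_Icc_pi.2 ⟨fun i => (h i).1, fun i => (h i).2⟩

lemma tendsto_dyadicBox : Tendsto dyadicBox atTop atTop :=
  tendsto_atTop_finset_of_monotone dyadicBox_mono exists_mem_dyadicBox

lemma sum_dyadicBox (F : (Fin 3 → ℤ) → ℂ) (J : ℕ) :
    ∑ m ∈ dyadicBox J, F m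
      = ∑ m ∈ dyadicBox 0, F m + ∑ j ∈ Finset.range J, ∑ m ∈ shell (2 ^ (j + 1)), F m := by
  induction J with
  | zero => simp
  | succ J ih =>
    rw [Finset.sum_range_succ, ← add_assoc, ← ih]
    have h1 : shell (2 ^ (J + 1)) = dyadicBox (J + 1) \ dyadicBox J := by
      unfold shell dyadicBox
      rw [show (2 : ℤ) * 2 ^ (J + 1) - 1 = 2 ^ (J + 1 + 1) - 1 by rw [pow_succ _ (J + 1)]; ring]
    rw [h1, add_comm (∑ m ∈ dyadicBox J, F m), Finset.sum_sdiff (dyadicBox_mono (Nat.le_succ J))]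

lemma exists_far_bound_of_shell {κ : ℝ → ℝ → E3 → ℂ} (f : Module.Basis (Fin 3) ℝ E3)
    {P : ℝ → ℝ → Prop} {B : ℝ → ℝ → ℝ} {C c s : ℝ} (hs : 1 ≤ s) (hC : 0 ≤ C) (hc : 0 < c)
    (hB : ∀ lam δ, P lam δ → 0 < δ ∧ 0 ≤ B lam δ)
    (h : ∀ (R : ℤ) (lam δ : ℝ) (x : Fin 3 → ℝ), 2 ≤ R → P lam δ → ‖x‖ ≤ 1 →
      ‖∑ m ∈ shell R, κ lam δ (emb f x + lat f m)‖
        ≤ C * B lam δ * ((R : ℝ) ^ s * Real.exp (-(c * δ * R)))) :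
    ∃ C', 0 ≤ C' ∧ ∀ (lam δ : ℝ) (x : Fin 3 → ℝ) (J : ℕ), P lam δ → ‖x‖ ≤ 1 →
      ‖∑ m ∈ dyadicBox J, κ lam δ (emb f x + lat f m)
        - ∑ m ∈ dyadicBox 0, κ lam δ (emb f x + lat f m)‖ ≤ C' * (B lam δ * δ ^ (-s)) := by
  obtain ⟨D, hD, hsum⟩ := exists_sum_two_pow_rpow_mul_exp_le hs hc
  refine ⟨C * D, by positivity, fun lam δ x J hP hx => ?_⟩
  obtain ⟨hδ, hB0⟩ := hB lam δ hP
  rw [sum_dyadicBox, add_sub_cancel_left]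
  calc _ ≤ ∑ j ∈ Finset.range J, C * B lam δ * (((2 : ℝ) ^ (j + 1)) ^ s
        * Real.exp (-(c * δ * 2 ^ (j + 1)))) := by
        refine norm_sum_le_of_le _ fun j _ => ?_
        have h1 : (2 : ℤ) ≤ 2 ^ (j + 1) := by
          rw [pow_succ]; have := one_le_pow₀ (n := j) (show (1 : ℤ) ≤ 2 by norm_num); linarith
        have := h (2 ^ (j + 1)) lam δ x h1 hP hx
        push_cast at this
        exact this
    _ = C * B lam δ * ∑ j ∈ Finset.range J, (((2 : ℝ) ^ (j + 1)) ^ s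
        * Real.exp (-(c * δ * 2 ^ (j + 1)))) := by rw [Finset.mul_sum]
    _ ≤ C * B lam δ * ∑ j ∈ Finset.range (J + 1), (((2 : ℝ) ^ j) ^ s
        * Real.exp (-(c * δ * 2 ^ j))) := by
        rw [Finset.sum_range_succ' _ J]
        gcongr
        exact le_add_of_nonneg_right (by positivity)
    _ ≤ C * B lam δ * (D * δ ^ (-s)) := by gcongr; exact hsum δ _ hδ
    _ = _ := by ring

lemma exists_far_bound_trivial (f : Module.Basis (Fin 3) ℝ E3) :
    ∃ C, 0 ≤ C ∧ ∀ (lam δ : ℝ) (x : Fin 3 → ℝ) (J : ℕ), 0 < δ → ‖x‖ ≤ 1 →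
      ‖∑ m ∈ dyadicBox J, ker lam δ (emb f x + lat f m)
        - ∑ m ∈ dyadicBox 0, ker lam δ (emb f x + lat f m)‖ ≤ C * δ ^ (-2 : ℝ) := by
  obtain ⟨C, c, hC, hc, h⟩ := exists_shell_bound_trivial f
  obtain ⟨C', hC', h'⟩ := exists_far_bound_of_shell (κ := ker) f (P := fun _ δ => 0 < δ)
    (B := fun _ _ => 1) (s := 2) (by norm_num) hC hc (fun _ _ h => ⟨h, zero_le_one⟩)
    (fun R lam δ x hR hδ hx => (norm_sum_le _ _).trans ((h R lam δ x hR hδ.le hx).trans_eq (by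
      rw [Real.rpow_two]; ring)))
  exact ⟨C', hC', fun lam δ x J hδ hx => by simpa using h' lam δ x J hδ hx⟩

lemma exists_far_bound_rpow (f : Module.Basis (Fin 3) ℝ E3) :
    ∃ C, 0 ≤ C ∧ ∀ (lam δ : ℝ) (x : Fin 3 → ℝ) (J : ℕ),
      1 < lam → lam ^ (-(85 / 158) : ℝ) ≤ δ → ‖x‖ ≤ 1 →
      ‖∑ m ∈ dyadicBox J, ker lam δ (emb f x + lat f m)
        - ∑ m ∈ dyadicBox 0, ker lam δ (emb f x + lat f m)‖
        ≤ C * (lam ^ (9 / 94 : ℝ) * δ ^ (-(158 / 94) : ℝ)) := by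
  obtain ⟨C, c, hC, hc, h⟩ := exists_shell_bound_rpow f
  obtain ⟨C', hC', h'⟩ := exists_far_bound_of_shell (κ := ker) f
    (P := fun lam δ => 1 < lam ∧ lam ^ (-(85 / 158) : ℝ) ≤ δ)
    (B := fun lam _ => lam ^ (9 / 94 : ℝ)) (s := 158 / 94) (by norm_num) hC hc
    (fun lam δ h => ⟨lt_of_lt_of_le (Real.rpow_pos_of_pos (by linarith [h.1]) _) h.2,
      Real.rpow_nonneg (by linarith [h.1]) _⟩)
    (fun R lam δ x hR hP hx => h R lam δ x hR hP.1 hP.2 hx)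
  exact ⟨C', hC', fun lam δ x J h1 h2 hx => h' lam δ x J ⟨h1, h2⟩ hx⟩

/-- The three-dimensional torus. -/
abbrev T3 := UnitAddTorus (Fin 3)

/-- The normalised Haar measure on the torus. -/
noncomputable abbrev haarT : Measure T3 := Measure.pi fun _ => AddCircle.haarAddCircle

/-- The quotient map to the torus. -/
noncomputable def toTorus (x : Fin 3 → ℝ) : T3 := fun i => (x i : UnitAddCircle)

/-- The half-open unit cube. -/
def cube : Set (Fin 3 → ℝ) := {x | ∀ i, x i ∈ Set.Ioc 0 1}

/-- The autocorrelation of a function on the torus. -/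
noncomputable def autocorr (G : T3 → ℂ) (t : T3) : ℂ := ∫ s, (starRingEnd ℂ) (G s) * G (s + t) ∂haarT

open UnitAddTorus in
lemma mFourierCoeff_translate (G : T3 → ℂ) (t : T3) (n : Fin 3 → ℤ) :
    mFourierCoeff (fun s => G (s + t)) n = mFourier n t * mFourierCoeff G n := by
  change ∫ s, mFourier (-n) s • G (s + t) ∂haarT = _ * ∫ s, mFourier (-n) s • G s ∂haarT
  rw [← integral_add_right_eq_self (μ := haarT) (fun s => mFourier (-n) s • G s) t, ← integral_const_mul]
  congr 1
  ext s
  have h : mFourier (-n) (s + t) = mFourier (-n) s * mFourier (-n) t := by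
    simp only [mFourier, ContinuousMap.coe_mk, Pi.add_apply, fourier_apply, smul_add,
      AddCircle.toCircle_add, Circle.coe_mul, Finset.prod_mul_distrib]
  have h2 : mFourier n t * mFourier (-n) t = 1 := by
    rw [← mFourier_add, add_neg_cancel, mFourier_zero]; rfl
  rw [h]
  simp only [smul_eq_mul]
  linear_combination (-(mFourier (-n) s * G (s + t))) * h2

open UnitAddTorus in
lemma hasSum_autocorr {G : T3 → ℂ} (hG : MemLp G 2 haarT) (t : T3) :
    HasSum (fun n => ((‖mFourierCoeff G n‖ ^ 2 : ℝ) : ℂ) * mFourier n t) (autocorr G t) := by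
  have hGt : MemLp (fun s => G (s + t)) 2 haarT :=
    hG.comp_measurePreserving (measurePreserving_add_right haarT t)
  have h := hasSum_prod_mFourierCoeff hG.toLp hGt.toLp
  have h1 : ∀ n, mFourierCoeff hG.toLp n = mFourierCoeff G n := fun n =>
    integral_congr_ae (by filter_upwards [hG.coeFn_toLp] with s hs; rw [hs])
  have h2 : ∀ n, mFourierCoeff hGt.toLp n = mFourierCoeff (fun s => G (s + t)) n := fun n =>
    integral_congr_ae (by filter_upwards [hGt.coeFn_toLp] with s hs; rw [hs])
  have h3 : ∫ s, (starRingEnd ℂ) ((hG.toLp G : T3 → ℂ) s) * (hGt.toLp _ : T3 → ℂ) s ∂haarT = autocorr G t :=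
    integral_congr_ae (by
      filter_upwards [hG.coeFn_toLp, hGt.coeFn_toLp] with s hs hs'; rw [hs, hs'])
  rw [← h3]
  refine HasSum.congr_fun h fun n => ?_
  rw [h1, h2, mFourierCoeff_translate, Complex.ofReal_pow, ← Complex.conj_mul']
  ring

open UnitAddTorus in
lemma hasSum_norm_sq_mFourierCoeff {G : T3 → ℂ} (hG : MemLp G 2 haarT) :
    HasSum (fun n => ‖mFourierCoeff G n‖ ^ 2) (∫ t, ‖G t‖ ^ 2 ∂haarT) := by
  have h := hasSum_sq_mFourierCoeff hG.toLp
  have h1 : ∀ n, mFourierCoeff hG.toLp n = mFourierCoeff G n := fun n =>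
    integral_congr_ae (by filter_upwards [hG.coeFn_toLp] with s hs; rw [hs])
  have h3 : ∫ s, ‖(hG.toLp G : T3 → ℂ) s‖ ^ 2 ∂haarT = ∫ t, ‖G t‖ ^ 2 ∂haarT :=
    integral_congr_ae (by filter_upwards [hG.coeFn_toLp] with s hs; rw [hs])
  simp only [h1] at h
  rw [← h3]
  exact h

open UnitAddTorus in
lemma norm_mFourier_apply (n : Fin 3 → ℤ) (t : T3) : ‖mFourier n t‖ = 1 := by
  simp [mFourier, fourier_apply, norm_prod, Circle.norm_coe]

open UnitAddTorus in
lemma continuous_autocorr {G : T3 → ℂ} (hG : MemLp G 2 haarT) : Continuous (autocorr G) := by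
  have h : autocorr G = fun t => ∑' n, ((‖mFourierCoeff G n‖ ^ 2 : ℝ) : ℂ) * mFourier n t := by
    ext t
    exact (hasSum_autocorr hG t).tsum_eq.symm
  rw [h]
  refine continuous_tsum (fun n => continuous_const.mul (mFourier n).continuous)
    (hasSum_norm_sq_mFourierCoeff hG).summable fun n t => ?_
  rw [norm_mul, norm_mFourier_apply, mul_one, Complex.norm_real, Real.norm_eq_abs,
    abs_of_nonneg (by positivity)]

lemma memLp_of_bound {G : T3 → ℂ} (hm : Measurable G) (hb : ∀ t, ‖G t‖ ≤ 1) (p : ENNReal) :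
    MemLp G p haarT :=
  MemLp.of_bound hm.aestronglyMeasurable 1 (ae_of_all _ hb)

lemma integral_norm_autocorr_le {G : T3 → ℂ} (hm : Measurable G) (hb : ∀ t, ‖G t‖ ≤ 1) :
    ∫ t, ‖autocorr G t‖ ∂haarT ≤ (∫ t, ‖G t‖ ∂haarT) ^ 2 := by
  have hint : Integrable (fun q : T3 × T3 => ‖G q.2‖ * ‖G (q.2 + q.1)‖) (haarT.prod haarT) := by
    refine Integrable.of_bound (C := 1) (Measurable.aestronglyMeasurable (by fun_prop))
      (ae_of_all _ fun q => ?_)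
    rw [Real.norm_eq_abs, abs_of_nonneg (by positivity)]
    exact mul_le_one₀ (hb _) (norm_nonneg _) (hb _)
  calc ∫ t, ‖autocorr G t‖ ∂haarT ≤ ∫ t, ∫ s, ‖G s‖ * ‖G (s + t)‖ ∂haarT ∂haarT := by
        refine integral_mono ?_
          hint.integral_prod_left fun t => ?_
        · exact (continuous_autocorr (memLp_of_bound hm hb 2)).norm.integrable_of_hasCompactSupport
            (HasCompactSupport.of_compactSpace _)
        refine (norm_integral_le_integral_norm _).trans_eq ?_
        simp
    _ = ∫ s, ∫ t, ‖G s‖ * ‖G (s + t)‖ ∂haarT ∂haarT := integral_integral_swap hint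
    _ = ∫ s, ‖G s‖ * ∫ t, ‖G t‖ ∂haarT ∂haarT := by
        congr 1
        ext s
        rw [integral_const_mul, integral_add_left_eq_self (μ := haarT) (fun t => ‖G t‖) s]
    _ = _ := by rw [integral_mul_const, sq]

lemma continuous_toTorus : Continuous toTorus :=
  continuous_pi fun i => (AddCircle.continuous_mk' 1).comp (continuous_apply i)

lemma toTorus_add_castVec (x : Fin 3 → ℝ) (m : Fin 3 → ℤ) : toTorus (x + castVec m) = toTorus x := by
  ext i
  simp only [toTorus, castVec, Pi.add_apply, AddCircle.coe_add]
  rw [add_eq_left]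
  exact (AddCircle.coe_eq_zero_iff 1).2 ⟨m i, by simp⟩

lemma integral_haarT {E : Type*} [NormedAddCommGroup E] [NormedSpace ℝ E] (g : T3 → E) :
    ∫ t, g t ∂haarT = ∫ x in cube, g (toTorus x) := by
  have h := UnitAddTorus.integral_preimage g (fun _ : Fin 3 => (0 : ℝ))
  simp only [zero_add] at h
  exact h

lemma cube_eq_pi : cube = Set.univ.pi fun _ => Set.Ioc (0 : ℝ) 1 := by
  ext x; simp [cube]

lemma measurableSet_cube : MeasurableSet cube := by
  rw [cube_eq_pi]
  exact MeasurableSet.univ_pi fun _ => measurableSet_Ioc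

open UnitAddTorus in
lemma hasSum_integral_mul_autocorr {G : T3 → ℂ} (hG : MemLp G 2 haarT) {κ : (Fin 3 → ℝ) → ℂ}
    (hκ : Integrable κ) :
    HasSum (fun n => ((‖mFourierCoeff G n‖ ^ 2 : ℝ) : ℂ) * ∫ y, κ y * mFourier n (toTorus y))
      (∫ y, κ y * autocorr G (toTorus y)) := by
  have hs := hasSum_norm_sq_mFourierCoeff hG
  simp only [← integral_const_mul]
  refine hasSum_integral_of_dominated_convergence
    (fun n y => ‖mFourierCoeff G n‖ ^ 2 * ‖κ y‖) (fun n => ?_) (fun n => ae_of_all _ fun y => ?_)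
    (ae_of_all _ fun y => hs.summable.mul_right _) ?_ (ae_of_all _ fun y => ?_)
  · exact (hκ.1.mul ((mFourier n).continuous.comp
      continuous_toTorus).aestronglyMeasurable).const_mul _
  · rw [norm_mul, norm_mul, norm_mFourier_apply, mul_one, Complex.norm_real, Real.norm_eq_abs,
      abs_of_nonneg (by positivity)]
  · simp only [tsum_mul_right]
    exact hκ.norm.const_mul _
  · refine ((hasSum_autocorr hG (toTorus y)).mul_left (κ y)).congr_fun fun n => ?_
    ring

lemma hasSum_integral_cube {φ : (Fin 3 → ℝ) → ℂ} (hφ : Integrable φ) :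
    HasSum (fun m : Fin 3 → ℤ => ∫ x in cube, φ (x + castVec m)) (∫ y, φ y) := by
  obtain ⟨s, hs⟩ : ∃ s : (Fin 3 → ℤ) → Set (Fin 3 → ℝ), s = fun m =>
    Set.univ.pi fun i => Set.Ioc (m i : ℝ) (m i + 1) := ⟨_, rfl⟩
  have hmem : ∀ m x, x ∈ s m ↔ ∀ i, (m i : ℝ) < x i ∧ x i ≤ m i + 1 := by
    intro m x; rw [hs]; simp
  have hU : ⋃ m, s m = Set.univ := by
    refine Set.eq_univ_of_forall fun x => Set.mem_iUnion.2 ⟨fun i => ⌈x i⌉ - 1, ?_⟩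
    rw [hmem]
    intro i
    push_cast
    constructor <;> linarith [Int.ceil_lt_add_one (x i), Int.le_ceil (x i)]
  have hm : ∀ m, MeasurableSet (s m) := fun m => by
    rw [hs]; exact MeasurableSet.univ_pi fun _ => measurableSet_Ioc
  have hd : Pairwise (Function.onFun Disjoint s) := by
    intro m n hmn
    refine Set.disjoint_left.2 fun x h1 h2 => hmn ?_
    rw [hmem] at h1 h2
    ext i
    have h3 : (m i : ℝ) < n i + 1 := by linarith [(h1 i).1, (h2 i).2]
    have h4 : (n i : ℝ) < m i + 1 := by linarith [(h1 i).2, (h2 i).1]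
    have h5 : m i < n i + 1 := by exact_mod_cast h3
    have h6 : n i < m i + 1 := by exact_mod_cast h4
    omega
  have h := hasSum_integral_iUnion hm hd (hφ.integrableOn (s := ⋃ m, s m))
  rw [hU, setIntegral_univ] at h
  refine h.congr_fun fun m => ?_
  have hpre : (fun x => x + castVec m) ⁻¹' s m = cube := by
    ext x
    rw [Set.mem_preimage, hmem]
    simp only [cube, castVec, Pi.add_apply, Set.mem_ofPred_eq, Set.mem_Ioc]
    refine forall_congr' fun i => and_congr ?_ ?_ <;> constructor <;> intro h <;> linarith
  rw [← hpre]
  exact (measurePreserving_add_right volume (castVec m)).setIntegral_preimage_emb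
    (measurableEmbedding_addRight _) φ (s m)

lemma norm_integral_mul_autocorr_le {G : T3 → ℂ} (hm : Measurable G) (hb : ∀ t, ‖G t‖ ≤ 1)
    {κ : (Fin 3 → ℝ) → ℂ} (hκ : Integrable κ) {D : ℝ} (hD0 : 0 ≤ D)
    (hD : ∀ x ∈ cube, ∀ J, ‖∑ m ∈ dyadicBox J, κ (x + castVec m)‖ ≤ D) :
    ‖∫ y, κ y * autocorr G (toTorus y)‖ ≤ D * (∫ t, ‖G t‖ ∂haarT) ^ 2 := by
  have hR := continuous_autocorr (memLp_of_bound hm hb 2)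
  obtain ⟨M, hM⟩ : ∃ M, ∀ t, ‖autocorr G t‖ ≤ M := by
    obtain ⟨M, hM⟩ := isCompact_univ.exists_bound_of_continuousOn hR.continuousOn
    exact ⟨M, fun t => hM t trivial⟩
  have hint : Integrable (fun y => κ y * autocorr G (toTorus y)) :=
    hκ.mul_bdd (c := M) (hR.comp continuous_toTorus).aestronglyMeasurable
      (ae_of_all _ fun y => hM _)
  have htend := (hasSum_integral_cube hint).comp tendsto_dyadicBox
  refine le_of_tendsto htend.norm (Eventually.of_forall fun J => ?_)
  have hshift : ∀ m : Fin 3 → ℤ, Integrable (fun x => κ (x + castVec m)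
      * autocorr G (toTorus (x + castVec m))) := fun m => hint.comp_add_right (castVec m)
  have hRint : IntegrableOn (fun x => ‖autocorr G (toTorus x)‖) cube := by
    refine Measure.integrableOn_of_bounded (M := M) ?_
      (hR.comp continuous_toTorus).norm.aestronglyMeasurable (ae_of_all _ fun y => ?_)
    · rw [cube_eq_pi, Real.volume_pi_Ioc]
      simp
    · rw [norm_norm]; exact hM _
  simp only [Function.comp_apply]
  rw [← integral_finsetSum _ fun m _ => (hshift m).integrableOn]
  calc _ ≤ ∫ x in cube, D * ‖autocorr G (toTorus x)‖ := by
        refine norm_integral_le_of_norm_le (hRint.const_mul D) ?_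
        refine (ae_restrict_iff' measurableSet_cube).2 (ae_of_all _ fun x hx => ?_)
        simp only [toTorus_add_castVec]
        rw [← Finset.sum_mul, norm_mul]
        exact mul_le_mul_of_nonneg_right (hD x hx J) (norm_nonneg _)
    _ = D * ∫ t, ‖autocorr G t‖ ∂haarT := by
        rw [integral_const_mul, integral_haarT]
    _ ≤ _ := mul_le_mul_of_nonneg_left (integral_norm_autocorr_le hm hb) hD0

/-- The fundamental solution `exp (-2 π c r) / r` as a function of the radius. -/
noncomputable def yukawa (c : ℂ) (r : ℝ) : ℂ := Complex.exp (-(2 * Real.pi * c * r)) / r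

lemma norm_yukawa (c : ℂ) {r : ℝ} (hr : 0 ≤ r) :
    ‖yukawa c r‖ = Real.exp (-(2 * Real.pi * c.re * r)) / r := by
  rw [yukawa, norm_div, Complex.norm_exp, Complex.norm_real, Real.norm_of_nonneg hr]
  congr 3
  simp

lemma measurable_yukawa (c : ℂ) : Measurable (yukawa c) := by
  unfold yukawa
  fun_prop

lemma ker_eq_yukawa (lam δ : ℝ) (X : E3) : ker lam δ X = yukawa (δ - lam * Complex.I) ‖X‖ := by
  rw [ker, yukawa, expi, Complex.ofReal_div, Complex.ofReal_exp, div_mul_eq_mul_div,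
    ← Complex.exp_add]
  congr 2
  push_cast
  ring

lemma integrable_yukawa {c : ℂ} (hc : 0 < c.re) : Integrable (fun X : E3 => yukawa c ‖X‖) := by
  rw [integrable_fun_norm_addHaar volume (f := yukawa c)]
  have h := integrableOn_rpow_mul_exp_neg_mul_rpow (p := 1) (s := 1) (b := 2 * Real.pi * c.re)
    (by norm_num) one_pos (by positivity)
  simp only [Real.rpow_one] at h
  refine Integrable.mono' h ((by fun_prop : Measurable fun y : ℝ => y ^ (Module.finrank ℝ E3 - 1)).smul
    (measurable_yukawa c)).aestronglyMeasurable ?_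
  refine (ae_restrict_iff' measurableSet_Ioi).2 (ae_of_all _ fun y (hy : 0 < y) => ?_)
  rw [norm_smul, norm_yukawa c hy.le, finrank_euclideanSpace, Fintype.card_fin, Real.norm_of_nonneg
    (by positivity), neg_mul]
  refine le_of_eq ?_
  field_simp

lemma integral_radial_yukawa {c : ℂ} (hc : 0 < c.re) {z : ℝ} (hz : z ≠ 0) :
    ∫ r in Set.Ioi (0 : ℝ), (r : ℂ) * yukawa c (Real.sqrt (z ^ 2 + r ^ 2))
      = Complex.exp (-(2 * Real.pi * c * |z|)) / (2 * Real.pi * c) := by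
  have hc0 : c ≠ 0 := by rintro rfl; simp at hc
  have hp : (2 * Real.pi * c : ℂ) ≠ 0 := by
    simp [hc0, Real.pi_ne_zero]
  have hpos : ∀ r : ℝ, 0 < z ^ 2 + r ^ 2 := fun r => by positivity
  have hsq : ∀ r : ℝ, 0 < Real.sqrt (z ^ 2 + r ^ 2) := fun r => Real.sqrt_pos.2 (hpos r)
  have hderiv : ∀ r : ℝ, HasDerivAt (fun r : ℝ => -Complex.exp (-(2 * Real.pi * c
      * (Real.sqrt (z ^ 2 + r ^ 2) : ℝ))) / (2 * Real.pi * c))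
      ((r : ℂ) * yukawa c (Real.sqrt (z ^ 2 + r ^ 2))) r := by
    intro r
    have h1 : HasDerivAt (fun r : ℝ => Real.sqrt (z ^ 2 + r ^ 2)) (r / Real.sqrt (z ^ 2 + r ^ 2)) r := by
      have h : HasDerivAt (fun r : ℝ => z ^ 2 + r ^ 2) (2 * r) r := by
        simpa using (hasDerivAt_pow 2 r).const_add (z ^ 2)
      exact (h.sqrt (hpos r).ne').congr_deriv (mul_div_mul_left _ _ two_ne_zero)
    have h2 := ((((h1.ofReal_comp).const_mul (2 * Real.pi * c : ℂ)).neg).cexp.neg).div_const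
      (2 * Real.pi * c : ℂ)
    refine h2.congr_deriv ?_
    rw [yukawa]
    push_cast
    have : (Real.sqrt (z ^ 2 + r ^ 2) : ℂ) ≠ 0 := by exact_mod_cast (hsq r).ne'
    field_simp
    exact mul_comm _ _
  have hlim : Tendsto (fun r : ℝ => -Complex.exp (-(2 * Real.pi * c
      * (Real.sqrt (z ^ 2 + r ^ 2) : ℝ))) / (2 * Real.pi * c)) atTop (𝓝 0) := by
    have h1 : Tendsto (fun r : ℝ => Real.sqrt (z ^ 2 + r ^ 2)) atTop atTop := by
      refine tendsto_atTop_mono (fun r => Real.le_sqrt_of_sq_le ?_) tendsto_id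
      simp [sq_nonneg]
    have h2 : Tendsto (fun r : ℝ => Complex.exp (-(2 * Real.pi * c
        * (Real.sqrt (z ^ 2 + r ^ 2) : ℝ)))) atTop (𝓝 0) := by
      rw [Complex.tendsto_exp_nhds_zero_iff]
      have h3 : ∀ r : ℝ, (-(2 * Real.pi * c * (Real.sqrt (z ^ 2 + r ^ 2) : ℝ))).re
          = -(2 * Real.pi * c.re * Real.sqrt (z ^ 2 + r ^ 2)) := fun r => by simp
      simp only [h3]
      exact tendsto_neg_atTop_atBot.comp (h1.const_mul_atTop (by positivity))
    simpa using h2.neg.div_const (2 * Real.pi * c : ℂ)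
  have hint : IntegrableOn (fun r : ℝ => (r : ℂ) * yukawa c (Real.sqrt (z ^ 2 + r ^ 2)))
      (Set.Ioi 0) := by
    have h := integrableOn_exp_mul_Ioi (a := -(2 * Real.pi * c.re)) (by
      have : 0 < 2 * Real.pi * c.re := by positivity
      linarith) 0
    refine Integrable.mono' h ?_ ?_
    · exact ((Complex.measurable_ofReal).mul ((measurable_yukawa c).comp
        (by fun_prop))).aestronglyMeasurable
    · refine (ae_restrict_iff' measurableSet_Ioi).2 (ae_of_all _ fun r (hr : 0 < r) => ?_)
      have h4 : r ≤ Real.sqrt (z ^ 2 + r ^ 2) := Real.le_sqrt_of_sq_le (by simp [sq_nonneg])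
      rw [norm_mul, norm_yukawa c (hsq r).le, Complex.norm_real, Real.norm_of_nonneg hr.le,
        ← mul_div_assoc, div_le_iff₀ (hsq r), mul_comm]
      refine mul_le_mul (Real.exp_le_exp.2 ?_) h4 hr.le (Real.exp_pos _).le
      rw [neg_mul]
      exact neg_le_neg (mul_le_mul_of_nonneg_left h4 (by positivity))
  rw [integral_Ioi_of_hasDerivAt_of_tendsto' (fun r _ => hderiv r) hint hlim]
  simp [Real.sqrt_sq_eq_abs, neg_div]

lemma integral_plane_yukawa {c : ℂ} (hc : 0 < c.re) {z : ℝ} (hz : z ≠ 0) :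
    ∫ q : ℝ × ℝ, yukawa c (Real.sqrt (z ^ 2 + (q.1 ^ 2 + q.2 ^ 2)))
      = Complex.exp (-(2 * Real.pi * c * |z|)) / c := by
  have hc0 : c ≠ 0 := by rintro rfl; simp at hc
  rw [← integral_comp_polarCoord_symm]
  have h : ∀ p : ℝ × ℝ, p.1 • yukawa c (Real.sqrt (z ^ 2 + ((polarCoord.symm p).1 ^ 2
      + (polarCoord.symm p).2 ^ 2)))
      = (fun r : ℝ => (r : ℂ) * yukawa c (Real.sqrt (z ^ 2 + r ^ 2))) p.1 * (fun _ => 1) p.2 := by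
    intro p
    have h1 : (polarCoord.symm p).1 ^ 2 + (polarCoord.symm p).2 ^ 2 = p.1 ^ 2 := by
      simp only [polarCoord_symm_apply]
      linear_combination p.1 ^ 2 * Real.cos_sq_add_sin_sq p.2
    rw [h1]
    simp
  simp only [h]
  rw [polarCoord_target, Measure.volume_eq_prod]
  refine (setIntegral_prod_mul (fun r : ℝ => (r : ℂ) * yukawa c (Real.sqrt (z ^ 2 + r ^ 2)))
    (fun _ => 1) _ _).trans ?_
  rw [integral_radial_yukawa hc hz]
  simp only [integral_const, measureReal_restrict_apply_univ, Real.volume_real_Ioo]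
  rw [max_eq_left (by linarith [Real.pi_pos])]
  simp
  have : (Real.pi : ℂ) ≠ 0 := by simp [Real.pi_ne_zero]
  field_simp
  ring

lemma integral_exp_abs {c : ℂ} (hc : 0 < c.re) (κ : ℝ) :
    ∫ z : ℝ, Complex.exp (-(2 * Real.pi * c * |z|)) / c * expi (κ * z)
      = 1 / (Real.pi * (c ^ 2 + κ ^ 2)) := by
  have hpi := Real.pi_pos
  have hc0 : c ≠ 0 := by rintro rfl; simp at hc
  obtain ⟨a, ha⟩ : ∃ a : ℂ, a = 2 * Real.pi * (-c + κ * Complex.I) := ⟨_, rfl⟩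
  obtain ⟨b, hb⟩ : ∃ b : ℂ, b = 2 * Real.pi * (c + κ * Complex.I) := ⟨_, rfl⟩
  have hare : a.re < 0 := by
    have : a.re = -(2 * Real.pi * c.re) := by rw [ha]; simp
    rw [this]
    have : 0 < 2 * Real.pi * c.re := by positivity
    linarith
  have hbre : 0 < b.re := by
    have : b.re = 2 * Real.pi * c.re := by rw [hb]; simp
    rw [this]
    positivity
  have h1 : ∀ z ∈ Set.Ioi (0 : ℝ), Complex.exp (-(2 * Real.pi * c * |z|)) / c * expi (κ * z)
      = Complex.exp (a * z) / c := by
    intro z hz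
    rw [abs_of_pos hz, expi, div_mul_eq_mul_div, ← Complex.exp_add, ha]
    congr 2; push_cast; ring
  have h2 : ∀ z ∈ Set.Iic (0 : ℝ), Complex.exp (-(2 * Real.pi * c * |z|)) / c * expi (κ * z)
      = Complex.exp (b * z) / c := by
    intro z hz
    rw [abs_of_nonpos hz, expi, div_mul_eq_mul_div, ← Complex.exp_add, hb]
    congr 2; push_cast; ring
  have i1 : IntegrableOn (fun z : ℝ => Complex.exp (-(2 * Real.pi * c * |z|)) / c * expi (κ * z))
      (Set.Ioi 0) := by
    rw [integrableOn_congr_fun h1 measurableSet_Ioi]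
    exact (integrableOn_exp_mul_complex_Ioi hare 0).div_const c
  have i2 : IntegrableOn (fun z : ℝ => Complex.exp (-(2 * Real.pi * c * |z|)) / c * expi (κ * z))
      (Set.Iic 0) := by
    rw [integrableOn_congr_fun h2 measurableSet_Iic]
    exact (integrableOn_exp_mul_complex_Iic hbre 0).div_const c
  rw [← intervalIntegral.integral_Iic_add_Ioi i2 i1, setIntegral_congr_fun measurableSet_Ioi h1,
    setIntegral_congr_fun measurableSet_Iic h2, integral_div, integral_div,
    integral_exp_mul_complex_Ioi hare, integral_exp_mul_complex_Iic hbre]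
  have ha0 : a ≠ 0 := by rintro rfl; simp at hare
  have hb0 : b ≠ 0 := by rintro rfl; simp at hbre
  have hpi' : (Real.pi : ℂ) ≠ 0 := by simp [hpi.ne']
  have hprod : a * b = -(4 * Real.pi ^ 2) * (c ^ 2 + κ ^ 2) := by
    rw [ha, hb]
    linear_combination (4 * Real.pi ^ 2 * κ ^ 2 : ℂ) * Complex.I_sq
  have hcκ : c ^ 2 + (κ : ℂ) ^ 2 ≠ 0 := by
    intro h0
    rw [h0, mul_zero] at hprod
    exact (mul_ne_zero ha0 hb0) hprod
  have hsub : a - b = -(4 * Real.pi) * c := by rw [ha, hb]; ring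
  simp only [Complex.ofReal_zero, mul_zero, Complex.exp_zero]
  rw [show (1 : ℂ) / b / c + -1 / a / c = (a - b) / (a * b * c) by field_simp; ring, hprod, hsub]
  field_simp

lemma continuous_expi : Continuous expi := by
  unfold expi
  fun_prop

lemma integrable_yukawa_mul_expi {c : ℂ} (hc : 0 < c.re) (ξ : E3) :
    Integrable (fun X : E3 => yukawa c ‖X‖ * expi (inner ℝ ξ X)) :=
  (integrable_yukawa hc).mul_bdd (c := 1)
    (continuous_expi.comp (continuous_const.inner continuous_id)).aestronglyMeasurable
    (ae_of_all _ fun _ => (norm_expi _).le)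

lemma integral_yukawa_mul_expi_coord {c : ℂ} (hc : 0 < c.re) (κ : ℝ) :
    ∫ X : E3, yukawa c ‖X‖ * expi (κ * X 0) = 1 / (Real.pi * (c ^ 2 + κ ^ 2)) := by
  have hint := integrable_yukawa_mul_expi hc (EuclideanSpace.single 0 κ)
  have hinner : ∀ X : E3, inner ℝ (EuclideanSpace.single 0 κ) X = κ * X 0 := fun X => by
    rw [EuclideanSpace.inner_single_left]; simp
  simp only [hinner] at hint
  obtain ⟨e, he⟩ : ∃ e : ℝ × (ℝ × ℝ) ≃ᵐ E3, e = (((MeasurableEquiv.refl ℝ).prodCongr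
    (MeasurableEquiv.finTwoArrow (α := ℝ)).symm).trans
    (MeasurableEquiv.piFinSuccAbove (fun _ : Fin 3 => ℝ) 0).symm).trans
    (MeasurableEquiv.toLp 2 (Fin 3 → ℝ)) := ⟨_, rfl⟩
  have hmp : MeasurePreserving e (volume.prod volume) volume := by
    rw [he]
    exact (((MeasurePreserving.id volume).prod (volume_preserving_finTwoArrow ℝ).symm).trans
      (volume_preserving_piFinSuccAbove (fun _ : Fin 3 => ℝ) 0).symm).trans
      (PiLp.volume_preserving_toLp (Fin 3))
  have h0 : ∀ q, e q 0 = q.1 := fun q => by rw [he]; rfl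
  have h1 : ∀ q, e q 1 = q.2.1 := fun q => by rw [he]; rfl
  have h2 : ∀ q, e q 2 = q.2.2 := fun q => by rw [he]; rfl
  have hnorm : ∀ q, ‖e q‖ = Real.sqrt (q.1 ^ 2 + (q.2.1 ^ 2 + q.2.2 ^ 2)) := fun q => by
    rw [EuclideanSpace.norm_eq, Fin.sum_univ_three, h0, h1, h2]
    simp [add_assoc]
  rw [← hmp.integral_comp e.measurableEmbedding]
  have hint' := (hmp.integrable_comp_emb e.measurableEmbedding).2 hint
  simp only [Function.comp_def, h0, hnorm] at hint' ⊢
  rw [integral_prod _ hint', ← integral_exp_abs hc κ]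
  refine integral_congr_ae ?_
  have hz : ∀ᵐ z : ℝ, z ≠ 0 := by simp [ae_iff]
  filter_upwards [hz] with z hz
  simp only [integral_mul_const]
  rw [integral_plane_yukawa hc hz]

lemma integral_yukawa_mul_expi {c : ℂ} (hc : 0 < c.re) (ξ : E3) :
    ∫ X : E3, yukawa c ‖X‖ * expi (inner ℝ ξ X) = 1 / (Real.pi * (c ^ 2 + ‖ξ‖ ^ 2)) := by
  obtain ⟨U, hU⟩ : ∃ U : E3 ≃ₗᵢ[ℝ] E3, U (EuclideanSpace.single 0 ‖ξ‖) = ξ :=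
    ⟨_, Submodule.reflection_sub (by simp)⟩
  rw [← integral_yukawa_mul_expi_coord hc, ← U.measurePreserving.integral_comp
    U.toHomeomorph.measurableEmbedding]
  congr 1
  ext X
  rw [U.norm_map]
  congr 2
  conv_lhs => rw [← hU]
  rw [U.inner_map_map, EuclideanSpace.inner_single_left]
  simp

lemma exists_measurePreserving_emb (f : Module.Basis (Fin 3) ℝ E3) : ∃ d : ℝ, 0 < d ∧
    (∀ φ : E3 → ℂ, Integrable φ → Integrable fun x => φ (emb f x)) ∧
    ∀ φ : E3 → ℂ, ∫ x, φ (emb f x) = d * ∫ X, φ X := by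
  obtain ⟨L, hL⟩ : ∃ L : (Fin 3 → ℝ) ≃L[ℝ] E3, ∀ x, L x = emb f x :=
    ⟨f.equivFunL.symm, fun x => by
      change f.equivFun.symm x = _
      rw [f.equivFun_symm_apply, emb]⟩
  have hHaar : (volume.map L).IsAddHaarMeasure := L.isAddHaarMeasure_map volume
  obtain ⟨d, hd⟩ : ∃ d : NNReal, d = Measure.addHaarScalarFactor (volume.map L) volume := ⟨_, rfl⟩
  have hmap : volume.map L = d • (volume : Measure E3) := by
    rw [hd]; exact Measure.isAddLeftInvariant_eq_smul _ _
  have hd0 : 0 < d := by rw [hd]; exact Measure.addHaarScalarFactor_pos_of_isAddHaarMeasure _ _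
  have hemb : MeasurableEmbedding L := L.toHomeomorph.measurableEmbedding
  refine ⟨d, hd0, fun φ hφ => ?_, fun φ => ?_⟩
  · have h : Integrable φ (volume.map L) := by
      rw [hmap]; exact hφ.smul_measure_nnreal
    simpa only [Function.comp_def, hL] using (hemb.integrable_map_iff).1 h
  · have h := hemb.integral_map (μ := volume) φ
    rw [hmap, integral_smul_nnreal_measure] at h
    simp only [hL] at h
    rw [← h]
    rfl

open scoped MatrixOrder in
/-- A basis adapted to the dual quadratic form. -/
lemma exists_basis_Qform {A : Matrix (Fin 3) (Fin 3) ℝ} (hA : A.PosDef) :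
    ∃ f : Module.Basis (Fin 3) ℝ E3, ∀ k : Fin 3 → ℝ, ∃ ξ : E3, ‖ξ‖ ^ 2 = Qform A k ∧
      ∀ x, inner ℝ ξ (emb f x) = ∑ i, k i * x i := by
  obtain ⟨B, hB⟩ := CStarAlgebra.nonneg_iff_eq_star_mul_self.mp hA.posSemidef.nonneg
  rw [Matrix.star_eq_conjTranspose, Matrix.conjTranspose_eq_transpose_of_trivial] at hB
  have hdet : IsUnit B.transpose.det := by
    have h := (Matrix.isUnit_iff_isUnit_det _).1 hA.isUnit
    rw [hB, Matrix.det_mul] at h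
    exact isUnit_of_mul_isUnit_left h
  have hinv : Invertible B.transpose := Matrix.invertibleOfIsUnitDet _ hdet
  obtain ⟨f, hf⟩ : ∃ f : Module.Basis (Fin 3) ℝ E3, f = .ofEquivFun
    ((WithLp.linearEquiv 2 ℝ (Fin 3 → ℝ)).trans (B.transpose.toLinearEquiv' hinv)) := ⟨_, rfl⟩
  have hx : ∀ x, B.transpose.mulVec (emb f x).ofLp = x := fun x => by
    have h : f.equivFun (f.equivFun.symm x) = x := f.equivFun.apply_symm_apply x
    rw [f.equivFun_symm_apply] at h
    conv_rhs => rw [← h]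
    rw [hf, Module.Basis.equivFun_ofEquivFun]
    rfl
  refine ⟨f, fun k => ⟨WithLp.toLp 2 (B.mulVec k), ?_, fun x => ?_⟩⟩
  · rw [EuclideanSpace.real_norm_sq_eq, Qform, hB]
    simp only [Matrix.mul_apply, Matrix.transpose_apply, Matrix.mulVec, dotProduct,
      Fin.sum_univ_three]
    ring
  · have h : dotProduct k (B.transpose.mulVec (emb f x).ofLp) = dotProduct k x := by rw [hx]
    rw [Matrix.dotProduct_mulVec, Matrix.vecMul_transpose] at h
    rw [PiLp.inner_apply]
    refine Eq.trans ?_ h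
    simp [dotProduct, mul_comm]

/-- The imaginary part of the kernel. -/
noncomputable def sinKer (lam δ : ℝ) (X : E3) : ℂ := ((ker lam δ X).im : ℂ)

/-- The Fourier transform of the imaginary part of the kernel, as a function of the frequency. -/
noncomputable def weight (lam δ ν : ℝ) : ℝ :=
  2 * lam * δ / (Real.pi * ((ν ^ 2 + δ ^ 2 - lam ^ 2) ^ 2 + 4 * lam ^ 2 * δ ^ 2))

lemma sinKer_eq (lam δ : ℝ) (X : E3) :
    sinKer lam δ X = (ker lam δ X - (starRingEnd ℂ) (ker lam δ X)) * (2 * Complex.I)⁻¹ := by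
  rw [sinKer, Complex.sub_conj]
  push_cast
  field_simp

lemma integrable_ker {lam δ : ℝ} (hδ : 0 < δ) : Integrable (ker lam δ) := by
  have h : ker lam δ = fun X : E3 => yukawa (δ - lam * Complex.I) ‖X‖ := by
    ext X; exact ker_eq_yukawa lam δ X
  rw [h]
  exact integrable_yukawa (by simpa using hδ)

lemma integrable_sinKer {lam δ : ℝ} (hδ : 0 < δ) : Integrable (sinKer lam δ) :=
  (integrable_ker hδ).im.ofReal

lemma integral_ker_mul_expi {lam δ : ℝ} (hδ : 0 < δ) (ξ : E3) :
    ∫ X, ker lam δ X * expi (inner ℝ ξ X) =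
      1 / (Real.pi * ((δ - lam * Complex.I) ^ 2 + ‖ξ‖ ^ 2)) := by
  simp only [ker_eq_yukawa]
  exact integral_yukawa_mul_expi (by simpa using hδ) ξ

lemma integral_sinKer_mul_expi {lam δ : ℝ} (hlam : 0 < lam) (hδ : 0 < δ) (ξ : E3) :
    ∫ X, sinKer lam δ X * expi (inner ℝ ξ X) = (weight lam δ ‖ξ‖ : ℂ) := by
  have hint : ∀ ζ : E3, Integrable (fun X => ker lam δ X * expi (inner ℝ ζ X)) := fun ζ => by
    simp only [ker_eq_yukawa]
    exact integrable_yukawa_mul_expi (by simpa using hδ) ζ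
  have h1 : ∀ X : E3, sinKer lam δ X * expi (inner ℝ ξ X) =
      (ker lam δ X * expi (inner ℝ ξ X) -
        (starRingEnd ℂ) (ker lam δ X * expi (inner ℝ (-ξ) X))) * (2 * Complex.I)⁻¹ := fun X => by
    rw [map_mul, conj_expi, inner_neg_left, neg_neg, sinKer_eq]
    ring
  simp only [h1]
  rw [integral_mul_const, integral_sub (hint ξ), integral_conj, integral_ker_mul_expi hδ,
    integral_ker_mul_expi hδ, norm_neg, Complex.sub_conj, weight]
  · have h2 : ((1 : ℂ) / (Real.pi * ((δ - lam * Complex.I) ^ 2 + ‖ξ‖ ^ 2))).im = 2 * lam * δ /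
        (Real.pi * ((‖ξ‖ ^ 2 + δ ^ 2 - lam ^ 2) ^ 2 + 4 * lam ^ 2 * δ ^ 2)) := by
      have h3 : ((Real.pi : ℂ) * ((δ - lam * Complex.I) ^ 2 + ‖ξ‖ ^ 2)) =
          ⟨Real.pi * (‖ξ‖ ^ 2 + δ ^ 2 - lam ^ 2), Real.pi * -(2 * δ * lam)⟩ := by
        apply Complex.ext <;> simp [pow_two] <;> ring
      have hπ := Real.pi_pos
      have hp : 0 < (‖ξ‖ ^ 2 + δ ^ 2 - lam ^ 2) ^ 2 + 4 * lam ^ 2 * δ ^ 2 := by positivity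
      rw [h3, one_div, Complex.inv_im, Complex.normSq_mk]
      have : Real.pi * (‖ξ‖ ^ 2 + δ ^ 2 - lam ^ 2) * (Real.pi * (‖ξ‖ ^ 2 + δ ^ 2 - lam ^ 2)) +
        Real.pi * -(2 * δ * lam) * (Real.pi * -(2 * δ * lam)) = Real.pi * (Real.pi *
          ((‖ξ‖ ^ 2 + δ ^ 2 - lam ^ 2) ^ 2 + 4 * lam ^ 2 * δ ^ 2)) := by ring
      rw [this]
      field_simp
    rw [h2]
    push_cast
    field_simp
  · exact (LinearIsometryEquiv.integrable_comp_iff Complex.conjLIE).2 (hint (-ξ))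

lemma mFourier_toTorus (n : Fin 3 → ℤ) (x : Fin 3 → ℝ) :
    UnitAddTorus.mFourier n (toTorus x) = expi (∑ i, (n i : ℝ) * x i) := by
  simp only [UnitAddTorus.mFourier, ContinuousMap.coe_mk, toTorus, Fin.prod_univ_three,
    Fin.sum_univ_three, expi_add]
  simp only [fourier_coe_apply, expi]
  congr 1
  · congr 1 <;> · push_cast; congr 1; ring
  · push_cast; congr 1; ring

lemma weight_nonneg {lam δ : ℝ} (hlam : 0 ≤ lam) (hδ : 0 ≤ δ) (ν : ℝ) : 0 ≤ weight lam δ ν := by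
  have := Real.pi_pos
  unfold weight; positivity

lemma weight_le {lam δ : ℝ} (hlam : 0 < lam) (hδ : 0 < δ) (ν : ℝ) :
    weight lam δ ν ≤ (2 * Real.pi * lam * δ)⁻¹ := by
  have := Real.pi_pos
  have h : 0 < 4 * lam ^ 2 * δ ^ 2 := by positivity
  calc weight lam δ ν ≤ 2 * lam * δ / (Real.pi * (4 * lam ^ 2 * δ ^ 2)) := by
        unfold weight; gcongr; nlinarith [sq_nonneg (ν ^ 2 + δ ^ 2 - lam ^ 2)]
    _ = (2 * Real.pi * lam * δ)⁻¹ := by field_simp; ring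

lemma le_weight {lam δ ν : ℝ} (hlam : 0 < lam) (hδ : 0 < δ) (hδl : δ ≤ lam) (hν : |ν - lam| ≤ δ) :
    (10 * Real.pi * lam * δ)⁻¹ ≤ weight lam δ ν := by
  have hπ := Real.pi_pos
  obtain ⟨h1, h2⟩ := abs_le.1 hν
  have h3 : |ν ^ 2 + δ ^ 2 - lam ^ 2| ≤ 4 * (lam * δ) := by
    rw [abs_le]; constructor <;> nlinarith
  have h4 : (ν ^ 2 + δ ^ 2 - lam ^ 2) ^ 2 ≤ (4 * (lam * δ)) ^ 2 := by
    rw [← sq_abs]; gcongr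
  have h5 : 0 < 4 * lam ^ 2 * δ ^ 2 := by positivity
  calc (10 * Real.pi * lam * δ)⁻¹ = 2 * lam * δ / (Real.pi * (20 * lam ^ 2 * δ ^ 2)) := by
        field_simp; norm_num
    _ ≤ weight lam δ ν := by
        unfold weight; gcongr; nlinarith

lemma ker_im (lam δ : ℝ) (X : E3) : (ker lam δ X).im =
    Real.exp (-(2 * Real.pi * δ * ‖X‖)) / ‖X‖ * Real.sin (2 * Real.pi * (lam * ‖X‖)) := by
  rw [ker, Complex.im_ofReal_mul, expi, Complex.exp_ofReal_mul_I_im]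

lemma norm_sinKer_le {lam δ : ℝ} (hlam : 0 ≤ lam) (hδ : 0 ≤ δ) (X : E3) :
    ‖sinKer lam δ X‖ ≤ 2 * Real.pi * lam := by
  have hπ := Real.pi_pos
  rw [sinKer, Complex.norm_real, ker_im, Real.norm_eq_abs, abs_mul, abs_div, abs_norm,
    Real.abs_exp]
  rcases (norm_nonneg X).eq_or_lt with h | h
  · rw [← h]; simp only [div_zero, zero_mul]; positivity
  · have h1 : |Real.sin (2 * Real.pi * (lam * ‖X‖))| ≤ 2 * Real.pi * (lam * ‖X‖) :=
      Real.abs_sin_le_abs.trans (abs_of_nonneg (by positivity)).le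
    have h2 : Real.exp (-(2 * Real.pi * δ * ‖X‖)) ≤ 1 := by
      rw [Real.exp_le_one_iff]
      have : 0 ≤ 2 * Real.pi * δ * ‖X‖ := by positivity
      linarith
    calc _ ≤ 1 / ‖X‖ * (2 * Real.pi * (lam * ‖X‖)) := by gcongr
      _ = _ := by field_simp

lemma norm_sinKer_sub_le {lam δ δ' : ℝ} (hδ : 0 ≤ δ) (hδ' : δ ≤ δ') (X : E3) :
    ‖sinKer lam δ X - sinKer lam δ' X‖ ≤ 2 * Real.pi * δ' := by
  have hπ := Real.pi_pos
  rw [sinKer, sinKer, ← Complex.ofReal_sub, Complex.norm_real, ker_im, ker_im, ← sub_mul,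
    ← sub_div, Real.norm_eq_abs, abs_mul, abs_div, abs_norm]
  rcases (norm_nonneg X).eq_or_lt with h | h
  · rw [← h]; simp only [div_zero, zero_mul]
    have := hδ.trans hδ'
    positivity
  · have h2 : Real.exp (-(2 * Real.pi * δ * ‖X‖)) ≤ 1 := by
      rw [Real.exp_le_one_iff]
      have : 0 ≤ 2 * Real.pi * δ * ‖X‖ := by positivity
      linarith
    have h3 := Real.add_one_le_exp (-(2 * Real.pi * δ' * ‖X‖))
    have h4 : Real.exp (-(2 * Real.pi * δ' * ‖X‖)) ≤ Real.exp (-(2 * Real.pi * δ * ‖X‖)) := by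
      gcongr
    have h5 : |Real.exp (-(2 * Real.pi * δ * ‖X‖)) - Real.exp (-(2 * Real.pi * δ' * ‖X‖))| ≤
        2 * Real.pi * δ' * ‖X‖ := by
      rw [abs_of_nonneg (by linarith)]; linarith
    calc _ ≤ 2 * Real.pi * δ' * ‖X‖ / ‖X‖ * 1 := by
          have := hδ.trans hδ'
          gcongr
          exact Real.abs_sin_le_one _
      _ = _ := by field_simp

lemma norm_sum_sinKer_sub_le {f : Module.Basis (Fin 3) ℝ E3} {lam δ D : ℝ} {x : Fin 3 → ℝ} {J : ℕ}
    (h : ‖∑ m ∈ dyadicBox J, ker lam δ (emb f x + lat f m) -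
      ∑ m ∈ dyadicBox 0, ker lam δ (emb f x + lat f m)‖ ≤ D) :
    ‖∑ m ∈ dyadicBox J, sinKer lam δ (emb f (x + castVec m)) -
      ∑ m ∈ dyadicBox 0, sinKer lam δ (emb f (x + castVec m))‖ ≤ D := by
  refine le_trans ?_ h
  refine le_trans (le_of_eq ?_) (Complex.abs_im_le_norm _)
  simp only [sinKer, emb_add, lat, ← Complex.ofReal_sum, ← Complex.ofReal_sub,
    Complex.norm_real, Complex.sub_im, Complex.im_sum, Real.norm_eq_abs]

lemma card_dyadicBox_zero : (dyadicBox 0).card = 27 := by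
  rw [dyadicBox]; decide

lemma norm_sum_dyadicBox_le {φ : (Fin 3 → ℤ) → ℂ} {D B : ℝ} {J : ℕ} (hφ : ∀ m, ‖φ m‖ ≤ B)
    (h : ‖∑ m ∈ dyadicBox J, φ m - ∑ m ∈ dyadicBox 0, φ m‖ ≤ D) :
    ‖∑ m ∈ dyadicBox J, φ m‖ ≤ 27 * B + D := by
  have h1 : ‖∑ m ∈ dyadicBox 0, φ m‖ ≤ 27 * B := by
    refine (norm_sum_le_of_le _ fun m _ => hφ m).trans ?_
    rw [Finset.sum_const, card_dyadicBox_zero, nsmul_eq_mul]; norm_num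
  calc _ = ‖(∑ m ∈ dyadicBox J, φ m - ∑ m ∈ dyadicBox 0, φ m) + ∑ m ∈ dyadicBox 0, φ m‖ := by
        rw [sub_add_cancel]
    _ ≤ _ := norm_add_le _ _
    _ ≤ _ := by linarith

lemma norm_le_one_of_mem_cube {x : Fin 3 → ℝ} (hx : x ∈ cube) : ‖x‖ ≤ 1 := by
  rw [pi_norm_le_iff_of_nonneg zero_le_one]
  intro i
  rw [Real.norm_of_nonneg (hx i).1.le]
  exact (hx i).2

/-- The pairing of the kernel with the autocorrelation of a function on the torus. -/
noncomputable def energy (f : Module.Basis (Fin 3) ℝ E3) (lam δ : ℝ) (G : T3 → ℂ) : ℂ :=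
  ∫ y, sinKer lam δ (emb f y) * autocorr G (toTorus y)

open UnitAddTorus in
lemma hasSum_energy {A : Matrix (Fin 3) (Fin 3) ℝ} {f : Module.Basis (Fin 3) ℝ E3} {d lam δ : ℝ}
    (hf : ∀ k : Fin 3 → ℝ, ∃ ξ : E3, ‖ξ‖ ^ 2 = Qform A k ∧
      ∀ x, inner ℝ ξ (emb f x) = ∑ i, k i * x i)
    (hd : ∀ φ : E3 → ℂ, Integrable φ → Integrable fun x => φ (emb f x))
    (hd' : ∀ φ : E3 → ℂ, ∫ x, φ (emb f x) = d * ∫ X, φ X) (hlam : 0 < lam) (hδ : 0 < δ)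
    {G : T3 → ℂ} (hG : MemLp G 2 haarT) :
    HasSum (fun n => ‖mFourierCoeff G n‖ ^ 2 * (d * weight lam δ (Real.sqrt (Qform A (castVec n)))))
      (energy f lam δ G).re := by
  have h := hasSum_integral_mul_autocorr hG (hd _ (integrable_sinKer (lam := lam) hδ))
  refine HasSum.congr_fun (Complex.reCLM.hasSum h) fun n => ?_
  obtain ⟨ξ, h1, h2⟩ := hf (castVec n)
  have h3 : ∫ y, sinKer lam δ (emb f y) * mFourier n (toTorus y) =
      ((d * weight lam δ (Real.sqrt (Qform A (castVec n))) : ℝ) : ℂ) := by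
    rw [← h1, Real.sqrt_sq (norm_nonneg ξ), Complex.ofReal_mul,
      ← integral_sinKer_mul_expi hlam hδ, ← hd']
    congr 1
    ext y
    rw [mFourier_toTorus, h2]
    rfl
  rw [h3, ← Complex.ofReal_mul, Complex.reCLM_apply, Complex.ofReal_re]

section

variable {A : Matrix (Fin 3) (Fin 3) ℝ} {f : Module.Basis (Fin 3) ℝ E3} {d lam δ : ℝ} {G : T3 → ℂ}

open UnitAddTorus in
lemma sum_mul_le_re_energy
    (hf : ∀ k : Fin 3 → ℝ, ∃ ξ : E3, ‖ξ‖ ^ 2 = Qform A k ∧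
      ∀ x, inner ℝ ξ (emb f x) = ∑ i, k i * x i) (hd0 : 0 < d)
    (hd : ∀ φ : E3 → ℂ, Integrable φ → Integrable fun x => φ (emb f x))
    (hd' : ∀ φ : E3 → ℂ, ∫ x, φ (emb f x) = d * ∫ X, φ X) (hlam : 0 < lam) (hδ : 0 < δ)
    (hδl : δ ≤ lam) (hG : MemLp G 2 haarT) {S : Finset (Fin 3 → ℤ)}
    (hS : ∀ k ∈ S, |Real.sqrt (Qform A (castVec k)) - lam| < δ) :
    (∑ k ∈ S, ‖mFourierCoeff G k‖ ^ 2) * (d * (10 * Real.pi * lam * δ)⁻¹) ≤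
      (energy f lam δ G).re := by
  refine le_trans ?_ (sum_le_hasSum S (fun k _ => ?_) (hasSum_energy hf hd hd' hlam hδ hG))
  · rw [Finset.sum_mul]
    refine Finset.sum_le_sum fun k hk => ?_
    have := le_weight hlam hδ hδl (hS k hk).le
    gcongr
  · have := weight_nonneg hlam.le hδ.le (Real.sqrt (Qform A (castVec k)))
    positivity

open UnitAddTorus in
lemma re_energy_le
    (hf : ∀ k : Fin 3 → ℝ, ∃ ξ : E3, ‖ξ‖ ^ 2 = Qform A k ∧
      ∀ x, inner ℝ ξ (emb f x) = ∑ i, k i * x i) (hd0 : 0 < d)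
    (hd : ∀ φ : E3 → ℂ, Integrable φ → Integrable fun x => φ (emb f x))
    (hd' : ∀ φ : E3 → ℂ, ∫ x, φ (emb f x) = d * ∫ X, φ X) (hlam : 0 < lam) (hδ : 0 < δ)
    (hG : MemLp G 2 haarT) :
    (energy f lam δ G).re ≤ (∫ t, ‖G t‖ ^ 2 ∂haarT) * (d * (2 * Real.pi * lam * δ)⁻¹) := by
  refine hasSum_le (fun k => ?_) (hasSum_energy hf hd hd' hlam hδ hG)
    ((hasSum_norm_sq_mFourierCoeff hG).mul_right _)
  have := weight_le hlam hδ (Real.sqrt (Qform A (castVec k)))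
  gcongr

end

/-- Trigonometric polynomials as functions on the torus. -/
noncomputable def torusSum (a : (Fin 3 → ℤ) →₀ ℂ) (t : T3) : ℂ :=
  ∑ k ∈ a.support, a k * UnitAddTorus.mFourier k t

lemma continuous_torusSum (a : (Fin 3 → ℤ) →₀ ℂ) : Continuous (torusSum a) := by
  unfold torusSum; fun_prop

open UnitAddTorus in
lemma norm_integral_torusSum_mul_conj_le (a : (Fin 3 → ℤ) →₀ ℂ) {G : T3 → ℂ}
    (hG : Integrable G haarT) :
    ‖∫ t, torusSum a t * (starRingEnd ℂ) (G t) ∂haarT‖ ^ 2 ≤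
      (∑ k ∈ a.support, ‖a k‖ ^ 2) * ∑ k ∈ a.support, ‖mFourierCoeff G k‖ ^ 2 := by
  have hint : ∀ k : Fin 3 → ℤ, Integrable (fun t => mFourier k t * (starRingEnd ℂ) (G t)) haarT :=
    fun k => ((LinearIsometryEquiv.integrable_comp_iff Complex.conjLIE).2 hG).bdd_mul (c := 1)
      (mFourier k).continuous.aestronglyMeasurable
      (ae_of_all _ fun t => (norm_mFourier_apply k t).le)
  have hcoeff : ∀ k, ∫ t, mFourier k t * (starRingEnd ℂ) (G t) ∂haarT =
      (starRingEnd ℂ) (mFourierCoeff G k) := fun k => by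
    change _ = (starRingEnd ℂ) (∫ t, mFourier (-k) t • G t ∂haarT)
    rw [← integral_conj]
    congr 1
    ext t
    rw [mFourier_neg, smul_eq_mul, map_mul, Complex.conj_conj]
  have h : ∫ t, torusSum a t * (starRingEnd ℂ) (G t) ∂haarT =
      ∑ k ∈ a.support, a k * (starRingEnd ℂ) (mFourierCoeff G k) := by
    simp only [torusSum, Finset.sum_mul, mul_assoc]
    rw [integral_finsetSum _ fun k _ => (hint k).const_mul _]
    refine Finset.sum_congr rfl fun k _ => ?_
    rw [integral_const_mul, hcoeff]
  rw [h]
  refine le_trans ?_ (Finset.sum_mul_sq_le_sq_mul_sq _ _ _)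
  gcongr
  refine norm_sum_le_of_le _ fun k _ => ?_
  rw [norm_mul, RCLike.norm_conj]

/-- The measure of the set where the trigonometric polynomial exceeds `α`. -/
noncomputable def levelMeasure (a : (Fin 3 → ℤ) →₀ ℂ) (α : ℝ) : ℝ :=
  haarT.real {t | α < ‖torusSum a t‖}

open UnitAddTorus in
lemma exists_levelSet_multiplier (a : (Fin 3 → ℤ) →₀ ℂ) {α : ℝ} (hα : 0 ≤ α) :
    ∃ G : T3 → ℂ, Measurable G ∧ (∀ t, ‖G t‖ ≤ 1) ∧ ∫ t, ‖G t‖ ∂haarT ≤ levelMeasure a α ∧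
      ∫ t, ‖G t‖ ^ 2 ∂haarT ≤ levelMeasure a α ∧
      (α * levelMeasure a α) ^ 2 ≤
        (∑ k ∈ a.support, ‖a k‖ ^ 2) * ∑ k ∈ a.support, ‖mFourierCoeff G k‖ ^ 2 := by
  obtain ⟨E, hE⟩ : ∃ E : Set T3, E = {t | α < ‖torusSum a t‖} := ⟨_, rfl⟩
  have hEm : MeasurableSet E := by
    rw [hE]
    exact (isOpen_lt continuous_const (continuous_torusSum a).norm).measurableSet
  have hpos : ∀ t ∈ E, 0 < ‖torusSum a t‖ := fun t ht => hα.trans_lt (by rw [hE] at ht; exact ht)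
  obtain ⟨G, hG⟩ : ∃ G : T3 → ℂ,
      G = E.indicator fun t => torusSum a t / (‖torusSum a t‖ : ℂ) := ⟨_, rfl⟩
  have hGm : Measurable G := by
    rw [hG]
    refine Measurable.indicator ?_ hEm
    have := (continuous_torusSum a).measurable
    fun_prop
  have hnorm : ∀ t, ‖G t‖ = E.indicator (fun _ => (1 : ℝ)) t := fun t => by
    rw [hG]
    by_cases ht : t ∈ E
    · rw [Set.indicator_of_mem ht, Set.indicator_of_mem ht, norm_div, Complex.norm_real, norm_norm,
        div_self (hpos t ht).ne']
    · rw [Set.indicator_of_notMem ht, Set.indicator_of_notMem ht, norm_zero]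
  have hle : ∀ t, ‖G t‖ ≤ 1 := fun t => by
    rw [hnorm]; exact Set.indicator_le_self' (fun _ _ => zero_le_one) t
  have hint : ∫ t, E.indicator (fun _ => (1 : ℝ)) t ∂haarT = levelMeasure a α := by
    rw [integral_indicator hEm, levelMeasure, ← hE]; simp
  refine ⟨G, hGm, hle, ?_, ?_, ?_⟩
  · simp only [hnorm]; exact hint.le
  · rw [← hint]
    refine le_of_eq (integral_congr_ae (ae_of_all _ fun t => ?_))
    simp only [hnorm]
    by_cases ht : t ∈ E <;> simp [ht]
  · refine le_trans ?_ (norm_integral_torusSum_mul_conj_le a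
      (memLp_one_iff_integrable.1 (memLp_of_bound hGm hle 1)))
    have h1 : ∀ t, torusSum a t * (starRingEnd ℂ) (G t) =
        ((E.indicator (fun t => ‖torusSum a t‖) t : ℝ) : ℂ) := fun t => by
      rw [hG]
      by_cases ht : t ∈ E
      · have h0 : (‖torusSum a t‖ : ℂ) ≠ 0 := by exact_mod_cast (hpos t ht).ne'
        rw [Set.indicator_of_mem ht, Set.indicator_of_mem ht, map_div₀, Complex.conj_ofReal,
          ← mul_div_assoc, Complex.mul_conj, Complex.normSq_eq_norm_sq, Complex.ofReal_pow]
        field_simp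
      · simp [ht]
    have h2 : levelMeasure a α * α ≤ ∫ t, E.indicator (fun t => ‖torusSum a t‖) t ∂haarT := by
      rw [← hint, ← integral_mul_const]
      refine integral_mono ((integrable_const (1 : ℝ)).indicator hEm |>.mul_const _)
        (((continuous_torusSum a).norm.integrable_of_hasCompactSupport
          (HasCompactSupport.of_compactSpace _)).indicator hEm) fun t => ?_
      by_cases ht : t ∈ E
      · have : α < ‖torusSum a t‖ := by rw [hE] at ht; exact ht
        simpa [ht] using this.le
      · simp [ht]
    have h3 : 0 ≤ levelMeasure a α := measureReal_nonneg
    simp only [h1]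
    rw [integral_complex_ofReal, Complex.norm_real, Real.norm_eq_abs, sq_abs, mul_comm α]
    gcongr

/-- The oscillating lattice sum away from the origin is at most `D`. -/
def FarBound (f : Module.Basis (Fin 3) ℝ E3) (lam δ D : ℝ) : Prop :=
  ∀ x : Fin 3 → ℝ, ‖x‖ ≤ 1 → ∀ J, ‖∑ m ∈ dyadicBox J, ker lam δ (emb f x + lat f m) -
    ∑ m ∈ dyadicBox 0, ker lam δ (emb f x + lat f m)‖ ≤ D

section

variable {f : Module.Basis (Fin 3) ℝ E3} {lam δ δ' D D' : ℝ} {G : T3 → ℂ}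

lemma FarBound.nonneg (h : FarBound f lam δ D) : 0 ≤ D :=
  (norm_nonneg _).trans (h 0 (by simp) 0)

lemma norm_energy_le (hd : ∀ φ : E3 → ℂ, Integrable φ → Integrable fun x => φ (emb f x))
    (hlam : 0 < lam) (hδ : 0 < δ) (hD : FarBound f lam δ D) (hm : Measurable G)
    (hb : ∀ t, ‖G t‖ ≤ 1) :
    ‖energy f lam δ G‖ ≤ (27 * (2 * Real.pi * lam) + D) * (∫ t, ‖G t‖ ∂haarT) ^ 2 := by
  have hπ := Real.pi_pos
  have hD0 := hD.nonneg
  exact norm_integral_mul_autocorr_le hm hb (hd _ (integrable_sinKer hδ)) (by positivity)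
    fun x hx J => norm_sum_dyadicBox_le (fun m => norm_sinKer_le hlam.le hδ.le _)
      (norm_sum_sinKer_sub_le (hD x (norm_le_one_of_mem_cube hx) J))

lemma integrable_sinKer_mul_autocorr
    (hd : ∀ φ : E3 → ℂ, Integrable φ → Integrable fun x => φ (emb f x)) (hδ : 0 < δ)
    (hG : MemLp G 2 haarT) :
    Integrable fun y => sinKer lam δ (emb f y) * autocorr G (toTorus y) := by
  have hR := continuous_autocorr hG
  obtain ⟨M, hM⟩ := isCompact_univ.exists_bound_of_continuousOn hR.continuousOn
  exact (hd _ (integrable_sinKer hδ)).mul_bdd (c := M)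
    (hR.comp continuous_toTorus).aestronglyMeasurable (ae_of_all _ fun y => hM _ trivial)

lemma norm_energy_sub_le (hd : ∀ φ : E3 → ℂ, Integrable φ → Integrable fun x => φ (emb f x))
    (hδ : 0 < δ) (hδ' : δ ≤ δ') (hD : FarBound f lam δ D) (hD' : FarBound f lam δ' D')
    (hm : Measurable G) (hb : ∀ t, ‖G t‖ ≤ 1) :
    ‖energy f lam δ G - energy f lam δ' G‖ ≤
      (27 * (2 * Real.pi * δ') + (D + D')) * (∫ t, ‖G t‖ ∂haarT) ^ 2 := by
  have hπ := Real.pi_pos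
  have h0' := hδ.trans_le hδ'
  have hG := memLp_of_bound hm hb 2
  have hD0 := hD.nonneg
  have hD0' := hD'.nonneg
  rw [energy, energy, ← integral_sub (integrable_sinKer_mul_autocorr hd hδ hG)
    (integrable_sinKer_mul_autocorr hd h0' hG)]
  simp only [← sub_mul]
  refine norm_integral_mul_autocorr_le (κ := fun y => sinKer lam δ (emb f y) - sinKer lam δ' (emb f y))
    hm hb ((hd _ (integrable_sinKer hδ)).sub (hd _ (integrable_sinKer h0'))) (by positivity)
    fun x hx J => norm_sum_dyadicBox_le (fun m => norm_sinKer_sub_le hδ.le hδ' _) ?_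
  rw [Finset.sum_sub_distrib, Finset.sum_sub_distrib, sub_sub_sub_comm]
  have hx' := norm_le_one_of_mem_cube hx
  exact (norm_sub_le _ _).trans (add_le_add (norm_sum_sinKer_sub_le (hD x hx' J))
    (norm_sum_sinKer_sub_le (hD' x hx' J)))

end

/-- Bounds for the level sets of trigonometric polynomials with frequencies in a shell. -/
lemma exists_levelMeasure_bound {A : Matrix (Fin 3) (Fin 3) ℝ} {f : Module.Basis (Fin 3) ℝ E3}
    (hf : ∀ k : Fin 3 → ℝ, ∃ ξ : E3, ‖ξ‖ ^ 2 = Qform A k ∧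
      ∀ x, inner ℝ ξ (emb f x) = ∑ i, k i * x i) :
    ∃ K : ℝ, 0 < K ∧ ∀ lam δ D : ℝ, 1 < lam → 0 < δ → δ < 1 → FarBound f lam δ D →
      ∀ a : (Fin 3 → ℤ) →₀ ℂ,
        (∀ k ∈ a.support, |Real.sqrt (Qform A fun i => (k i : ℝ)) - lam| < δ) → ∀ α, 0 ≤ α →
        (α * levelMeasure a α) ^ 2 ≤ (∑ k ∈ a.support, ‖a k‖ ^ 2) *
          (K * (lam * δ * (lam + D) * levelMeasure a α ^ 2)) ∧
        ∀ δ', 1 ≤ δ' → (α * levelMeasure a α) ^ 2 ≤ (∑ k ∈ a.support, ‖a k‖ ^ 2) *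
          (K * (δ / δ' * levelMeasure a α + lam * δ * (δ' + D) * levelMeasure a α ^ 2)) := by
  have hπ := Real.pi_pos
  obtain ⟨d, hd0, hd, hd'⟩ := exists_measurePreserving_emb f
  obtain ⟨C, hC0, hC⟩ := exists_far_bound_trivial f
  obtain ⟨K₁, hK₁⟩ : ∃ K₁ : ℝ, K₁ = 10 * Real.pi / d * (54 * Real.pi + 1 + C) := ⟨_, rfl⟩
  have hK₁0 : 0 < K₁ := by rw [hK₁]; positivity
  refine ⟨K₁ + 5, by positivity, fun lam δ D hlam hδ hδ1 hD a ha α hα => ?_⟩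
  have hlam0 : 0 < lam := by linarith
  have hD0 := hD.nonneg
  obtain ⟨G, hm, hb, hG1, hG2, hG3⟩ := exists_levelSet_multiplier a hα
  obtain ⟨M, hM⟩ : ∃ M, M = levelMeasure a α := ⟨_, rfl⟩
  rw [← hM] at hG1 hG2 hG3 ⊢
  have hM0 : 0 ≤ M := by rw [hM]; exact measureReal_nonneg
  have hn1 : 0 ≤ ∫ t, ‖G t‖ ∂haarT := integral_nonneg fun t => norm_nonneg _
  have hsq : (∫ t, ‖G t‖ ∂haarT) ^ 2 ≤ M ^ 2 := by gcongr
  have hlow := sum_mul_le_re_energy hf hd0 hd hd' hlam0 hδ (hδ1.trans hlam).le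
    (memLp_of_bound hm hb 2) ha
  obtain ⟨s, hs⟩ : ∃ s, s = ∑ k ∈ a.support, ‖UnitAddTorus.mFourierCoeff G k‖ ^ 2 := ⟨_, rfl⟩
  rw [← hs] at hlow hG3
  have hfin : ∀ B, s * (d * (10 * Real.pi * lam * δ)⁻¹) ≤ B →
      s ≤ 10 * Real.pi / d * (lam * δ * B) := fun B hB => by
    calc s = 10 * Real.pi / d * (lam * δ * (s * (d * (10 * Real.pi * lam * δ)⁻¹))) := by
          field_simp
      _ ≤ _ := by gcongr
  refine ⟨hG3.trans ?_, fun δ' hδ' => hG3.trans ?_⟩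
  · gcongr
    have h1 : (energy f lam δ G).re ≤ (27 * (2 * Real.pi * lam) + D) * M ^ 2 :=
      (Complex.re_le_norm _).trans ((norm_energy_le hd hlam0 hδ hD hm hb).trans (by gcongr))
    refine (hfin _ (hlow.trans h1)).trans ?_
    have h2 : 27 * (2 * Real.pi * lam) + D ≤ (54 * Real.pi + 1 + C) * (lam + D) := by
      nlinarith [mul_nonneg hπ.le hD0, mul_nonneg hC0 hD0, mul_nonneg hC0 hlam0.le]
    calc _ ≤ 10 * Real.pi / d * (lam * δ * ((54 * Real.pi + 1 + C) * (lam + D) * M ^ 2)) := by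
          gcongr
      _ = K₁ * (lam * δ * (lam + D) * M ^ 2) := by rw [hK₁]; ring
      _ ≤ _ := by gcongr; linarith
  · gcongr
    have hδ'0 : 0 < δ' := by linarith
    have hD' : FarBound f lam δ' C := fun x hx J => (hC lam δ' x J hδ'0 hx).trans <| by
      refine mul_le_of_le_one_right hC0 ?_
      exact Real.rpow_le_one_of_one_le_of_nonpos hδ' (by norm_num)
    have h1 : (energy f lam δ G).re ≤ M * (d * (2 * Real.pi * lam * δ')⁻¹) +
        (27 * (2 * Real.pi * δ') + (D + C)) * M ^ 2 := by
      have h3 := (Complex.re_le_norm _).trans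
        (norm_energy_sub_le hd hδ (hδ1.le.trans hδ') hD hD' hm hb)
      have h4 := re_energy_le hf hd0 hd hd' hlam0 hδ'0 (memLp_of_bound hm hb 2)
      rw [Complex.sub_re] at h3
      have h5 : (27 * (2 * Real.pi * δ') + (D + C)) * (∫ t, ‖G t‖ ∂haarT) ^ 2 ≤
        (27 * (2 * Real.pi * δ') + (D + C)) * M ^ 2 := by gcongr
      have h6 : (∫ t, ‖G t‖ ^ 2 ∂haarT) * (d * (2 * Real.pi * lam * δ')⁻¹) ≤
        M * (d * (2 * Real.pi * lam * δ')⁻¹) := by gcongr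
      linarith
    refine (hfin _ (hlow.trans h1)).trans ?_
    have h2 : 27 * (2 * Real.pi * δ') + (D + C) ≤ (54 * Real.pi + 1 + C) * (δ' + D) := by
      nlinarith [mul_nonneg hπ.le hD0, mul_nonneg hC0 hD0, mul_nonneg hC0 (sub_nonneg.2 hδ')]
    calc _ ≤ 10 * Real.pi / d * (lam * δ * (M * (d * (2 * Real.pi * lam * δ')⁻¹) +
          (54 * Real.pi + 1 + C) * (δ' + D) * M ^ 2)) := by gcongr
      _ = 5 * (δ / δ' * M) + K₁ * (lam * δ * (δ' + D) * M ^ 2) := by rw [hK₁]; field_simp; ring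
      _ ≤ (K₁ + 5) * (δ / δ' * M) + (K₁ + 5) * (lam * δ * (δ' + D) * M ^ 2) := by
          gcongr <;> linarith
      _ = _ := by ring

lemma lintegral_Ioc_rpow {a s B : ℝ} (ha : 0 ≤ a) (hs : 0 < s) (hB : 0 ≤ B) :
    ∫⁻ t in Set.Ioc 0 a, ENNReal.ofReal (B * t ^ (s - 1)) = ENNReal.ofReal (B * (a ^ s / s)) := by
  rw [← ofReal_integral_eq_lintegral_ofReal, ← intervalIntegral.integral_of_le ha,
    intervalIntegral.integral_const_mul, integral_rpow (Or.inl (by linarith)), sub_add_cancel,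
    Real.zero_rpow hs.ne', sub_zero]
  · exact ((intervalIntegrable_iff_integrableOn_Ioc_of_le ha).1
      (intervalIntegral.intervalIntegrable_rpow' (by linarith))).const_mul B
  · refine (ae_restrict_iff' measurableSet_Ioc).2 (ae_of_all _ fun t ht => ?_)
    have := ht.1.le
    simp only [Pi.zero_apply]
    positivity

/-- A bound for an `L^p` norm from weak type bounds. -/
lemma integral_rpow_le_of_level_bounds {Ω : Type*} [MeasurableSpace Ω] {μ : Measure Ω}
    [IsFiniteMeasure μ] {g : Ω → ℝ} (hg0 : ∀ ω, 0 ≤ g ω) (hgm : Measurable g)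
    (hint : Integrable (fun ω => g ω ^ 2) μ) (h2 : ∫ ω, g ω ^ 2 ∂μ ≤ 1) {p a B R : ℝ} (hp : 4 < p)
    (ha : 0 ≤ a) (hB : 0 ≤ B) (hR : 0 ≤ R)
    (hlev : ∀ t, a < t → μ.real {ω | t < g ω} ≤ B / t ^ 4)
    (hlev' : ∀ t, a < t → R < t → μ.real {ω | t < g ω} = 0) :
    ∫ ω, g ω ^ p ∂μ ≤ p * (a ^ (p - 2) / (p - 2)) + p * (B * (R ^ (p - 4) / (p - 4))) := by
  have hp2 : 0 < p - 2 := by linarith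
  have hp4 : 0 < p - 4 := by linarith
  have hp0 : 0 < p := by linarith
  have hcheb : ∀ t, 0 < t → μ.real {ω | t < g ω} ≤ 1 / t ^ 2 := fun t ht => by
    have h := mul_meas_ge_le_integral_of_nonneg (ae_of_all μ fun ω => sq_nonneg (g ω)) hint (t ^ 2)
    have hsub : {ω | t < g ω} ⊆ {ω | t ^ 2 ≤ g ω ^ 2} := fun ω hω =>
      pow_le_pow_left₀ ht.le (le_of_lt hω) 2
    have := measureReal_mono (μ := μ) hsub
    rw [le_div_iff₀ (by positivity)]
    nlinarith [sq_nonneg t]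
  have hpt : ∀ t ∈ Set.Ioi (0 : ℝ), μ {ω | t < g ω} * ENNReal.ofReal (t ^ (p - 1)) ≤
      (Set.Ioc 0 a).indicator (fun t => ENNReal.ofReal (1 * t ^ (p - 2 - 1))) t +
      (Set.Ioc 0 R).indicator (fun t => ENNReal.ofReal (B * t ^ (p - 4 - 1))) t := by
    intro t ht
    have ht0 : 0 < t := ht
    have hrw : μ {ω | t < g ω} * ENNReal.ofReal (t ^ (p - 1)) =
        ENNReal.ofReal (μ.real {ω | t < g ω} * t ^ (p - 1)) := by
      rw [ENNReal.ofReal_mul measureReal_nonneg, ofReal_measureReal]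
    rw [hrw]
    rcases le_or_gt t a with hta | hta
    · refine le_add_right ?_
      rw [Set.indicator_of_mem (Set.mem_Ioc.2 ⟨ht0, hta⟩)]
      refine ENNReal.ofReal_le_ofReal ?_
      calc μ.real {ω | t < g ω} * t ^ (p - 1) ≤ 1 / t ^ 2 * t ^ (p - 1) := by
            gcongr; exact hcheb t ht0
        _ = 1 * t ^ (p - 2 - 1) := by
            rw [show p - 2 - 1 = p - 1 - (2 : ℕ) by push_cast; ring, Real.rpow_sub_natCast ht0.ne']
            ring
    · refine le_add_left ?_
      rcases le_or_gt t R with htR | htR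
      · rw [Set.indicator_of_mem (Set.mem_Ioc.2 ⟨ht0, htR⟩)]
        refine ENNReal.ofReal_le_ofReal ?_
        calc μ.real {ω | t < g ω} * t ^ (p - 1) ≤ B / t ^ 4 * t ^ (p - 1) := by
              gcongr; exact hlev t hta
          _ = B * t ^ (p - 4 - 1) := by
              rw [show p - 4 - 1 = p - 1 - (4 : ℕ) by push_cast; ring,
                Real.rpow_sub_natCast ht0.ne']
              ring
      · rw [hlev' t hta htR]; simp
  have hmeas : ∀ c s : ℝ, Measurable fun t : ℝ => ENNReal.ofReal (c * t ^ s) := fun c s => by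
    fun_prop
  have hbound : ∫⁻ ω, ENNReal.ofReal (g ω ^ p) ∂μ ≤
      ENNReal.ofReal (p * (a ^ (p - 2) / (p - 2)) + p * (B * (R ^ (p - 4) / (p - 4)))) := by
    rw [lintegral_rpow_eq_lintegral_meas_lt_mul μ (ae_of_all _ hg0) hgm.aemeasurable hp0]
    calc _ ≤ ENNReal.ofReal p * ∫⁻ t, ((Set.Ioc 0 a).indicator
            (fun t => ENNReal.ofReal (1 * t ^ (p - 2 - 1))) t +
            (Set.Ioc 0 R).indicator (fun t => ENNReal.ofReal (B * t ^ (p - 4 - 1))) t) := by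
          exact mul_le_mul' le_rfl
            ((setLIntegral_mono' measurableSet_Ioi hpt).trans (setLIntegral_le_lintegral _ _))
      _ = ENNReal.ofReal p * (ENNReal.ofReal (1 * (a ^ (p - 2) / (p - 2))) +
            ENNReal.ofReal (B * (R ^ (p - 4) / (p - 4)))) := by
          rw [lintegral_add_left ((hmeas _ _).indicator measurableSet_Ioc),
            lintegral_indicator measurableSet_Ioc, lintegral_indicator measurableSet_Ioc,
            lintegral_Ioc_rpow ha hp2 zero_le_one, lintegral_Ioc_rpow hR hp4 hB]
      _ = _ := by
          rw [← ENNReal.ofReal_add (by positivity) (by positivity), ← ENNReal.ofReal_mul hp0.le,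
            one_mul, mul_add]
  rw [integral_eq_lintegral_of_nonneg_ae (ae_of_all _ fun ω => Real.rpow_nonneg (hg0 ω) p)
    (hgm.pow_const p).aestronglyMeasurable]
  exact ENNReal.toReal_le_of_le_ofReal (by positivity) hbound

lemma level_arith {K lam δ D α M : ℝ} (hK : 0 < K) (hlam : 0 < lam) (hδ : 0 < δ) (hD : 0 ≤ D)
    (hM : 0 < M) (hα : 4 * K * (lam * δ * (1 + D)) < α ^ 2)
    (h1 : (α * M) ^ 2 ≤ K * (lam * δ * (lam + D) * M ^ 2))
    (h2 : ∀ δ', 1 ≤ δ' → (α * M) ^ 2 ≤ K * (δ / δ' * M + lam * δ * (δ' + D) * M ^ 2)) :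
    M ≤ 8 * K ^ 2 * lam * δ ^ 2 / α ^ 4 ∧ α ^ 2 ≤ 2 * K * lam ^ 2 * δ := by
  have hM2 : 0 < M ^ 2 := by positivity
  have hld : 0 < lam * δ := by positivity
  have hα2 : 0 < α ^ 2 := lt_of_le_of_lt (by positivity) hα
  have hKD : K * (lam * δ * D) ≤ α ^ 2 / 4 := by nlinarith [mul_pos hK hld]
  constructor
  · obtain ⟨δ', hδ'⟩ : ∃ δ', δ' = α ^ 2 / (4 * K * (lam * δ)) := ⟨_, rfl⟩
    have h3 : 1 ≤ δ' := by
      rw [hδ', one_le_div (by positivity)]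
      nlinarith [mul_nonneg (mul_pos hK hld).le hD]
    have h4 := h2 δ' h3
    have h5 : K * (lam * δ * δ') = α ^ 2 / 4 := by rw [hδ']; field_simp
    have h6 : K * (δ / δ' * M) = 4 * K ^ 2 * lam * δ ^ 2 / α ^ 2 * M := by rw [hδ']; field_simp
    have h7 : α ^ 2 / 2 * M ^ 2 ≤ 4 * K ^ 2 * lam * δ ^ 2 / α ^ 2 * M := by
      rw [← h6]
      nlinarith [mul_le_mul_of_nonneg_right hKD hM2.le, congrArg (· * M ^ 2) h5]
    have h8 : α ^ 2 / 2 * M ≤ 4 * K ^ 2 * lam * δ ^ 2 / α ^ 2 := by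
      refine le_of_mul_le_mul_right ?_ hM
      linarith [sq M]
    have h9 : 0 < α ^ 4 := by
      rw [show α ^ 4 = (α ^ 2) ^ 2 by ring]; positivity
    rw [le_div_iff₀ h9]
    rw [le_div_iff₀ hα2] at h8
    linarith
  · have h3 : α ^ 2 ≤ K * (lam * δ * (lam + D)) := by
      refine le_of_mul_le_mul_right ?_ hM2
      linarith
    have h4 : 0 < K * (lam * δ * lam) := by positivity
    linarith

lemma integrable_of_continuous_torus {φ : T3 → ℝ} (h : Continuous φ) : Integrable φ haarT :=
  h.integrable_of_hasCompactSupport (HasCompactSupport.of_compactSpace _)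

open UnitAddTorus in
lemma integral_norm_torusSum_sq_le (a : (Fin 3 → ℤ) →₀ ℂ) :
    ∫ t, ‖torusSum a t‖ ^ 2 ∂haarT ≤ ∑ k ∈ a.support, ‖a k‖ ^ 2 := by
  have hc := continuous_torusSum a
  have hL : MemLp (torusSum a) 2 haarT :=
    hc.memLp_of_hasCompactSupport (HasCompactSupport.of_compactSpace _)
  have h := norm_integral_torusSum_mul_conj_le a (hL.integrable (by norm_num))
  have h1 : ∀ t, torusSum a t * (starRingEnd ℂ) (torusSum a t) =
      ((‖torusSum a t‖ ^ 2 : ℝ) : ℂ) := fun t => by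
    rw [Complex.mul_conj, Complex.normSq_eq_norm_sq]
  simp only [h1] at h
  rw [integral_complex_ofReal, Complex.norm_real, Real.norm_eq_abs, sq_abs] at h
  have h2 : ∑ k ∈ a.support, ‖mFourierCoeff (torusSum a) k‖ ^ 2 ≤
      ∫ t, ‖torusSum a t‖ ^ 2 ∂haarT :=
    sum_le_hasSum _ (fun k _ => by positivity) (hasSum_norm_sq_mFourierCoeff hL)
  have h3 : 0 ≤ ∑ k ∈ a.support, ‖a k‖ ^ 2 := Finset.sum_nonneg fun k _ => by positivity
  have h4 : 0 ≤ ∫ t, ‖torusSum a t‖ ^ 2 ∂haarT := integral_nonneg fun t => by positivity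
  rcases h4.eq_or_lt with h5 | h5
  · rw [← h5]; exact h3
  · refine le_of_mul_le_mul_right ?_ h5
    rw [← sq]
    exact h.trans (by gcongr)

lemma add_rpow_le {x y s : ℝ} (hx : 0 ≤ x) (hy : 0 ≤ y) (hs : 0 ≤ s) :
    (x + y) ^ s ≤ 2 ^ s * (x ^ s + y ^ s) := by
  have hx' := Real.rpow_nonneg hx s
  have hy' := Real.rpow_nonneg hy s
  have h2 : (0 : ℝ) ≤ 2 ^ s := by positivity
  rcases le_total x y with h | h
  · calc (x + y) ^ s ≤ (2 * y) ^ s := by gcongr; linarith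
      _ = 2 ^ s * y ^ s := Real.mul_rpow (by norm_num) hy
      _ ≤ _ := by gcongr; linarith
  · calc (x + y) ^ s ≤ (2 * x) ^ s := by gcongr; linarith
      _ = 2 ^ s * x ^ s := Real.mul_rpow (by norm_num) hx
      _ ≤ _ := by gcongr; linarith

lemma sqrt_rpow {x : ℝ} (hx : 0 ≤ x) (s : ℝ) : Real.sqrt x ^ s = x ^ (s / 2) := by
  rw [Real.sqrt_eq_rpow, ← Real.rpow_mul hx]; ring_nf

lemma exists_integral_rpow_torusSum_le {A : Matrix (Fin 3) (Fin 3) ℝ}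
    {f : Module.Basis (Fin 3) ℝ E3}
    (hf : ∀ k : Fin 3 → ℝ, ∃ ξ : E3, ‖ξ‖ ^ 2 = Qform A k ∧
      ∀ x, inner ℝ ξ (emb f x) = ∑ i, k i * x i) {p C₀ : ℝ} (hp : 4 < p) (hC₀ : 0 ≤ C₀) :
    ∃ C : ℝ, 0 < C ∧ ∀ lam δ E : ℝ, 1 < lam → 0 < δ → δ < 1 → 0 ≤ E →
      E ^ ((p - 2) / 2) ≤ lam ^ ((p - 4) / 2) * δ → FarBound f lam δ (C₀ * E) →
      ∀ a : (Fin 3 → ℤ) →₀ ℂ, a ≠ 0 →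
        (∀ k ∈ a.support, |Real.sqrt (Qform A fun i => (k i : ℝ)) - lam| < δ) →
        ∫ t, ‖torusSum a t‖ ^ p ∂haarT ≤ (∑ k ∈ a.support, ‖a k‖ ^ 2) ^ (p / 2) *
          (C * ((lam * δ) ^ ((p - 2) / 2) + lam ^ (p - 3) * δ ^ (p / 2))) := by
  obtain ⟨K, hK, hlevel⟩ := exists_levelMeasure_bound hf
  have hp2 : 0 < p - 2 := by linarith
  have hp4 : 0 < p - 4 := by linarith
  have hp0 : 0 < p := by linarith
  obtain ⟨C₁, hC₁⟩ : ∃ C₁, C₁ = p / (p - 2) * ((4 * K * (1 + C₀)) ^ ((p - 2) / 2) *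
    2 ^ ((p - 2) / 2)) := ⟨_, rfl⟩
  obtain ⟨C₂, hC₂⟩ : ∃ C₂, C₂ = p / (p - 4) * (8 * K ^ 2 * (2 * K) ^ ((p - 4) / 2)) := ⟨_, rfl⟩
  have hC₁0 : 0 < C₁ := by rw [hC₁]; positivity
  have hC₂0 : 0 < C₂ := by rw [hC₂]; positivity
  refine ⟨C₁ + C₂, by positivity, fun lam δ E hlam hδ hδ1 hE hE' hD a ha hshell => ?_⟩
  have hlam0 : 0 < lam := by linarith
  obtain ⟨S, hS⟩ : ∃ S, S = ∑ k ∈ a.support, ‖a k‖ ^ 2 := ⟨_, rfl⟩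
  have hS0 : 0 < S := by
    rw [hS]
    refine Finset.sum_pos (fun k hk => ?_) (Finsupp.support_nonempty_iff.2 ha)
    have := norm_pos_iff.2 (Finsupp.mem_support_iff.1 hk)
    positivity
  have hs0 := Real.sqrt_pos.2 hS0
  have hss := Real.sq_sqrt hS0.le
  have hc := continuous_torusSum a
  obtain ⟨g, hg⟩ : ∃ g : T3 → ℝ, g = fun t => ‖torusSum a t‖ / Real.sqrt S := ⟨_, rfl⟩
  have hg0 : ∀ t, 0 ≤ g t := fun t => by rw [hg]; positivity
  have hgc : Continuous g := by rw [hg]; exact hc.norm.div_const _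
  have hg2 : ∫ t, g t ^ 2 ∂haarT ≤ 1 := by
    simp only [hg, div_pow, hss, integral_div]
    rw [div_le_one hS0, hS]
    exact integral_norm_torusSum_sq_le a
  obtain ⟨r, hr⟩ : ∃ r, r = Real.sqrt (4 * K * (lam * δ * (1 + C₀ * E))) := ⟨_, rfl⟩
  have hr0 : 0 ≤ r := by rw [hr]; positivity
  have hset : ∀ t, {ω | t < g ω} = {ω | t * Real.sqrt S < ‖torusSum a ω‖} := fun t => by
    ext ω; rw [hg]; exact lt_div_iff₀ hs0
  have hlev : ∀ t, r < t → 0 < haarT.real {ω | t < g ω} →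
      haarT.real {ω | t < g ω} ≤ 8 * K ^ 2 * lam * δ ^ 2 / t ^ 4 ∧
        t ^ 2 ≤ 2 * K * lam ^ 2 * δ := fun t ht hpos => by
    have ht0 : 0 ≤ t := hr0.trans ht.le
    have h := hlevel lam δ _ hlam hδ hδ1 hD a hshell (t * Real.sqrt S) (by positivity)
    rw [levelMeasure, ← hset, ← hS] at h
    have hpull : (t * Real.sqrt S * haarT.real {ω | t < g ω}) ^ 2 =
        S * (t * haarT.real {ω | t < g ω}) ^ 2 := by
      rw [mul_pow, mul_pow, mul_pow, hss]; ring
    rw [hpull] at h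
    refine level_arith hK hlam0 hδ (by positivity) hpos ?_ (le_of_mul_le_mul_left h.1 hS0)
      fun δ' hδ' => le_of_mul_le_mul_left (h.2 δ' hδ') hS0
    rw [hr] at ht
    exact (Real.sqrt_lt' (lt_of_le_of_lt (Real.sqrt_nonneg _) ht)).1 ht
  have hmain := integral_rpow_le_of_level_bounds (μ := haarT) (B := 8 * K ^ 2 * lam * δ ^ 2)
    (R := Real.sqrt (2 * K * lam ^ 2 * δ)) hg0 hgc.measurable
    (integrable_of_continuous_torus (hgc.pow 2)) hg2 hp hr0 (by positivity) (Real.sqrt_nonneg _)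
    (fun t ht => by
      rcases (measureReal_nonneg (μ := haarT) (s := {ω | t < g ω})).eq_or_lt with h | h
      · rw [← h]; positivity
      · exact (hlev t ht h).1)
    (fun t ht ht' => by
      rcases (measureReal_nonneg (μ := haarT) (s := {ω | t < g ω})).eq_or_lt with h | h
      · exact h.symm
      · exact absurd (Real.le_sqrt_of_sq_le (hlev t ht h).2) (not_le.2 ht'))
  have hscale : ∫ t, ‖torusSum a t‖ ^ p ∂haarT = S ^ (p / 2) * ∫ t, g t ^ p ∂haarT := by
    rw [← integral_const_mul]
    congr 1
    ext t
    simp only [hg]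
    rw [Real.div_rpow (norm_nonneg _) hs0.le, sqrt_rpow hS0.le]
    have : 0 < S ^ (p / 2) := by positivity
    field_simp
  rw [hscale, ← hS]
  gcongr
  refine hmain.trans ?_
  have hX : 0 ≤ (lam * δ) ^ ((p - 2) / 2) := by positivity
  have hY : 0 ≤ lam ^ (p - 3) * δ ^ (p / 2) := by positivity
  have h1 : r ^ (p - 2) ≤ (4 * K * (1 + C₀)) ^ ((p - 2) / 2) * 2 ^ ((p - 2) / 2) *
      ((lam * δ) ^ ((p - 2) / 2) + lam ^ (p - 3) * δ ^ (p / 2)) := by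
    rw [hr, sqrt_rpow (by positivity)]
    calc (4 * K * (lam * δ * (1 + C₀ * E))) ^ ((p - 2) / 2)
        ≤ (4 * K * (1 + C₀) * (lam * δ + lam * δ * E)) ^ ((p - 2) / 2) := by
          refine Real.rpow_le_rpow (by positivity) ?_ (by linarith)
          have : 0 ≤ K * (lam * δ) := by positivity
          nlinarith [mul_nonneg this hE, mul_nonneg this hC₀]
      _ = (4 * K * (1 + C₀)) ^ ((p - 2) / 2) * (lam * δ + lam * δ * E) ^ ((p - 2) / 2) :=
          Real.mul_rpow (by positivity) (by positivity)
      _ ≤ (4 * K * (1 + C₀)) ^ ((p - 2) / 2) * (2 ^ ((p - 2) / 2) *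
            ((lam * δ) ^ ((p - 2) / 2) + (lam * δ * E) ^ ((p - 2) / 2))) := by
          gcongr
          exact add_rpow_le (by positivity) (by positivity) (by linarith)
      _ ≤ (4 * K * (1 + C₀)) ^ ((p - 2) / 2) * (2 ^ ((p - 2) / 2) *
            ((lam * δ) ^ ((p - 2) / 2) + lam ^ (p - 3) * δ ^ (p / 2))) := by
          gcongr
          calc (lam * δ * E) ^ ((p - 2) / 2)
              = lam ^ ((p - 2) / 2) * δ ^ ((p - 2) / 2) * E ^ ((p - 2) / 2) := by
                rw [Real.mul_rpow (by positivity) hE, Real.mul_rpow hlam0.le hδ.le]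
            _ ≤ lam ^ ((p - 2) / 2) * δ ^ ((p - 2) / 2) * (lam ^ ((p - 4) / 2) * δ) := by gcongr
            _ = (lam ^ ((p - 2) / 2) * lam ^ ((p - 4) / 2)) *
                  (δ ^ ((p - 2) / 2) * δ ^ (1 : ℝ)) := by rw [Real.rpow_one]; ring
            _ = lam ^ (p - 3) * δ ^ (p / 2) := by
                rw [← Real.rpow_add hlam0, ← Real.rpow_add hδ]; ring_nf
      _ = _ := by ring
  have h2 : 8 * K ^ 2 * lam * δ ^ 2 * Real.sqrt (2 * K * lam ^ 2 * δ) ^ (p - 4) =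
      8 * K ^ 2 * (2 * K) ^ ((p - 4) / 2) * (lam ^ (p - 3) * δ ^ (p / 2)) := by
    rw [sqrt_rpow (by positivity), Real.mul_rpow (by positivity) hδ.le,
      Real.mul_rpow (by positivity) (by positivity), ← Real.rpow_natCast lam 2,
      ← Real.rpow_mul hlam0.le]
    calc _ = 8 * K ^ 2 * (2 * K) ^ ((p - 4) / 2) * ((lam ^ (1 : ℝ) *
          lam ^ (((2 : ℕ) : ℝ) * ((p - 4) / 2))) * (δ ^ (2 : ℝ) * δ ^ ((p - 4) / 2))) := by
          rw [Real.rpow_one, Real.rpow_two]; ring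
      _ = _ := by
          rw [← Real.rpow_add hlam0, ← Real.rpow_add hδ]
          push_cast
          ring_nf
  calc p * (r ^ (p - 2) / (p - 2)) + p * (8 * K ^ 2 * lam * δ ^ 2 *
        (Real.sqrt (2 * K * lam ^ 2 * δ) ^ (p - 4) / (p - 4)))
      = p / (p - 2) * r ^ (p - 2) + p / (p - 4) * (8 * K ^ 2 * lam * δ ^ 2 *
        Real.sqrt (2 * K * lam ^ 2 * δ) ^ (p - 4)) := by ring
    _ ≤ p / (p - 2) * ((4 * K * (1 + C₀)) ^ ((p - 2) / 2) * 2 ^ ((p - 2) / 2) *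
          ((lam * δ) ^ ((p - 2) / 2) + lam ^ (p - 3) * δ ^ (p / 2))) +
        p / (p - 4) * (8 * K ^ 2 * (2 * K) ^ ((p - 4) / 2) *
          (lam ^ (p - 3) * δ ^ (p / 2))) := by
        rw [h2]; gcongr
    _ = C₁ * ((lam * δ) ^ ((p - 2) / 2) + lam ^ (p - 3) * δ ^ (p / 2)) +
          C₂ * (lam ^ (p - 3) * δ ^ (p / 2)) := by rw [hC₁, hC₂]; ring
    _ ≤ C₁ * ((lam * δ) ^ ((p - 2) / 2) + lam ^ (p - 3) * δ ^ (p / 2)) +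
          C₂ * ((lam * δ) ^ ((p - 2) / 2) + lam ^ (p - 3) * δ ^ (p / 2)) := by
        gcongr; linarith
    _ = _ := by ring

lemma trigSum_eq_torusSum (a : (Fin 3 → ℤ) →₀ ℂ) (x : Fin 3 → ℝ) :
    trigSum a x = torusSum a (toTorus x) := by
  rw [trigSum, torusSum]
  refine Finset.sum_congr rfl fun k _ => ?_
  rw [mFourier_toTorus, expi]
  congr 2
  push_cast
  ring

lemma lpNorm_eq (p : ℝ) (a : (Fin 3 → ℤ) →₀ ℂ) :
    lpNorm p a = (∫ t, ‖torusSum a t‖ ^ p ∂haarT) ^ (1 / p) := by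
  rw [_root_.lpNorm, integral_haarT]
  congr 1
  have h : (Set.univ.pi fun _ : Fin 3 => Set.Icc (0:ℝ) 1) =ᵐ[volume] cube := by
    rw [cube_eq_pi, Set.pi_univ_Icc]
    exact Measure.univ_pi_Ioc_ae_eq_Icc.symm
  rw [setIntegral_congr_set h]
  simp only [trigSum_eq_torusSum]

lemma FarBound.mono {f : Module.Basis (Fin 3) ℝ E3} {lam δ D D' : ℝ} (h : FarBound f lam δ D)
    (hD : D ≤ D') : FarBound f lam δ D' :=
  fun x hx J => (h x hx J).trans hD

lemma trivial_range {lam δ p : ℝ} (hlam : 1 < lam) (hδ : 0 < δ) (hp : 4 < p)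
    (h : lam ^ (-((p - 4) / (2 * p - 2))) < δ) :
    (δ ^ (-2 : ℝ)) ^ ((p - 2) / 2) ≤ lam ^ ((p - 4) / 2) * δ := by
  have hlam0 : 0 < lam := by linarith
  have h1 : (lam ^ (-((p - 4) / (2 * p - 2)))) ^ (p - 1) ≤ δ ^ (p - 1) := by
    gcongr; linarith
  have hne : p - 1 ≠ 0 := by linarith
  rw [← Real.rpow_mul hlam0.le, show -((p - 4) / (2 * p - 2)) * (p - 1) = -((p - 4) / 2) by
    rw [show 2 * p - 2 = 2 * (p - 1) by ring]; field_simp, Real.rpow_neg hlam0.le] at h1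
  have h2 : 1 ≤ lam ^ ((p - 4) / 2) * δ ^ (p - 1) := by
    rwa [inv_le_iff_one_le_mul₀' (by positivity)] at h1
  rw [← Real.rpow_mul hδ.le]
  calc δ ^ (-2 * ((p - 2) / 2)) = δ ^ (-(p - 2)) * 1 := by rw [mul_one]; ring_nf
    _ ≤ δ ^ (-(p - 2)) * (lam ^ ((p - 4) / 2) * δ ^ (p - 1)) := by gcongr
    _ = lam ^ ((p - 4) / 2) * (δ ^ (-(p - 2)) * δ ^ (p - 1)) := by ring
    _ = lam ^ ((p - 4) / 2) * δ := by
      rw [← Real.rpow_add hδ]; ring_nf; rw [Real.rpow_one]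

lemma weyl_range {lam δ p : ℝ} (hlam : 1 < lam) (hδ : 0 < δ) (hp : 4 < p)
    (h : lam ^ (-((85 * p - 358) / (158 * p - 128))) < δ) :
    lam ^ (-(85 / 158) : ℝ) ≤ δ ∧ (lam ^ (9 / 94 : ℝ) * δ ^ (-(158 / 94) : ℝ)) ^ ((p - 2) / 2) ≤
      lam ^ ((p - 4) / 2) * δ := by
  have hlam0 : 0 < lam := by linarith
  have hq : 0 < 158 * p - 128 := by linarith
  constructor
  · refine le_trans ?_ h.le
    refine Real.rpow_le_rpow_of_exponent_le hlam.le ?_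
    rw [neg_le_neg_iff, div_le_div_iff₀ hq (by norm_num)]
    linarith
  · have h1 : (lam ^ (-((85 * p - 358) / (158 * p - 128)))) ^ ((158 * p - 128) / 188) ≤
        δ ^ ((158 * p - 128) / 188) := by
      gcongr
    rw [← Real.rpow_mul hlam0.le, show -((85 * p - 358) / (158 * p - 128)) *
      ((158 * p - 128) / 188) = -((85 * p - 358) / 188) by
        rw [neg_mul, div_mul_div_cancel₀ hq.ne'],
      Real.rpow_neg hlam0.le] at h1
    have h2 : 1 ≤ lam ^ ((85 * p - 358) / 188) * δ ^ ((158 * p - 128) / 188) := by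
      rwa [inv_le_iff_one_le_mul₀' (by positivity)] at h1
    rw [Real.mul_rpow (by positivity) (by positivity), ← Real.rpow_mul hδ.le,
      ← Real.rpow_mul hlam0.le]
    calc _ = lam ^ (9 / 94 * ((p - 2) / 2)) * δ ^ (-(158 / 94) * ((p - 2) / 2)) * 1 := by
          rw [mul_one]
      _ ≤ lam ^ (9 / 94 * ((p - 2) / 2)) * δ ^ (-(158 / 94) * ((p - 2) / 2)) *
          (lam ^ ((85 * p - 358) / 188) * δ ^ ((158 * p - 128) / 188)) := by gcongr
      _ = (lam ^ (9 / 94 * ((p - 2) / 2)) * lam ^ ((85 * p - 358) / 188)) *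
          (δ ^ (-(158 / 94) * ((p - 2) / 2)) * δ ^ ((158 * p - 128) / 188)) := by ring
      _ = lam ^ ((p - 4) / 2) * δ ^ (1 : ℝ) := by
          rw [← Real.rpow_add hlam0, ← Real.rpow_add hδ]; ring_nf
      _ = _ := by rw [Real.rpow_one]

end ShellBound

theorem statement3 (A : Matrix (Fin 3) (Fin 3) ℝ) (hA : A.IsSymm) (hApd : A.PosDef)
    (p : ℝ) (hp4 : 4 ≤ p) :
    ∃ C : ℝ, 0 < C ∧
      ∀ lam δ : ℝ, 1 < lam → lam⁻¹ < δ → δ < 1 →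
        min (lam ^ (-((p - 4) / (2 * p - 2)))) (lam ^ (-((85 * p - 358) / (158 * p - 128)))) < δ →
        ∀ a : (Fin 3 → ℤ) →₀ ℂ,
          (∀ k ∈ a.support, |Real.sqrt (Qform A fun i => (k i : ℝ)) - lam| < δ) →
          lpNorm p a ≤
            C * ((lam * δ) ^ (1 / 2 - 1 / p) + lam ^ (1 - 3 / p) * δ ^ ((1:ℝ) / 2)) * l2Norm a := by
  open ShellBound in
  rcases hp4.eq_or_lt with rfl | hp
  · refine ⟨1, one_pos, fun lam δ hlam _ hδ1 hmin => absurd hmin (not_lt.2 (hδ1.le.trans ?_))⟩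
    refine le_min (by norm_num) (Real.one_le_rpow hlam.le (by norm_num))
  obtain ⟨f, hf⟩ := exists_basis_Qform hApd
  obtain ⟨C₁, hC₁, h₁⟩ := exists_far_bound_trivial f
  obtain ⟨C₂, hC₂, h₂⟩ := exists_far_bound_rpow f
  obtain ⟨C, hC, h⟩ := exists_integral_rpow_torusSum_le hf hp (le_max_of_le_left hC₁ : 0 ≤ max C₁ C₂)
  have hp0 : 0 < p := by linarith
  refine ⟨C ^ (1 / p), by positivity, fun lam δ hlam hlamδ hδ1 hmin a ha => ?_⟩
  have hlam0 : 0 < lam := by linarith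
  have hδ : 0 < δ := (inv_pos.2 hlam0).trans hlamδ
  rcases eq_or_ne a 0 with rfl | ha0
  · have : lpNorm p 0 = 0 := by
      simp [_root_.lpNorm, trigSum, Real.zero_rpow hp0.ne', hp0.ne']
    rw [this]
    have : 0 ≤ l2Norm 0 := by unfold l2Norm; positivity
    positivity
  have hkey : ∫ t, ‖torusSum a t‖ ^ p ∂haarT ≤ (∑ k ∈ a.support, ‖a k‖ ^ 2) ^ (p / 2) *
      (C * ((lam * δ) ^ ((p - 2) / 2) + lam ^ (p - 3) * δ ^ (p / 2))) := by
    rcases min_lt_iff.1 hmin with hm | hm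
    · refine h lam δ (δ ^ (-2 : ℝ)) hlam hδ hδ1 (by positivity) (trivial_range hlam hδ hp hm)
        (FarBound.mono (fun x hx J => h₁ lam δ x J hδ hx) ?_) a ha0 ha
      gcongr
      exact le_max_left _ _
    · obtain ⟨hr, hE⟩ := weyl_range hlam hδ hp hm
      refine h lam δ _ hlam hδ hδ1 (by positivity) hE
        (FarBound.mono (fun x hx J => h₂ lam δ x J hlam hr hx) ?_) a ha0 ha
      gcongr
      exact le_max_right _ _
  have hS : 0 ≤ ∑ k ∈ a.support, ‖a k‖ ^ 2 := Finset.sum_nonneg fun k _ => by positivity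
  have hp1 : 0 ≤ 1 / p := by positivity
  have hp1' : 1 / p ≤ 1 := by rw [div_le_one hp0]; linarith
  rw [lpNorm_eq, l2Norm]
  calc (∫ t, ‖torusSum a t‖ ^ p ∂haarT) ^ (1 / p)
      ≤ ((∑ k ∈ a.support, ‖a k‖ ^ 2) ^ (p / 2) *
        (C * ((lam * δ) ^ ((p - 2) / 2) + lam ^ (p - 3) * δ ^ (p / 2)))) ^ (1 / p) :=
        Real.rpow_le_rpow (integral_nonneg fun t => by positivity) hkey hp1
    _ = (∑ k ∈ a.support, ‖a k‖ ^ 2) ^ ((1:ℝ) / 2) * (C ^ (1 / p) *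
        ((lam * δ) ^ ((p - 2) / 2) + lam ^ (p - 3) * δ ^ (p / 2)) ^ (1 / p)) := by
        rw [Real.mul_rpow (by positivity) (by positivity), Real.mul_rpow hC.le (by positivity),
          ← Real.rpow_mul hS]
        congr 2
        field_simp
    _ ≤ (∑ k ∈ a.support, ‖a k‖ ^ 2) ^ ((1:ℝ) / 2) * (C ^ (1 / p) *
        (((lam * δ) ^ ((p - 2) / 2)) ^ (1 / p) + (lam ^ (p - 3) * δ ^ (p / 2)) ^ (1 / p))) := by
        gcongr
        exact Real.rpow_add_le_add_rpow (by positivity) (by positivity) hp1 hp1'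
    _ = (∑ k ∈ a.support, ‖a k‖ ^ 2) ^ ((1:ℝ) / 2) * (C ^ (1 / p) *
        ((lam * δ) ^ (1 / 2 - 1 / p) + lam ^ (1 - 3 / p) * δ ^ ((1:ℝ) / 2))) := by
        have hld : 0 ≤ lam * δ := by positivity
        have e1 : (p - 2) / 2 * (1 / p) = 1 / 2 - 1 / p := by field_simp
        have e2 : (p - 3) * (1 / p) = 1 - 3 / p := by field_simp
        have e3 : p / 2 * (1 / p) = 1 / 2 := by field_simp
        rw [← Real.rpow_mul hld, Real.mul_rpow (x := lam ^ (p - 3)) (by positivity) (by positivity),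
          ← Real.rpow_mul hlam0.le, ← Real.rpow_mul hδ.le, e1, e2, e3]
    _ = _ := by ring
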